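/- (Decay of the second fundamental form, Theorem 4.3.) For every q ∈ (0,2) and every positive integer m there exist L₂ > 0 and δ₂ > 0 (depending on m, q) such that: if L > L₂, k ≥ 3 is an integer, and f : [0,kL]×S¹ → ℝⁿ is a conformal Willmore immersion whose conformal factor is e^{2u} with u(t,θ) = −mt + v(t,θ), if τ₁(f,c)(t) = 0 and τ₂(f,S)(t) = 0 for all t, all c ∈ ℝⁿ and all n×n real skew-symmetric matrices S, and if sup_{Q_i} |∇v| + ∫_{Q_i} |A|² dV_g < δ₂ for all 1 ≤ i ≤ k, then there is C > 0 (depending on m, q, L) with ∫_{Q_i} |A|² dV_g ≤ C ( e^{−iqL} ∫_{Q₁∪Q₂∪Q₃} |A|² dV_g + e^{−(k−i)qL} ∫_{Q_{k−2}∪Q_{k−1}∪Q_k} |A|² dV_g ) for all 1 ≤ i ≤ k. -/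

import Mathlib

noncomputable section

open Real MeasureTheory Set Filter
open scoped InnerProductSpace

/-- Partial derivative in the first variable. -/
def pt {F : Type*} [NormedAddCommGroup F] [NormedSpace ℝ F] (f : ℝ → ℝ → F) (t θ : ℝ) : F :=
  deriv (fun s => f s θ) t

/-- Partial derivative in the second variable. -/
def pth {F : Type*} [NormedAddCommGroup F] [NormedSpace ℝ F] (f : ℝ → ℝ → F) (t θ : ℝ) : F :=
  deriv (fun s => f t s) θ

variable {n : ℕ}

/-- Mean curvature vector `H = e^{-2u}(∂_t² f + ∂_θ² f)`. -/
def Hmc (f : ℝ → ℝ → EuclideanSpace ℝ (Fin n)) (u : ℝ → ℝ → ℝ) :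
    ℝ → ℝ → EuclideanSpace ℝ (Fin n) :=
  fun t θ => Real.exp (-(2 * u t θ)) • (pt (pt f) t θ + pth (pth f) t θ)

/-- Component `A_tt` of the second fundamental form. -/
def Att (f : ℝ → ℝ → EuclideanSpace ℝ (Fin n)) (u : ℝ → ℝ → ℝ) :
    ℝ → ℝ → EuclideanSpace ℝ (Fin n) :=
  fun t θ => pt (pt f) t θ - pt u t θ • pt f t θ + pth u t θ • pth f t θ

/-- Component `A_tθ` of the second fundamental form. -/
def Atth (f : ℝ → ℝ → EuclideanSpace ℝ (Fin n)) (u : ℝ → ℝ → ℝ) :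
    ℝ → ℝ → EuclideanSpace ℝ (Fin n) :=
  fun t θ => pt (pth f) t θ - pth u t θ • pt f t θ - pt u t θ • pth f t θ

/-- Component `A_θθ` of the second fundamental form. -/
def Athth (f : ℝ → ℝ → EuclideanSpace ℝ (Fin n)) (u : ℝ → ℝ → ℝ) :
    ℝ → ℝ → EuclideanSpace ℝ (Fin n) :=
  fun t θ => pth (pth f) t θ + pt u t θ • pt f t θ - pth u t θ • pth f t θ

/-- `|A|²`, the squared norm of the second fundamental form. -/
def Asq (f : ℝ → ℝ → EuclideanSpace ℝ (Fin n)) (u : ℝ → ℝ → ℝ) : ℝ → ℝ → ℝ :=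
  fun t θ => Real.exp (-(4 * u t θ)) *
    (‖Att f u t θ‖ ^ 2 + 2 * ‖Atth f u t θ‖ ^ 2 + ‖Athth f u t θ‖ ^ 2)

/-- The left-hand side of the Willmore equation in conformal coordinates. -/
def willmoreOp (f : ℝ → ℝ → EuclideanSpace ℝ (Fin n)) (u : ℝ → ℝ → ℝ) :
    ℝ → ℝ → EuclideanSpace ℝ (Fin n) :=
  fun t θ =>
    (2 : ℝ) • (pt (pt (Hmc f u)) t θ + pth (pth (Hmc f u)) t θ)
    + (4 : ℝ) • pt (fun a b => Real.exp (-(2 * u a b)) •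
        (⟪Hmc f u a b, Att f u a b⟫_ℝ • pt f a b + ⟪Hmc f u a b, Atth f u a b⟫_ℝ • pth f a b)) t θ
    + (4 : ℝ) • pth (fun a b => Real.exp (-(2 * u a b)) •
        (⟪Hmc f u a b, Atth f u a b⟫_ℝ • pt f a b + ⟪Hmc f u a b, Athth f u a b⟫_ℝ • pth f a b)) t θ
    - pt (fun a b => ‖Hmc f u a b‖ ^ 2 • pt f a b) t θ
    - pth (fun a b => ‖Hmc f u a b‖ ^ 2 • pth f a b) t θ

/-- A conformal immersion of a cylinder `s × S¹` (in the `t` variable),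
with conformal factor `e^{2u}`; maps are `2π`-periodic in the second variable. -/
structure ConfImm (f : ℝ → ℝ → EuclideanSpace ℝ (Fin n)) (u : ℝ → ℝ → ℝ) (s : Set ℝ) :
    Prop where
  smooth_f : ContDiff ℝ (⊤ : ℕ∞) (fun p : ℝ × ℝ => f p.1 p.2)
  smooth_u : ContDiff ℝ (⊤ : ℕ∞) (fun p : ℝ × ℝ => u p.1 p.2)
  periodic_f : ∀ t θ, f t (θ + 2 * π) = f t θ
  periodic_u : ∀ t θ, u t (θ + 2 * π) = u t θ
  conf_t : ∀ t ∈ s, ∀ θ : ℝ, ‖pt f t θ‖ ^ 2 = Real.exp (2 * u t θ)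
  conf_th : ∀ t ∈ s, ∀ θ : ℝ, ‖pth f t θ‖ ^ 2 = Real.exp (2 * u t θ)
  conf_orth : ∀ t ∈ s, ∀ θ : ℝ, ⟪pt f t θ, pth f t θ⟫_ℝ = 0

/-- A conformal Willmore immersion of a cylinder. -/
structure ConfWillmore (f : ℝ → ℝ → EuclideanSpace ℝ (Fin n)) (u : ℝ → ℝ → ℝ) (s : Set ℝ)
    extends ConfImm f u s : Prop where
  willmore : ∀ t ∈ s, ∀ θ : ℝ, willmoreOp f u t θ = 0

/-- The first residue `τ₁(f,c)(t)`. -/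
def tau1 (f : ℝ → ℝ → EuclideanSpace ℝ (Fin n)) (u : ℝ → ℝ → ℝ)
    (c : EuclideanSpace ℝ (Fin n)) (t : ℝ) : ℝ :=
  ⟪(-2 : ℝ) • (∫ θ in (0 : ℝ)..(2 * π), pt (Hmc f u) t θ)
    - (4 : ℝ) • (∫ θ in (0 : ℝ)..(2 * π), Real.exp (-(2 * u t θ)) •
        (⟪Hmc f u t θ, Att f u t θ⟫_ℝ • pt f t θ + ⟪Hmc f u t θ, Atth f u t θ⟫_ℝ • pth f t θ))
    + ∫ θ in (0 : ℝ)..(2 * π), ‖Hmc f u t θ‖ ^ 2 • pt f t θ, c⟫_ℝ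

/-- The second residue `τ₂(f,S)(t)`, for a matrix `S`. -/
def tau2 (f : ℝ → ℝ → EuclideanSpace ℝ (Fin n)) (u : ℝ → ℝ → ℝ)
    (S : Matrix (Fin n) (Fin n) ℝ) (t : ℝ) : ℝ :=
  2 * (∫ θ in (0 : ℝ)..(2 * π),
        (⟪Hmc f u t θ, pt (fun a b => (Matrix.toEuclideanLin S) (f a b)) t θ⟫_ℝ
          - ⟪pt (Hmc f u) t θ, (Matrix.toEuclideanLin S) (f t θ)⟫_ℝ))
  - 4 * (∫ θ in (0 : ℝ)..(2 * π), Real.exp (-(2 * u t θ)) *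
        (⟪Hmc f u t θ, Att f u t θ⟫_ℝ * ⟪pt f t θ, (Matrix.toEuclideanLin S) (f t θ)⟫_ℝ
          + ⟪Hmc f u t θ, Atth f u t θ⟫_ℝ * ⟪pth f t θ, (Matrix.toEuclideanLin S) (f t θ)⟫_ℝ))
  + ∫ θ in (0 : ℝ)..(2 * π), ‖Hmc f u t θ‖ ^ 2 * ⟪pt f t θ, (Matrix.toEuclideanLin S) (f t θ)⟫_ℝ

/-- Pointwise norm of the gradient of a scalar function on the cylinder. -/
def gradNorm (u : ℝ → ℝ → ℝ) (t θ : ℝ) : ℝ :=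
  Real.sqrt ((pt u t θ) ^ 2 + (pth u t θ) ^ 2)

/-- Integral of a density over the piece `[a,b] × S¹` of the cylinder. -/
def cylInt (F : ℝ → ℝ → ℝ) (a b : ℝ) : ℝ :=
  ∫ p in Set.Icc a b ×ˢ Set.Icc (0 : ℝ) (2 * π), F p.1 p.2

/-- The density `|A|² dV_g` (with respect to `dt dθ`). -/
def Adens (f : ℝ → ℝ → EuclideanSpace ℝ (Fin n)) (u : ℝ → ℝ → ℝ) : ℝ → ℝ → ℝ :=
  fun t θ => Asq f u t θ * Real.exp (2 * u t θ)

/-- The density `|H|² dV_g` (with respect to `dt dθ`). -/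
def Hdens (f : ℝ → ℝ → EuclideanSpace ℝ (Fin n)) (u : ℝ → ℝ → ℝ) : ℝ → ℝ → ℝ :=
  fun t θ => ‖Hmc f u t θ‖ ^ 2 * Real.exp (2 * u t θ)

section Calculus

variable {V : Type*} [NormedAddCommGroup V] [InnerProductSpace ℝ V]
variable {F : Type*} [NormedAddCommGroup F] [NormedSpace ℝ F]
variable {G : Type*} [NormedAddCommGroup G] [NormedSpace ℝ G]

/-- Smoothness of a function of two real variables in curried form. -/
abbrev Sm {F : Type*} [NormedAddCommGroup F] [NormedSpace ℝ F] (f : ℝ → ℝ → F) : Prop :=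
  ContDiff ℝ (⊤ : ℕ∞) (fun p : ℝ × ℝ => f p.1 p.2)

/-- `2π`-periodicity in the second variable. -/
def Per {F : Type*} (f : ℝ → ℝ → F) : Prop := ∀ t θ, f t (θ + 2 * π) = f t θ

@[fun_prop]
theorem contDiff_real_inner {E : Type*} [NormedAddCommGroup E] [NormedSpace ℝ E]
    {k : WithTop ℕ∞} {f g : E → V} (hf : ContDiff ℝ k f) (hg : ContDiff ℝ k g) :
    ContDiff ℝ k (fun x => ⟪f x, g x⟫_ℝ) := hf.inner ℝ hg

@[fun_prop]
theorem contDiff_real_norm_sq {E : Type*} [NormedAddCommGroup E] [NormedSpace ℝ E]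
    {k : WithTop ℕ∞} {f : E → V} (hf : ContDiff ℝ k f) :
    ContDiff ℝ k (fun x => ‖f x‖ ^ 2) := hf.norm_sq ℝ

theorem Sm.hasDerivAt_t {f : ℝ → ℝ → F}
    (h : ContDiff ℝ (⊤ : ℕ∞) (fun p : ℝ × ℝ => f p.1 p.2)) (t θ : ℝ) :
    HasDerivAt (fun s => f s θ) (pt f t θ) t := by
  have : ContDiff ℝ (⊤ : ℕ∞) (fun s => f s θ) := by fun_prop
  exact ((this.differentiable (by simp)) t).hasDerivAt

theorem Sm.hasDerivAt_th {f : ℝ → ℝ → F}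
    (h : ContDiff ℝ (⊤ : ℕ∞) (fun p : ℝ × ℝ => f p.1 p.2)) (t θ : ℝ) :
    HasDerivAt (fun s => f t s) (pth f t θ) θ := by
  have : ContDiff ℝ (⊤ : ℕ∞) (fun s => f t s) := by fun_prop
  exact ((this.differentiable (by simp)) θ).hasDerivAt

theorem Sm.pt_eq {f : ℝ → ℝ → F} (h : Sm f) (t θ : ℝ) :
    pt f t θ = fderiv ℝ (fun p : ℝ × ℝ => f p.1 p.2) (t, θ) (1, 0) := by
  have h1 := ((h.differentiable (by simp)) (t, θ)).hasFDerivAt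
  have h2 : HasDerivAt (fun s : ℝ => (s, θ)) ((1 : ℝ), (0 : ℝ)) t :=
    (hasDerivAt_id t).prodMk (hasDerivAt_const t θ)
  exact (h1.comp_hasDerivAt t h2).deriv

theorem Sm.pth_eq {f : ℝ → ℝ → F} (h : Sm f) (t θ : ℝ) :
    pth f t θ = fderiv ℝ (fun p : ℝ × ℝ => f p.1 p.2) (t, θ) (0, 1) := by
  have h1 := ((h.differentiable (by simp)) (t, θ)).hasFDerivAt
  have h2 : HasDerivAt (fun s : ℝ => (t, s)) ((0 : ℝ), (1 : ℝ)) θ :=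
    (hasDerivAt_const θ t).prodMk (hasDerivAt_id θ)
  exact (h1.comp_hasDerivAt θ h2).deriv

@[fun_prop]
theorem contDiff_pt {f : ℝ → ℝ → F} (h : ContDiff ℝ (⊤ : ℕ∞) (fun p : ℝ × ℝ => f p.1 p.2)) :
    ContDiff ℝ (⊤ : ℕ∞) (fun p : ℝ × ℝ => pt f p.1 p.2) := by
  have h1 : (fun p : ℝ × ℝ => pt f p.1 p.2)
      = fun p => fderiv ℝ (fun p : ℝ × ℝ => f p.1 p.2) p (1, 0) := by
    funext p; exact Sm.pt_eq h p.1 p.2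
  rw [h1]
  exact (h.fderiv_right (by simp)).clm_apply contDiff_const

@[fun_prop]
theorem contDiff_pth {f : ℝ → ℝ → F} (h : ContDiff ℝ (⊤ : ℕ∞) (fun p : ℝ × ℝ => f p.1 p.2)) :
    ContDiff ℝ (⊤ : ℕ∞) (fun p : ℝ × ℝ => pth f p.1 p.2) := by
  have h1 : (fun p : ℝ × ℝ => pth f p.1 p.2)
      = fun p => fderiv ℝ (fun p : ℝ × ℝ => f p.1 p.2) p (0, 1) := by
    funext p; exact Sm.pth_eq h p.1 p.2
  rw [h1]
  exact (h.fderiv_right (by simp)).clm_apply contDiff_const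

@[fun_prop]
theorem continuous_pt {f : ℝ → ℝ → F} (h : ContDiff ℝ (⊤ : ℕ∞) (fun p : ℝ × ℝ => f p.1 p.2)) :
    Continuous (fun p : ℝ × ℝ => pt f p.1 p.2) := (contDiff_pt h).continuous

@[fun_prop]
theorem continuous_pth {f : ℝ → ℝ → F} (h : ContDiff ℝ (⊤ : ℕ∞) (fun p : ℝ × ℝ => f p.1 p.2)) :
    Continuous (fun p : ℝ × ℝ => pth f p.1 p.2) := (contDiff_pth h).continuous

theorem pt_pth_comm {f : ℝ → ℝ → F} (h : Sm f) (t θ : ℝ) :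
    pt (pth f) t θ = pth (pt f) t θ := by
  have hd : ContDiff ℝ (⊤ : ℕ∞) (fderiv ℝ (fun p : ℝ × ℝ => f p.1 p.2)) :=
    h.fderiv_right (by simp)
  have hd1 := ((hd.differentiable (by simp)) (t, θ)).hasFDerivAt
  have e1 : (fun p : ℝ × ℝ => pt f p.1 p.2)
      = fun p => fderiv ℝ (fun p : ℝ × ℝ => f p.1 p.2) p (1, 0) := by
    funext p; exact Sm.pt_eq h p.1 p.2
  have e2 : (fun p : ℝ × ℝ => pth f p.1 p.2)
      = fun p => fderiv ℝ (fun p : ℝ × ℝ => f p.1 p.2) p (0, 1) := by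
    funext p; exact Sm.pth_eq h p.1 p.2
  rw [Sm.pt_eq (contDiff_pth h), Sm.pth_eq (contDiff_pt h), e1, e2]
  have h1 : ∀ w : ℝ × ℝ, HasFDerivAt (fun p => fderiv ℝ (fun p : ℝ × ℝ => f p.1 p.2) p w)
      ((fderiv ℝ (fderiv ℝ (fun p : ℝ × ℝ => f p.1 p.2)) (t, θ)).flip w) (t, θ) := by
    intro w
    exact ((ContinuousLinearMap.apply ℝ F w).hasFDerivAt.comp (t, θ) hd1)
  rw [(h1 _).fderiv, (h1 _).fderiv]
  have hs : IsSymmSndFDerivAt ℝ (fun p : ℝ × ℝ => f p.1 p.2) (t, θ) :=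
    (h.contDiffAt).isSymmSndFDerivAt (by
      rw [minSmoothness_of_isRCLikeNormedField]; 
      exact WithTop.coe_le_coe.2 (le_top : (2 : ℕ∞) ≤ ⊤))
  exact hs.eq _ _

section Rules

variable {f g : ℝ → ℝ → F} {a b : ℝ → ℝ → ℝ} {x y : ℝ → ℝ → V}
variable (t θ : ℝ)

theorem pt_add (hf : ContDiff ℝ (⊤ : ℕ∞) (fun p : ℝ × ℝ => f p.1 p.2))
    (hg : ContDiff ℝ (⊤ : ℕ∞) (fun p : ℝ × ℝ => g p.1 p.2)) :
    pt (fun s φ => f s φ + g s φ) t θ = pt f t θ + pt g t θ :=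
  ((Sm.hasDerivAt_t hf t θ).add (Sm.hasDerivAt_t hg t θ)).deriv

theorem pth_add (hf : ContDiff ℝ (⊤ : ℕ∞) (fun p : ℝ × ℝ => f p.1 p.2))
    (hg : ContDiff ℝ (⊤ : ℕ∞) (fun p : ℝ × ℝ => g p.1 p.2)) :
    pth (fun s φ => f s φ + g s φ) t θ = pth f t θ + pth g t θ :=
  ((Sm.hasDerivAt_th hf t θ).add (Sm.hasDerivAt_th hg t θ)).deriv

theorem pt_sub (hf : ContDiff ℝ (⊤ : ℕ∞) (fun p : ℝ × ℝ => f p.1 p.2))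
    (hg : ContDiff ℝ (⊤ : ℕ∞) (fun p : ℝ × ℝ => g p.1 p.2)) :
    pt (fun s φ => f s φ - g s φ) t θ = pt f t θ - pt g t θ :=
  ((Sm.hasDerivAt_t hf t θ).sub (Sm.hasDerivAt_t hg t θ)).deriv

theorem pth_sub (hf : ContDiff ℝ (⊤ : ℕ∞) (fun p : ℝ × ℝ => f p.1 p.2))
    (hg : ContDiff ℝ (⊤ : ℕ∞) (fun p : ℝ × ℝ => g p.1 p.2)) :
    pth (fun s φ => f s φ - g s φ) t θ = pth f t θ - pth g t θ :=
  ((Sm.hasDerivAt_th hf t θ).sub (Sm.hasDerivAt_th hg t θ)).deriv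

theorem pt_neg (hf : ContDiff ℝ (⊤ : ℕ∞) (fun p : ℝ × ℝ => f p.1 p.2)) :
    pt (fun s φ => - f s φ) t θ = - pt f t θ :=
  (Sm.hasDerivAt_t hf t θ).neg.deriv

theorem pth_neg (hf : ContDiff ℝ (⊤ : ℕ∞) (fun p : ℝ × ℝ => f p.1 p.2)) :
    pth (fun s φ => - f s φ) t θ = - pth f t θ :=
  (Sm.hasDerivAt_th hf t θ).neg.deriv

theorem pt_smul (ha : ContDiff ℝ (⊤ : ℕ∞) (fun p : ℝ × ℝ => a p.1 p.2))
    (hf : ContDiff ℝ (⊤ : ℕ∞) (fun p : ℝ × ℝ => f p.1 p.2)) :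
    pt (fun s φ => a s φ • f s φ) t θ = pt a t θ • f t θ + a t θ • pt f t θ := by
  rw [add_comm]
  exact ((Sm.hasDerivAt_t ha t θ).smul (Sm.hasDerivAt_t hf t θ)).deriv

theorem pth_smul (ha : ContDiff ℝ (⊤ : ℕ∞) (fun p : ℝ × ℝ => a p.1 p.2))
    (hf : ContDiff ℝ (⊤ : ℕ∞) (fun p : ℝ × ℝ => f p.1 p.2)) :
    pth (fun s φ => a s φ • f s φ) t θ = pth a t θ • f t θ + a t θ • pth f t θ := by
  rw [add_comm]
  exact ((Sm.hasDerivAt_th ha t θ).smul (Sm.hasDerivAt_th hf t θ)).deriv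

theorem pt_mul (ha : ContDiff ℝ (⊤ : ℕ∞) (fun p : ℝ × ℝ => a p.1 p.2))
    (hb : ContDiff ℝ (⊤ : ℕ∞) (fun p : ℝ × ℝ => b p.1 p.2)) :
    pt (fun s φ => a s φ * b s φ) t θ = pt a t θ * b t θ + a t θ * pt b t θ :=
  ((Sm.hasDerivAt_t ha t θ).mul (Sm.hasDerivAt_t hb t θ)).deriv

theorem pth_mul (ha : ContDiff ℝ (⊤ : ℕ∞) (fun p : ℝ × ℝ => a p.1 p.2))
    (hb : ContDiff ℝ (⊤ : ℕ∞) (fun p : ℝ × ℝ => b p.1 p.2)) :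
    pth (fun s φ => a s φ * b s φ) t θ = pth a t θ * b t θ + a t θ * pth b t θ :=
  ((Sm.hasDerivAt_th ha t θ).mul (Sm.hasDerivAt_th hb t θ)).deriv

theorem pt_inner (hx : ContDiff ℝ (⊤ : ℕ∞) (fun p : ℝ × ℝ => x p.1 p.2))
    (hy : ContDiff ℝ (⊤ : ℕ∞) (fun p : ℝ × ℝ => y p.1 p.2)) :
    pt (fun s φ => ⟪x s φ, y s φ⟫_ℝ) t θ = ⟪pt x t θ, y t θ⟫_ℝ + ⟪x t θ, pt y t θ⟫_ℝ := by
  rw [add_comm]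
  exact ((Sm.hasDerivAt_t hx t θ).inner ℝ (Sm.hasDerivAt_t hy t θ)).deriv

theorem pth_inner (hx : ContDiff ℝ (⊤ : ℕ∞) (fun p : ℝ × ℝ => x p.1 p.2))
    (hy : ContDiff ℝ (⊤ : ℕ∞) (fun p : ℝ × ℝ => y p.1 p.2)) :
    pth (fun s φ => ⟪x s φ, y s φ⟫_ℝ) t θ = ⟪pth x t θ, y t θ⟫_ℝ + ⟪x t θ, pth y t θ⟫_ℝ := by
  rw [add_comm]
  exact ((Sm.hasDerivAt_th hx t θ).inner ℝ (Sm.hasDerivAt_th hy t θ)).deriv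

theorem pt_norm_sq (hx : ContDiff ℝ (⊤ : ℕ∞) (fun p : ℝ × ℝ => x p.1 p.2)) :
    pt (fun s φ => ‖x s φ‖ ^ 2) t θ = 2 * ⟪x t θ, pt x t θ⟫_ℝ :=
  (Sm.hasDerivAt_t hx t θ).norm_sq.deriv

theorem pth_norm_sq (hx : ContDiff ℝ (⊤ : ℕ∞) (fun p : ℝ × ℝ => x p.1 p.2)) :
    pth (fun s φ => ‖x s φ‖ ^ 2) t θ = 2 * ⟪x t θ, pth x t θ⟫_ℝ :=
  (Sm.hasDerivAt_th hx t θ).norm_sq.deriv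

theorem pt_exp (ha : ContDiff ℝ (⊤ : ℕ∞) (fun p : ℝ × ℝ => a p.1 p.2)) :
    pt (fun s φ => Real.exp (a s φ)) t θ = Real.exp (a t θ) * pt a t θ :=
  (Sm.hasDerivAt_t ha t θ).exp.deriv

theorem pth_exp (ha : ContDiff ℝ (⊤ : ℕ∞) (fun p : ℝ × ℝ => a p.1 p.2)) :
    pth (fun s φ => Real.exp (a s φ)) t θ = Real.exp (a t θ) * pth a t θ :=
  (Sm.hasDerivAt_th ha t θ).exp.deriv

theorem pt_clm (A : F →L[ℝ] G) (hf : ContDiff ℝ (⊤ : ℕ∞) (fun p : ℝ × ℝ => f p.1 p.2)) :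
    pt (fun s φ => A (f s φ)) t θ = A (pt f t θ) :=
  (A.hasFDerivAt.comp_hasDerivAt t (Sm.hasDerivAt_t hf t θ)).deriv

theorem pth_clm (A : F →L[ℝ] G) (hf : ContDiff ℝ (⊤ : ℕ∞) (fun p : ℝ × ℝ => f p.1 p.2)) :
    pth (fun s φ => A (f s φ)) t θ = A (pth f t θ) :=
  (A.hasFDerivAt.comp_hasDerivAt θ (Sm.hasDerivAt_th hf t θ)).deriv

theorem pt_fst (χ : ℝ → F) : pt (fun s _ => χ s) t θ = deriv χ t := rfl
theorem pth_fst (χ : ℝ → F) : pth (fun s _ => χ s) t θ = 0 := deriv_const θ (χ t)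
theorem pt_snd (χ : ℝ → F) : pt (fun _ φ => χ φ) t θ = 0 := deriv_const t (χ θ)
theorem pth_snd (χ : ℝ → F) : pth (fun _ φ => χ φ) t θ = deriv χ θ := rfl

theorem pt_const (c : F) : pt (fun _ _ => c) t θ = 0 := deriv_const t c
theorem pth_const (c : F) : pth (fun _ _ => c) t θ = 0 := deriv_const θ c

end Rules

theorem Per.pt {f : ℝ → ℝ → F} (h : Per f) : Per (pt f) := by
  intro t θ
  have : (fun s => f s (θ + 2 * π)) = fun s => f s θ := funext fun s => h s θ
  simp only [_root_.pt, this]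

theorem Per.pth {f : ℝ → ℝ → F} (h : Per f) : Per (pth f) := by
  intro t θ
  have h1 := deriv_comp_add_const (f := fun s => f t s) (2 * π) θ
  have h2 : (fun s => f t (s + 2 * π)) = fun s => f t s := funext fun s => h t s
  rw [h2] at h1
  exact h1.symm

end Calculus

section Integrals

variable {F G : ℝ → ℝ → ℝ} {a b : ℝ}

theorem cylInt_integrable {E : Type*} [NormedAddCommGroup E] {F : ℝ → ℝ → E}
    (hF : Continuous (fun p : ℝ × ℝ => F p.1 p.2)) (a b : ℝ) :
    IntegrableOn (fun p : ℝ × ℝ => F p.1 p.2) (Icc a b ×ˢ Icc (0 : ℝ) (2 * π)) :=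
  hF.continuousOn.integrableOn_compact (isCompact_Icc.prod isCompact_Icc)

theorem cylInt_add (hF : Continuous (fun p : ℝ × ℝ => F p.1 p.2))
    (hG : Continuous (fun p : ℝ × ℝ => G p.1 p.2)) :
    cylInt (fun t θ => F t θ + G t θ) a b = cylInt F a b + cylInt G a b :=
  integral_add (cylInt_integrable hF a b) (cylInt_integrable hG a b)

theorem cylInt_const_mul (c : ℝ) :
    cylInt (fun t θ => c * F t θ) a b = c * cylInt F a b :=
  integral_const_mul c _

theorem cylInt_mono (hF : Continuous (fun p : ℝ × ℝ => F p.1 p.2))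
    (hG : Continuous (fun p : ℝ × ℝ => G p.1 p.2))
    (h : ∀ t ∈ Icc a b, ∀ θ ∈ Icc (0 : ℝ) (2 * π), F t θ ≤ G t θ) :
    cylInt F a b ≤ cylInt G a b :=
  setIntegral_mono_on (cylInt_integrable hF a b) (cylInt_integrable hG a b)
    (measurableSet_Icc.prod measurableSet_Icc) (fun p hp => h p.1 hp.1 p.2 hp.2)

theorem cylInt_congr (h : ∀ t ∈ Icc a b, ∀ θ ∈ Icc (0 : ℝ) (2 * π), F t θ = G t θ) :
    cylInt F a b = cylInt G a b :=
  setIntegral_congr_fun (measurableSet_Icc.prod measurableSet_Icc)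
    (fun p hp => h p.1 hp.1 p.2 hp.2)

theorem cylInt_nonneg (h : ∀ t ∈ Icc a b, ∀ θ ∈ Icc (0 : ℝ) (2 * π), 0 ≤ F t θ) :
    0 ≤ cylInt F a b :=
  setIntegral_nonneg (measurableSet_Icc.prod measurableSet_Icc)
    (fun p hp => h p.1 hp.1 p.2 hp.2)

theorem cylInt_subset {a' b' : ℝ} (hF : Continuous (fun p : ℝ × ℝ => F p.1 p.2))
    (ha : a ≤ a') (hb : b' ≤ b)
    (h : ∀ t ∈ Icc a b, ∀ θ ∈ Icc (0 : ℝ) (2 * π), 0 ≤ F t θ) :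
    cylInt F a' b' ≤ cylInt F a b := by
  refine setIntegral_mono_set (cylInt_integrable hF a b) ?_ ?_
  · refine (ae_restrict_iff' (measurableSet_Icc.prod measurableSet_Icc)).2 (ae_of_all _ ?_)
    exact fun p hp => h p.1 hp.1 p.2 hp.2
  · exact (prod_mono (Icc_subset_Icc ha hb) subset_rfl).eventuallyLE

theorem cylInt_eq_iterated (hab : a ≤ b) (hF : Continuous (fun p : ℝ × ℝ => F p.1 p.2)) :
    cylInt F a b = ∫ t in a..b, ∫ θ in (0 : ℝ)..(2 * π), F t θ := by
  have h2 : (0 : ℝ) ≤ 2 * π := by positivity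
  have := setIntegral_prod (μ := volume) (ν := volume) (fun p : ℝ × ℝ => F p.1 p.2)
    (s := Icc a b) (t := Icc 0 (2 * π)) (cylInt_integrable hF a b)
  rw [cylInt, intervalIntegral.integral_of_le hab]
  simp only [intervalIntegral.integral_of_le h2]
  rw [← integral_Icc_eq_integral_Ioc]
  simp only [← integral_Icc_eq_integral_Ioc]
  exact this

theorem cylInt_eq_iterated_swap (hab : a ≤ b) (hF : Continuous (fun p : ℝ × ℝ => F p.1 p.2)) :
    cylInt F a b = ∫ θ in (0 : ℝ)..(2 * π), ∫ t in a..b, F t θ := by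
  have h2 : (0 : ℝ) ≤ 2 * π := by positivity
  rw [cylInt_eq_iterated hab hF]
  simp only [intervalIntegral.integral_of_le h2, intervalIntegral.integral_of_le hab]
  refine integral_integral_swap ?_
  rw [Measure.prod_restrict]
  exact (cylInt_integrable hF a b).mono_set (prod_mono Ioc_subset_Icc_self Ioc_subset_Icc_self)

theorem continuous_slice {E : Type*} [NormedAddCommGroup E] [NormedSpace ℝ E]
    {F : ℝ → ℝ → E} (hF : Continuous (fun p : ℝ × ℝ => F p.1 p.2)) :
    Continuous (fun t => ∫ θ in (0 : ℝ)..(2 * π), F t θ) :=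
  intervalIntegral.continuous_parametric_intervalIntegral_of_continuous' hF 0 (2 * π)

theorem cylInt_split {c : ℝ} (hab : a ≤ b) (hbc : b ≤ c)
    (hF : Continuous (fun p : ℝ × ℝ => F p.1 p.2)) :
    cylInt F a c = cylInt F a b + cylInt F b c := by
  rw [cylInt_eq_iterated hab hF, cylInt_eq_iterated hbc hF,
    cylInt_eq_iterated (hab.trans hbc) hF]
  exact (intervalIntegral.integral_add_adjacent_intervals
    ((continuous_slice hF).intervalIntegrable _ _)
    ((continuous_slice hF).intervalIntegrable _ _)).symm

theorem cylInt_slice_mono (hab : a ≤ b) (hF : Continuous (fun p : ℝ × ℝ => F p.1 p.2))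
    (hG : Continuous (fun p : ℝ × ℝ => G p.1 p.2))
    (h : ∀ t ∈ Icc a b, ∫ θ in (0 : ℝ)..(2 * π), F t θ ≤ ∫ θ in (0 : ℝ)..(2 * π), G t θ) :
    cylInt F a b ≤ cylInt G a b := by
  rw [cylInt_eq_iterated hab hF, cylInt_eq_iterated hab hG]
  exact intervalIntegral.integral_mono_on hab ((continuous_slice hF).intervalIntegrable _ _)
    ((continuous_slice hG).intervalIntegrable _ _) h

theorem cylInt_slice_zero (hab : a ≤ b) (hF : Continuous (fun p : ℝ × ℝ => F p.1 p.2))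
    (h : ∀ t ∈ Icc a b, ∫ θ in (0 : ℝ)..(2 * π), F t θ = 0) :
    cylInt F a b = 0 := by
  rw [cylInt_eq_iterated hab hF]
  rw [intervalIntegral.integral_congr (g := fun _ => (0 : ℝ))]
  · simp
  · intro t ht
    rw [uIcc_of_le hab] at ht
    exact h t ht

theorem cylInt_pt (hab : a ≤ b) (hF : Sm F) (ha : ∀ θ, F a θ = 0) (hb : ∀ θ, F b θ = 0) :
    cylInt (pt F) a b = 0 := by
  rw [cylInt_eq_iterated_swap hab (by fun_prop)]
  have : ∀ θ, ∫ t in a..b, pt F t θ = 0 := by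
    intro θ
    rw [intervalIntegral.integral_eq_sub_of_hasDerivAt
      (fun t _ => Sm.hasDerivAt_t hF t θ) (Continuous.intervalIntegrable (by fun_prop) _ _),
      ha, hb, sub_zero]
  simp [this]

theorem slice_pth_zero {E : Type*} [NormedAddCommGroup E] [NormedSpace ℝ E] [CompleteSpace E]
    {F : ℝ → ℝ → E} (hF : Sm F) (hp : Per F) (t : ℝ) :
    ∫ θ in (0 : ℝ)..(2 * π), pth F t θ = 0 := by
  rw [intervalIntegral.integral_eq_sub_of_hasDerivAt
      (fun θ _ => Sm.hasDerivAt_th hF t θ) (Continuous.intervalIntegrable (by fun_prop) _ _)]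
  have := hp t 0
  rw [zero_add] at this
  rw [this, sub_self]

theorem cylInt_pth (hab : a ≤ b) (hF : Sm F) (hp : Per F) : cylInt (pth F) a b = 0 :=
  cylInt_slice_zero hab (by fun_prop) (fun t _ => slice_pth_zero hF hp t)

/-- Divergence terms drop out of an integrated pointwise inequality. -/
theorem cylInt_le_of_div (hab : a ≤ b) {U W Z : ℝ → ℝ → ℝ}
    (hF : Continuous (fun p : ℝ × ℝ => F p.1 p.2))
    (hG : Continuous (fun p : ℝ × ℝ => G p.1 p.2))
    (hZ : Continuous (fun p : ℝ × ℝ => Z p.1 p.2))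
    (hU : Sm U) (hW : Sm W) (hWp : Per W)
    (ha : ∀ θ, U a θ = 0) (hb : ∀ θ, U b θ = 0)
    (hZ0 : ∀ t ∈ Icc a b, ∫ θ in (0 : ℝ)..(2 * π), Z t θ = 0)
    (h : ∀ t ∈ Icc a b, ∀ θ ∈ Icc (0 : ℝ) (2 * π),
      F t θ ≤ G t θ + pt U t θ + pth W t θ + Z t θ) :
    cylInt F a b ≤ cylInt G a b := by
  have h1 := cylInt_mono (F := F) (G := fun t θ => G t θ + pt U t θ + pth W t θ + Z t θ)
    hF (by fun_prop) h
  rw [cylInt_add (F := fun t θ => G t θ + pt U t θ + pth W t θ) (by fun_prop) (by fun_prop),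
    cylInt_add (F := fun t θ => G t θ + pt U t θ) (by fun_prop) (by fun_prop),
    cylInt_add (F := fun t θ => G t θ) (by fun_prop) (by fun_prop),
    cylInt_pt hab hU ha hb, cylInt_pth hab hW hWp, cylInt_slice_zero hab hZ hZ0] at h1
  simpa using h1

theorem sq_setIntegral_le {α : Type*} [MeasurableSpace α] {μ : Measure α} {s : Set α}
    (hs : MeasurableSet s) {h f g : α → ℝ} (hh : IntegrableOn h s μ) (hf : IntegrableOn f s μ)
    (hg : IntegrableOn g s μ) (hf0 : ∀ x ∈ s, 0 ≤ f x) (hg0 : ∀ x ∈ s, 0 ≤ g x)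
    (hle : ∀ x ∈ s, h x ^ 2 ≤ f x * g x) :
    (∫ x in s, h x ∂μ) ^ 2 ≤ (∫ x in s, f x ∂μ) * ∫ x in s, g x ∂μ := by
  have key : ∀ l : ℝ, 0 ≤ (∫ x in s, f x ∂μ) * (l * l) + (-(2 * ∫ x in s, h x ∂μ)) * l
      + ∫ x in s, g x ∂μ := by
    intro l
    have e : (∫ x in s, f x ∂μ) * (l * l) + (-(2 * ∫ x in s, h x ∂μ)) * l + ∫ x in s, g x ∂μ
        = ∫ x in s, ((l * l) * f x - (2 * l) * h x + g x) ∂μ := by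
      have i1 : Integrable (fun x => (l * l) * f x) (μ.restrict s) := hf.const_mul _
      have i2 : Integrable (fun x => (2 * l) * h x) (μ.restrict s) := hh.const_mul _
      have e1 := integral_add (i1.sub i2) hg
      have e2 := integral_sub i1 i2
      simp only [Pi.sub_apply, integral_const_mul] at e1 e2
      rw [e1, e2]
      ring
    rw [e]
    refine setIntegral_nonneg hs (fun x hx => ?_)
    have h0 := hf0 x hx
    have h1 := hg0 x hx
    have h2 := hle x hx
    have h3 : |h x| ≤ √(f x) * √(g x) := by
      rw [← Real.sqrt_mul h0]
      exact Real.abs_le_sqrt h2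
    have h4 : l * h x ≤ |l| * (√(f x) * √(g x)) := by
      calc l * h x ≤ |l * h x| := le_abs_self _
        _ = |l| * |h x| := abs_mul _ _
        _ ≤ _ := by gcongr
    nlinarith [sq_nonneg (|l| * √(f x) - √(g x)), Real.sq_sqrt h0, Real.sq_sqrt h1, sq_abs l]
  have := discrim_le_zero key
  rw [discrim] at this
  nlinarith

/-- Cauchy–Schwarz on a piece of the cylinder. -/
theorem cylInt_sq_le {h : ℝ → ℝ → ℝ} (hh : Continuous (fun p : ℝ × ℝ => h p.1 p.2))
    (hF : Continuous (fun p : ℝ × ℝ => F p.1 p.2)) (hG : Continuous (fun p : ℝ × ℝ => G p.1 p.2))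
    (hF0 : ∀ t θ, 0 ≤ F t θ) (hG0 : ∀ t θ, 0 ≤ G t θ)
    (hle : ∀ t ∈ Icc a b, ∀ θ ∈ Icc (0 : ℝ) (2 * π), h t θ ^ 2 ≤ F t θ * G t θ) :
    cylInt h a b ^ 2 ≤ cylInt F a b * cylInt G a b :=
  sq_setIntegral_le (measurableSet_Icc.prod measurableSet_Icc) (cylInt_integrable hh a b)
    (cylInt_integrable hF a b) (cylInt_integrable hG a b) (fun p _ => hF0 p.1 p.2)
    (fun p _ => hG0 p.1 p.2) (fun p hp => hle p.1 hp.1 p.2 hp.2)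

theorem sq_circleInt_le {h f : ℝ → ℝ} (hh : Continuous h) (hf : Continuous f)
    (hle : ∀ θ ∈ Icc (0 : ℝ) (2 * π), h θ ^ 2 ≤ f θ) :
    (∫ θ in (0 : ℝ)..(2 * π), h θ) ^ 2 ≤ 2 * π * ∫ θ in (0 : ℝ)..(2 * π), f θ := by
  have h2 : (0 : ℝ) ≤ 2 * π := by positivity
  have h3 : ∀ {k : ℝ → ℝ}, Continuous k → IntegrableOn k (Icc 0 (2 * π)) := fun hk =>
    hk.continuousOn.integrableOn_compact isCompact_Icc
  simp only [intervalIntegral.integral_of_le h2, ← integral_Icc_eq_integral_Ioc]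
  have := sq_setIntegral_le (μ := volume) (s := Icc (0 : ℝ) (2 * π)) measurableSet_Icc (h3 hh)
    (h3 (continuous_const (y := (1 : ℝ)))) (h3 hf) (fun _ _ => zero_le_one)
    (fun θ hθ => (sq_nonneg _).trans (hle θ hθ)) (fun θ hθ => by simpa using hle θ hθ)
  simpa [h2] using this

end Integrals

section Wirtinger

theorem wirtinger_real {x x' : ℝ → ℝ} (hx : ∀ θ, HasDerivAt x (x' θ) θ) (hx' : Continuous x')
    (hp : x (2 * π) = x 0) (h0 : ∫ θ in (0 : ℝ)..(2 * π), x θ = 0) :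
    ∫ θ in (0 : ℝ)..(2 * π), x θ ^ 2 ≤ ∫ θ in (0 : ℝ)..(2 * π), x' θ ^ 2 := by
  have h2 : (0 : ℝ) < 2 * π := by positivity
  have hxc : Continuous x := continuous_iff_continuousAt.2 fun θ => (hx θ).continuousAt
  set f : ℝ → ℂ := fun θ => (x θ : ℂ) with hf
  set f' : ℝ → ℂ := fun θ => (x' θ : ℂ) with hf'
  have hfc : Continuous f := by fun_prop
  have hfc' : Continuous f' := by fun_prop
  have hfd : ∀ θ, HasDerivAt f (f' θ) θ := fun θ => (hx θ).ofReal_comp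
  have hmem : ∀ {g : ℝ → ℂ}, Continuous g → MemLp g 2 (volume.restrict (Ioc 0 (2 * π))) := by
    intro g hg
    refine (memLp_two_iff_integrable_sq_norm hg.aestronglyMeasurable).2 ?_
    exact ((hg.norm.pow 2).continuousOn.integrableOn_compact
      (isCompact_Icc (a := (0 : ℝ)) (b := 2 * π))).mono_set Ioc_subset_Icc_self
  have s1 := hasSum_sq_fourierCoeffOn h2 (hmem hfc)
  have s2 := hasSum_sq_fourierCoeffOn h2 (hmem hfc')
  have hle := hasSum_le (fun n => ?_) s1 s2
  · have e1 : ∀ θ, ‖f θ‖ ^ 2 = x θ ^ 2 := fun θ => by simp [hf]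
    have e2 : ∀ θ, ‖f' θ‖ ^ 2 = x' θ ^ 2 := fun θ => by simp [hf']
    simp only [e1, e2, smul_eq_mul, sub_zero] at hle
    exact le_of_mul_le_mul_left hle (by positivity)
  · by_cases hn : n = 0
    · have : fourierCoeffOn h2 f n = 0 := by
        rw [fourierCoeffOn_eq_integral, hn]
        simp [hf, intervalIntegral.integral_ofReal, h0]
      rw [this]
      simp
    · have hd := fourierCoeffOn_of_hasDerivAt h2 hn (fun θ _ => hfd θ)
        (hfc'.intervalIntegrable _ _)
      have hp' : f (2 * π) - f 0 = 0 := by simp [hf, hp]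
      rw [hd, hp']
      have hn1 : (1 : ℝ) ≤ |(n : ℝ)| := by exact_mod_cast Int.one_le_abs hn
      have e : (1 : ℂ) / (-2 * π * Complex.I * n) * (fourier (-n) ((0 : ℝ) : AddCircle (2 * π - 0)) * 0
          - ((2 * π : ℝ) - (0 : ℝ)) * fourierCoeffOn h2 f' n)
          = (Complex.I * (n : ℂ))⁻¹ * fourierCoeffOn h2 f' n := by
        have hpi : (π : ℂ) ≠ 0 := by exact_mod_cast Real.pi_ne_zero
        have hnc : (n : ℂ) ≠ 0 := by exact_mod_cast hn
        push_cast
        field_simp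
        ring
      rw [e, norm_mul, mul_pow]
      have hnn : ‖(Complex.I * (n : ℂ))⁻¹‖ ^ 2 ≤ 1 := by
        rw [norm_inv, norm_mul, Complex.norm_I, one_mul, Complex.norm_intCast]
        exact pow_le_one₀ (by positivity) (inv_le_one_of_one_le₀ hn1)
      exact mul_le_of_le_one_left (by positivity) hnn

/-- Wirtinger's inequality for curves in Euclidean space. -/
theorem wirtinger {n : ℕ} {x x' : ℝ → EuclideanSpace ℝ (Fin n)}
    (hx : ∀ θ, HasDerivAt x (x' θ) θ) (hx' : Continuous x')
    (hp : x (2 * π) = x 0) (h0 : ∫ θ in (0 : ℝ)..(2 * π), x θ = 0) :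
    ∫ θ in (0 : ℝ)..(2 * π), ‖x θ‖ ^ 2 ≤ ∫ θ in (0 : ℝ)..(2 * π), ‖x' θ‖ ^ 2 := by
  have hxc : Continuous x := continuous_iff_continuousAt.2 fun θ => (hx θ).continuousAt
  simp only [EuclideanSpace.real_norm_sq_eq]
  rw [intervalIntegral.integral_finsetSum
      (fun i _ => Continuous.intervalIntegrable (by fun_prop) _ _),
    intervalIntegral.integral_finsetSum
      (fun i _ => Continuous.intervalIntegrable (by fun_prop) _ _)]
  refine Finset.sum_le_sum fun i _ => ?_
  have hd : ∀ θ, HasDerivAt (fun θ => x θ i) (x' θ i) θ := fun θ =>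
    ((EuclideanSpace.proj (𝕜 := ℝ) i).hasFDerivAt.comp_hasDerivAt θ (hx θ))
  refine wirtinger_real hd (by fun_prop) (by rw [hp]) ?_
  have := (EuclideanSpace.proj (𝕜 := ℝ) i : EuclideanSpace ℝ (Fin n) →L[ℝ] ℝ).intervalIntegral_comp_comm
    (hxc.intervalIntegrable (μ := volume) 0 (2 * π))
  rw [h0, map_zero] at this
  exact this

end Wirtinger

section SliceMean

variable {E : Type*} [NormedAddCommGroup E] [NormedSpace ℝ E]

theorem hasDerivAt_slice {F : ℝ → ℝ → E} (hF : Sm F) (t : ℝ) :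
    HasDerivAt (fun t => ∫ θ in (0 : ℝ)..(2 * π), F t θ)
      (∫ θ in (0 : ℝ)..(2 * π), pt F t θ) t := by
  have hc : Continuous (fun p : ℝ × ℝ => pt F p.1 p.2) := by fun_prop
  obtain ⟨C, hC⟩ := ((isCompact_Icc (a := t - 1) (b := t + 1)).prod
    (isCompact_Icc (a := (0 : ℝ)) (b := 2 * π))).exists_bound_of_continuousOn hc.continuousOn
  have h2 : (0 : ℝ) ≤ 2 * π := by positivity
  refine (intervalIntegral.hasDerivAt_integral_of_dominated_loc_of_deriv_le
    (F := F) (F' := fun s θ => pt F s θ) (bound := fun _ => C) (s := Icc (t - 1) (t + 1))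
    (Icc_mem_nhds (by linarith) (by linarith)) (Eventually.of_forall fun s => ?_) ?_ ?_ ?_ ?_ ?_).2
  · exact Continuous.aestronglyMeasurable (by fun_prop)
  · exact Continuous.intervalIntegrable (by fun_prop) _ _
  · exact Continuous.aestronglyMeasurable (by fun_prop)
  · refine ae_of_all _ fun θ hθ s hs => hC (s, θ) ⟨hs, ?_⟩
    rw [uIoc_of_le h2] at hθ
    exact Ioc_subset_Icc_self hθ
  · exact intervalIntegrable_const
  · exact ae_of_all _ fun θ _ s _ => Sm.hasDerivAt_t hF s θ

theorem contDiff_slice {F : ℝ → ℝ → E} (hF : Sm F) :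
    ContDiff ℝ (⊤ : ℕ∞) (fun t => ∫ θ in (0 : ℝ)..(2 * π), F t θ) := by
  have h : ∀ k : ℕ, ∀ F : ℝ → ℝ → E, Sm F →
      ContDiff ℝ k (fun t => ∫ θ in (0 : ℝ)..(2 * π), F t θ) := by
    intro k
    induction k with
    | zero =>
      intro F hF
      exact contDiff_zero.2 (continuous_slice hF.continuous)
    | succ k ih =>
      intro F hF
      push_cast
      refine contDiff_succ_iff_deriv.2 ⟨fun t => (hasDerivAt_slice hF t).differentiableAt,
        by simp, ?_⟩
      have : deriv (fun t => ∫ θ in (0 : ℝ)..(2 * π), F t θ)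
          = fun t => ∫ θ in (0 : ℝ)..(2 * π), pt F t θ :=
        funext fun t => (hasDerivAt_slice hF t).deriv
      rw [this]
      exact ih _ (contDiff_pt hF)
  exact contDiff_infty.2 fun k => h k F hF

/-- The mean of `F` over the circle at height `t`. -/
def smean (F : ℝ → ℝ → E) (t : ℝ) : E := (2 * π)⁻¹ • ∫ θ in (0 : ℝ)..(2 * π), F t θ

@[fun_prop]
theorem contDiff_smean {F : ℝ → ℝ → E}
    (hF : ContDiff ℝ (⊤ : ℕ∞) (fun p : ℝ × ℝ => F p.1 p.2)) :
    ContDiff ℝ (⊤ : ℕ∞) (smean F) :=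
  contDiff_const.smul (contDiff_slice hF)

theorem deriv_smean {F : ℝ → ℝ → E} (hF : Sm F) (t : ℝ) :
    deriv (smean F) t = smean (pt F) t :=
  ((hasDerivAt_slice hF t).const_smul _).deriv

theorem hasDerivAt_smean {F : ℝ → ℝ → E} (hF : Sm F) (t : ℝ) :
    HasDerivAt (smean F) (smean (pt F) t) t :=
  (hasDerivAt_slice hF t).const_smul _

variable [CompleteSpace E]

theorem integral_sub_smean {F : ℝ → ℝ → E} (hF : Continuous (fun p : ℝ × ℝ => F p.1 p.2)) (t : ℝ) :
    ∫ θ in (0 : ℝ)..(2 * π), (F t θ - smean F t) = 0 := by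
  rw [intervalIntegral.integral_sub (Continuous.intervalIntegrable (by fun_prop) _ _)
    intervalIntegrable_const, intervalIntegral.integral_const, smean, sub_zero, smul_smul,
    mul_inv_cancel₀ (by positivity), one_smul, sub_self]

/-- The oscillation of a function on a circle is bounded by the integral of its derivative. -/
theorem norm_sub_le_circleInt {x x' : ℝ → E} (hx : ∀ θ, HasDerivAt x (x' θ) θ)
    (hx' : Continuous x') {φ θ : ℝ} (hφ : φ ∈ Icc (0 : ℝ) (2 * π)) (hθ : θ ∈ Icc (0 : ℝ) (2 * π)) :
    ‖x θ - x φ‖ ≤ ∫ s in (0 : ℝ)..(2 * π), ‖x' s‖ := by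
  have hpi : (0 : ℝ) ≤ 2 * π := by positivity
  rw [← intervalIntegral.integral_eq_sub_of_hasDerivAt (a := φ) (b := θ)
    (fun s _ => hx s) (hx'.intervalIntegrable _ _)]
  refine (intervalIntegral.norm_integral_le_abs_integral_norm).trans ?_
  have := intervalIntegral.abs_integral_mono_interval (a := φ) (b := θ)
    (f := fun s => ‖x' s‖) (μ := volume) (c := 0) (d := 2 * π) (by
      rw [uIoc_of_le hpi]
      intro s hs
      rcases le_total φ θ with h | h
      · rw [uIoc_of_le h] at hs; exact ⟨hφ.1.trans_lt hs.1, hs.2.trans hθ.2⟩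
      · rw [uIoc_of_ge h] at hs; exact ⟨hθ.1.trans_lt hs.1, hs.2.trans hφ.2⟩)
    (ae_of_all _ fun s => norm_nonneg _) (hx'.norm.intervalIntegrable _ _)
  refine this.trans (le_of_eq (abs_of_nonneg ?_))
  exact intervalIntegral.integral_nonneg hpi fun s _ => norm_nonneg _

/-- A function whose gradient has small integrals along the circles is close to a mean value. -/
theorem norm_sub_smean_le {F : ℝ → ℝ → E} (hF : Sm F) {a b tc κ : ℝ}
    (htc : tc ∈ Icc a b)
    (h1 : ∀ t ∈ Icc a b, ∫ θ in (0 : ℝ)..(2 * π), ‖pt F t θ‖ ≤ κ)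
    (h2 : ∀ t ∈ Icc a b, ∫ θ in (0 : ℝ)..(2 * π), ‖pth F t θ‖ ≤ κ)
    {t : ℝ} (ht : t ∈ Icc a b) {θ : ℝ} (hθ : θ ∈ Icc (0 : ℝ) (2 * π)) :
    ‖F t θ - smean F tc‖ ≤ (1 + (b - a)) * κ := by
  have hpi : (0 : ℝ) ≤ 2 * π := by positivity
  have hpi' : (2 * π)⁻¹ * (2 * π) = 1 := inv_mul_cancel₀ (by positivity)
  have hosc : ∀ φ ∈ Icc (0 : ℝ) (2 * π), ‖F t θ - F t φ‖ ≤ κ := fun φ hφ =>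
    (norm_sub_le_circleInt (x := F t) (fun s => Sm.hasDerivAt_th hF t s) (by fun_prop) hφ hθ).trans
      (h2 t ht)
  have hA : ‖F t θ - smean F t‖ ≤ κ := by
    have e : F t θ - smean F t = (2 * π)⁻¹ • ∫ φ in (0 : ℝ)..(2 * π), (F t θ - F t φ) := by
      rw [intervalIntegral.integral_sub intervalIntegrable_const
        (Continuous.intervalIntegrable (by fun_prop) _ _), intervalIntegral.integral_const,
        smul_sub, sub_zero, smul_smul, hpi', one_smul, smean]
    rw [e, norm_smul, Real.norm_of_nonneg (by positivity)]
    have := intervalIntegral.norm_integral_le_of_norm_le_const (a := 0) (b := 2 * π) (C := κ)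
      (f := fun φ => F t θ - F t φ) (fun φ hφ => hosc φ (by
        rw [uIoc_of_le hpi] at hφ; exact Ioc_subset_Icc_self hφ))
    rw [sub_zero, abs_of_nonneg hpi] at this
    calc (2 * π)⁻¹ * _ ≤ (2 * π)⁻¹ * (κ * (2 * π)) := by gcongr
      _ = κ := by rw [mul_comm κ, ← mul_assoc, hpi', one_mul]
  have hB : ‖smean F t - smean F tc‖ ≤ κ * |t - tc| := by
    refine (convex_Icc a b).norm_image_sub_le_of_norm_hasDerivWithin_le
      (f' := smean (pt F)) (fun s _ => (hasDerivAt_smean hF s).hasDerivWithinAt) ?_ htc ht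
    intro s hs
    rw [smean, norm_smul, Real.norm_of_nonneg (by positivity)]
    have h3 := (intervalIntegral.norm_integral_le_integral_norm (f := fun θ => pt F s θ)
      (μ := volume) hpi).trans (h1 s hs)
    have h4 : (2 * π)⁻¹ ≤ 1 := inv_le_one_of_one_le₀ (by linarith [Real.pi_gt_three])
    have h5 : 0 ≤ κ := (norm_nonneg _).trans h3
    calc (2 * π)⁻¹ * ‖∫ θ in (0 : ℝ)..(2 * π), pt F s θ‖ ≤ 1 * κ := by gcongr
      _ = κ := one_mul κ
  have hκ : 0 ≤ κ := (norm_nonneg _).trans hA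
  have hd : |t - tc| ≤ b - a := abs_sub_le_iff.2 ⟨by linarith [ht.2, htc.1], by linarith [ht.1, htc.2]⟩
  calc ‖F t θ - smean F tc‖ = ‖(F t θ - smean F t) + (smean F t - smean F tc)‖ := by
        rw [sub_add_sub_cancel]
    _ ≤ κ + κ * (b - a) := (norm_add_le _ _).trans (add_le_add hA (hB.trans (by gcongr)))
    _ = _ := by ring

end SliceMean

section Inequalities

theorem inner_le_young {V : Type*} [NormedAddCommGroup V] [InnerProductSpace ℝ V] (x y : V)
    {κ : ℝ} (hκ : 0 < κ) : ⟪x, y⟫_ℝ ≤ κ * ‖x‖ ^ 2 + 1 / (4 * κ) * ‖y‖ ^ 2 := by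
  have h1 := real_inner_le_norm x y
  have h2 : κ * ‖x‖ ^ 2 + 1 / (4 * κ) * ‖y‖ ^ 2 - ‖x‖ * ‖y‖
      = κ * (‖x‖ - ‖y‖ / (2 * κ)) ^ 2 := by
    field_simp
    ring
  nlinarith [mul_nonneg hκ.le (sq_nonneg (‖x‖ - ‖y‖ / (2 * κ)))]

theorem norm_smul_sq_real {V : Type*} [NormedAddCommGroup V] [NormedSpace ℝ V] (r : ℝ) (x : V) :
    ‖r • x‖ ^ 2 = r ^ 2 * ‖x‖ ^ 2 := by
  rw [norm_smul, mul_pow, Real.norm_eq_abs, sq_abs]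

theorem norm_add_sq_le_two {V : Type*} [NormedAddCommGroup V] [InnerProductSpace ℝ V] (x y : V) :
    ‖x + y‖ ^ 2 ≤ 2 * ‖x‖ ^ 2 + 2 * ‖y‖ ^ 2 := by
  nlinarith [norm_add_le x y, sq_nonneg (‖x‖ - ‖y‖), norm_nonneg (x + y), norm_nonneg x,
    norm_nonneg y]

theorem norm_sub_sq_le_two {V : Type*} [NormedAddCommGroup V] [InnerProductSpace ℝ V] (x y : V) :
    ‖x - y‖ ^ 2 ≤ 2 * ‖x‖ ^ 2 + 2 * ‖y‖ ^ 2 := by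
  have := norm_add_sq_le_two x (-y)
  rwa [norm_neg, ← sub_eq_add_neg] at this

theorem slice_le_cylInt {h : ℝ → ℝ → ℝ} (hh : Sm h) {a b : ℝ} (ha : ∀ θ, h a θ = 0) {t : ℝ}
    (ht : t ∈ Icc a b) :
    ∫ θ in (0 : ℝ)..(2 * π), h t θ ≤ cylInt (fun t θ => |pt h t θ|) a b := by
  have e : ∫ θ in (0 : ℝ)..(2 * π), h t θ = cylInt (pt h) a t := by
    rw [cylInt_eq_iterated_swap ht.1 (by fun_prop)]
    refine intervalIntegral.integral_congr fun θ _ => ?_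
    rw [intervalIntegral.integral_eq_sub_of_hasDerivAt
      (fun t _ => Sm.hasDerivAt_t hh t θ) (Continuous.intervalIntegrable (by fun_prop) _ _),
      ha, sub_zero]
  rw [e]
  refine (cylInt_mono (G := fun t θ => |pt h t θ|) (by fun_prop) (by fun_prop)
    fun _ _ _ _ => le_abs_self _).trans ?_
  exact cylInt_subset (by fun_prop) le_rfl ht.2 fun _ _ _ _ => abs_nonneg _

/-- A Ladyzhenskaya-type inequality on a piece of the cylinder. -/
theorem ladyzhenskaya {g : ℝ → ℝ → ℝ} (hg : Sm g) {a b : ℝ} (hab : a ≤ b)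
    (ha : ∀ θ, g a θ = 0) (hg0 : ∀ t ∈ Icc a b, ∀ θ ∈ Icc (0 : ℝ) (2 * π), 0 ≤ g t θ) :
    cylInt (fun t θ => g t θ ^ 2) a b
      ≤ cylInt (fun t θ => |pt g t θ|) a b * cylInt (fun t θ => g t θ + |pth g t θ|) a b := by
  have hpi : (0 : ℝ) ≤ 2 * π := by positivity
  set M := cylInt (fun t θ => |pt g t θ|) a b with hM
  rw [← cylInt_const_mul]
  refine cylInt_slice_mono hab (by fun_prop) (by fun_prop) fun t ht => ?_
  set S := ∫ θ in (0 : ℝ)..(2 * π), (g t θ + |pth g t θ|) with hS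
  have hSe : S = (∫ θ in (0 : ℝ)..(2 * π), g t θ) + ∫ θ in (0 : ℝ)..(2 * π), |pth g t θ| :=
    intervalIntegral.integral_add (Continuous.intervalIntegrable (by fun_prop) _ _)
      (Continuous.intervalIntegrable (by fun_prop) _ _)
  have hI0 : 0 ≤ ∫ θ in (0 : ℝ)..(2 * π), g t θ :=
    intervalIntegral.integral_nonneg hpi fun θ hθ => hg0 t ht θ hθ
  have hS0 : 0 ≤ S := intervalIntegral.integral_nonneg hpi fun θ hθ =>
    add_nonneg (hg0 t ht θ hθ) (abs_nonneg _)
  have hgS : ∀ θ ∈ Icc (0 : ℝ) (2 * π), g t θ ≤ S := by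
    intro θ hθ
    have h1 : ∀ φ ∈ Icc (0 : ℝ) (2 * π), g t θ - ∫ s in (0 : ℝ)..(2 * π), |pth g t s| ≤ g t φ := by
      intro φ hφ
      have := norm_sub_le_circleInt (x := g t) (fun s => Sm.hasDerivAt_th hg t s) (by fun_prop)
        hφ hθ
      have h2 := (Real.le_norm_self _).trans this
      simp only [Real.norm_eq_abs] at h2
      linarith
    have h2 := intervalIntegral.integral_mono_on hpi intervalIntegrable_const
      (Continuous.intervalIntegrable (μ := volume) (u := g t) (by fun_prop) _ _) h1
    rw [intervalIntegral.integral_const, sub_zero, smul_eq_mul] at h2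
    by_contra hcon
    push Not at hcon
    have h3 : (∫ φ in (0 : ℝ)..(2 * π), g t φ)
        < g t θ - ∫ s in (0 : ℝ)..(2 * π), |pth g t s| := by linarith
    nlinarith [Real.pi_gt_three]
  have h1 : ∫ θ in (0 : ℝ)..(2 * π), g t θ ^ 2 ≤ ∫ θ in (0 : ℝ)..(2 * π), S * g t θ :=
    intervalIntegral.integral_mono_on hpi (Continuous.intervalIntegrable (by fun_prop) _ _)
      (Continuous.intervalIntegrable (by fun_prop) _ _) fun θ hθ => by
        nlinarith [hgS θ hθ, hg0 t ht θ hθ]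
  refine h1.trans ?_
  rw [intervalIntegral.integral_const_mul, intervalIntegral.integral_const_mul, mul_comm M]
  exact mul_le_mul_of_nonneg_left (slice_le_cylInt hg ha ht) hS0

variable {n : ℕ}

/-- Wirtinger's inequality along a circle of the cylinder. -/
theorem wirtinger_slice {x : ℝ → ℝ → EuclideanSpace ℝ (Fin n)} (hx : Sm x) (hp : Per x) {t : ℝ}
    (h0 : ∫ θ in (0 : ℝ)..(2 * π), x t θ = 0) :
    ∫ θ in (0 : ℝ)..(2 * π), ‖x t θ‖ ^ 2 ≤ ∫ θ in (0 : ℝ)..(2 * π), ‖pth x t θ‖ ^ 2 := by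
  refine wirtinger (x := x t) (fun θ => Sm.hasDerivAt_th hx t θ) (by fun_prop) ?_ h0
  have := hp t 0
  rwa [zero_add] at this

theorem poincare {x : ℝ → ℝ → EuclideanSpace ℝ (Fin n)} (hx : Sm x) (hp : Per x) {a b tc : ℝ}
    (htc : tc ∈ Icc a b) (h0 : smean x tc = 0) :
    cylInt (fun t θ => ‖x t θ‖ ^ 2) a b
      ≤ 2 * cylInt (fun t θ => ‖pth x t θ‖ ^ 2) a b
        + 2 * (b - a) ^ 2 * cylInt (fun t θ => ‖pt x t θ‖ ^ 2) a b := by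
  have hpi : (0 : ℝ) ≤ 2 * π := by positivity
  have hab : a ≤ b := htc.1.trans htc.2
  set D := cylInt (fun t θ => ‖pt x t θ‖ ^ 2) a b with hD
  set X := cylInt (fun t θ => ‖pt x t θ‖) a b with hX
  have hone : cylInt (fun _ _ => (1 : ℝ)) a b = (b - a) * (2 * π) := by
    rw [cylInt_eq_iterated hab (by fun_prop)]
    simp
    ring
  have hXD : X ^ 2 ≤ (b - a) * (2 * π) * D := by
    rw [← hone]
    refine cylInt_sq_le (by fun_prop) (by fun_prop) (by fun_prop) (fun _ _ => zero_le_one)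
      (fun _ _ => sq_nonneg _) (fun _ _ _ _ => by simp)
  have hmean : ∀ t ∈ Icc a b, 2 * π * ‖smean x t‖ ≤ X := by
    intro t ht
    have hc : Continuous (fun s => ∫ θ in (0 : ℝ)..(2 * π), ‖pt x s θ‖) :=
      continuous_slice (F := fun s θ => ‖pt x s θ‖) (by fun_prop)
    have e : smean x t = ∫ s in tc..t, smean (pt x) s := by
      rw [intervalIntegral.integral_eq_sub_of_hasDerivAt
        (fun s _ => hasDerivAt_smean hx s)
        ((contDiff_smean (contDiff_pt hx)).continuous.intervalIntegrable _ _), h0, sub_zero]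
    have h1 : ‖smean x t‖ ≤ |∫ s in tc..t, (2 * π)⁻¹ * ∫ θ in (0 : ℝ)..(2 * π), ‖pt x s θ‖| := by
      rw [e]
      refine intervalIntegral.norm_integral_le_abs_of_norm_le (ae_of_all _ fun s => ?_)
        (Continuous.intervalIntegrable (by fun_prop) _ _)
      rw [smean, norm_smul, Real.norm_of_nonneg (by positivity)]
      gcongr
      exact intervalIntegral.norm_integral_le_integral_norm hpi
    rw [intervalIntegral.integral_const_mul, abs_mul, abs_of_nonneg (by positivity)] at h1
    have h2 := intervalIntegral.abs_integral_mono_interval (a := tc) (b := t)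
      (f := fun s => ∫ θ in (0 : ℝ)..(2 * π), ‖pt x s θ‖) (μ := volume) (c := a) (d := b) (by
        rw [uIoc_of_le hab]
        intro s hs
        rcases le_total tc t with h | h
        · rw [uIoc_of_le h] at hs; exact ⟨htc.1.trans_lt hs.1, hs.2.trans ht.2⟩
        · rw [uIoc_of_ge h] at hs; exact ⟨ht.1.trans_lt hs.1, hs.2.trans htc.2⟩)
      (ae_of_all _ fun s => intervalIntegral.integral_nonneg hpi fun _ _ => norm_nonneg _)
      (hc.intervalIntegrable _ _)
    rw [← cylInt_eq_iterated hab (by fun_prop), abs_of_nonneg (a := cylInt _ _ _)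
      (cylInt_nonneg fun _ _ _ _ => norm_nonneg _)] at h2
    calc 2 * π * ‖smean x t‖ ≤ 2 * π * ((2 * π)⁻¹ * X) := by
          gcongr
          exact h1.trans (by gcongr)
      _ = X := by rw [← mul_assoc, mul_inv_cancel₀ (by positivity), one_mul]
  have hD0 : 0 ≤ D := cylInt_nonneg fun _ _ _ _ => sq_nonneg _
  have hmean2 : ∀ t ∈ Icc a b, 2 * π * ‖smean x t‖ ^ 2 ≤ (b - a) * D := by
    intro t ht
    have h1 := hmean t ht
    have h2 : (2 * π * ‖smean x t‖) ^ 2 ≤ (b - a) * (2 * π) * D :=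
      (pow_le_pow_left₀ (by positivity) h1 2).trans hXD
    have h3 : 2 * π * (2 * π * ‖smean x t‖ ^ 2) ≤ 2 * π * ((b - a) * D) := by nlinarith
    exact le_of_mul_le_mul_left h3 (by positivity)
  have h1 : cylInt (fun t θ => ‖x t θ‖ ^ 2) a b
      ≤ cylInt (fun t θ => 2 * ‖pth x t θ‖ ^ 2 + 2 * ((2 * π)⁻¹ * ((b - a) * D))) a b := by
    refine cylInt_slice_mono hab (by fun_prop) (by fun_prop) fun t ht => ?_
    have hy : Sm (fun t θ => x t θ - smean x t) := by unfold Sm; fun_prop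
    have hyp : Per (fun t θ => x t θ - smean x t) := fun t θ => by simp only [hp t θ]
    have h2 := wirtinger_slice hy hyp (t := t) (integral_sub_smean (by fun_prop) t)
    have e : ∀ θ, pth (fun t θ => x t θ - smean x t) t θ = pth x t θ := fun θ => by
      rw [pth_sub t θ (by fun_prop) (by fun_prop), pth_fst, sub_zero]
    simp only [e] at h2
    have h3 : ∫ θ in (0 : ℝ)..(2 * π), ‖x t θ‖ ^ 2
        ≤ ∫ θ in (0 : ℝ)..(2 * π), (2 * ‖x t θ - smean x t‖ ^ 2 + 2 * ‖smean x t‖ ^ 2) := by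
      refine intervalIntegral.integral_mono_on hpi (Continuous.intervalIntegrable (by fun_prop) _ _)
        (Continuous.intervalIntegrable (by fun_prop) _ _) fun θ _ => ?_
      have := norm_add_sq_le_two (x t θ - smean x t) (smean x t)
      rwa [sub_add_cancel] at this
    rw [intervalIntegral.integral_add (Continuous.intervalIntegrable (by fun_prop) _ _)
      intervalIntegrable_const, intervalIntegral.integral_const_mul,
      intervalIntegral.integral_const, sub_zero, smul_eq_mul] at h3
    rw [intervalIntegral.integral_add (Continuous.intervalIntegrable (by fun_prop) _ _)
      intervalIntegrable_const, intervalIntegral.integral_const_mul,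
      intervalIntegral.integral_const, sub_zero, smul_eq_mul]
    have h4 := hmean2 t ht
    have h5 : 2 * π * (2 * ((2 * π)⁻¹ * ((b - a) * D))) = 2 * ((b - a) * D) := by
      field_simp
    linarith
  refine h1.trans (le_of_eq ?_)
  rw [cylInt_add (F := fun t θ => 2 * ‖pth x t θ‖ ^ 2) (by fun_prop) (by fun_prop),
    cylInt_const_mul, show (fun _ _ : ℝ => 2 * ((2 * π)⁻¹ * ((b - a) * D)))
      = fun _ _ => (2 * ((2 * π)⁻¹ * ((b - a) * D))) * (1 : ℝ) by simp, cylInt_const_mul, hone]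
  field_simp

end Inequalities

section Agmon

variable {n : ℕ}

theorem contDiff_deriv_top {F : Type*} [NormedAddCommGroup F] [NormedSpace ℝ F] {ζ : ℝ → F}
    (hζ : ContDiff ℝ (⊤ : ℕ∞) ζ) : ContDiff ℝ (⊤ : ℕ∞) (deriv ζ) :=
  (contDiff_pt (f := fun t (_ : ℝ) => ζ t) (by fun_prop)).comp
    (contDiff_id.prodMk (contDiff_const (c := (0 : ℝ))))

theorem agmon_energy {x Qt Qh Q0 : ℝ → ℝ → EuclideanSpace ℝ (Fin n)}
    {κv : ℝ → EuclideanSpace ℝ (Fin n)} {ζ : ℝ → ℝ} {a b s β : ℝ} (hab : a ≤ b)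
    (hx : Sm x) (hxp : Per x) (hQt : Sm Qt) (hQh : Sm Qh) (hQhp : Per Qh) (hQ0 : Sm Q0)
    (hκv : Continuous κv) (hζ : ContDiff ℝ (⊤ : ℕ∞) ζ)
    (heq : ∀ t ∈ Icc a b, ∀ θ, pt (pt x) t θ + pth (pth x) t θ
      = pt Qt t θ + pth Qh t θ + Q0 t θ + κv t)
    (h0 : ∀ t, ∫ θ in (0 : ℝ)..(2 * π), x t θ = 0)
    (hζa : ζ a = 0) (hζb : ζ b = 0) (hζ1 : ∀ t ∈ Icc a b, ζ t ^ 2 ≤ 1)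
    (hζ' : ∀ t ∈ Icc a b, deriv ζ t ^ 2 ≤ s ^ 2 * ζ t ^ 2 + β)
    {κ : ℝ} (hκ0 : 0 < κ) :
    cylInt (fun t θ => 1 / 2 * ‖ζ t • pt x t θ + deriv ζ t • x t θ‖ ^ 2
        + (1 - κ) * (ζ t ^ 2 * ‖pth x t θ‖ ^ 2)) a b
      ≤ cylInt (fun t θ => (((1 + κ) * s ^ 2 + κ) * (ζ t ^ 2 * ‖x t θ‖ ^ 2)
          + (1 + κ) * β * ‖x t θ‖ ^ 2)
          + (1 / 2 + 1 / (4 * κ)) * (‖Qt t θ‖ ^ 2 + ‖Qh t θ‖ ^ 2 + ‖Q0 t θ‖ ^ 2)) a b := by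
  have hζd := contDiff_deriv_top hζ
  set g : ℝ → ℝ → EuclideanSpace ℝ (Fin n) := fun t θ => ζ t • pt x t θ + deriv ζ t • x t θ with hg
  have hgS : Sm g := by unfold Sm; fun_prop
  refine cylInt_le_of_div hab (U := fun t θ => (ζ t * ζ t) * ⟪x t θ, pt x t θ - Qt t θ⟫_ℝ)
    (W := fun t θ => (ζ t * ζ t) * ⟪x t θ, pth x t θ - Qh t θ⟫_ℝ)
    (Z := fun t θ => -((ζ t * ζ t) * ⟪x t θ, κv t⟫_ℝ)) (by fun_prop) (by fun_prop) (by fun_prop)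
    (by unfold Sm; fun_prop) (by unfold Sm; fun_prop)
    (fun t θ => by simp only [hxp t θ, hxp.pth t θ, hQhp t θ]) (fun θ => by simp [hζa])
    (fun θ => by simp [hζb]) ?_ ?_
  · intro t _
    have e1 : ∀ θ, -((ζ t * ζ t) * ⟪x t θ, κv t⟫_ℝ) = -(ζ t * ζ t) * innerSL ℝ (κv t) (x t θ) :=
      fun θ => by rw [innerSL_apply_apply, real_inner_comm]; ring
    simp only [e1]
    rw [intervalIntegral.integral_const_mul, ContinuousLinearMap.intervalIntegral_comp_comm _
      (Continuous.intervalIntegrable (by fun_prop) _ _), h0 t]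
    simp
  · intro t ht θ _
    have eU : pt (fun t θ => (ζ t * ζ t) * ⟪x t θ, pt x t θ - Qt t θ⟫_ℝ) t θ
        = (2 * (ζ t * deriv ζ t)) * ⟪x t θ, pt x t θ - Qt t θ⟫_ℝ
          + (ζ t * ζ t) * (⟪pt x t θ, pt x t θ - Qt t θ⟫_ℝ
            + ⟪x t θ, pt (pt x) t θ - pt Qt t θ⟫_ℝ) := by
      rw [pt_mul t θ (by fun_prop) (by fun_prop), pt_mul t θ (by fun_prop) (by fun_prop),
        pt_fst, pt_inner t θ (by fun_prop) (by fun_prop), pt_sub t θ (by fun_prop) (by fun_prop)]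
      ring
    have eW : pth (fun t θ => (ζ t * ζ t) * ⟪x t θ, pth x t θ - Qh t θ⟫_ℝ) t θ
        = (ζ t * ζ t) * (⟪pth x t θ, pth x t θ - Qh t θ⟫_ℝ
            + ⟪x t θ, pth (pth x) t θ - pth Qh t θ⟫_ℝ) := by
      rw [pth_mul t θ (by fun_prop) (by fun_prop), pth_mul t θ (by fun_prop) (by fun_prop),
        pth_fst, pth_inner t θ (by fun_prop) (by fun_prop),
        pth_sub t θ (by fun_prop) (by fun_prop)]
      ring
    rw [eU, eW]
    have e2 : ⟪x t θ, pt (pt x) t θ⟫_ℝ + ⟪x t θ, pth (pth x) t θ⟫_ℝ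
        = ⟪x t θ, pt Qt t θ⟫_ℝ + ⟪x t θ, pth Qh t θ⟫_ℝ + ⟪x t θ, Q0 t θ⟫_ℝ + ⟪x t θ, κv t⟫_ℝ := by
      rw [← inner_add_right, heq t ht θ, inner_add_right, inner_add_right, inner_add_right]
    have hz := hζ' t ht
    have hz1 := hζ1 t ht
    have y1 := inner_le_young (g t θ) (ζ t • Qt t θ) (κ := 1 / 2) (by norm_num)
    have y2 := inner_le_young (deriv ζ t • x t θ) (ζ t • Qt t θ) hκ0
    have y3 := inner_le_young (ζ t • pth x t θ) (ζ t • Qh t θ) hκ0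
    have y4 := inner_le_young (ζ t • x t θ) (-(ζ t • Q0 t θ)) hκ0
    have eg : ‖g t θ‖ ^ 2 = ζ t ^ 2 * ‖pt x t θ‖ ^ 2
        + 2 * (ζ t * deriv ζ t) * ⟪x t θ, pt x t θ⟫_ℝ + deriv ζ t ^ 2 * ‖x t θ‖ ^ 2 := by
      rw [hg]
      simp only
      rw [norm_add_sq_real, norm_smul_sq_real, norm_smul_sq_real, real_inner_smul_left,
        real_inner_smul_right, real_inner_comm]
      ring
    have eg2 : ⟪g t θ, ζ t • Qt t θ⟫_ℝ = ζ t ^ 2 * ⟪pt x t θ, Qt t θ⟫_ℝ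
        + ζ t * deriv ζ t * ⟪x t θ, Qt t θ⟫_ℝ := by
      rw [hg]
      simp only [inner_add_left, real_inner_smul_left, real_inner_smul_right]
      ring
    rw [eg2] at y1
    simp only [real_inner_smul_left, real_inner_smul_right, inner_neg_right, norm_neg,
      norm_smul_sq_real] at y1 y2 y3 y4
    simp only [inner_sub_right, real_inner_self_eq_norm_sq]
    have hX := sq_nonneg ‖x t θ‖
    have hA := mul_le_mul_of_nonneg_right hz1 (sq_nonneg ‖Qt t θ‖)
    have hB := mul_le_mul_of_nonneg_right hz1 (sq_nonneg ‖Qh t θ‖)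
    have hC := mul_le_mul_of_nonneg_right hz1 (sq_nonneg ‖Q0 t θ‖)
    have hk : 0 < 1 / (4 * κ) := by positivity
    set k4 := 1 / (4 * κ) with hk4
    have hA' := mul_le_mul_of_nonneg_left hA hk.le
    have hB' := mul_le_mul_of_nonneg_left hB hk.le
    have hC' := mul_le_mul_of_nonneg_left hC hk.le
    have hzx := mul_le_mul_of_nonneg_right hz hX
    have hzx' := mul_le_mul_of_nonneg_left hzx hκ0.le
    norm_num at y1
    have e3 := congrArg (fun r => ζ t * ζ t * r) e2
    ring_nf at e3
    rw [eg]
    rw [eg] at y1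
    have q1 := sq_nonneg ‖Qh t θ‖
    have q2 := sq_nonneg ‖Q0 t θ‖
    ring_nf at *
    linarith

theorem agmon_constants {s β X1 X2 Y1 Y2 G Q κ : ℝ} (hs0 : 0 ≤ s) (hs1 : s < 1) (hβ : 0 ≤ β)
    (hκ : κ = (1 - s ^ 2) / 6) (w1 : X1 ≤ Y1) (w2 : X2 ≤ Y2) (hX1n : 0 ≤ X1) (hX2n : 0 ≤ X2)
    (hGn : 0 ≤ G) (hQn : 0 ≤ Q)
    (key : 1 / 2 * G + (1 - κ) * Y2
      ≤ ((1 + κ) * s ^ 2 + κ) * X2 + (1 + κ) * β * X1 + (1 / 2 + 1 / (4 * κ)) * Q) :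
    2 * G + 2 * X2 + 2 * β * X1 + Y2 ≤ 14 / (1 - s ^ 2) ^ 2 * (β * Y1 + Q) := by
  have hδ : 0 < 1 - s ^ 2 := by nlinarith
  obtain ⟨δ, hδdef⟩ : ∃ δ, δ = 1 - s ^ 2 := ⟨_, rfl⟩
  rw [← hδdef] at hδ hκ ⊢
  have hκ0 : 0 < κ := by rw [hκ]; positivity
  have hδ1 : δ ≤ 1 := by nlinarith
  have hinv : 1 / 2 + 1 / (4 * κ) ≤ 2 / δ := by
    rw [hκ]
    field_simp
    nlinarith
  have k1 : 1 / 2 * G + δ / 2 * Y2 ≤ 2 * β * Y1 + 2 / δ * Q := by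
    have a1 := mul_le_mul_of_nonneg_right hinv hQn
    have a2 : ((1 + κ) * s ^ 2 + κ) * X2 ≤ (s ^ 2 + 2 * κ) * Y2 := by
      have : ((1 + κ) * s ^ 2 + κ) ≤ s ^ 2 + 2 * κ := by nlinarith
      exact mul_le_mul this w2 hX2n (by positivity)
    have a3 : (1 + κ) * β * X1 ≤ 2 * β * Y1 := by
      have : (1 + κ) * β ≤ 2 * β := by
        apply mul_le_mul_of_nonneg_right _ hβ
        rw [hκ]; linarith
      exact mul_le_mul this w1 hX1n (by positivity)
    have a4 : (1 - κ) * Y2 - (s ^ 2 + 2 * κ) * Y2 = δ / 2 * Y2 := by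
      rw [hκ, hδdef]; ring
    linarith
  have k2 : G + Y2 ≤ 2 / δ * (2 * β * Y1 + 2 / δ * Q) := by
    have := mul_le_mul_of_nonneg_left k1 (show 0 ≤ 2 / δ by positivity)
    have e : 2 / δ * (1 / 2 * G + δ / 2 * Y2) = G / δ + Y2 := by field_simp
    have : G ≤ G / δ := by rw [le_div_iff₀ hδ]; nlinarith
    linarith
  have hY1n : 0 ≤ Y1 := hX1n.trans w1
  have f1 : 2 * G + 2 * X2 + 2 * β * X1 + Y2
      ≤ 3 * (2 / δ * (2 * β * Y1 + 2 / δ * Q)) + 2 * β * Y1 := by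
    have := mul_le_mul_of_nonneg_left w1 (show 0 ≤ 2 * β by positivity)
    linarith
  refine f1.trans ?_
  have hβY : 0 ≤ β * Y1 := by positivity
  have i1 : 1 ≤ 1 / δ := by rw [le_div_iff₀ hδ]; linarith
  have i2 : 1 / δ ≤ 1 / δ ^ 2 := by
    rw [div_le_div_iff₀ hδ (by positivity)]; nlinarith
  have e : 3 * (2 / δ * (2 * β * Y1 + 2 / δ * Q)) + 2 * β * Y1
      = 12 * (1 / δ) * (β * Y1) + 12 * (1 / δ ^ 2) * Q + 2 * (β * Y1) := by ring
  have e2 : 14 / δ ^ 2 * (β * Y1 + Q) = 14 * (1 / δ ^ 2) * (β * Y1) + 14 * (1 / δ ^ 2) * Q := by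
    ring
  rw [e, e2]
  have j1 := mul_le_mul_of_nonneg_right i2 hβY
  have j2 := mul_le_mul_of_nonneg_right i1 hβY
  have j3 : 0 ≤ 1 / δ ^ 2 * Q := by positivity
  linarith

/-- Weighted energy estimate for a function with vanishing circle means. -/
theorem agmon_zero_mean {x Qt Qh Q0 : ℝ → ℝ → EuclideanSpace ℝ (Fin n)}
    {κv : ℝ → EuclideanSpace ℝ (Fin n)} {ζ : ℝ → ℝ} {a b s β : ℝ} (hab : a ≤ b)
    (hx : Sm x) (hxp : Per x) (hQt : Sm Qt) (hQh : Sm Qh) (hQhp : Per Qh) (hQ0 : Sm Q0)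
    (hκv : Continuous κv) (hζ : ContDiff ℝ (⊤ : ℕ∞) ζ)
    (heq : ∀ t ∈ Icc a b, ∀ θ, pt (pt x) t θ + pth (pth x) t θ
      = pt Qt t θ + pth Qh t θ + Q0 t θ + κv t)
    (h0 : ∀ t, ∫ θ in (0 : ℝ)..(2 * π), x t θ = 0)
    (hζa : ζ a = 0) (hζb : ζ b = 0) (hζ1 : ∀ t ∈ Icc a b, ζ t ^ 2 ≤ 1)
    (hζ' : ∀ t ∈ Icc a b, deriv ζ t ^ 2 ≤ s ^ 2 * ζ t ^ 2 + β)
    (hs0 : 0 ≤ s) (hs1 : s < 1) (hβ : 0 ≤ β) :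
    cylInt (fun t θ => ζ t ^ 2 * (‖pt x t θ‖ ^ 2 + ‖pth x t θ‖ ^ 2)) a b
      ≤ 14 / (1 - s ^ 2) ^ 2 * (β * cylInt (fun t θ => ‖pth x t θ‖ ^ 2) a b
        + cylInt (fun t θ => ‖Qt t θ‖ ^ 2 + ‖Qh t θ‖ ^ 2 + ‖Q0 t θ‖ ^ 2) a b) := by
  have hζd := contDiff_deriv_top hζ
  have hδ : 0 < 1 - s ^ 2 := by nlinarith
  have hκ0 : 0 < (1 - s ^ 2) / 6 := by positivity
  have key := agmon_energy hab hx hxp hQt hQh hQhp hQ0 hκv hζ heq h0 hζa hζb hζ1 hζ' hκ0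
  obtain ⟨κ, hκ⟩ : ∃ κ, κ = (1 - s ^ 2) / 6 := ⟨_, rfl⟩
  rw [← hκ] at key hκ0
  set X2 := cylInt (fun t θ => ζ t ^ 2 * ‖x t θ‖ ^ 2) a b with hX2
  set X1 := cylInt (fun t θ => ‖x t θ‖ ^ 2) a b with hX1
  set Y2 := cylInt (fun t θ => ζ t ^ 2 * ‖pth x t θ‖ ^ 2) a b with hY2
  set Y1 := cylInt (fun t θ => ‖pth x t θ‖ ^ 2) a b with hY1
  set G := cylInt (fun t θ => ‖ζ t • pt x t θ + deriv ζ t • x t θ‖ ^ 2) a b with hG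
  set Q := cylInt (fun t θ => ‖Qt t θ‖ ^ 2 + ‖Qh t θ‖ ^ 2 + ‖Q0 t θ‖ ^ 2) a b with hQ
  have w1 : X1 ≤ Y1 := cylInt_slice_mono hab (by fun_prop) (by fun_prop) fun t _ =>
    wirtinger_slice hx hxp (h0 t)
  have w2 : X2 ≤ Y2 := cylInt_slice_mono hab (by fun_prop) (by fun_prop) fun t _ => by
    rw [intervalIntegral.integral_const_mul, intervalIntegral.integral_const_mul]
    exact mul_le_mul_of_nonneg_left (wirtinger_slice hx hxp (h0 t)) (sq_nonneg _)
  have hX2n : 0 ≤ X2 := cylInt_nonneg fun _ _ _ _ => by positivity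
  have hX1n : 0 ≤ X1 := cylInt_nonneg fun _ _ _ _ => by positivity
  have hGn : 0 ≤ G := cylInt_nonneg fun _ _ _ _ => by positivity
  have hQn : 0 ≤ Q := cylInt_nonneg fun _ _ _ _ => by positivity
  rw [cylInt_add (F := fun t θ => 1 / 2 * ‖ζ t • pt x t θ + deriv ζ t • x t θ‖ ^ 2) (by fun_prop) (by fun_prop),
    cylInt_const_mul, cylInt_const_mul,
    cylInt_add (F := fun t θ => ((1 + κ) * s ^ 2 + κ) * (ζ t ^ 2 * ‖x t θ‖ ^ 2)
      + (1 + κ) * β * ‖x t θ‖ ^ 2) (by fun_prop) (by fun_prop),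
    cylInt_add (F := fun t θ => ((1 + κ) * s ^ 2 + κ) * (ζ t ^ 2 * ‖x t θ‖ ^ 2))
      (by fun_prop) (by fun_prop),
    cylInt_const_mul, cylInt_const_mul, cylInt_const_mul] at key
  have fin : cylInt (fun t θ => ζ t ^ 2 * (‖pt x t θ‖ ^ 2 + ‖pth x t θ‖ ^ 2)) a b
      ≤ 2 * G + 2 * X2 + 2 * β * X1 + Y2 := by
    rw [hG, hX2, hX1, hY2, ← cylInt_const_mul, ← cylInt_const_mul, ← cylInt_const_mul,
      ← cylInt_add (by fun_prop) (by fun_prop), ← cylInt_add (by fun_prop) (by fun_prop),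
      ← cylInt_add (by fun_prop) (by fun_prop)]
    refine cylInt_mono (by fun_prop) (by fun_prop) fun t ht θ _ => ?_
    have h1 := norm_sub_sq_le_two (ζ t • pt x t θ + deriv ζ t • x t θ) (deriv ζ t • x t θ)
    rw [add_sub_cancel_right, norm_smul_sq_real, norm_smul_sq_real] at h1
    have h2 := mul_le_mul_of_nonneg_right (hζ' t ht) (sq_nonneg ‖x t θ‖)
    have h3 : s ^ 2 * (ζ t ^ 2 * ‖x t θ‖ ^ 2) ≤ 1 * (ζ t ^ 2 * ‖x t θ‖ ^ 2) :=
      mul_le_mul_of_nonneg_right (by nlinarith) (by positivity)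
    linarith
  exact fin.trans (agmon_constants hs0 hs1 hβ hκ w1 w2 hX1n hX2n hGn hQn key)

end Agmon

section Linear

variable {n : ℕ}

/-- Weighted energy estimate with control of the circle means of `∂_t w`. -/
theorem agmon_flux {w Qt Qh Q0 : ℝ → ℝ → EuclideanSpace ℝ (Fin n)}
    {Φ : ℝ → ℝ → ℝ} {ζ : ℝ → ℝ} {a b s β : ℝ} (hab : a ≤ b)
    (hw : Sm w) (hwp : Per w) (hQt : Sm Qt) (hQh : Sm Qh) (hQhp : Per Qh) (hQ0 : Sm Q0)
    (hΦ : Continuous (fun p : ℝ × ℝ => Φ p.1 p.2))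
    (hζ : ContDiff ℝ (⊤ : ℕ∞) ζ)
    (heq : ∀ t ∈ Icc a b, ∀ θ, pt (pt w) t θ + pth (pth w) t θ
      = pt Qt t θ + pth Qh t θ + Q0 t θ)
    (hζa : ζ a = 0) (hζb : ζ b = 0) (hζ1 : ∀ t ∈ Icc a b, ζ t ^ 2 ≤ 1)
    (hζ' : ∀ t ∈ Icc a b, deriv ζ t ^ 2 ≤ s ^ 2 * ζ t ^ 2 + β)
    (hs0 : 0 ≤ s) (hs1 : s < 1) (hβ : 0 ≤ β)
    (hflux : ∀ t ∈ Icc a b, 2 * π * ‖smean (pt w) t‖ ^ 2 ≤ ∫ θ in (0 : ℝ)..(2 * π), Φ t θ) :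
    cylInt (fun t θ => ζ t ^ 2 * (‖pt w t θ‖ ^ 2 + ‖pth w t θ‖ ^ 2)) a b
      ≤ 28 / (1 - s ^ 2) ^ 2 * (β * cylInt (fun t θ => ‖pth w t θ‖ ^ 2) a b
        + cylInt (fun t θ => ‖Qt t θ‖ ^ 2 + ‖Qh t θ‖ ^ 2 + ‖Q0 t θ‖ ^ 2) a b)
        + 2 * cylInt Φ a b := by
  set x : ℝ → ℝ → EuclideanSpace ℝ (Fin n) := fun t θ => w t θ - smean w t with hx
  have hxS : Sm x := by unfold Sm; fun_prop
  have hxp : Per x := fun t θ => by simp only [hx, hwp t θ]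
  have e1 : pt x = fun t θ => pt w t θ - smean (pt w) t := by
    funext t θ
    rw [hx, pt_sub t θ (by fun_prop) (by fun_prop), pt_fst, deriv_smean hw]
  have e2 : pth x = pth w := by
    funext t θ
    rw [hx, pth_sub t θ (by fun_prop) (by fun_prop), pth_fst, sub_zero]
  have e3 : ∀ t θ, pt (pt x) t θ = pt (pt w) t θ - smean (pt (pt w)) t := by
    intro t θ
    rw [e1, pt_sub t θ (by fun_prop) (by fun_prop), pt_fst, deriv_smean (contDiff_pt hw)]
  have main := agmon_zero_mean (κv := fun t => -smean (pt (pt w)) t) hab hxS hxp hQt hQh hQhp hQ0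
    (by fun_prop) hζ (fun t ht θ => by
      rw [e3, e2, ← heq t ht θ]
      abel) (fun t => integral_sub_smean (by fun_prop) t) hζa hζb hζ1 hζ' hs0 hs1 hβ
  rw [e2, e1] at main
  have hmean : cylInt (fun t θ => ζ t ^ 2 * ‖smean (pt w) t‖ ^ 2) a b ≤ cylInt Φ a b := by
    refine cylInt_slice_mono hab (by fun_prop) hΦ fun t ht => ?_
    rw [intervalIntegral.integral_const, smul_eq_mul, sub_zero]
    have h1 := hflux t ht
    have h2 := mul_le_mul_of_nonneg_right (hζ1 t ht)
      (show 0 ≤ 2 * π * ‖smean (pt w) t‖ ^ 2 by positivity)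
    linarith
  have hsum : cylInt (fun t θ => ζ t ^ 2 * (‖pt w t θ‖ ^ 2 + ‖pth w t θ‖ ^ 2)) a b
      ≤ 2 * cylInt (fun t θ => ζ t ^ 2 * (‖pt w t θ - smean (pt w) t‖ ^ 2 + ‖pth w t θ‖ ^ 2)) a b
        + 2 * cylInt (fun t θ => ζ t ^ 2 * ‖smean (pt w) t‖ ^ 2) a b := by
    rw [← cylInt_const_mul, ← cylInt_const_mul, ← cylInt_add (by fun_prop) (by fun_prop)]
    refine cylInt_mono (by fun_prop) (by fun_prop) fun t _ θ _ => ?_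
    have h1 := norm_add_sq_le_two (pt w t θ - smean (pt w) t) (smean (pt w) t)
    rw [sub_add_cancel] at h1
    have h2 := mul_le_mul_of_nonneg_left h1 (sq_nonneg (ζ t))
    have h3 : 0 ≤ ζ t ^ 2 * ‖pth w t θ‖ ^ 2 := by positivity
    linarith
  have e : 28 / (1 - s ^ 2) ^ 2 * (β * cylInt (fun t θ => ‖pth w t θ‖ ^ 2) a b
        + cylInt (fun t θ => ‖Qt t θ‖ ^ 2 + ‖Qh t θ‖ ^ 2 + ‖Q0 t θ‖ ^ 2) a b)
      = 2 * (14 / (1 - s ^ 2) ^ 2 * (β * cylInt (fun t θ => ‖pth w t θ‖ ^ 2) a b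
        + cylInt (fun t θ => ‖Qt t θ‖ ^ 2 + ‖Qh t θ‖ ^ 2 + ‖Q0 t θ‖ ^ 2) a b)) := by ring
  rw [e]
  linarith

/-- The linear system satisfied by a projected neck region. -/
structure LinSys (m a b : ℝ) (c s : ℝ → ℝ) (E : ℝ → ℝ → ℝ)
    (P R N yt yh : ℝ → ℝ → EuclideanSpace ℝ (Fin n)) : Prop where
  one_le : 1 ≤ m
  c_smooth : ContDiff ℝ (⊤ : ℕ∞) c
  s_smooth : ContDiff ℝ (⊤ : ℕ∞) s
  c_deriv : ∀ θ, deriv c θ = -(m * s θ)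
  s_deriv : ∀ θ, deriv s θ = m * c θ
  sq_add_sq : ∀ θ, c θ ^ 2 + s θ ^ 2 = 1
  c_per : ∀ θ, c (θ + 2 * π) = c θ
  s_per : ∀ θ, s (θ + 2 * π) = s θ
  E_smooth : Sm E
  P_smooth : Sm P
  R_smooth : Sm R
  N_smooth : Sm N
  yt_smooth : Sm yt
  yh_smooth : Sm yh
  E_per : Per E
  P_per : Per P
  R_per : Per R
  N_per : Per N
  yt_per : Per yt
  yh_per : Per yh
  first : ∀ t θ, pt P t θ - pth R t θ = (E t θ * c θ) • N t θ
  second : ∀ t θ, pth P t θ + pt R t θ = (E t θ * s θ) • N t θ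
  willmore : ∀ t ∈ Icc a b, ∀ θ, pt (pt N) t θ + pth (pth N) t θ + (2 * m) • pt N t θ
    + m ^ 2 • N t θ = pt yt t θ + m • yt t θ + pth yh t θ

variable {m a b : ℝ} {c s : ℝ → ℝ} {E : ℝ → ℝ → ℝ}
  {P R N yt yh : ℝ → ℝ → EuclideanSpace ℝ (Fin n)}

/-- The system is invariant under a quarter rotation. -/
theorem LinSys.rotate (h : LinSys m a b c s E P R N yt yh) :
    LinSys m a b s (fun θ => -c θ) E R (fun t θ => -P t θ) N yt yh where
  one_le := h.one_le
  c_smooth := h.s_smooth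
  s_smooth := h.c_smooth.neg
  c_deriv θ := by rw [h.s_deriv]; ring
  s_deriv θ := by rw [deriv.fun_neg, h.c_deriv]; ring
  sq_add_sq θ := by rw [neg_sq, add_comm]; exact h.sq_add_sq θ
  c_per := h.s_per
  s_per θ := by rw [h.c_per]
  E_smooth := h.E_smooth
  P_smooth := h.R_smooth
  R_smooth := h.P_smooth.neg
  N_smooth := h.N_smooth
  yt_smooth := h.yt_smooth
  yh_smooth := h.yh_smooth
  E_per := h.E_per
  P_per := h.R_per
  R_per t θ := by simp only [h.P_per t θ]
  N_per := h.N_per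
  yt_per := h.yt_per
  yh_per := h.yh_per
  first t θ := by
    rw [pth_neg t θ h.P_smooth, sub_neg_eq_add, add_comm, h.second]
  second t θ := by
    rw [pt_neg t θ h.P_smooth, ← sub_eq_add_neg, ← neg_sub, h.first, mul_neg, neg_smul]
  willmore := h.willmore

/-- The function `P + (c / 2m) N`, whose Laplacian is a divergence of small terms. -/
def LinSys.w (m : ℝ) (c : ℝ → ℝ) (P N : ℝ → ℝ → EuclideanSpace ℝ (Fin n)) :
    ℝ → ℝ → EuclideanSpace ℝ (Fin n) := fun t θ => P t θ + ((2 * m)⁻¹ * c θ) • N t θ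

theorem LinSys.w_smooth (h : LinSys m a b c s E P R N yt yh) : Sm (LinSys.w m c P N) := by
  have h1 := h.c_smooth
  have h2 := h.P_smooth
  have h3 := h.N_smooth
  unfold LinSys.w Sm
  fun_prop

theorem LinSys.pt_w (h : LinSys m a b c s E P R N yt yh) : pt (LinSys.w m c P N)
    = fun t θ => pt P t θ + ((2 * m)⁻¹ * c θ) • pt N t θ := by
  have h1 := h.c_smooth
  have h2 := h.P_smooth
  have h3 := h.N_smooth
  funext t θ
  unfold LinSys.w
  rw [pt_add t θ (by fun_prop) (by fun_prop), pt_smul t θ (by fun_prop) (by fun_prop), pt_snd,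
    zero_smul, zero_add]

theorem LinSys.pth_w (h : LinSys m a b c s E P R N yt yh) : pth (LinSys.w m c P N)
    = fun t θ => pth P t θ - (2⁻¹ * s θ) • N t θ + ((2 * m)⁻¹ * c θ) • pth N t θ := by
  have h1 := h.c_smooth
  have h2 := h.P_smooth
  have h3 := h.N_smooth
  have hm : m ≠ 0 := by linarith [h.one_le]
  funext t θ
  unfold LinSys.w
  rw [pth_add t θ (by fun_prop) (by fun_prop), pth_smul t θ (by fun_prop) (by fun_prop), pth_snd,
    deriv_const_mul _ (h1.differentiable (by simp) θ), h.c_deriv]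
  match_scalars <;> field_simp

theorem LinSys.laplace_w (h : LinSys m a b c s E P R N yt yh) {t : ℝ} (ht : t ∈ Icc a b) (θ : ℝ) :
    pt (pt (LinSys.w m c P N)) t θ + pth (pth (LinSys.w m c P N)) t θ
      = pt (fun t θ => ((E t θ - 1) * c θ) • N t θ + ((2 * m)⁻¹ * c θ) • yt t θ) t θ
        + pth (fun t θ => ((E t θ - 1) * s θ) • N t θ + ((2 * m)⁻¹ * c θ) • yh t θ) t θ
        + (2⁻¹ : ℝ) • (c θ • yt t θ + s θ • yh t θ) := by
  have h1 := h.c_smooth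
  have h1' := h.s_smooth
  have h2 := h.P_smooth
  have h2' := h.R_smooth
  have h3 := h.N_smooth
  have h4 := h.E_smooth
  have h5 := h.yt_smooth
  have h6 := h.yh_smooth
  have hm : m ≠ 0 := by linarith [h.one_le]
  have hdc := h1.differentiable (by simp)
  have hds := h1'.differentiable (by simp)
  have eP : pt P = fun t θ => pth R t θ + (E t θ * c θ) • N t θ := by
    funext t θ; rw [← h.first]; abel
  have eP' : pth P = fun t θ => (E t θ * s θ) • N t θ - pt R t θ := by
    funext t θ; rw [← h.second]; abel
  have hcomm := pt_pth_comm h2' t θ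
  have hW := h.willmore t ht θ
  rw [h.pt_w, h.pth_w, eP, eP']
  simp (disch := fun_prop) only [pt_add, pth_add, pt_sub, pth_sub, pt_smul, pth_smul, pt_mul,
    pth_mul, pt_snd, pth_snd, deriv_const']
  rw [deriv_const_mul _ (hds θ), deriv_const_mul _ (hdc θ), h.c_deriv, h.s_deriv, hcomm]
  linear_combination (norm := skip) ((2 * m)⁻¹ * c θ) • hW
  match_scalars <;> field_simp <;> ring

theorem norm_smul_sq_le {V : Type*} [NormedAddCommGroup V] [NormedSpace ℝ V] {r k : ℝ} (x : V)
    (h : r ^ 2 ≤ k) : ‖r • x‖ ^ 2 ≤ k * ‖x‖ ^ 2 := by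
  rw [norm_smul_sq_real]
  exact mul_le_mul_of_nonneg_right h (sq_nonneg _)

theorem LinSys.c_sq_le (h : LinSys m a b c s E P R N yt yh) (θ : ℝ) : c θ ^ 2 ≤ 1 := by
  nlinarith [h.sq_add_sq θ, sq_nonneg (s θ)]

theorem LinSys.half_inv_sq_le (h : LinSys m a b c s E P R N yt yh) : ((2 * m)⁻¹) ^ 2 ≤ 1 / 4 := by
  have h1 := h.one_le
  have h2 : (2 * m)⁻¹ ≤ 1 / 2 := by
    rw [inv_eq_one_div]
    exact one_div_le_one_div_of_le (by norm_num) (by linarith)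
  have h3 : 0 ≤ (2 * m)⁻¹ := by positivity
  nlinarith

/-- Weighted decay estimate for `w`. -/
theorem LinSys.w_estimate (h : LinSys m a b c s E P R N yt yh) {ζ : ℝ → ℝ} {Φ : ℝ → ℝ → ℝ}
    {σ β η : ℝ} (hab : a ≤ b)
    (hE : ∀ t ∈ Icc a b, ∀ θ, |E t θ - 1| ≤ η)
    (hΦ : Continuous (fun p : ℝ × ℝ => Φ p.1 p.2))
    (hζ : ContDiff ℝ (⊤ : ℕ∞) ζ)
    (hζa : ζ a = 0) (hζb : ζ b = 0) (hζ1 : ∀ t ∈ Icc a b, ζ t ^ 2 ≤ 1)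
    (hζ' : ∀ t ∈ Icc a b, deriv ζ t ^ 2 ≤ σ ^ 2 * ζ t ^ 2 + β)
    (hs0 : 0 ≤ σ) (hs1 : σ < 1) (hβ : 0 ≤ β)
    (hflux : ∀ t ∈ Icc a b, ‖∫ θ in (0 : ℝ)..(2 * π), c θ • (pt N t θ + (2 * m) • N t θ)‖ ^ 2
      ≤ ∫ θ in (0 : ℝ)..(2 * π), Φ t θ) :
    cylInt (fun t θ => ζ t ^ 2 * (‖pt (LinSys.w m c P N) t θ‖ ^ 2
        + ‖pth (LinSys.w m c P N) t θ‖ ^ 2)) a b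
      ≤ 116 / (1 - σ ^ 2) ^ 2 * (β * cylInt (fun t θ => ‖pth P t θ‖ ^ 2 + ‖N t θ‖ ^ 2
          + ‖pth N t θ‖ ^ 2) a b
        + (η ^ 2 * cylInt (fun t θ => ‖N t θ‖ ^ 2) a b
          + cylInt (fun t θ => ‖yt t θ‖ ^ 2 + ‖yh t θ‖ ^ 2) a b + cylInt Φ a b)) := by
  have h1 := h.c_smooth
  have h1' := h.s_smooth
  have h2 := h.P_smooth
  have h2' := h.R_smooth
  have h3 := h.N_smooth
  have h4 := h.E_smooth
  have h5 := h.yt_smooth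
  have h6 := h.yh_smooth
  have hm : m ≠ 0 := by linarith [h.one_le]
  have hE2 : ∀ t ∈ Icc a b, ∀ θ, (E t θ - 1) ^ 2 ≤ η ^ 2 := fun t ht θ =>
    sq_le_sq' (abs_le.1 (hE t ht θ)).1 (abs_le.1 (hE t ht θ)).2
  have hk := h.half_inv_sq_le
  have hc2 := h.c_sq_le
  have hs2 : ∀ θ, s θ ^ 2 ≤ 1 := h.rotate.c_sq_le
  have hw := h.w_smooth
  have hΨ : Continuous (fun p : ℝ × ℝ => 2 * η ^ 2 * ‖N p.1 p.2‖ ^ 2 + Φ p.1 p.2) := by fun_prop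
  have main := agmon_flux (w := LinSys.w m c P N)
    (Qt := fun t θ => ((E t θ - 1) * c θ) • N t θ + ((2 * m)⁻¹ * c θ) • yt t θ)
    (Qh := fun t θ => ((E t θ - 1) * s θ) • N t θ + ((2 * m)⁻¹ * c θ) • yh t θ)
    (Q0 := fun t θ => (2⁻¹ : ℝ) • (c θ • yt t θ + s θ • yh t θ))
    (Φ := fun t θ => 2 * η ^ 2 * ‖N t θ‖ ^ 2 + Φ t θ) hab hw
    (fun t θ => by simp only [LinSys.w, h.P_per t θ, h.c_per θ, h.N_per t θ])
    (by unfold Sm; fun_prop) (by unfold Sm; fun_prop)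
    (fun t θ => by simp only [h.E_per t θ, h.s_per θ, h.N_per t θ, h.c_per θ, h.yh_per t θ])
    (by unfold Sm; fun_prop) hΨ hζ (fun t ht θ => h.laplace_w ht θ) hζa hζb hζ1 hζ' hs0 hs1 hβ
    ?_
  · refine main.trans ?_
    have a1 : cylInt (fun t θ => ‖pth (LinSys.w m c P N) t θ‖ ^ 2) a b
        ≤ cylInt (fun t θ => 3 * (‖pth P t θ‖ ^ 2 + ‖N t θ‖ ^ 2 + ‖pth N t θ‖ ^ 2)) a b := by
      refine cylInt_mono (by fun_prop) (by fun_prop) fun t ht θ _ => ?_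
      rw [h.pth_w]
      have b1 := norm_add_sq_le_two (pth P t θ - (2⁻¹ * s θ) • N t θ)
        (((2 * m)⁻¹ * c θ) • pth N t θ)
      have b2 : ‖pth P t θ - (2⁻¹ * s θ) • N t θ‖ ^ 2
          ≤ 3 / 2 * ‖pth P t θ‖ ^ 2 + 3 * ‖(2⁻¹ * s θ) • N t θ‖ ^ 2 := by
        nlinarith [norm_sub_le (pth P t θ) ((2⁻¹ * s θ) • N t θ),
          sq_nonneg (‖pth P t θ‖ - 2 * ‖(2⁻¹ * s θ) • N t θ‖),
          norm_nonneg (pth P t θ - (2⁻¹ * s θ) • N t θ), norm_nonneg (pth P t θ),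
          norm_nonneg ((2⁻¹ * s θ) • N t θ)]
      have b3 := norm_smul_sq_le (k := 1 / 4) (N t θ)
        (show (2⁻¹ * s θ) ^ 2 ≤ 1 / 4 by nlinarith [hs2 θ])
      have b4 := norm_smul_sq_le (k := 1 / 4) (pth N t θ)
        (show ((2 * m)⁻¹ * c θ) ^ 2 ≤ 1 / 4 by rw [mul_pow]; nlinarith [hc2 θ, sq_nonneg (c θ)])
      have b5 := sq_nonneg ‖pth N t θ‖
      have b6 := sq_nonneg ‖N t θ‖
      linarith
    have a2 : cylInt (fun t θ => ‖((E t θ - 1) * c θ) • N t θ + ((2 * m)⁻¹ * c θ) • yt t θ‖ ^ 2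
          + ‖((E t θ - 1) * s θ) • N t θ + ((2 * m)⁻¹ * c θ) • yh t θ‖ ^ 2
          + ‖(2⁻¹ : ℝ) • (c θ • yt t θ + s θ • yh t θ)‖ ^ 2) a b
        ≤ cylInt (fun t θ => 4 * η ^ 2 * ‖N t θ‖ ^ 2 + (‖yt t θ‖ ^ 2 + ‖yh t θ‖ ^ 2)) a b := by
      refine cylInt_mono (by fun_prop) (by fun_prop) fun t ht θ _ => ?_
      have b1 := norm_add_sq_le_two (((E t θ - 1) * c θ) • N t θ) (((2 * m)⁻¹ * c θ) • yt t θ)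
      have b2 := norm_add_sq_le_two (((E t θ - 1) * s θ) • N t θ) (((2 * m)⁻¹ * c θ) • yh t θ)
      have b3 := norm_add_sq_le_two (c θ • yt t θ) (s θ • yh t θ)
      have e4 : ∀ r : ℝ, r ^ 2 ≤ 1 → ((E t θ - 1) * r) ^ 2 ≤ η ^ 2 := fun r hr => by
        rw [mul_pow]
        nlinarith [hE2 t ht θ, sq_nonneg (E t θ - 1)]
      have b4 := norm_smul_sq_le (N t θ) (e4 _ (hc2 θ))
      have b5 := norm_smul_sq_le (N t θ) (e4 _ (hs2 θ))
      have e6 : ((2 * m)⁻¹ * c θ) ^ 2 ≤ 1 / 4 := by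
        rw [mul_pow]; nlinarith [hc2 θ, sq_nonneg (c θ)]
      have b6 := norm_smul_sq_le (yt t θ) e6
      have b7 := norm_smul_sq_le (yh t θ) e6
      have b8 := norm_smul_sq_le (yt t θ) (hc2 θ)
      have b9 := norm_smul_sq_le (yh t θ) (hs2 θ)
      rw [norm_smul_sq_real (2⁻¹ : ℝ)]
      linarith
    rw [cylInt_const_mul] at a1
    rw [cylInt_add (F := fun t θ => 4 * η ^ 2 * ‖N t θ‖ ^ 2) (by fun_prop) (by fun_prop),
      cylInt_const_mul] at a2
    rw [cylInt_add (F := fun t θ => 2 * η ^ 2 * ‖N t θ‖ ^ 2) (by fun_prop) hΦ, cylInt_const_mul]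
    have hδ : 0 < 1 - σ ^ 2 := by nlinarith
    have hi : 1 ≤ 1 / (1 - σ ^ 2) ^ 2 := by
      rw [le_div_iff₀ (by positivity)]; nlinarith
    set I := 1 / (1 - σ ^ 2) ^ 2 with hI
    have i1 : 28 / (1 - σ ^ 2) ^ 2 = 28 * I := by rw [hI]; ring
    have i2 : 116 / (1 - σ ^ 2) ^ 2 = 116 * I := by rw [hI]; ring
    rw [i1, i2]
    have n1 : 0 ≤ cylInt (fun t θ => ‖N t θ‖ ^ 2) a b := cylInt_nonneg fun _ _ _ _ => by positivity
    have n2 : 0 ≤ cylInt (fun t θ => ‖yt t θ‖ ^ 2 + ‖yh t θ‖ ^ 2) a b :=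
      cylInt_nonneg fun _ _ _ _ => by positivity
    have n3 : 0 ≤ cylInt (fun t θ => ‖pth P t θ‖ ^ 2 + ‖N t θ‖ ^ 2 + ‖pth N t θ‖ ^ 2) a b :=
      cylInt_nonneg fun _ _ _ _ => by positivity
    have n4 : 0 ≤ cylInt Φ a b := by
      have : cylInt (fun _ _ => (0 : ℝ)) a b ≤ cylInt Φ a b :=
        cylInt_slice_mono hab (by fun_prop) hΦ fun t ht => by
          rw [intervalIntegral.integral_zero]
          exact (sq_nonneg _).trans (hflux t ht)
      simpa [cylInt] using this
    have a1' := mul_le_mul_of_nonneg_left a1 hβ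
    have a3 := mul_le_mul_of_nonneg_left (add_le_add a1' a2) (show 0 ≤ 28 * I by positivity)
    have c1 := mul_le_mul_of_nonneg_right hi (mul_nonneg (sq_nonneg η) n1)
    have c2 := mul_le_mul_of_nonneg_right hi n4
    have c3 : 0 ≤ I * (β * cylInt (fun t θ => ‖pth P t θ‖ ^ 2 + ‖N t θ‖ ^ 2
      + ‖pth N t θ‖ ^ 2) a b) := by positivity
    have c4 : 0 ≤ I * cylInt (fun t θ => ‖yt t θ‖ ^ 2 + ‖yh t θ‖ ^ 2) a b := by positivity
    have c5 : 0 ≤ I * cylInt Φ a b := by positivity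
    linarith
  · intro t ht
    have e : (2 * π) • smean (pt (LinSys.w m c P N)) t
        = (∫ θ in (0 : ℝ)..(2 * π), ((E t θ - 1) * c θ) • N t θ)
          + (2 * m)⁻¹ • ∫ θ in (0 : ℝ)..(2 * π), c θ • (pt N t θ + (2 * m) • N t θ) := by
      rw [smean, smul_smul, mul_inv_cancel₀ (by positivity), one_smul, h.pt_w]
      have e1 : ∀ θ, pt P t θ + ((2 * m)⁻¹ * c θ) • pt N t θ = (((E t θ - 1) * c θ) • N t θ
          + (2 * m)⁻¹ • (c θ • (pt N t θ + (2 * m) • N t θ))) + pth R t θ := by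
        intro θ
        rw [sub_eq_iff_eq_add.1 (h.first t θ)]
        match_scalars <;> field_simp <;> ring
      simp only [e1]
      rw [intervalIntegral.integral_add (Continuous.intervalIntegrable (by fun_prop) _ _)
        (Continuous.intervalIntegrable (by fun_prop) _ _),
        intervalIntegral.integral_add (Continuous.intervalIntegrable (by fun_prop) _ _)
        (Continuous.intervalIntegrable (by fun_prop) _ _), intervalIntegral.integral_smul,
        slice_pth_zero h2' h.R_per, add_zero]
    have e2 := congrArg (fun x => ‖x‖ ^ 2) e
    rw [norm_smul_sq_real] at e2
    have b1 := norm_add_sq_le_two (∫ θ in (0 : ℝ)..(2 * π), ((E t θ - 1) * c θ) • N t θ)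
      ((2 * m)⁻¹ • ∫ θ in (0 : ℝ)..(2 * π), c θ • (pt N t θ + (2 * m) • N t θ))
    rw [← e2] at b1
    have b2 := norm_smul_sq_le (∫ θ in (0 : ℝ)..(2 * π), c θ • (pt N t θ + (2 * m) • N t θ)) hk
    have b3 : ‖∫ θ in (0 : ℝ)..(2 * π), ((E t θ - 1) * c θ) • N t θ‖ ^ 2
        ≤ 2 * π * ∫ θ in (0 : ℝ)..(2 * π), η ^ 2 * ‖N t θ‖ ^ 2 := by
      refine (pow_le_pow_left₀ (norm_nonneg _)
        (intervalIntegral.norm_integral_le_integral_norm (by positivity)) 2).trans ?_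
      refine sq_circleInt_le (by fun_prop) (by fun_prop) fun θ _ => norm_smul_sq_le _ ?_
      rw [mul_pow]
      nlinarith [hE2 t ht θ, sq_nonneg (E t θ - 1), hc2 θ]
    rw [intervalIntegral.integral_add (Continuous.intervalIntegrable (by fun_prop) _ _)
        (Continuous.intervalIntegrable (by fun_prop) _ _)]
    have b4 : ∫ θ in (0 : ℝ)..(2 * π), 2 * η ^ 2 * ‖N t θ‖ ^ 2
        = 2 * ∫ θ in (0 : ℝ)..(2 * π), η ^ 2 * ‖N t θ‖ ^ 2 := by
      rw [← intervalIntegral.integral_const_mul]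
      simp only [mul_assoc]
    rw [b4]
    have hf := hflux t ht
    have hpi := Real.pi_gt_three
    set J := ∫ θ in (0 : ℝ)..(2 * π), Φ t θ with hJ
    have hJ0 : 0 ≤ J := (sq_nonneg _).trans hf
    have hfin : 2 * π * (2 * π * ‖smean (pt (LinSys.w m c P N)) t‖ ^ 2)
        ≤ 2 * π * (2 * (∫ θ in (0 : ℝ)..(2 * π), η ^ 2 * ‖N t θ‖ ^ 2) + J) := by
      nlinarith
    exact le_of_mul_le_mul_left hfin (by positivity)

end Linear

section LinearDecay

variable {n : ℕ} {m a b : ℝ} {c s : ℝ → ℝ} {E : ℝ → ℝ → ℝ}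
  {P R N yt yh : ℝ → ℝ → EuclideanSpace ℝ (Fin n)}

theorem LinSys.normal_estimate (h : LinSys m a b c s E P R N yt yh) {ζ : ℝ → ℝ}
    {σ β : ℝ} (hab : a ≤ b) (hζ : ContDiff ℝ (⊤ : ℕ∞) ζ)
    (hζa : ζ a = 0) (hζb : ζ b = 0)
    (hζ' : ∀ t ∈ Icc a b, deriv ζ t ^ 2 ≤ σ ^ 2 * ζ t ^ 2 + β)
    (hs0 : 1 / 2 ≤ σ) (hs1 : σ < 1) (hβ : 0 ≤ β) :
    (1 - σ) / 2 * cylInt (fun t θ => ζ t ^ 2 * ‖N t θ‖ ^ 2) a b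
      ≤ 2 / (1 - σ) * cylInt (fun t θ => ζ t ^ 2 * ‖(2 * m)⁻¹ • (pt N t θ + m • N t θ)‖ ^ 2) a b
        + β * cylInt (fun t θ => ‖N t θ‖ ^ 2) a b := by
  have h3 := h.N_smooth
  have hm := h.one_le
  have hm0 : m ≠ 0 := by linarith
  have hd : 0 < 1 - σ := by linarith
  have hζd := contDiff_deriv_top hζ
  rw [← cylInt_const_mul, ← cylInt_const_mul, ← cylInt_const_mul,
    ← cylInt_add (by fun_prop) (by fun_prop)]
  refine cylInt_le_of_div hab (U := fun t θ => -((2 * m)⁻¹ * ((ζ t * ζ t) * ‖N t θ‖ ^ 2)))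
    (W := fun _ _ => 0) (Z := fun _ _ => 0) (by fun_prop) (by fun_prop) (by fun_prop)
    (by unfold Sm; fun_prop) (by unfold Sm; fun_prop) (fun _ _ => rfl) (fun θ => by simp [hζa])
    (fun θ => by simp [hζb]) (by simp) fun t ht θ _ => ?_
  obtain ⟨q, hq⟩ : ∃ q, q = (2 * m)⁻¹ • (pt N t θ + m • N t θ) := ⟨_, rfl⟩
  have hq' : pt N t θ = (2 * m) • q - m • N t θ := by
    rw [hq]
    match_scalars <;> field_simp
    ring
  rw [← hq]
  have eU : pt (fun t θ => -((2 * m)⁻¹ * ((ζ t * ζ t) * ‖N t θ‖ ^ 2))) t θ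
      = -(m⁻¹ * (ζ t * deriv ζ t)) * ‖N t θ‖ ^ 2 - 2 * ζ t ^ 2 * ⟪N t θ, q⟫_ℝ
        + ζ t ^ 2 * ‖N t θ‖ ^ 2 := by
    rw [pt_neg t θ (by fun_prop), pt_mul t θ (by fun_prop) (by fun_prop),
      pt_mul t θ (by fun_prop) (by fun_prop), pt_mul t θ (by fun_prop) (by fun_prop), pt_const,
      pt_fst, pt_norm_sq t θ (by fun_prop), hq', inner_sub_right, inner_smul_right, inner_smul_right, real_inner_self_eq_norm_sq]
    field_simp
    ring
  rw [eU, pth_const]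
  have y := inner_le_young (N t θ) q (κ := (1 - σ) / 4) (by linarith)
  have y' := mul_le_mul_of_nonneg_left y (show 0 ≤ 2 * ζ t ^ 2 by positivity)
  have ek : 1 / (4 * ((1 - σ) / 4)) = 1 / (1 - σ) := by congr 1; ring
  rw [ek] at y'
  have z1 : m⁻¹ * (ζ t * deriv ζ t) ≤ σ * ζ t ^ 2 + β := by
    have e1 : |ζ t * deriv ζ t| ≤ σ * ζ t ^ 2 + β := by
      rw [abs_mul, ← sq_abs (ζ t)]
      have h1 := hζ' t ht
      rw [← sq_abs (ζ t), ← sq_abs (deriv ζ t)] at h1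
      have h2 : 2 * σ * (|ζ t| * |deriv ζ t|) ≤ σ ^ 2 * |ζ t| ^ 2 + |deriv ζ t| ^ 2 := by
        nlinarith [sq_nonneg (σ * |ζ t| - |deriv ζ t|)]
      have h3 : 2 * σ * (|ζ t| * |deriv ζ t|) ≤ 2 * σ * (σ * |ζ t| ^ 2 + β) := by nlinarith
      exact le_of_mul_le_mul_left h3 (by linarith)
    have e2 : m⁻¹ ≤ 1 := inv_le_one_of_one_le₀ hm
    have e3 : 0 ≤ m⁻¹ := by positivity
    nlinarith [le_abs_self (ζ t * deriv ζ t), abs_nonneg (ζ t * deriv ζ t)]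
  have z2 := mul_le_mul_of_nonneg_right z1 (sq_nonneg ‖N t θ‖)
  have e2 : 2 / (1 - σ) = 2 * (1 / (1 - σ)) := by ring
  rw [e2]
  linarith

/-- Pointwise recovery of first derivatives from those of the auxiliary functions. -/
theorem LinSys.pointwise (h : LinSys m a b c s E P R N yt yh) {η : ℝ} {t θ : ℝ}
    (hE : |E t θ - 1| ≤ η) :
    ‖(2 * m)⁻¹ • (pt N t θ + m • N t θ)‖ ^ 2
        ≤ 4 * (‖pt (LinSys.w m c P N) t θ‖ ^ 2 + ‖pth (LinSys.w m c P N) t θ‖ ^ 2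
          + (‖pt (LinSys.w m s R N) t θ‖ ^ 2 + ‖pth (LinSys.w m s R N) t θ‖ ^ 2))
          + 2 * η ^ 2 * ‖N t θ‖ ^ 2
      ∧ ‖pt P t θ + pth R t θ‖ ^ 2 + ‖pt R t θ - pth P t θ‖ ^ 2
        ≤ 12 * (‖pt (LinSys.w m c P N) t θ‖ ^ 2 + ‖pth (LinSys.w m c P N) t θ‖ ^ 2
          + (‖pt (LinSys.w m s R N) t θ‖ ^ 2 + ‖pth (LinSys.w m s R N) t θ‖ ^ 2))
          + 4 * η ^ 2 * ‖N t θ‖ ^ 2 := by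
  have hm0 : m ≠ 0 := by linarith [h.one_le]
  have hcs := h.sq_add_sq θ
  obtain ⟨x1, hx1⟩ : ∃ x, x = pt (LinSys.w m c P N) t θ := ⟨_, rfl⟩
  obtain ⟨x2, hx2⟩ : ∃ x, x = pth (LinSys.w m c P N) t θ := ⟨_, rfl⟩
  obtain ⟨z1, hz1⟩ : ∃ x, x = pt (LinSys.w m s R N) t θ := ⟨_, rfl⟩
  obtain ⟨z2, hz2⟩ : ∃ x, x = pth (LinSys.w m s R N) t θ := ⟨_, rfl⟩
  rw [← hx1, ← hx2, ← hz1, ← hz2]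
  rw [h.pt_w] at hx1
  rw [h.pth_w] at hx2
  rw [h.rotate.pt_w] at hz1
  rw [h.rotate.pth_w] at hz2
  have f1 := h.first t θ
  have f2 := h.second t θ
  obtain ⟨q, hq⟩ : ∃ q, q = (2 * m)⁻¹ • (pt N t θ + m • N t θ) := ⟨_, rfl⟩
  obtain ⟨r, hr⟩ : ∃ r, r = (2 * m)⁻¹ • pth N t θ := ⟨_, rfl⟩
  rw [← hq]
  have eA : x1 - z2 = (c θ) • (q + (E t θ - 1) • N t θ) - s θ • r := by
    rw [hx1, hz2, hq, hr]
    linear_combination (norm := skip) f1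
    match_scalars <;> field_simp <;> ring
  have eB : z1 + x2 = (s θ) • (q + (E t θ - 1) • N t θ) + c θ • r := by
    rw [hz1, hx2, hq, hr]
    linear_combination (norm := skip) f2
    match_scalars <;> field_simp <;> ring
  have eC : pt P t θ + pth R t θ = x1 + z2 - (c θ • q + s θ • r) := by
    rw [hx1, hz2, hq, hr]
    match_scalars <;> field_simp <;> ring
  have eD : pt R t θ - pth P t θ = z1 - x2 - (s θ • q - c θ • r) := by
    rw [hz1, hx2, hq, hr]
    match_scalars <;> field_simp <;> ring
  have rotA : ∀ u w : EuclideanSpace ℝ (Fin n), ‖c θ • u - s θ • w‖ ^ 2 + ‖s θ • u + c θ • w‖ ^ 2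
      = ‖u‖ ^ 2 + ‖w‖ ^ 2 := by
    intro u w
    rw [norm_sub_sq_real, norm_add_sq_real]
    simp only [norm_smul_sq_real, real_inner_smul_left, real_inner_smul_right]
    linear_combination (‖u‖ ^ 2 + ‖w‖ ^ 2) * hcs
  have rotB : ∀ u w : EuclideanSpace ℝ (Fin n), ‖c θ • u + s θ • w‖ ^ 2 + ‖s θ • u - c θ • w‖ ^ 2
      = ‖u‖ ^ 2 + ‖w‖ ^ 2 := by
    intro u w
    rw [norm_sub_sq_real, norm_add_sq_real]
    simp only [norm_smul_sq_real, real_inner_smul_left, real_inner_smul_right]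
    linear_combination (‖u‖ ^ 2 + ‖w‖ ^ 2) * hcs
  have g1 := rotA (q + (E t θ - 1) • N t θ) r
  rw [← eA, ← eB] at g1
  have g2 := norm_sub_sq_le_two x1 z2
  have g3 := norm_add_sq_le_two z1 x2
  have g4 : ‖q‖ ^ 2 ≤ 2 * ‖q + (E t θ - 1) • N t θ‖ ^ 2 + 2 * ‖(E t θ - 1) • N t θ‖ ^ 2 := by
    have := norm_sub_sq_le_two (q + (E t θ - 1) • N t θ) ((E t θ - 1) • N t θ)
    rwa [add_sub_cancel_right] at this
  have g5 : ‖(E t θ - 1) • N t θ‖ ^ 2 ≤ η ^ 2 * ‖N t θ‖ ^ 2 :=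
    norm_smul_sq_le _ (sq_le_sq' (abs_le.1 hE).1 (abs_le.1 hE).2)
  have g6 := norm_sub_sq_le_two (x1 + z2) (c θ • q + s θ • r)
  have g7 := norm_sub_sq_le_two (z1 - x2) (s θ • q - c θ • r)
  rw [← eC] at g6
  rw [← eD] at g7
  have g8 := rotB q r
  have g9 := norm_add_sq_le_two x1 z2
  have g10 := norm_sub_sq_le_two z1 x2
  have g11 := sq_nonneg ‖r‖
  constructor <;> linarith

theorem decay_constants {σ β η G1 G2 F F1 F2 N1 N2 q2 Y Ψ : ℝ} (hs0 : 1 / 2 ≤ σ) (hs1 : σ < 1)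
    (hβ : 0 ≤ β) (n1 : 0 ≤ N1) (n4 : 0 ≤ Y) (n5 : 0 ≤ Ψ)
    (W1 : G1 ≤ 116 / (1 - σ ^ 2) ^ 2 * (β * F1 + (η ^ 2 * N1 + Y + Ψ)))
    (W2 : G2 ≤ 116 / (1 - σ ^ 2) ^ 2 * (β * F2 + (η ^ 2 * N1 + Y + Ψ)))
    (hN : (1 - σ) / 2 * N2 ≤ 2 / (1 - σ) * q2 + β * N1)
    (hF1 : F1 ≤ F) (hF2 : F2 ≤ F) (hF3 : N1 ≤ F)
    (Q2 : q2 ≤ 4 * (G1 + G2) + 2 * η ^ 2 * N1) :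
    12 * (G1 + G2) + 4 * η ^ 2 * N1 + N2
      ≤ 7000 / (1 - σ) ^ 4 * (β * F + (η ^ 2 * N1 + Y + Ψ)) := by
  obtain ⟨d, hd⟩ : ∃ d, d = 1 - σ := ⟨_, rfl⟩
  have hd0 : 0 < d := by linarith
  have hd1 : d ≤ 1 := by linarith
  rw [← hd] at hN ⊢
  obtain ⟨X, hX⟩ : ∃ X, X = β * F + (η ^ 2 * N1 + Y + Ψ) := ⟨_, rfl⟩
  have hβF := mul_nonneg hβ (n1.trans hF3)
  have hηN := mul_nonneg (sq_nonneg η) n1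
  have hX0 : 0 ≤ X := by rw [hX]; positivity
  have hi : 1 / (1 - σ ^ 2) ^ 2 ≤ 1 / d ^ 2 := by
    apply one_div_le_one_div_of_le (by positivity)
    apply pow_le_pow_left₀ hd0.le
    nlinarith
  have k1 : ∀ {G A : ℝ}, G ≤ 116 / (1 - σ ^ 2) ^ 2 * (β * A + (η ^ 2 * N1 + Y + Ψ)) → A ≤ F →
      G ≤ 116 * (1 / d ^ 2 * X) := by
    intro G A hG hA
    have : β * A + (η ^ 2 * N1 + Y + Ψ) ≤ X := by
      rw [hX]; linarith [mul_le_mul_of_nonneg_left hA hβ]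
    have e : 116 / (1 - σ ^ 2) ^ 2 = 116 * (1 / (1 - σ ^ 2) ^ 2) := by ring
    rw [e] at hG
    have i0 : 0 ≤ 1 / (1 - σ ^ 2) ^ 2 := by positivity
    have := mul_le_mul_of_nonneg_left this i0
    have := mul_le_mul_of_nonneg_right hi hX0
    linarith
  have b1 := k1 W1 hF1
  have b2 := k1 W2 hF2
  have hI : 1 ≤ 1 / d := by rw [le_div_iff₀ hd0]; linarith
  obtain ⟨I, hIdef⟩ : ∃ I, I = 1 / d := ⟨_, rfl⟩
  rw [← hIdef] at hI
  have e1 : 1 / d ^ 2 = I ^ 2 := by rw [hIdef]; ring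
  have e2 : 7000 / d ^ 4 = 7000 * I ^ 4 := by rw [hIdef]; ring
  have e3 : 2 / d = 2 * I := by rw [hIdef]; ring
  have e4 : d * I = 1 := by rw [hIdef]; field_simp
  rw [e1] at b1 b2
  rw [e3] at hN
  rw [e2, ← hX]
  have hN' : N2 ≤ 4 * I ^ 2 * q2 + 2 * I * (β * N1) := by
    have := mul_le_mul_of_nonneg_left hN (show 0 ≤ 2 * I by linarith)
    have e5 : 2 * I * (d / 2 * N2) = (d * I) * N2 := by ring
    rw [e5, e4, one_mul] at this
    linarith
  have hI0 : 0 ≤ I ^ 2 := sq_nonneg I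
  have s1 := mul_le_mul_of_nonneg_left Q2 (show 0 ≤ 4 * I ^ 2 by positivity)
  have s2 : β * N1 ≤ X := by
    rw [hX]; linarith [mul_le_mul_of_nonneg_left hF3 hβ]
  have s3 : η ^ 2 * N1 ≤ X := by rw [hX]; linarith
  have hI1 : 1 ≤ I ^ 2 := by nlinarith
  have hI2 : I ≤ I ^ 2 := by nlinarith
  have hI4 : I ^ 2 ≤ I ^ 4 := pow_le_pow_right₀ hI (by norm_num)
  have s4 := mul_le_mul_of_nonneg_left s2 (show 0 ≤ 2 * I by linarith)
  have s5 := mul_le_mul_of_nonneg_left s3 hI0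
  have s6 := mul_le_mul_of_nonneg_left b1 hI0
  have s7 := mul_le_mul_of_nonneg_left b2 hI0
  have s8 := mul_le_mul_of_nonneg_right hI4 hX0
  have s9 := mul_le_mul_of_nonneg_right hI2 hX0
  have s10 := mul_le_mul_of_nonneg_right hI1 hX0
  have s11 : I ^ 2 * (116 * (I ^ 2 * X)) = 116 * (I ^ 4 * X) := by ring
  rw [s11] at s6 s7
  linarith

/-- Decay for the linear system: the weighted energy is controlled by the boundary weight and the
size of the perturbation. -/
theorem LinSys.decay (h : LinSys m a b c s E P R N yt yh) {ζ : ℝ → ℝ} {Φ : ℝ → ℝ → ℝ}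
    {σ β η : ℝ} (hab : a ≤ b)
    (hE : ∀ t ∈ Icc a b, ∀ θ, |E t θ - 1| ≤ η)
    (hΦ : Continuous (fun p : ℝ × ℝ => Φ p.1 p.2))
    (hζ : ContDiff ℝ (⊤ : ℕ∞) ζ)
    (hζa : ζ a = 0) (hζb : ζ b = 0) (hζ1 : ∀ t ∈ Icc a b, ζ t ^ 2 ≤ 1)
    (hζ' : ∀ t ∈ Icc a b, deriv ζ t ^ 2 ≤ σ ^ 2 * ζ t ^ 2 + β)
    (hs0 : 1 / 2 ≤ σ) (hs1 : σ < 1) (hβ : 0 ≤ β)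
    (hfluxc : ∀ t ∈ Icc a b, ‖∫ θ in (0 : ℝ)..(2 * π), c θ • (pt N t θ + (2 * m) • N t θ)‖ ^ 2
      ≤ ∫ θ in (0 : ℝ)..(2 * π), Φ t θ)
    (hfluxs : ∀ t ∈ Icc a b, ‖∫ θ in (0 : ℝ)..(2 * π), s θ • (pt N t θ + (2 * m) • N t θ)‖ ^ 2
      ≤ ∫ θ in (0 : ℝ)..(2 * π), Φ t θ) :
    cylInt (fun t θ => ζ t ^ 2 * (‖pt P t θ + pth R t θ‖ ^ 2 + ‖pt R t θ - pth P t θ‖ ^ 2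
        + ‖N t θ‖ ^ 2)) a b
      ≤ 7000 / (1 - σ) ^ 4 * (β * cylInt (fun t θ => ‖pth P t θ‖ ^ 2 + ‖pth R t θ‖ ^ 2
          + ‖N t θ‖ ^ 2 + ‖pth N t θ‖ ^ 2) a b
        + (η ^ 2 * cylInt (fun t θ => ‖N t θ‖ ^ 2) a b
          + cylInt (fun t θ => ‖yt t θ‖ ^ 2 + ‖yh t θ‖ ^ 2) a b + cylInt Φ a b)) := by
  have h2 := h.P_smooth
  have h2' := h.R_smooth
  have h3 := h.N_smooth
  have h5 := h.yt_smooth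
  have h6 := h.yh_smooth
  have hw := h.w_smooth
  have hw' := h.rotate.w_smooth
  have W1 := h.w_estimate hab hE hΦ hζ hζa hζb hζ1 hζ' (by linarith) hs1 hβ hfluxc
  have W2 := h.rotate.w_estimate hab hE hΦ hζ hζa hζb hζ1 hζ' (by linarith) hs1 hβ hfluxs
  have hN := h.normal_estimate hab hζ hζa hζb hζ' hs0 hs1 hβ
  set G1 := cylInt (fun t θ => ζ t ^ 2 * (‖pt (LinSys.w m c P N) t θ‖ ^ 2
        + ‖pth (LinSys.w m c P N) t θ‖ ^ 2)) a b with hG1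
  set G2 := cylInt (fun t θ => ζ t ^ 2 * (‖pt (LinSys.w m s R N) t θ‖ ^ 2
        + ‖pth (LinSys.w m s R N) t θ‖ ^ 2)) a b with hG2
  set F := cylInt (fun t θ => ‖pth P t θ‖ ^ 2 + ‖pth R t θ‖ ^ 2
          + ‖N t θ‖ ^ 2 + ‖pth N t θ‖ ^ 2) a b with hF
  set N1 := cylInt (fun t θ => ‖N t θ‖ ^ 2) a b with hN1
  set N2 := cylInt (fun t θ => ζ t ^ 2 * ‖N t θ‖ ^ 2) a b with hN2
  set q2 := cylInt (fun t θ => ζ t ^ 2 * ‖(2 * m)⁻¹ • (pt N t θ + m • N t θ)‖ ^ 2) a b with hq2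
  set Y := cylInt (fun t θ => ‖yt t θ‖ ^ 2 + ‖yh t θ‖ ^ 2) a b with hY
  have F1 : cylInt (fun t θ => ‖pth P t θ‖ ^ 2 + ‖N t θ‖ ^ 2 + ‖pth N t θ‖ ^ 2) a b ≤ F :=
    cylInt_mono (by fun_prop) (by fun_prop) fun t _ θ _ => by linarith [sq_nonneg ‖pth R t θ‖]
  have F2 : cylInt (fun t θ => ‖pth R t θ‖ ^ 2 + ‖N t θ‖ ^ 2 + ‖pth N t θ‖ ^ 2) a b ≤ F :=
    cylInt_mono (by fun_prop) (by fun_prop) fun t _ θ _ => by linarith [sq_nonneg ‖pth P t θ‖]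
  have F3 : N1 ≤ F :=
    cylInt_mono (by fun_prop) (by fun_prop) fun t _ θ _ => by
      linarith [sq_nonneg ‖pth P t θ‖, sq_nonneg ‖pth R t θ‖, sq_nonneg ‖pth N t θ‖]
  have hz : ∀ t ∈ Icc a b, ∀ θ, ζ t ^ 2 * ‖N t θ‖ ^ 2 ≤ ‖N t θ‖ ^ 2 := fun t ht θ =>
    mul_le_of_le_one_left (sq_nonneg _) (hζ1 t ht)
  have Q2 : q2 ≤ 4 * (G1 + G2) + 2 * η ^ 2 * N1 := by
    rw [hG1, hG2, hN1, ← cylInt_add (by fun_prop) (by fun_prop), ← cylInt_const_mul,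
      ← cylInt_const_mul, ← cylInt_add (by fun_prop) (by fun_prop)]
    refine cylInt_mono (by fun_prop) (by fun_prop) fun t ht θ _ => ?_
    have p1 := mul_le_mul_of_nonneg_left (h.pointwise (hE t ht θ)).1 (sq_nonneg (ζ t))
    have p2 := mul_le_mul_of_nonneg_left (hz t ht θ) (sq_nonneg η)
    linarith
  have T : cylInt (fun t θ => ζ t ^ 2 * (‖pt P t θ + pth R t θ‖ ^ 2 + ‖pt R t θ - pth P t θ‖ ^ 2
        + ‖N t θ‖ ^ 2)) a b ≤ 12 * (G1 + G2) + 4 * η ^ 2 * N1 + N2 := by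
    rw [hG1, hG2, hN1, hN2, ← cylInt_add (by fun_prop) (by fun_prop), ← cylInt_const_mul,
      ← cylInt_const_mul, ← cylInt_add (by fun_prop) (by fun_prop),
      ← cylInt_add (by fun_prop) (by fun_prop)]
    refine cylInt_mono (by fun_prop) (by fun_prop) fun t ht θ _ => ?_
    have p1 := mul_le_mul_of_nonneg_left (h.pointwise (hE t ht θ)).2 (sq_nonneg (ζ t))
    have p2 := mul_le_mul_of_nonneg_left (hz t ht θ) (sq_nonneg η)
    linarith
  have n1 : 0 ≤ N1 := cylInt_nonneg fun _ _ _ _ => by positivity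
  have n2 : 0 ≤ G1 := cylInt_nonneg fun _ _ _ _ => by positivity
  have n3 : 0 ≤ G2 := cylInt_nonneg fun _ _ _ _ => by positivity
  have n4 : 0 ≤ Y := cylInt_nonneg fun _ _ _ _ => by positivity
  have n5 : 0 ≤ cylInt Φ a b := by
    have : cylInt (fun _ _ => (0 : ℝ)) a b ≤ cylInt Φ a b :=
      cylInt_slice_mono hab (by fun_prop) hΦ fun t ht => by
        rw [intervalIntegral.integral_zero]
        exact (sq_nonneg _).trans (hfluxc t ht)
    simpa [cylInt] using this
  refine T.trans ?_
  exact decay_constants hs0 hs1 hβ n1 n4 n5 W1 W2 hN F1 F2 F3 Q2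

end LinearDecay

section Regularity

variable {n : ℕ} {m a b K ε : ℝ} {c s : ℝ → ℝ} {E ν : ℝ → ℝ → ℝ}
  {p r P R N yt yh γ E1 E2 : ℝ → ℝ → EuclideanSpace ℝ (Fin n)}

/-- Squared norm of a triple of vector fields. -/
def tripleSq (E1 E2 N : ℝ → ℝ → EuclideanSpace ℝ (Fin n)) (t θ : ℝ) : ℝ :=
  ‖E1 t θ‖ ^ 2 + ‖E2 t θ‖ ^ 2 + ‖N t θ‖ ^ 2

/-- Squared norm of the gradient of a vector field. -/
def gradSq (x : ℝ → ℝ → EuclideanSpace ℝ (Fin n)) (t θ : ℝ) : ℝ :=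
  ‖pt x t θ‖ ^ 2 + ‖pth x t θ‖ ^ 2

@[fun_prop]
theorem contDiff_tripleSq (h1 : ContDiff ℝ (⊤ : ℕ∞) (fun p : ℝ × ℝ => E1 p.1 p.2))
    (h2 : ContDiff ℝ (⊤ : ℕ∞) (fun p : ℝ × ℝ => E2 p.1 p.2))
    (h3 : ContDiff ℝ (⊤ : ℕ∞) (fun p : ℝ × ℝ => N p.1 p.2)) :
    ContDiff ℝ (⊤ : ℕ∞) (fun p : ℝ × ℝ => tripleSq E1 E2 N p.1 p.2) := by
  unfold tripleSq; fun_prop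

@[fun_prop]
theorem continuous_tripleSq (h1 : Continuous (fun p : ℝ × ℝ => E1 p.1 p.2))
    (h2 : Continuous (fun p : ℝ × ℝ => E2 p.1 p.2))
    (h3 : Continuous (fun p : ℝ × ℝ => N p.1 p.2)) :
    Continuous (fun p : ℝ × ℝ => tripleSq E1 E2 N p.1 p.2) := by
  unfold tripleSq; fun_prop

@[fun_prop]
theorem continuous_gradSq (h1 : ContDiff ℝ (⊤ : ℕ∞) (fun p : ℝ × ℝ => N p.1 p.2)) :
    Continuous (fun p : ℝ × ℝ => gradSq N p.1 p.2) := by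
  unfold gradSq; fun_prop

theorem tripleSq_nonneg (t θ : ℝ) : 0 ≤ tripleSq E1 E2 N t θ := by unfold tripleSq; positivity

theorem gradSq_nonneg (t θ : ℝ) : 0 ≤ gradSq N t θ := by unfold gradSq; positivity

/-- Normalised data of a conformal Willmore immersion of a cylinder with vanishing residues
whose conformal factor is close to the one of an `m`-fold covered plane. -/
structure Neck (m a b K ε : ℝ) (c s : ℝ → ℝ) (ν : ℝ → ℝ → ℝ)
    (p r N yt yh γ E1 E2 : ℝ → ℝ → EuclideanSpace ℝ (Fin n)) : Prop
    extends LinSys m a b c s (fun t θ => Real.exp (2 * ν t θ)) p r N yt yh where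
  one_le_K : 1 ≤ K
  nu_smooth : Sm ν
  γ_smooth : Sm γ
  E1_smooth : Sm E1
  E2_smooth : Sm E2
  E1_per : Per E1
  E2_per : Per E2
  ε_le : ε ≤ 1 / 100
  nu_le : ∀ t ∈ Icc a b, ∀ θ, |ν t θ| ≤ ε
  nu_t_le : ∀ t ∈ Icc a b, ∀ θ, |pt ν t θ| ≤ ε
  nu_th_le : ∀ t ∈ Icc a b, ∀ θ, |pth ν t θ| ≤ ε
  E1_eq : ∀ t θ, E1 t θ = (1 / 2 : ℝ) • (pt p t θ + pth r t θ) - pt ν t θ • p t θ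
    - pth ν t θ • r t θ
  E2_eq : ∀ t θ, E2 t θ = (1 / 2 : ℝ) • (pt r t θ - pth p t θ) - pt ν t θ • r t θ
    + pth ν t θ • p t θ
  norm_p : ∀ t ∈ Icc a b, ∀ θ, ‖p t θ‖ ^ 2 = Real.exp (2 * ν t θ)
  norm_r : ∀ t ∈ Icc a b, ∀ θ, ‖r t θ‖ ^ 2 = Real.exp (2 * ν t θ)
  inner_p_r : ∀ t ∈ Icc a b, ∀ θ, ⟪p t θ, r t θ⟫_ℝ = 0
  inner_N : ∀ t ∈ Icc a b, ∀ θ, ⟪p t θ, N t θ⟫_ℝ = 0 ∧ ⟪r t θ, N t θ⟫_ℝ = 0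
  inner_E1 : ∀ t ∈ Icc a b, ∀ θ, ⟪p t θ, E1 t θ⟫_ℝ = 0 ∧ ⟪r t θ, E1 t θ⟫_ℝ = 0
  inner_E2 : ∀ t ∈ Icc a b, ∀ θ, ⟪p t θ, E2 t θ⟫_ℝ = 0 ∧ ⟪r t θ, E2 t θ⟫_ℝ = 0
  gauss : ∀ t ∈ Icc a b, ∀ θ,
    |pt (pt ν) t θ + pth (pth ν) t θ| ≤ K * tripleSq E1 E2 N t θ
  yt_le : ∀ t ∈ Icc a b, ∀ θ, ‖yt t θ‖ ≤ K * tripleSq E1 E2 N t θ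
  yh_le : ∀ t ∈ Icc a b, ∀ θ, ‖yh t θ‖ ≤ K * tripleSq E1 E2 N t θ
  flux : ∀ t ∈ Icc a b, ∀ y z : EuclideanSpace ℝ (Fin n),
    ∫ θ in (0 : ℝ)..(2 * π), ⟪pt N t θ + (2 * m) • N t θ,
        ⟪c θ • p t θ + s θ • r t θ, y⟫_ℝ • z - ⟪c θ • p t θ + s θ • r t θ, z⟫_ℝ • y⟫_ℝ
      = (∫ θ in (0 : ℝ)..(2 * π), ⟪yt t θ,
        ⟪c θ • p t θ + s θ • r t θ, y⟫_ℝ • z - ⟪c θ • p t θ + s θ • r t θ, z⟫_ℝ • y⟫_ℝ)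
        + m * ∫ θ in (0 : ℝ)..(2 * π), ⟪pt N t θ + m • N t θ - yt t θ,
          ⟪γ t θ, y⟫_ℝ • z - ⟪γ t θ, z⟫_ℝ • y⟫_ℝ
  γ_zero : ∀ t ∈ Icc a b, γ t 0 = 0
  γ_th_le : ∀ t ∈ Icc a b, ∀ θ, ‖pth γ t θ‖
    ≤ 2 * (‖E1 t θ‖ + ‖E2 t θ‖) + 4 * (|pt ν t θ| + |pth ν t θ|)

theorem LinSys.gradient_estimate (h : LinSys m a b c s E P R N yt yh) {χ : ℝ → ℝ}
    (hab : a ≤ b) (hχ : ContDiff ℝ (⊤ : ℕ∞) χ) (hχa : χ a = 0) (hχb : χ b = 0) :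
    cylInt (fun t θ => χ t ^ 2 * gradSq N t θ) a b
      ≤ 12 * m ^ 2 * cylInt (fun t θ => (χ t ^ 2 + deriv χ t ^ 2) * ‖N t θ‖ ^ 2) a b
        + 6 * cylInt (fun t θ => χ t ^ 2 * (‖yt t θ‖ ^ 2 + ‖yh t θ‖ ^ 2)) a b := by
  have h3 := h.N_smooth
  have h4 := h.yt_smooth
  have h5 := h.yh_smooth
  have hm := h.one_le
  have hχd := contDiff_deriv_top hχ
  have key : cylInt (fun t θ => (1 / 2) * (χ t ^ 2 * gradSq N t θ)) a b
      ≤ cylInt (fun t θ => 6 * m ^ 2 * ((χ t ^ 2 + deriv χ t ^ 2) * ‖N t θ‖ ^ 2)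
        + 3 * (χ t ^ 2 * (‖yt t θ‖ ^ 2 + ‖yh t θ‖ ^ 2))) a b := by
    refine cylInt_le_of_div hab
      (U := fun t θ => (χ t * χ t) * ⟪N t θ, pt N t θ + m • N t θ - yt t θ⟫_ℝ)
      (W := fun t θ => (χ t * χ t) * ⟪N t θ, pth N t θ - yh t θ⟫_ℝ) (Z := fun _ _ => 0)
      (by fun_prop) (by fun_prop) (by fun_prop)
      (by unfold Sm; fun_prop) (by unfold Sm; fun_prop)
      (fun t θ => by simp only [h.N_per t θ, h.N_per.pth t θ, h.yh_per t θ])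
      (fun θ => by simp [hχa]) (fun θ => by simp [hχb]) (by simp) fun t ht θ _ => ?_
    have eU : pt (fun t θ => (χ t * χ t) * ⟪N t θ, pt N t θ + m • N t θ - yt t θ⟫_ℝ) t θ
        = 2 * (χ t * deriv χ t) * ⟪N t θ, pt N t θ + m • N t θ - yt t θ⟫_ℝ
          + χ t ^ 2 * (⟪pt N t θ, pt N t θ + m • N t θ - yt t θ⟫_ℝ
            + ⟪N t θ, pt (pt N) t θ + m • pt N t θ - pt yt t θ⟫_ℝ) := by
      rw [pt_mul t θ (by fun_prop) (by fun_prop), pt_mul t θ (by fun_prop) (by fun_prop), pt_fst,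
        pt_inner t θ (by fun_prop) (by fun_prop), pt_sub t θ (by fun_prop) (by fun_prop),
        pt_add t θ (by fun_prop) (by fun_prop), pt_smul t θ (by fun_prop) (by fun_prop), pt_const]
      simp only [zero_smul, zero_add]
      ring
    have eW : pth (fun t θ => (χ t * χ t) * ⟪N t θ, pth N t θ - yh t θ⟫_ℝ) t θ
        = χ t ^ 2 * (⟪pth N t θ, pth N t θ - yh t θ⟫_ℝ
            + ⟪N t θ, pth (pth N) t θ - pth yh t θ⟫_ℝ) := by
      rw [pth_mul t θ (by fun_prop) (by fun_prop), pth_mul t θ (by fun_prop) (by fun_prop), pth_fst,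
        pth_inner t θ (by fun_prop) (by fun_prop), pth_sub t θ (by fun_prop) (by fun_prop)]
      ring
    rw [eU, eW]
    have w := congrArg (fun x => ⟪N t θ, x⟫_ℝ) (h.willmore t ht θ)
    simp only [inner_add_right, inner_sub_right, inner_smul_right,
      real_inner_self_eq_norm_sq, gradSq] at w ⊢
    rw [real_inner_comm (N t θ) (pt N t θ)]
    have y1 := inner_le_young (pt N t θ) (yt t θ) (κ := 1 / 4) (by norm_num)
    have y2 := inner_le_young (pth N t θ) (yh t θ) (κ := 1 / 4) (by norm_num)
    have y3 := inner_le_young ((-2 * deriv χ t) • N t θ) (χ t • pt N t θ) (κ := 1) (by norm_num)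
    have y4 := inner_le_young ((2 * deriv χ t) • N t θ) (χ t • yt t θ) (κ := 1 / 4) (by norm_num)
    have y5 := inner_le_young ((-m) • N t θ) (yt t θ) (κ := 1 / 4) (by norm_num)
    simp only [real_inner_smul_left, real_inner_smul_right, norm_smul_sq_real] at y3 y4 y5
    have y1' := mul_le_mul_of_nonneg_left y1 (sq_nonneg (χ t))
    have y2' := mul_le_mul_of_nonneg_left y2 (sq_nonneg (χ t))
    have y5' := mul_le_mul_of_nonneg_left y5 (sq_nonneg (χ t))
    have y6 : -(2 * (χ t * deriv χ t * m)) * ‖N t θ‖ ^ 2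
        ≤ (m ^ 2 * χ t ^ 2 + deriv χ t ^ 2) * ‖N t θ‖ ^ 2 := by
      apply mul_le_mul_of_nonneg_right _ (sq_nonneg _)
      nlinarith [sq_nonneg (m * χ t + deriv χ t)]
    have y7 : 6 * deriv χ t ^ 2 * ‖N t θ‖ ^ 2 ≤ 6 * (m ^ 2 * (deriv χ t ^ 2 * ‖N t θ‖ ^ 2)) := by
      have : 1 * (deriv χ t ^ 2 * ‖N t θ‖ ^ 2) ≤ m ^ 2 * (deriv χ t ^ 2 * ‖N t θ‖ ^ 2) := by
        apply mul_le_mul_of_nonneg_right _ (by positivity)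
        nlinarith
      linarith
    have p1 : 0 ≤ χ t ^ 2 * ‖yh t θ‖ ^ 2 := by positivity
    have p3 : 0 ≤ χ t ^ 2 * ‖pth N t θ‖ ^ 2 := by positivity
    have p2 : 0 ≤ m ^ 2 * χ t ^ 2 * ‖N t θ‖ ^ 2 := by positivity
    have w' : ⟪N t θ, pt (pt N) t θ⟫_ℝ = m * ⟪N t θ, yt t θ⟫_ℝ + ⟪N t θ, pt yt t θ⟫_ℝ
      + ⟪N t θ, pth yh t θ⟫_ℝ - ⟪N t θ, pth (pth N) t θ⟫_ℝ - 2 * m * ⟪N t θ, pt N t θ⟫_ℝ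
      - m ^ 2 * ‖N t θ‖ ^ 2 := by linarith
    rw [w']
    norm_num at y1' y2' y3 y4 y5' ⊢
    linarith
  rw [cylInt_const_mul, cylInt_add (by fun_prop) (by fun_prop), cylInt_const_mul,
    cylInt_const_mul] at key
  linarith

end Regularity

section CauchyRiemann

variable {n : ℕ} {m a b K ε : ℝ} {c s : ℝ → ℝ} {ν : ℝ → ℝ → ℝ}
  {p r P R N yt yh γ E1 E2 : ℝ → ℝ → EuclideanSpace ℝ (Fin n)}

theorem LinSys.cauchy_riemann
    (h : LinSys m a b c s (fun t θ => Real.exp (2 * ν t θ)) P R N yt yh) (hν : Sm ν)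
    (h1 : ∀ t θ, E1 t θ = (1 / 2 : ℝ) • (pt P t θ + pth R t θ) - pt ν t θ • P t θ
      - pth ν t θ • R t θ)
    (h2 : ∀ t θ, E2 t θ = (1 / 2 : ℝ) • (pt R t θ - pth P t θ) - pt ν t θ • R t θ
      + pth ν t θ • P t θ) (t θ : ℝ) :
    pt E1 t θ - pth E2 t θ
      = (1 / 2 * Real.exp (2 * ν t θ)) • (c θ • (pt N t θ + m • N t θ) + s θ • pth N t θ)
        - (pt (pt ν) t θ + pth (pth ν) t θ) • P t θ := by
  have i1 := h.P_smooth
  have i2 := h.R_smooth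
  have i3 := h.N_smooth
  have i4 := h.c_smooth
  have i5 := h.s_smooth
  have e1 : E1 = fun t θ => (1 / 2 : ℝ) • (pt P t θ + pth R t θ) - pt ν t θ • P t θ
      - pth ν t θ • R t θ := by ext1 t; ext1 θ; exact h1 t θ
  have e2 : E2 = fun t θ => (1 / 2 : ℝ) • (pt R t θ - pth P t θ) - pt ν t θ • R t θ
      + pth ν t θ • P t θ := by ext1 t; ext1 θ; exact h2 t θ
  have f1 : pt (fun t θ => pt P t θ - pth R t θ) t θ
      = pt (fun t θ => (Real.exp (2 * ν t θ) * c θ) • N t θ) t θ := by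
    congr 1; ext1 t; ext1 θ; exact h.first t θ
  have f2 : pth (fun t θ => pth P t θ + pt R t θ) t θ
      = pth (fun t θ => (Real.exp (2 * ν t θ) * s θ) • N t θ) t θ := by
    congr 1; ext1 t; ext1 θ; exact h.second t θ
  rw [pt_sub t θ (by fun_prop) (by fun_prop), pt_smul t θ (by fun_prop) (by fun_prop),
    pt_mul t θ (by fun_prop) (by fun_prop), pt_exp t θ (by fun_prop),
    pt_mul t θ (by fun_prop) (by fun_prop), pt_const, pt_snd] at f1
  rw [pth_add t θ (by fun_prop) (by fun_prop), pth_smul t θ (by fun_prop) (by fun_prop),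
    pth_mul t θ (by fun_prop) (by fun_prop), pth_exp t θ (by fun_prop),
    pth_mul t θ (by fun_prop) (by fun_prop), pth_const, pth_snd, h.s_deriv] at f2
  have g1 := h.first t θ
  have g2 := h.second t θ
  rw [e1, e2, pt_sub t θ (by fun_prop) (by fun_prop), pt_sub t θ (by fun_prop) (by fun_prop),
    pt_smul t θ (by fun_prop) (by fun_prop), pt_smul t θ (by fun_prop) (by fun_prop),
    pt_smul t θ (by fun_prop) (by fun_prop), pt_const, pt_add t θ (by fun_prop) (by fun_prop),
    pth_add t θ (by fun_prop) (by fun_prop), pth_sub t θ (by fun_prop) (by fun_prop),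
    pth_smul t θ (by fun_prop) (by fun_prop), pth_smul t θ (by fun_prop) (by fun_prop),
    pth_smul t θ (by fun_prop) (by fun_prop), pth_const, pth_sub t θ (by fun_prop) (by fun_prop)]
  rw [pt_pth_comm hν, pt_pth_comm i2] at *
  linear_combination (norm := skip) (1 / 2 : ℝ) • f1 + (1 / 2 : ℝ) • f2 - pt ν t θ • g1
    - pth ν t θ • g2
  match_scalars <;> ring

theorem Neck.cauchy_riemann (h : Neck m a b K ε c s ν p r N yt yh γ E1 E2) (t θ : ℝ) :
    pt E1 t θ - pth E2 t θ
      = (1 / 2 * Real.exp (2 * ν t θ)) • (c θ • (pt N t θ + m • N t θ) + s θ • pth N t θ)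
        - (pt (pt ν) t θ + pth (pth ν) t θ) • p t θ :=
  h.toLinSys.cauchy_riemann h.nu_smooth h.E1_eq h.E2_eq t θ

theorem Neck.cauchy_riemann' (h : Neck m a b K ε c s ν p r N yt yh γ E1 E2) (t θ : ℝ) :
    pt E2 t θ + pth E1 t θ
      = (1 / 2 * Real.exp (2 * ν t θ)) • (s θ • (pt N t θ + m • N t θ) - c θ • pth N t θ)
        - (pt (pt ν) t θ + pth (pth ν) t θ) • r t θ := by
  have i1 := h.P_smooth
  have i6 := h.E1_smooth
  have := h.toLinSys.rotate.cauchy_riemann (E1 := E2) (E2 := fun t θ => -E1 t θ) h.nu_smooth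
    (fun t θ => by rw [h.E2_eq, pth_neg t θ i1, smul_neg]; module)
    (fun t θ => by rw [h.E1_eq, pt_neg t θ i1, smul_neg]; module) t θ
  rw [pth_neg t θ i6, sub_neg_eq_add] at this
  rw [this]
  module

theorem Neck.exp_le (h : Neck m a b K ε c s ν p r N yt yh γ E1 E2) {t : ℝ} (ht : t ∈ Icc a b)
    (θ : ℝ) : Real.exp (2 * ν t θ) ≤ 2 ∧ 1 / 2 ≤ Real.exp (2 * ν t θ)
      ∧ |Real.exp (2 * ν t θ) - 1| ≤ 4 * ε := by
  have h1 := h.nu_le t ht θ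
  have h2 := h.ε_le
  have h3 : |2 * ν t θ| ≤ 2 * ε := by rw [abs_mul, abs_two]; linarith
  have h4 := Real.abs_exp_sub_one_le (x := 2 * ν t θ) (h3.trans (by linarith))
  have h5 : |Real.exp (2 * ν t θ) - 1| ≤ 4 * ε := by linarith
  have h6 := abs_le.1 h5
  exact ⟨by linarith, by linarith, h5⟩

theorem Neck.cauchy_riemann_le (h : Neck m a b K ε c s ν p r N yt yh γ E1 E2) {t : ℝ}
    (ht : t ∈ Icc a b) (θ : ℝ) :
    ‖pt E1 t θ - pth E2 t θ‖ ^ 2 + ‖pt E2 t θ + pth E1 t θ‖ ^ 2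
      ≤ 4 * gradSq N t θ + 4 * m ^ 2 * ‖N t θ‖ ^ 2 + 8 * K ^ 2 * tripleSq E1 E2 N t θ ^ 2 := by
  rw [h.cauchy_riemann, h.cauchy_riemann']
  obtain ⟨e1, e2, -⟩ := h.exp_le ht θ
  have hcs := h.sq_add_sq θ
  obtain ⟨A, hA⟩ : ∃ A, A = pt N t θ + m • N t θ := ⟨_, rfl⟩
  have hA2 := norm_add_sq_le_two (pt N t θ) (m • N t θ)
  rw [← hA, norm_smul_sq_real] at hA2
  rw [← hA]
  have rot : ‖c θ • A + s θ • pth N t θ‖ ^ 2 + ‖s θ • A - c θ • pth N t θ‖ ^ 2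
      = ‖A‖ ^ 2 + ‖pth N t θ‖ ^ 2 := by
    rw [norm_sub_sq_real, norm_add_sq_real]
    simp only [norm_smul_sq_real, real_inner_smul_left, real_inner_smul_right]
    linear_combination (‖A‖ ^ 2 + ‖pth N t θ‖ ^ 2) * hcs
  have hg := h.gauss t ht θ
  obtain ⟨d, hd⟩ : ∃ d, d = pt (pt ν) t θ + pth (pth ν) t θ := ⟨_, rfl⟩
  rw [← hd] at hg ⊢
  have hd2 : d ^ 2 ≤ K ^ 2 * tripleSq E1 E2 N t θ ^ 2 := by
    rw [← mul_pow, ← sq_abs d]; exact pow_le_pow_left₀ (abs_nonneg _) hg 2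
  have k1 := norm_sub_sq_le_two ((1 / 2 * Real.exp (2 * ν t θ)) • (c θ • A + s θ • pth N t θ))
    (d • p t θ)
  have k2 := norm_sub_sq_le_two ((1 / 2 * Real.exp (2 * ν t θ)) • (s θ • A - c θ • pth N t θ))
    (d • r t θ)
  rw [norm_smul_sq_real, norm_smul_sq_real] at k1 k2
  rw [h.norm_p t ht] at k1
  rw [h.norm_r t ht] at k2
  have e3 : (1 / 2 * Real.exp (2 * ν t θ)) ^ 2 ≤ 1 := by nlinarith
  have l1 := mul_le_mul_of_nonneg_right e3 (sq_nonneg ‖c θ • A + s θ • pth N t θ‖)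
  have l2 := mul_le_mul_of_nonneg_right e3 (sq_nonneg ‖s θ • A - c θ • pth N t θ‖)
  have l3 := mul_le_mul_of_nonneg_left e1 (sq_nonneg d)
  unfold gradSq
  linarith [sq_nonneg ‖pth N t θ‖]

theorem Neck.gradient_estimate_E (h : Neck m a b K ε c s ν p r N yt yh γ E1 E2) {χ : ℝ → ℝ}
    (hab : a ≤ b) (hχ : ContDiff ℝ (⊤ : ℕ∞) χ) (hχa : χ a = 0) (hχb : χ b = 0) :
    cylInt (fun t θ => χ t ^ 2 * (gradSq E1 t θ + gradSq E2 t θ)) a b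
      ≤ 16 * cylInt (fun t θ => χ t ^ 2 * gradSq N t θ) a b
        + 16 * m ^ 2 * cylInt (fun t θ => (χ t ^ 2 + deriv χ t ^ 2) * tripleSq E1 E2 N t θ) a b
        + 32 * K ^ 2 * cylInt (fun t θ => χ t ^ 2 * tripleSq E1 E2 N t θ ^ 2) a b := by
  have i1 := h.E1_smooth
  have i2 := h.E2_smooth
  have i3 := h.N_smooth
  have hm := h.one_le
  have hχd := contDiff_deriv_top hχ
  rw [← cylInt_const_mul, ← cylInt_const_mul, ← cylInt_const_mul,
    ← cylInt_add (by fun_prop) (by fun_prop), ← cylInt_add (by fun_prop) (by fun_prop)]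
  have hU1 : Sm fun t θ => χ t • E1 t θ := by unfold Sm; fun_prop
  have hU2 : Sm fun t θ => χ t • E2 t θ := by unfold Sm; fun_prop
  refine cylInt_le_of_div hab
    (U := fun t θ => 4 * ⟪χ t • E1 t θ, χ t • pth E2 t θ⟫_ℝ)
    (W := fun t θ => -4 * ⟪χ t • E1 t θ, χ t • pt E2 t θ + deriv χ t • E2 t θ⟫_ℝ)
    (Z := fun _ _ => 0)
    (by fun_prop) (by fun_prop) (by fun_prop) (by unfold Sm; fun_prop) (by unfold Sm; fun_prop)
    (fun t θ => by simp only [h.E1_per t θ, h.E2_per t θ, h.E2_per.pt t θ])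
    (fun θ => by simp [hχa]) (fun θ => by simp [hχb]) (by simp) fun t ht θ _ => ?_
  have eU : pt (fun t θ => 4 * ⟪χ t • E1 t θ, χ t • pth E2 t θ⟫_ℝ) t θ
      = 4 * (⟪χ t • pt E1 t θ + deriv χ t • E1 t θ, χ t • pth E2 t θ⟫_ℝ
        + ⟪χ t • E1 t θ, χ t • pth (pt E2) t θ + deriv χ t • pth E2 t θ⟫_ℝ) := by
    rw [pt_mul t θ (by fun_prop) (by fun_prop), pt_const, pt_inner t θ (by fun_prop) (by fun_prop),
      pt_smul t θ (by fun_prop) (by fun_prop), pt_smul t θ (by fun_prop) (by fun_prop), pt_fst,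
      pt_pth_comm i2, zero_mul, zero_add]
    simp only [inner_add_left, inner_add_right]
    ring
  have eW : pth (fun t θ => -4 * ⟪χ t • E1 t θ, χ t • pt E2 t θ + deriv χ t • E2 t θ⟫_ℝ) t θ
      = -4 * (⟪χ t • pth E1 t θ, χ t • pt E2 t θ + deriv χ t • E2 t θ⟫_ℝ
        + ⟪χ t • E1 t θ, χ t • pth (pt E2) t θ + deriv χ t • pth E2 t θ⟫_ℝ) := by
    rw [pth_mul t θ (by fun_prop) (by fun_prop), pth_const,
      pth_inner t θ (by fun_prop) (by fun_prop), pth_add t θ (by fun_prop) (by fun_prop),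
      pth_smul t θ (by fun_prop) (by fun_prop), pth_smul t θ (by fun_prop) (by fun_prop),
      pth_smul t θ (by fun_prop) (by fun_prop), pth_fst, pth_fst]
    simp only [zero_smul, zero_add, zero_mul]
  rw [eU, eW]
  have cr := mul_le_mul_of_nonneg_left (h.cauchy_riemann_le ht θ) (sq_nonneg (χ t))
  obtain ⟨A, hA⟩ : ∃ A, A = χ t • pt E1 t θ + deriv χ t • E1 t θ := ⟨_, rfl⟩
  obtain ⟨B, hB⟩ : ∃ B, B = χ t • pth E1 t θ := ⟨_, rfl⟩
  obtain ⟨C, hC⟩ : ∃ C, C = χ t • pt E2 t θ + deriv χ t • E2 t θ := ⟨_, rfl⟩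
  obtain ⟨D, hD⟩ : ∃ D, D = χ t • pth E2 t θ := ⟨_, rfl⟩
  rw [← hA, ← hB, ← hC, ← hD]
  have a1 := norm_sub_sq_le_two A (deriv χ t • E1 t θ)
  have a2 := norm_sub_sq_le_two C (deriv χ t • E2 t θ)
  rw [hA, add_sub_cancel_right, ← hA, norm_smul_sq_real, norm_smul_sq_real] at a1
  rw [hC, add_sub_cancel_right, ← hC, norm_smul_sq_real, norm_smul_sq_real] at a2
  have b1 : ‖B‖ ^ 2 = χ t ^ 2 * ‖pth E1 t θ‖ ^ 2 := by rw [hB, norm_smul_sq_real]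
  have b2 : ‖D‖ ^ 2 = χ t ^ 2 * ‖pth E2 t θ‖ ^ 2 := by rw [hD, norm_smul_sq_real]
  have c1 := norm_add_sq_le_two (χ t • (pt E1 t θ - pth E2 t θ)) (deriv χ t • E1 t θ)
  have c2 := norm_add_sq_le_two (χ t • (pt E2 t θ + pth E1 t θ)) (deriv χ t • E2 t θ)
  have d1 : χ t • (pt E1 t θ - pth E2 t θ) + deriv χ t • E1 t θ = A - D := by
    rw [hA, hD]; module
  have d2 : χ t • (pt E2 t θ + pth E1 t θ) + deriv χ t • E2 t θ = C + B := by
    rw [hC, hB]; module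
  rw [d1, norm_smul_sq_real, norm_smul_sq_real, norm_sub_sq_real] at c1
  rw [d2, norm_smul_sq_real, norm_smul_sq_real, norm_add_sq_real, real_inner_comm B C] at c2
  have m1 : 1 ≤ m ^ 2 := by nlinarith
  have z1 := mul_le_mul_of_nonneg_right m1 (show 0 ≤ deriv χ t ^ 2 * (‖E1 t θ‖ ^ 2 + ‖E2 t θ‖ ^ 2)
    by positivity)
  have z2 : 0 ≤ m ^ 2 * (χ t ^ 2 * (‖E1 t θ‖ ^ 2 + ‖E2 t θ‖ ^ 2)) := by positivity
  have z3 : 0 ≤ m ^ 2 * (deriv χ t ^ 2 * ‖N t θ‖ ^ 2) := by positivity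
  have z4 : 0 ≤ deriv χ t ^ 2 * (‖E1 t θ‖ ^ 2 + ‖E2 t θ‖ ^ 2) := by positivity
  have z5 : 0 ≤ χ t ^ 2 * (‖pth E1 t θ‖ ^ 2 + ‖pth E2 t θ‖ ^ 2) := by positivity
  have et : tripleSq E1 E2 N t θ = ‖E1 t θ‖ ^ 2 + ‖E2 t θ‖ ^ 2 + ‖N t θ‖ ^ 2 := rfl
  obtain ⟨T, hT⟩ : ∃ T, T = tripleSq E1 E2 N t θ ^ 2 := ⟨_, rfl⟩
  rw [← hT] at cr ⊢
  rw [et]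
  unfold gradSq at cr ⊢
  linarith

end CauchyRiemann

section CurvatureEnergy

variable {n : ℕ} {m a b K ε κ : ℝ} {c s : ℝ → ℝ} {ν : ℝ → ℝ → ℝ}
  {p r N yt yh γ E1 E2 : ℝ → ℝ → EuclideanSpace ℝ (Fin n)}

theorem sq_inner_triple_le {V : Type*} [NormedAddCommGroup V] [InnerProductSpace ℝ V]
    (x1 x2 x3 y1 y2 y3 : V) :
    (⟪x1, y1⟫_ℝ + ⟪x2, y2⟫_ℝ + ⟪x3, y3⟫_ℝ) ^ 2
      ≤ (‖x1‖ ^ 2 + ‖x2‖ ^ 2 + ‖x3‖ ^ 2) * (‖y1‖ ^ 2 + ‖y2‖ ^ 2 + ‖y3‖ ^ 2) := by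
  have h1 := abs_real_inner_le_norm x1 y1
  have h2 := abs_real_inner_le_norm x2 y2
  have h3 := abs_real_inner_le_norm x3 y3
  have h4 : |⟪x1, y1⟫_ℝ + ⟪x2, y2⟫_ℝ + ⟪x3, y3⟫_ℝ| ≤ ‖x1‖ * ‖y1‖ + ‖x2‖ * ‖y2‖ + ‖x3‖ * ‖y3‖ :=
    (abs_add_three _ _ _).trans (by linarith)
  rw [← sq_abs]
  refine (pow_le_pow_left₀ (abs_nonneg _) h4 2).trans ?_
  nlinarith [sq_nonneg (‖x1‖ * ‖y2‖ - ‖x2‖ * ‖y1‖), sq_nonneg (‖x1‖ * ‖y3‖ - ‖x3‖ * ‖y1‖),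
    sq_nonneg (‖x2‖ * ‖y3‖ - ‖x3‖ * ‖y2‖)]

theorem pt_tripleSq_sq_le (h1 : Sm E1) (h2 : Sm E2) (h3 : Sm N) (t θ : ℝ) :
    pt (tripleSq E1 E2 N) t θ ^ 2
      ≤ 4 * (tripleSq E1 E2 N t θ * (gradSq E1 t θ + gradSq E2 t θ + gradSq N t θ)) := by
  have e : tripleSq E1 E2 N = fun t θ => ‖E1 t θ‖ ^ 2 + ‖E2 t θ‖ ^ 2 + ‖N t θ‖ ^ 2 := rfl
  have e1 : pt (tripleSq E1 E2 N) t θ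
      = 2 * (⟪E1 t θ, pt E1 t θ⟫_ℝ + ⟪E2 t θ, pt E2 t θ⟫_ℝ + ⟪N t θ, pt N t θ⟫_ℝ) := by
    rw [e, pt_add t θ (by fun_prop) (by fun_prop), pt_add t θ (by fun_prop) (by fun_prop),
      pt_norm_sq t θ h1, pt_norm_sq t θ h2, pt_norm_sq t θ h3]
    ring
  rw [e1, mul_pow]
  have := (sq_inner_triple_le (E1 t θ) (E2 t θ) (N t θ) (pt E1 t θ) (pt E2 t θ) (pt N t θ)).trans
    (mul_le_mul_of_nonneg_left (show _ ≤ gradSq E1 t θ + gradSq E2 t θ + gradSq N t θ by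
      unfold gradSq
      linarith [sq_nonneg ‖pth E1 t θ‖, sq_nonneg ‖pth E2 t θ‖, sq_nonneg ‖pth N t θ‖])
      (by positivity))
  unfold tripleSq
  linarith

theorem pth_tripleSq_sq_le (h1 : Sm E1) (h2 : Sm E2) (h3 : Sm N) (t θ : ℝ) :
    pth (tripleSq E1 E2 N) t θ ^ 2
      ≤ 4 * (tripleSq E1 E2 N t θ * (gradSq E1 t θ + gradSq E2 t θ + gradSq N t θ)) := by
  have e : tripleSq E1 E2 N = fun t θ => ‖E1 t θ‖ ^ 2 + ‖E2 t θ‖ ^ 2 + ‖N t θ‖ ^ 2 := rfl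
  have e1 : pth (tripleSq E1 E2 N) t θ
      = 2 * (⟪E1 t θ, pth E1 t θ⟫_ℝ + ⟪E2 t θ, pth E2 t θ⟫_ℝ + ⟪N t θ, pth N t θ⟫_ℝ) := by
    rw [e, pth_add t θ (by fun_prop) (by fun_prop), pth_add t θ (by fun_prop) (by fun_prop),
      pth_norm_sq t θ h1, pth_norm_sq t θ h2, pth_norm_sq t θ h3]
    ring
  rw [e1, mul_pow]
  have := (sq_inner_triple_le (E1 t θ) (E2 t θ) (N t θ) (pth E1 t θ) (pth E2 t θ)
    (pth N t θ)).trans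
    (mul_le_mul_of_nonneg_left (show _ ≤ gradSq E1 t θ + gradSq E2 t θ + gradSq N t θ by
      unfold gradSq
      linarith [sq_nonneg ‖pt E1 t θ‖, sq_nonneg ‖pt E2 t θ‖, sq_nonneg ‖pt N t θ‖])
      (by positivity))
  unfold tripleSq
  linarith

theorem quartic_estimate (h1 : Sm E1) (h2 : Sm E2) (h3 : Sm N) {χ : ℝ → ℝ}
    (hab : a ≤ b) (hχ : ContDiff ℝ (⊤ : ℕ∞) χ) (hχa : χ a = 0)
    (hχ0 : ∀ t ∈ Icc a b, 0 ≤ χ t) (hχ1 : ∀ t ∈ Icc a b, χ t ^ 2 ≤ κ)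
    (hχ2 : ∀ t ∈ Icc a b, deriv χ t ^ 2 ≤ κ) :
    cylInt (fun t θ => χ t ^ 2 * tripleSq E1 E2 N t θ ^ 2) a b
      ≤ cylInt (tripleSq E1 E2 N) a b * (2 * κ * cylInt (tripleSq E1 E2 N) a b
        + 8 * cylInt (fun t θ => χ t ^ 2 * (gradSq E1 t θ + gradSq E2 t θ + gradSq N t θ)) a b) := by
  have hχd := contDiff_deriv_top hχ
  have hα : Sm (tripleSq E1 E2 N) := contDiff_tripleSq h1 h2 h3
  have g0 : ∀ t θ, 0 ≤ gradSq E1 t θ + gradSq E2 t θ + gradSq N t θ := fun t θ =>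
    add_nonneg (add_nonneg (gradSq_nonneg t θ) (gradSq_nonneg t θ)) (gradSq_nonneg t θ)
  have L := ladyzhenskaya (g := fun t θ => χ t * tripleSq E1 E2 N t θ) (by unfold Sm; fun_prop) hab
    (fun θ => by simp [hχa]) fun t ht θ _ => mul_nonneg (hχ0 t ht) (tripleSq_nonneg t θ)
  have et : ∀ t θ, pt (fun t θ => χ t * tripleSq E1 E2 N t θ) t θ
      = deriv χ t * tripleSq E1 E2 N t θ + χ t * pt (tripleSq E1 E2 N) t θ := fun t θ => by
    rw [pt_mul t θ (by fun_prop) (by fun_prop), pt_fst]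
  have eh : ∀ t θ, pth (fun t θ => χ t * tripleSq E1 E2 N t θ) t θ
      = χ t * pth (tripleSq E1 E2 N) t θ := fun t θ => by
    rw [pth_mul t θ (by fun_prop) (by fun_prop), pth_fst, zero_mul, zero_add]
  have X1 := cylInt_sq_le (a := a) (b := b)
    (h := fun t θ => |pt (fun t θ => χ t * tripleSq E1 E2 N t θ) t θ|)
    (F := tripleSq E1 E2 N) (G := fun t θ => 2 * (deriv χ t ^ 2 * tripleSq E1 E2 N t θ)
      + 8 * (χ t ^ 2 * (gradSq E1 t θ + gradSq E2 t θ + gradSq N t θ)))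
    (by fun_prop) (by fun_prop) (by fun_prop) tripleSq_nonneg
    (fun t θ => by have := g0 t θ; have := tripleSq_nonneg (E1 := E1) (E2 := E2) (N := N) t θ
                   positivity)
    (fun t _ θ _ => by
      rw [sq_abs, et]
      have := mul_le_mul_of_nonneg_left (pt_tripleSq_sq_le h1 h2 h3 t θ) (sq_nonneg (χ t))
      nlinarith [sq_nonneg (deriv χ t * tripleSq E1 E2 N t θ - χ t * pt (tripleSq E1 E2 N) t θ)])
  have X2 := cylInt_sq_le (a := a) (b := b)
    (h := fun t θ => χ t * tripleSq E1 E2 N t θ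
      + |pth (fun t θ => χ t * tripleSq E1 E2 N t θ) t θ|)
    (F := tripleSq E1 E2 N) (G := fun t θ => 2 * (χ t ^ 2 * tripleSq E1 E2 N t θ)
      + 8 * (χ t ^ 2 * (gradSq E1 t θ + gradSq E2 t θ + gradSq N t θ)))
    (by fun_prop) (by fun_prop) (by fun_prop) tripleSq_nonneg
    (fun t θ => by have := g0 t θ; have := tripleSq_nonneg (E1 := E1) (E2 := E2) (N := N) t θ
                   positivity)
    (fun t _ θ _ => by
      rw [eh]
      have := mul_le_mul_of_nonneg_left (pth_tripleSq_sq_le h1 h2 h3 t θ) (sq_nonneg (χ t))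
      nlinarith [sq_nonneg (χ t * tripleSq E1 E2 N t θ - |χ t * pth (tripleSq E1 E2 N) t θ|),
        sq_abs (χ t * pth (tripleSq E1 E2 N) t θ)])
  have hE0 : 0 ≤ cylInt (tripleSq E1 E2 N) a b := cylInt_nonneg fun t _ θ _ => tripleSq_nonneg t θ
  have cD : Continuous fun q : ℝ × ℝ =>
    χ q.1 ^ 2 * (gradSq E1 q.1 q.2 + gradSq E2 q.1 q.2 + gradSq N q.1 q.2) := by fun_prop
  have Y1 : cylInt (fun t θ => 2 * (deriv χ t ^ 2 * tripleSq E1 E2 N t θ)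
      + 8 * (χ t ^ 2 * (gradSq E1 t θ + gradSq E2 t θ + gradSq N t θ))) a b
      ≤ 2 * κ * cylInt (tripleSq E1 E2 N) a b
        + 8 * cylInt (fun t θ => χ t ^ 2 * (gradSq E1 t θ + gradSq E2 t θ + gradSq N t θ)) a b := by
    rw [← cylInt_const_mul, ← cylInt_const_mul 8, ← cylInt_add (by fun_prop) (by fun_prop)]
    exact cylInt_mono (by fun_prop) (by fun_prop) fun t ht θ _ => by
      have := mul_le_mul_of_nonneg_right (hχ2 t ht)
        (tripleSq_nonneg (E1 := E1) (E2 := E2) (N := N) t θ)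
      linarith
  have Y2 : cylInt (fun t θ => 2 * (χ t ^ 2 * tripleSq E1 E2 N t θ)
      + 8 * (χ t ^ 2 * (gradSq E1 t θ + gradSq E2 t θ + gradSq N t θ))) a b
      ≤ 2 * κ * cylInt (tripleSq E1 E2 N) a b
        + 8 * cylInt (fun t θ => χ t ^ 2 * (gradSq E1 t θ + gradSq E2 t θ + gradSq N t θ)) a b := by
    rw [← cylInt_const_mul, ← cylInt_const_mul 8, ← cylInt_add (by fun_prop) (by fun_prop)]
    exact cylInt_mono (by fun_prop) (by fun_prop) fun t ht θ _ => by
      have := mul_le_mul_of_nonneg_right (hχ1 t ht)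
        (tripleSq_nonneg (E1 := E1) (E2 := E2) (N := N) t θ)
      linarith
  have Z1 := X1.trans (mul_le_mul_of_nonneg_left Y1 hE0)
  have Z2 := X2.trans (mul_le_mul_of_nonneg_left Y2 hE0)
  simp only [mul_pow] at L
  refine L.trans ?_
  nlinarith [sq_nonneg (cylInt (fun t θ => |pt (fun t θ => χ t * tripleSq E1 E2 N t θ) t θ|) a b
    - cylInt (fun t θ => χ t * tripleSq E1 E2 N t θ
      + |pth (fun t θ => χ t * tripleSq E1 E2 N t θ) t θ|) a b)]

theorem slice_estimate (h1 : Sm E1) (h2 : Sm E2) (h3 : Sm N) {χ : ℝ → ℝ}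
    (hχ : ContDiff ℝ (⊤ : ℕ∞) χ) (hχa : χ a = 0)
    (hχ1 : ∀ t ∈ Icc a b, χ t ^ 2 ≤ κ) (hχ2 : ∀ t ∈ Icc a b, deriv χ t ^ 2 ≤ κ)
    {t : ℝ} (ht : t ∈ Icc a b) :
    χ t ^ 2 * ∫ θ in (0 : ℝ)..(2 * π), tripleSq E1 E2 N t θ
      ≤ 3 * κ * cylInt (tripleSq E1 E2 N) a b
        + cylInt (fun t θ => χ t ^ 2 * (gradSq E1 t θ + gradSq E2 t θ + gradSq N t θ)) a b := by
  have hχd := contDiff_deriv_top hχ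
  have hα : Sm (tripleSq E1 E2 N) := contDiff_tripleSq h1 h2 h3
  have L := slice_le_cylInt (h := fun t θ => (χ t * χ t) * tripleSq E1 E2 N t θ)
    (by unfold Sm; fun_prop) (fun θ => by simp [hχa]) ht
  rw [intervalIntegral.integral_const_mul, ← sq] at L
  refine L.trans ?_
  rw [← cylInt_const_mul, ← cylInt_add (by fun_prop) (by fun_prop)]
  refine cylInt_mono (by fun_prop) (by fun_prop) fun t ht θ _ => ?_
  rw [pt_mul t θ (by fun_prop) (by fun_prop), pt_mul t θ (by fun_prop) (by fun_prop), pt_fst]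
  have k1 := pt_tripleSq_sq_le h1 h2 h3 t θ
  obtain ⟨G, hG⟩ : ∃ G, G = gradSq E1 t θ + gradSq E2 t θ + gradSq N t θ := ⟨_, rfl⟩
  have hG0 : 0 ≤ G := by
    rw [hG]; exact add_nonneg (add_nonneg (gradSq_nonneg t θ) (gradSq_nonneg t θ))
      (gradSq_nonneg t θ)
  have hT0 := tripleSq_nonneg (E1 := E1) (E2 := E2) (N := N) t θ
  rw [← hG] at k1 ⊢
  obtain ⟨A, hA⟩ : ∃ A, A = tripleSq E1 E2 N t θ := ⟨_, rfl⟩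
  rw [← hA] at k1 hT0 ⊢
  have k2 : |pt (tripleSq E1 E2 N) t θ| ≤ A + G :=
    abs_le_of_sq_le_sq (k1.trans (by nlinarith [sq_nonneg (A - G)])) (by linarith)
  have k3 : |χ t * deriv χ t| ≤ κ :=
    abs_le.2 ⟨by nlinarith [sq_nonneg (χ t + deriv χ t), hχ1 t ht, hχ2 t ht],
      by nlinarith [sq_nonneg (χ t - deriv χ t), hχ1 t ht, hχ2 t ht]⟩
  calc |(deriv χ t * χ t + χ t * deriv χ t) * A + χ t * χ t * pt (tripleSq E1 E2 N) t θ|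
      ≤ |(2 * (χ t * deriv χ t)) * A| + |χ t ^ 2 * pt (tripleSq E1 E2 N) t θ| := by
        refine le_trans (le_of_eq ?_) (abs_add_le _ _)
        congr 1; ring
    _ = 2 * (|χ t * deriv χ t| * A) + χ t ^ 2 * |pt (tripleSq E1 E2 N) t θ| := by
        rw [abs_mul, abs_mul 2, abs_two, abs_of_nonneg hT0, abs_mul (χ t ^ 2),
          abs_of_nonneg (sq_nonneg (χ t))]
        ring
    _ ≤ 2 * (κ * A) + (κ * A + χ t ^ 2 * G) := by
        have k4 := mul_le_mul_of_nonneg_right k3 hT0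
        have k5 := mul_le_mul_of_nonneg_left k2 (sq_nonneg (χ t))
        have k6 := mul_le_mul_of_nonneg_right (hχ1 t ht) hT0
        linarith
    _ = 3 * κ * A + χ t ^ 2 * G := by ring

end CurvatureEnergy

section InteriorRegularity

variable {n : ℕ} {m a b K ε κ : ℝ} {c s : ℝ → ℝ} {ν : ℝ → ℝ → ℝ}
  {p r N yt yh γ E1 E2 : ℝ → ℝ → EuclideanSpace ℝ (Fin n)}

theorem regularity_constants {𝓔 DN DE Q Y B BN : ℝ} (hm : 1 ≤ m) (hκ : 1 ≤ κ)
    (hE0 : 0 ≤ 𝓔) (hE1 : 4000 * K ^ 2 * 𝓔 ≤ 1)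
    (hDN : DN ≤ 12 * m ^ 2 * BN + 6 * Y) (hDE : DE ≤ 16 * DN + 16 * m ^ 2 * B + 32 * K ^ 2 * Q)
    (hBN : BN ≤ B) (hB : B ≤ 2 * κ * 𝓔) (hY : Y ≤ 2 * K ^ 2 * Q)
    (hQ : Q ≤ 𝓔 * (2 * κ * 𝓔 + 8 * (DE + DN))) :
    DE + DN ≤ 900 * m ^ 2 * κ * 𝓔 ∧ Y ≤ 15000 * K ^ 2 * m ^ 2 * κ * 𝓔 ^ 2 := by
  have hm2 : 1 ≤ m ^ 2 := by nlinarith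
  have b1 := mul_le_mul_of_nonneg_left (hBN.trans hB) (sq_nonneg m)
  have b2 := mul_le_mul_of_nonneg_left hB (sq_nonneg m)
  have q1 := mul_le_mul_of_nonneg_left hQ (sq_nonneg K)
  have hκE : 0 ≤ κ * 𝓔 := by positivity
  have b3 := mul_le_mul_of_nonneg_right hm2 hκE
  obtain ⟨D, hD⟩ : ∃ D, D = DE + DN := ⟨_, rfl⟩
  rw [← hD] at hQ q1 ⊢
  have d1 : D ≤ 440 * (m ^ 2 * (κ * 𝓔)) + 236 * (K ^ 2 * Q) := by linarith
  have q2 := mul_le_mul_of_nonneg_right hE1 hκE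
  have d0 : D ≤ 900 * (m ^ 2 * (κ * 𝓔)) := by
    by_cases hD0 : D ≤ 0
    · exact hD0.trans (by positivity)
    · have q3 := mul_le_mul_of_nonneg_right hE1 (not_le.1 hD0).le
      linarith
  refine ⟨by linarith, ?_⟩
  have q4 := mul_le_mul_of_nonneg_left d0 hE0
  have q5 := mul_le_mul_of_nonneg_left b3 hE0
  have q6 : Q ≤ 7202 * (𝓔 * (m ^ 2 * (κ * 𝓔))) := by linarith
  have q7 := mul_le_mul_of_nonneg_left q6 (sq_nonneg K)
  have q8 : 0 ≤ K ^ 2 * (𝓔 * (m ^ 2 * (κ * 𝓔))) := by positivity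
  linarith

theorem Neck.weighted_regularity (h : Neck m a b K ε c s ν p r N yt yh γ E1 E2) {χ : ℝ → ℝ}
    (hab : a ≤ b) (hχ : ContDiff ℝ (⊤ : ℕ∞) χ) (hχa : χ a = 0) (hχb : χ b = 0)
    (hχ0 : ∀ t ∈ Icc a b, 0 ≤ χ t) (hχ1 : ∀ t ∈ Icc a b, χ t ^ 2 ≤ κ)
    (hχ2 : ∀ t ∈ Icc a b, deriv χ t ^ 2 ≤ κ) (hκ : 1 ≤ κ)
    (hE : 4000 * K ^ 2 * cylInt (tripleSq E1 E2 N) a b ≤ 1) :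
    cylInt (fun t θ => χ t ^ 2 * (gradSq E1 t θ + gradSq E2 t θ + gradSq N t θ)) a b
        ≤ 900 * m ^ 2 * κ * cylInt (tripleSq E1 E2 N) a b ∧
      cylInt (fun t θ => χ t ^ 2 * (‖yt t θ‖ ^ 2 + ‖yh t θ‖ ^ 2)) a b
        ≤ 15000 * K ^ 2 * m ^ 2 * κ * cylInt (tripleSq E1 E2 N) a b ^ 2 := by
  have i1 := h.E1_smooth
  have i2 := h.E2_smooth
  have i3 := h.N_smooth
  have i4 := h.yt_smooth
  have i5 := h.yh_smooth
  have hχd := contDiff_deriv_top hχ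
  have hD : cylInt (fun t θ => χ t ^ 2 * (gradSq E1 t θ + gradSq E2 t θ + gradSq N t θ)) a b
      = cylInt (fun t θ => χ t ^ 2 * (gradSq E1 t θ + gradSq E2 t θ)) a b
        + cylInt (fun t θ => χ t ^ 2 * gradSq N t θ) a b := by
    rw [← cylInt_add (by fun_prop) (by fun_prop)]
    exact cylInt_congr fun t _ θ _ => by ring
  have hQ := quartic_estimate i1 i2 i3 hab hχ hχa hχ0 hχ1 hχ2
  rw [hD] at hQ ⊢
  refine regularity_constants h.one_le hκ (cylInt_nonneg fun t _ θ _ => tripleSq_nonneg t θ) hE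
    (h.toLinSys.gradient_estimate hab hχ hχa hχb) (h.gradient_estimate_E hab hχ hχa hχb)
    ?_ ?_ ?_ hQ
  · refine cylInt_mono (by fun_prop) (by fun_prop) fun t _ θ _ => ?_
    unfold tripleSq
    apply mul_le_mul_of_nonneg_left _ (by positivity)
    linarith [sq_nonneg ‖E1 t θ‖, sq_nonneg ‖E2 t θ‖]
  · rw [← cylInt_const_mul]
    refine cylInt_mono (by fun_prop) (by fun_prop) fun t ht θ _ => ?_
    exact mul_le_mul_of_nonneg_right (by linarith [hχ1 t ht, hχ2 t ht]) (tripleSq_nonneg t θ)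
  · rw [← cylInt_const_mul]
    refine cylInt_mono (by fun_prop) (by fun_prop) fun t ht θ _ => ?_
    have k1 := pow_le_pow_left₀ (norm_nonneg _) (h.yt_le t ht θ) 2
    have k2 := pow_le_pow_left₀ (norm_nonneg _) (h.yh_le t ht θ) 2
    have := mul_le_mul_of_nonneg_left (add_le_add k1 k2) (sq_nonneg (χ t))
    linarith

/-- Interior estimates on the cylinder shortened by one at both ends. -/
theorem Neck.regularity (h : Neck m a b K ε c s ν p r N yt yh γ E1 E2) (hab : 2 ≤ b - a)
    (hE : 4000 * K ^ 2 * cylInt (tripleSq E1 E2 N) a b ≤ 1) :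
    cylInt (gradSq N) (a + 1) (b - 1)
        ≤ 900 * m ^ 2 * (b - a) ^ 4 * cylInt (tripleSq E1 E2 N) a b ∧
      cylInt (fun t θ => ‖yt t θ‖ ^ 2 + ‖yh t θ‖ ^ 2) (a + 1) (b - 1)
        ≤ 15000 * K ^ 2 * m ^ 2 * (b - a) ^ 4 * cylInt (tripleSq E1 E2 N) a b ^ 2 ∧
      ∀ t ∈ Icc (a + 1) (b - 1), ∫ θ in (0 : ℝ)..(2 * π), tripleSq E1 E2 N t θ
        ≤ 903 * m ^ 2 * (b - a) ^ 4 * cylInt (tripleSq E1 E2 N) a b := by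
  have i1 := h.E1_smooth
  have i2 := h.E2_smooth
  have i3 := h.N_smooth
  have i4 := h.yt_smooth
  have i5 := h.yh_smooth
  obtain ⟨χ, hχ⟩ : ∃ χ : ℝ → ℝ, χ = fun t => (t - a) * (b - t) := ⟨_, rfl⟩
  have hχs : ContDiff ℝ (⊤ : ℕ∞) χ := by rw [hχ]; fun_prop
  have hχd : ∀ t, deriv χ t = b + a - 2 * t := fun t => by
    have : HasDerivAt χ (1 * (b - t) + (t - a) * (-1)) t := by
      rw [hχ]
      exact ((hasDerivAt_id t).sub_const a).mul ((hasDerivAt_id t).const_sub b)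
    rw [this.deriv]; ring
  obtain ⟨T, hT⟩ : ∃ T, T = b - a := ⟨_, rfl⟩
  rw [← hT] at hab ⊢
  have hκ : 1 ≤ T ^ 4 := one_le_pow₀ (by linarith)
  have hχ0 : ∀ t ∈ Icc a b, 0 ≤ χ t := fun t ht => by
    rw [hχ]; exact mul_nonneg (by linarith [ht.1]) (by linarith [ht.2])
  have hχ1 : ∀ t ∈ Icc a b, χ t ^ 2 ≤ T ^ 4 := fun t ht => by
    have : χ t ≤ T ^ 2 := by
      rw [hχ]
      simp only
      nlinarith [ht.1, ht.2]
    calc χ t ^ 2 ≤ (T ^ 2) ^ 2 := pow_le_pow_left₀ (hχ0 t ht) this 2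
      _ = T ^ 4 := by ring
  have hχ2 : ∀ t ∈ Icc a b, deriv χ t ^ 2 ≤ T ^ 4 := fun t ht => by
    have k1 : deriv χ t ^ 2 ≤ T ^ 2 := by
      rw [hχd]
      exact sq_le_sq' (by linarith [ht.1, ht.2]) (by linarith [ht.1, ht.2])
    exact k1.trans (pow_le_pow_right₀ (by linarith) (by norm_num))
  have hχ3 : ∀ t ∈ Icc (a + 1) (b - 1), 1 ≤ χ t ^ 2 := fun t ht => by
    apply one_le_pow₀
    rw [hχ]
    simp only
    nlinarith [ht.1, ht.2]
  have hχa : χ a = 0 := by simp [hχ]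
  have hχb : χ b = 0 := by simp [hχ]
  have hab' : a ≤ b := by linarith
  obtain ⟨R1, R2⟩ := h.weighted_regularity hab' hχs hχa hχb hχ0 hχ1 hχ2 hκ hE
  refine ⟨le_trans ?_ R1, le_trans ?_ R2, fun t ht => ?_⟩
  · refine (cylInt_mono (G := fun t θ => χ t ^ 2 * (gradSq E1 t θ + gradSq E2 t θ + gradSq N t θ))
      (by fun_prop) (by fun_prop) fun t ht θ _ => ?_).trans
      (cylInt_subset (by fun_prop) (by linarith) (by linarith) fun t _ θ _ => ?_)
    · have := mul_le_mul_of_nonneg_right (hχ3 t ht) (gradSq_nonneg (N := N) t θ)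
      have := mul_nonneg (sq_nonneg (χ t)) (gradSq_nonneg (N := E1) t θ)
      have := mul_nonneg (sq_nonneg (χ t)) (gradSq_nonneg (N := E2) t θ)
      linarith
    · exact mul_nonneg (sq_nonneg _) (add_nonneg (add_nonneg (gradSq_nonneg t θ)
        (gradSq_nonneg t θ)) (gradSq_nonneg t θ))
  · refine (cylInt_mono (G := fun t θ => χ t ^ 2 * (‖yt t θ‖ ^ 2 + ‖yh t θ‖ ^ 2))
      (by fun_prop) (by fun_prop) fun t ht θ _ => ?_).trans
      (cylInt_subset (by fun_prop) (by linarith) (by linarith) fun t _ θ _ => by positivity)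
    exact le_mul_of_one_le_left (by positivity) (hχ3 t ht)
  · have S := slice_estimate i1 i2 i3 hχs hχa hχ1 hχ2
      (t := t) ⟨by linarith [ht.1], by linarith [ht.2]⟩
    have hI : 0 ≤ ∫ θ in (0 : ℝ)..(2 * π), tripleSq E1 E2 N t θ :=
      intervalIntegral.integral_nonneg (by positivity) fun θ _ => tripleSq_nonneg t θ
    have hE0 : 0 ≤ T ^ 4 * cylInt (tripleSq E1 E2 N) a b :=
      mul_nonneg (by positivity) (cylInt_nonneg fun t _ θ _ => tripleSq_nonneg t θ)
    have hm2 : 1 ≤ m ^ 2 := one_le_pow₀ h.one_le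
    have := mul_le_mul_of_nonneg_right hm2 hE0
    have := le_mul_of_one_le_left hI (hχ3 t ht)
    linarith

end InteriorRegularity

section Projection

variable {V : Type*} [NormedAddCommGroup V] [InnerProductSpace ℝ V]

/-- The projection along the plane spanned by two vectors. -/
theorem exists_normal_projection (p₀ r₀ : V) : ∃ Q : V →L[ℝ] V, Q p₀ = 0 ∧ Q r₀ = 0 ∧
    (∀ x, ⟪Q x, p₀⟫_ℝ = 0 ∧ ⟪Q x, r₀⟫_ℝ = 0) ∧ (∀ x, ‖Q x‖ ≤ ‖x‖) ∧
    ∀ x, ∃ α β : ℝ, x = Q x + (α • p₀ + β • r₀) := by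
  have : FiniteDimensional ℝ (Submodule.span ℝ {p₀, r₀}) :=
    FiniteDimensional.span_of_finite ℝ (by simp)
  have hp : p₀ ∈ Submodule.span ℝ {p₀, r₀} := Submodule.subset_span (by simp)
  have hr : r₀ ∈ Submodule.span ℝ {p₀, r₀} := Submodule.subset_span (by simp)
  refine ⟨(Submodule.span ℝ {p₀, r₀})ᗮ.starProjection, ?_, ?_, fun x => ⟨?_, ?_⟩,
    fun x => Submodule.norm_starProjection_apply_le _ x, fun x => ?_⟩
  · rw [Submodule.starProjection_orthogonal_val, Submodule.starProjection_eq_self_iff.2 hp, sub_self]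
  · rw [Submodule.starProjection_orthogonal_val, Submodule.starProjection_eq_self_iff.2 hr, sub_self]
  · exact (Submodule.mem_orthogonal' _ _).1 (Submodule.starProjection_apply_mem _ x) _ hp
  · exact (Submodule.mem_orthogonal' _ _).1 (Submodule.starProjection_apply_mem _ x) _ hr
  · have := Submodule.starProjection_apply_mem (Submodule.span ℝ {p₀, r₀}) x
    obtain ⟨α, β, h⟩ := Submodule.mem_span_pair.1 this
    refine ⟨α, β, ?_⟩
    rw [Submodule.starProjection_orthogonal_val, h, sub_add_cancel]

/-- Projecting along a plane close to the one a vector is orthogonal to changes it only slightly. -/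
theorem norm_sq_le_two_projection {p r p₀ r₀ x y : V} {ω α β : ℝ} (hω : ω ≤ 1 / 100)
    (hp : 1 / 2 ≤ ‖p‖ ^ 2) (hr : 1 / 2 ≤ ‖r‖ ^ 2) (hpr : ⟪p, r⟫_ℝ = 0)
    (hp₀ : ‖p - p₀‖ ≤ ω) (hr₀ : ‖r - r₀‖ ≤ ω) (hxp : ⟪p, x⟫_ℝ = 0) (hxr : ⟪r, x⟫_ℝ = 0)
    (hyp : ⟪y, p₀⟫_ℝ = 0) (hyr : ⟪y, r₀⟫_ℝ = 0) (hx : x = y + (α • p₀ + β • r₀)) :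
    ‖x‖ ^ 2 ≤ 2 * ‖y‖ ^ 2 := by
  obtain ⟨w, hw⟩ : ∃ w, w = α • p₀ + β • r₀ := ⟨_, rfl⟩
  have hω0 : 0 ≤ ω := (norm_nonneg _).trans hp₀
  have hyw : ⟪y, w⟫_ℝ = 0 := by
    rw [hw, inner_add_right, inner_smul_right, inner_smul_right, hyp, hyr]; ring
  have hx2 : ‖x‖ ^ 2 = ‖y‖ ^ 2 + ‖w‖ ^ 2 := by
    rw [hx, ← hw, norm_add_sq_real, hyw]; ring
  have hww : ‖w‖ ^ 2 = -⟪α • (p - p₀) + β • (r - r₀), x⟫_ℝ := by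
    have e1 : ⟪w, x⟫_ℝ = ‖w‖ ^ 2 := by
      rw [hx, ← hw, inner_add_right, real_inner_comm, hyw, real_inner_self_eq_norm_sq, zero_add]
    rw [← e1, hw]
    simp only [inner_add_left, inner_sub_left, real_inner_smul_left, hxp, hxr]
    ring
  have hd : ‖α • (p - p₀) + β • (r - r₀)‖ ≤ (|α| + |β|) * ω := by
    refine (norm_add_le _ _).trans ?_
    rw [norm_smul, norm_smul, Real.norm_eq_abs, Real.norm_eq_abs, add_mul]
    gcongr
  have h1 : ‖w‖ ^ 2 ≤ (|α| + |β|) * ω * ‖x‖ := by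
    rw [hww]
    refine (neg_le_abs _).trans ((abs_real_inner_le_norm _ _).trans ?_)
    gcongr
  have h2 : ((|α| + |β|) / 2) ^ 2 ≤ ‖α • p + β • r‖ ^ 2 := by
    rw [norm_add_sq_real, norm_smul_sq_real, norm_smul_sq_real, real_inner_smul_left,
      real_inner_smul_right, hpr, ← sq_abs α, ← sq_abs β]
    have a1 := mul_le_mul_of_nonneg_left hp (sq_nonneg |α|)
    have a2 := mul_le_mul_of_nonneg_left hr (sq_nonneg |β|)
    nlinarith [sq_nonneg (|α| - |β|)]
  have h3 : (|α| + |β|) / 2 ≤ ‖α • p + β • r‖ :=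
    le_of_sq_le_sq h2 (norm_nonneg _)
  have h4 : ‖α • p + β • r‖ ≤ ‖w‖ + (|α| + |β|) * ω := by
    have : α • p + β • r = w + (α • (p - p₀) + β • (r - r₀)) := by rw [hw]; module
    rw [this]
    exact (norm_add_le _ _).trans (by gcongr)
  have h5 : |α| + |β| ≤ 3 * ‖w‖ := by
    have := mul_le_mul_of_nonneg_left hω (add_nonneg (abs_nonneg α) (abs_nonneg β))
    have := norm_nonneg w
    linarith
  have h6 : ‖w‖ ^ 2 ≤ 3 * ‖w‖ * (1 / 100) * ‖x‖ := h1.trans (by gcongr)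
  nlinarith [sq_nonneg (‖w‖ - ‖x‖), sq_nonneg ‖w‖, sq_nonneg ‖x‖]

/-- Bounds for the pairing of a nearly constant frame with constant vectors. -/
theorem frame_pairing {p r p₀ r₀ : V} {ω ε ρ : ℝ} (hω : ω ≤ 1 / 100) (hε : ε ≤ 1 / 100)
    (hp : ‖p‖ ^ 2 = ρ) (hr : ‖r‖ ^ 2 = ρ) (hρ : |ρ - 1| ≤ 4 * ε) (hpr : ⟪p, r⟫_ℝ = 0)
    (hp₀ : ‖p - p₀‖ ≤ ω) (hr₀ : ‖r - r₀‖ ≤ ω) {c s : ℝ} (hc : |c| ≤ 1) (hs : |s| ≤ 1) :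
    ‖p₀‖ ≤ 11 / 10 ∧ |⟪c • p + s • r, p₀⟫_ℝ - c| ≤ 4 * ε + 4 * ω ∧
      ‖c • p + s • r‖ ≤ 22 / 10 ∧
      ∀ z : V, ⟪z, p₀⟫_ℝ = 0 → ⟪z, r₀⟫_ℝ = 0 → |⟪c • p + s • r, z⟫_ℝ| ≤ 2 * ω * ‖z‖ := by
  have hρ' := abs_le.1 hρ
  have np : ‖p‖ ≤ 103 / 100 := le_of_sq_le_sq (by rw [hp]; linarith) (by norm_num)
  have nr : ‖r‖ ≤ 103 / 100 := le_of_sq_le_sq (by rw [hr]; linarith) (by norm_num)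
  have np₀ : ‖p₀‖ ≤ ‖p‖ + ω := by
    have : p₀ = p - (p - p₀) := by abel
    calc ‖p₀‖ = ‖p - (p - p₀)‖ := by rw [← this]
      _ ≤ ‖p‖ + ‖p - p₀‖ := norm_sub_le _ _
      _ ≤ _ := by gcongr
  refine ⟨by linarith, ?_, ?_, fun z z1 z2 => ?_⟩
  · have e : ⟪c • p + s • r, p₀⟫_ℝ - c
        = c * (ρ - 1) - c * ⟪p, p - p₀⟫_ℝ - s * ⟪r, p - p₀⟫_ℝ := by
      simp only [inner_add_left, inner_sub_right, real_inner_smul_left, real_inner_self_eq_norm_sq,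
        hp, real_inner_comm p r, hpr]
      ring
    rw [e]
    have b1 : |c * (ρ - 1)| ≤ 4 * ε := by
      rw [abs_mul]; exact (mul_le_of_le_one_left (abs_nonneg _) hc).trans hρ
    have b2 : |⟪p, p - p₀⟫_ℝ| ≤ 2 * ω := (abs_real_inner_le_norm _ _).trans
      (mul_le_mul (by linarith) hp₀ (norm_nonneg _) (by norm_num))
    have b3 : |⟪r, p - p₀⟫_ℝ| ≤ 2 * ω := (abs_real_inner_le_norm _ _).trans
      (mul_le_mul (by linarith) hp₀ (norm_nonneg _) (by norm_num))
    have b4 : |c * ⟪p, p - p₀⟫_ℝ| ≤ 2 * ω := by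
      rw [abs_mul]; exact (mul_le_of_le_one_left (abs_nonneg _) hc).trans b2
    have b5 : |s * ⟪r, p - p₀⟫_ℝ| ≤ 2 * ω := by
      rw [abs_mul]; exact (mul_le_of_le_one_left (abs_nonneg _) hs).trans b3
    rw [abs_le] at *
    constructor <;> linarith
  · refine (norm_add_le _ _).trans ?_
    rw [norm_smul, norm_smul, Real.norm_eq_abs, Real.norm_eq_abs]
    have b1 := mul_le_of_le_one_left (norm_nonneg p) hc
    have b2 := mul_le_of_le_one_left (norm_nonneg r) hs
    linarith
  · have e : ⟪c • p + s • r, z⟫_ℝ = c * ⟪p - p₀, z⟫_ℝ + s * ⟪r - r₀, z⟫_ℝ := by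
      simp only [inner_add_left, inner_sub_left, real_inner_smul_left, real_inner_comm z p₀,
        real_inner_comm z r₀, z1, z2]
      ring
    rw [e]
    have b2 : |⟪p - p₀, z⟫_ℝ| ≤ ω * ‖z‖ := (abs_real_inner_le_norm _ _).trans (by gcongr)
    have b3 : |⟪r - r₀, z⟫_ℝ| ≤ ω * ‖z‖ := (abs_real_inner_le_norm _ _).trans (by gcongr)
    have b4 : |c * ⟪p - p₀, z⟫_ℝ| ≤ ω * ‖z‖ := by
      rw [abs_mul]; exact (mul_le_of_le_one_left (abs_nonneg _) hc).trans b2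
    have b5 : |s * ⟪r - r₀, z⟫_ℝ| ≤ ω * ‖z‖ := by
      rw [abs_mul]; exact (mul_le_of_le_one_left (abs_nonneg _) hs).trans b3
    have := abs_add_le (c * ⟪p - p₀, z⟫_ℝ) (s * ⟪r - r₀, z⟫_ℝ)
    linarith

end Projection

section NeckOscillation

variable {n : ℕ} {m a b K ε : ℝ} {c s : ℝ → ℝ} {ν : ℝ → ℝ → ℝ}
  {p r N yt yh γ E1 E2 : ℝ → ℝ → EuclideanSpace ℝ (Fin n)}

theorem norm_sq_le_of_frame {V : Type*} [NormedAddCommGroup V] [InnerProductSpace ℝ V]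
    (x y z w : V) {α β k : ℝ} (hα : |α| ≤ ε) (hβ : |β| ≤ ε) (hk : |k| ≤ 1) :
    ‖x + α • y + β • z + k • w‖ ^ 2
      ≤ 4 * (‖x‖ ^ 2 + ‖w‖ ^ 2) + 4 * ε ^ 2 * (‖y‖ ^ 2 + ‖z‖ ^ 2) := by
  have h1 := norm_add_sq_le_two (x + α • y) (β • z + k • w)
  have h2 := norm_add_sq_le_two x (α • y)
  have h3 := norm_add_sq_le_two (β • z) (k • w)
  rw [norm_smul_sq_real] at h2 h3
  rw [norm_smul_sq_real] at h3
  have a1 : α ^ 2 * ‖y‖ ^ 2 ≤ ε ^ 2 * ‖y‖ ^ 2 := by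
    gcongr 1; rw [← sq_abs α]; gcongr
  have a2 : β ^ 2 * ‖z‖ ^ 2 ≤ ε ^ 2 * ‖z‖ ^ 2 := by
    gcongr 1; rw [← sq_abs β]; gcongr
  have a3 : k ^ 2 * ‖w‖ ^ 2 ≤ 1 * ‖w‖ ^ 2 := by
    gcongr 1; rw [← sq_abs k]; exact pow_le_one₀ (abs_nonneg _) hk
  rw [← add_assoc (x + α • y)] at h1
  linarith

theorem LinSys.abs_c_le {E : ℝ → ℝ → ℝ} (h : LinSys m a b c s E p r N yt yh) (θ : ℝ) :
    |c θ| ≤ 1 ∧ |s θ| ≤ 1 := by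
  have := h.sq_add_sq θ
  exact ⟨abs_le_one_iff_mul_self_le_one.2 (by nlinarith [sq_nonneg (s θ)]),
    abs_le_one_iff_mul_self_le_one.2 (by nlinarith [sq_nonneg (c θ)])⟩

theorem Neck.derivatives (h : Neck m a b K ε c s ν p r N yt yh γ E1 E2) (t θ : ℝ) :
    pt p t θ = E1 t θ + pt ν t θ • p t θ + pth ν t θ • r t θ
        + (1 / 2 * (Real.exp (2 * ν t θ) * c θ)) • N t θ ∧
      pth r t θ = E1 t θ + pt ν t θ • p t θ + pth ν t θ • r t θ
        + (-(1 / 2 * (Real.exp (2 * ν t θ) * c θ))) • N t θ ∧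
      pt r t θ = E2 t θ + pt ν t θ • r t θ + (-pth ν t θ) • p t θ
        + (1 / 2 * (Real.exp (2 * ν t θ) * s θ)) • N t θ ∧
      -pth p t θ = E2 t θ + pt ν t θ • r t θ + (-pth ν t θ) • p t θ
        + (-(1 / 2 * (Real.exp (2 * ν t θ) * s θ))) • N t θ := by
  have h1 := h.first t θ
  have h2 := h.second t θ
  rw [h.E1_eq, h.E2_eq]
  refine ⟨?_, ?_, ?_, ?_⟩
  · linear_combination (norm := module) (1 / 2 : ℝ) • h1
  · linear_combination (norm := module) (-(1 / 2) : ℝ) • h1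
  · linear_combination (norm := module) (1 / 2 : ℝ) • h2
  · linear_combination (norm := module) (-(1 / 2) : ℝ) • h2

/-- Bounds for the gradients of the projected frame. -/
theorem Neck.derivatives_le (h : Neck m a b K ε c s ν p r N yt yh γ E1 E2)
    (Q : EuclideanSpace ℝ (Fin n) →L[ℝ] EuclideanSpace ℝ (Fin n)) (hQ : ∀ x, ‖Q x‖ ≤ ‖x‖)
    {t : ℝ} (ht : t ∈ Icc a b) (θ : ℝ) :
    ‖Q (pt p t θ)‖ ^ 2 ≤ 4 * tripleSq E1 E2 N t θ
        + 4 * ε ^ 2 * (‖Q (p t θ)‖ ^ 2 + ‖Q (r t θ)‖ ^ 2) ∧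
      ‖Q (pth r t θ)‖ ^ 2 ≤ 4 * tripleSq E1 E2 N t θ
        + 4 * ε ^ 2 * (‖Q (p t θ)‖ ^ 2 + ‖Q (r t θ)‖ ^ 2) ∧
      ‖Q (pt r t θ)‖ ^ 2 ≤ 4 * tripleSq E1 E2 N t θ
        + 4 * ε ^ 2 * (‖Q (p t θ)‖ ^ 2 + ‖Q (r t θ)‖ ^ 2) ∧
      ‖Q (pth p t θ)‖ ^ 2 ≤ 4 * tripleSq E1 E2 N t θ
        + 4 * ε ^ 2 * (‖Q (p t θ)‖ ^ 2 + ‖Q (r t θ)‖ ^ 2) := by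
  obtain ⟨d1, d2, d3, d4⟩ := h.derivatives t θ
  obtain ⟨c1, s1⟩ := h.abs_c_le θ
  obtain ⟨e1, e2, -⟩ := h.exp_le ht θ
  have n1 := h.nu_t_le t ht θ
  have n2 := h.nu_th_le t ht θ
  have hk : ∀ {x : ℝ}, |x| ≤ 1 → |1 / 2 * (Real.exp (2 * ν t θ) * x)| ≤ 1 := fun {x} hx => by
    rw [abs_mul, abs_mul, abs_of_pos (Real.exp_pos _), abs_of_pos (by norm_num)]
    nlinarith [abs_nonneg x]
  have q1 : ‖Q (E1 t θ)‖ ^ 2 ≤ ‖E1 t θ‖ ^ 2 := by gcongr; exact hQ _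
  have q2 : ‖Q (E2 t θ)‖ ^ 2 ≤ ‖E2 t θ‖ ^ 2 := by gcongr; exact hQ _
  have q3 : ‖Q (N t θ)‖ ^ 2 ≤ ‖N t θ‖ ^ 2 := by gcongr; exact hQ _
  have p1 := sq_nonneg ‖E1 t θ‖
  have p2 := sq_nonneg ‖E2 t θ‖
  unfold tripleSq
  refine ⟨?_, ?_, ?_, ?_⟩
  · rw [d1]
    simp only [map_add, map_smul]
    refine (norm_sq_le_of_frame _ _ _ _ n1 n2 (hk c1)).trans ?_
    linarith
  · rw [d2]
    simp only [map_add, map_smul]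
    refine (norm_sq_le_of_frame _ _ _ _ n1 n2 (by rw [abs_neg]; exact hk c1)).trans ?_
    linarith
  · rw [d3]
    simp only [map_add, map_smul]
    refine (norm_sq_le_of_frame _ _ _ _ n1 (by rwa [abs_neg]) (hk s1)).trans ?_
    linarith
  · rw [← norm_neg, ← map_neg, d4]
    simp only [map_add, map_smul]
    refine (norm_sq_le_of_frame _ _ _ _ n1 (by rwa [abs_neg])
      (by rw [abs_neg]; exact hk s1)).trans ?_
    linarith

theorem circleInt_norm_le {x : ℝ → EuclideanSpace ℝ (Fin n)} {f : ℝ → ℝ} (hx : Continuous x)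
    (hf : Continuous f) {A κ k : ℝ} (hk : 0 ≤ k)
    (hle : ∀ θ ∈ Icc (0 : ℝ) (2 * π), ‖x θ‖ ^ 2 ≤ k * (4 * f θ + 16 * ε ^ 2))
    (hA0 : 0 ≤ A) (hA : ∫ θ in (0 : ℝ)..(2 * π), f θ ≤ A)
    (hAκ : 26 * A + 640 * ε ^ 2 ≤ κ ^ 2) :
    (∫ θ in (0 : ℝ)..(2 * π), ‖x θ‖) ^ 2 ≤ k * κ ^ 2 := by
  have h1 := sq_circleInt_le (h := fun θ => ‖x θ‖) (f := fun θ => k * (4 * f θ + 16 * ε ^ 2))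
    (by fun_prop) (by fun_prop) hle
  rw [intervalIntegral.integral_const_mul, intervalIntegral.integral_add
    (Continuous.intervalIntegrable (by fun_prop) _ _)
    (Continuous.intervalIntegrable (by fun_prop) _ _),
    intervalIntegral.integral_const_mul, intervalIntegral.integral_const, smul_eq_mul,
    sub_zero] at h1
  refine h1.trans ?_
  have hpi := Real.pi_pos
  have hpi2 := Real.pi_lt_d2
  have a1 : π * ∫ θ in (0 : ℝ)..(2 * π), f θ ≤ 3.15 * A :=
    (mul_le_mul_of_nonneg_left hA hpi.le).trans (by gcongr)
  have a2 : π * π * ε ^ 2 ≤ 3.15 * 3.15 * ε ^ 2 := by gcongr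
  have a3 : 2 * π * (4 * (∫ θ in (0 : ℝ)..(2 * π), f θ) + 2 * π * (16 * ε ^ 2)) ≤ κ ^ 2 := by
    nlinarith [sq_nonneg ε]
  calc _ = k * (2 * π * (4 * (∫ θ in (0 : ℝ)..(2 * π), f θ) + 2 * π * (16 * ε ^ 2))) := by ring
    _ ≤ _ := mul_le_mul_of_nonneg_left a3 hk

theorem continuous_tripleSq_slice (h1 : Sm E1) (h2 : Sm E2) (h3 : Sm N) (t : ℝ) :
    Continuous (tripleSq E1 E2 N t) := by
  have h : ∀ {x : ℝ → ℝ → EuclideanSpace ℝ (Fin n)}, Sm x → Continuous (x t) := fun hx =>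
    hx.continuous.comp (by fun_prop : Continuous fun θ : ℝ => (t, θ))
  exact (((h h1).norm.pow 2).add ((h h2).norm.pow 2)).add ((h h3).norm.pow 2)

theorem Neck.circleInt_le (h : Neck m a b K ε c s ν p r N yt yh γ E1 E2)
    {x : ℝ → ℝ → EuclideanSpace ℝ (Fin n)} (hx : Sm x)
    (hle : ∀ t ∈ Icc a b, ∀ θ, ‖x t θ‖ ^ 2 ≤ 4 * tripleSq E1 E2 N t θ
      + 4 * ε ^ 2 * (‖p t θ‖ ^ 2 + ‖r t θ‖ ^ 2)) {t : ℝ} (ht : t ∈ Icc a b) {A κ : ℝ} (hκ : 0 ≤ κ)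
    (hA : ∫ θ in (0 : ℝ)..(2 * π), tripleSq E1 E2 N t θ ≤ A) (hA0 : 0 ≤ A)
    (hAκ : 26 * A + 640 * ε ^ 2 ≤ κ ^ 2) :
    ∫ θ in (0 : ℝ)..(2 * π), ‖x t θ‖ ≤ κ := by
  refine le_of_sq_le_sq ?_ hκ
  have hxt : Continuous (x t) :=
    hx.continuous.comp (by fun_prop : Continuous fun θ : ℝ => (t, θ))
  have := circleInt_norm_le (ε := ε) (x := x t) (f := tripleSq E1 E2 N t) (k := 1) hxt
    (continuous_tripleSq_slice h.E1_smooth h.E2_smooth h.N_smooth t)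
    zero_le_one (fun θ _ => ?_) hA0 hA hAκ
  · rwa [one_mul] at this
  · have e := (h.exp_le ht θ).1
    have := mul_le_mul_of_nonneg_left e (sq_nonneg ε)
    have := hle t ht θ
    rw [h.norm_p t ht, h.norm_r t ht] at this
    linarith

/-- The frame of a neck is nearly constant. -/
theorem Neck.oscillation (h : Neck m a b K ε c s ν p r N yt yh γ E1 E2) {a' b' A κ ω tc : ℝ}
    (ha : a ≤ a') (hb : b' ≤ b) (htc : tc ∈ Icc a' b') (hκ : 0 ≤ κ)
    (hA : ∀ t ∈ Icc a' b', ∫ θ in (0 : ℝ)..(2 * π), tripleSq E1 E2 N t θ ≤ A)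
    (hAκ : 26 * A + 640 * ε ^ 2 ≤ κ ^ 2) (hω : (4 + (b' - a')) * κ ≤ ω)
    {t : ℝ} (ht : t ∈ Icc a' b') {θ : ℝ} (hθ : θ ∈ Icc 0 (2 * π)) :
    ‖p t θ - smean p tc‖ ≤ ω ∧ ‖r t θ - smean r tc‖ ≤ ω ∧ ‖γ t θ‖ ≤ ω := by
  have i1 := h.E1_smooth
  have i2 := h.E2_smooth
  have i3 := h.N_smooth
  have i4 := h.P_smooth
  have i5 := h.R_smooth
  have i6 := h.γ_smooth
  have hε := h.ε_le
  have hI : ∀ t ∈ Icc a' b', t ∈ Icc a b := fun t ht => ⟨ha.trans ht.1, ht.2.trans hb⟩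
  have hab : 0 ≤ b' - a' := sub_nonneg.2 (ht.1.trans ht.2)
  have hcont : ∀ t, Continuous (tripleSq E1 E2 N t) := continuous_tripleSq_slice i1 i2 i3
  have hA0 : 0 ≤ A := (intervalIntegral.integral_nonneg (by positivity)
    fun θ _ => tripleSq_nonneg t θ).trans (hA t ht)
  have hbd := fun {x : ℝ → ℝ → EuclideanSpace ℝ (Fin n)} (hx : Sm x) hle t ht =>
    h.circleInt_le hx hle (hI t ht) hκ (hA t ht) hA0 hAκ
  have D := fun t (ht : t ∈ Icc a b) θ =>
    h.derivatives_le (ContinuousLinearMap.id ℝ _) (fun _ => le_rfl) ht θ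
  simp only [ContinuousLinearMap.id_apply] at D
  have hω' : (1 + (b' - a')) * κ ≤ ω := le_trans (by gcongr; norm_num) hω
  refine ⟨?_, ?_, ?_⟩
  · exact (norm_sub_smean_le i4 htc (hbd (contDiff_pt i4) fun t ht θ => (D t ht θ).1)
      (hbd (contDiff_pth i4) fun t ht θ => (D t ht θ).2.2.2) ht hθ).trans hω'
  · exact (norm_sub_smean_le i5 htc (hbd (contDiff_pt i5) fun t ht θ => (D t ht θ).2.2.1)
      (hbd (contDiff_pth i5) fun t ht θ => (D t ht θ).2.1) ht hθ).trans hω'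
  · have h1 := norm_sub_le_circleInt (x := γ t) (x' := pth γ t) (φ := 0) (θ := θ)
      (fun s => Sm.hasDerivAt_th i6 t s) (by fun_prop) ⟨le_rfl, hθ.1.trans hθ.2⟩ hθ
    rw [h.γ_zero t (hI t ht), sub_zero] at h1
    have h2 := circleInt_norm_le (x := pth γ t) (f := tripleSq E1 E2 N t) (k := 16) (by fun_prop)
      (hcont t) (by norm_num) (fun θ _ => ?_) hA0 (hA t ht) hAκ
    · have h3 : ∫ θ in (0 : ℝ)..(2 * π), ‖pth γ t θ‖ ≤ 4 * κ :=
        le_of_sq_le_sq (by linarith) (by positivity)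
      refine (h1.trans h3).trans (le_trans ?_ hω)
      gcongr
      linarith
    · have g := h.γ_th_le t (hI t ht) θ
      have n1 := h.nu_t_le t (hI t ht) θ
      have n2 := h.nu_th_le t (hI t ht) θ
      have g' : ‖pth γ t θ‖ ≤ 2 * (‖E1 t θ‖ + ‖E2 t θ‖) + 8 * ε := by linarith
      have g2 : ‖pth γ t θ‖ ^ 2 ≤ (2 * (‖E1 t θ‖ + ‖E2 t θ‖) + 8 * ε) ^ 2 := by gcongr
      refine g2.trans ?_
      unfold tripleSq
      nlinarith [sq_nonneg (‖E1 t θ‖ - ‖E2 t θ‖), sq_nonneg (2 * (‖E1 t θ‖ + ‖E2 t θ‖) - 8 * ε),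
        sq_nonneg ‖N t θ‖, sq_nonneg ‖E1 t θ‖, sq_nonneg ‖E2 t θ‖, sq_nonneg ε]

end NeckOscillation

section NeckFlux

variable {n : ℕ} {m a b K ε : ℝ} {c s : ℝ → ℝ} {ν : ℝ → ℝ → ℝ}
  {p r N yt yh γ E1 E2 : ℝ → ℝ → EuclideanSpace ℝ (Fin n)}

/-- The density controlling the fluxes of a neck. -/
def fluxDens (m ω : ℝ) (N yt yh : ℝ → ℝ → EuclideanSpace ℝ (Fin n)) (t θ : ℝ) : ℝ :=
  12000 * m ^ 4 * ω ^ 2 * (gradSq N t θ + ‖N t θ‖ ^ 2) + 1300 * (‖yt t θ‖ ^ 2 + ‖yh t θ‖ ^ 2)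

theorem wedge_le {V : Type*} [NormedAddCommGroup V] [InnerProductSpace ℝ V] (x e y z : V)
    {k : ℝ} (hk : ‖e‖ * ‖y‖ ≤ k) :
    ⟪x, ⟪e, y⟫_ℝ • z - ⟪e, z⟫_ℝ • y⟫_ℝ ≤ 2 * k * ‖x‖ * ‖z‖ := by
  refine (real_inner_le_norm _ _).trans ?_
  have h1 : ‖⟪e, y⟫_ℝ • z - ⟪e, z⟫_ℝ • y‖ ≤ 2 * (‖e‖ * ‖y‖) * ‖z‖ := by
    refine (norm_sub_le _ _).trans ?_
    rw [norm_smul, norm_smul]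
    have a1 := mul_le_mul_of_nonneg_right (norm_inner_le_norm (𝕜 := ℝ) e y) (norm_nonneg z)
    have a2 := mul_le_mul_of_nonneg_right (norm_inner_le_norm (𝕜 := ℝ) e z) (norm_nonneg y)
    linarith
  calc ‖x‖ * _ ≤ ‖x‖ * (2 * (‖e‖ * ‖y‖) * ‖z‖) := by gcongr
    _ ≤ ‖x‖ * (2 * k * ‖z‖) := by gcongr
    _ = _ := by ring

theorem flux_pointwise {V : Type*} [NormedAddCommGroup V] [InnerProductSpace ℝ V]
    {N' N₀ Y e g y z : V} {w ω : ℝ} (hm : 1 ≤ m) (hω : 0 ≤ ω) (hmω : m * ω ≤ 1)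
    (hy : ‖y‖ ≤ 11 / 10) (he : ‖e‖ ≤ 22 / 10) (hw : |⟪e, y⟫_ℝ - w| ≤ 8 * ω)
    (hz : |⟪e, z⟫_ℝ| ≤ 2 * ω * ‖z‖) (hg : ‖g‖ ≤ ω) :
    w * ⟪N' + (2 * m) • N₀, z⟫_ℝ - ⟪N' + (2 * m) • N₀, ⟪e, y⟫_ℝ • z - ⟪e, z⟫_ℝ • y⟫_ℝ
        + (⟪Y, ⟪e, y⟫_ℝ • z - ⟪e, z⟫_ℝ • y⟫_ℝ
          + m * ⟪N' + m • N₀ - Y, ⟪g, y⟫_ℝ • z - ⟪g, z⟫_ℝ • y⟫_ℝ)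
      ≤ (14 * m * ω * ‖N'‖ + 25 * m ^ 2 * ω * ‖N₀‖ + 8 * ‖Y‖) * ‖z‖ := by
  have n2 : ∀ k : ℝ, 0 ≤ k → ‖N' + k • N₀‖ ≤ ‖N'‖ + k * ‖N₀‖ := fun k hk => by
    refine (norm_add_le _ _).trans ?_
    rw [norm_smul, Real.norm_of_nonneg hk]
  have nx := n2 (2 * m) (by linarith)
  have nx' : ‖N' + m • N₀ - Y‖ ≤ ‖N'‖ + m * ‖N₀‖ + ‖Y‖ :=
    (norm_sub_le _ _).trans (by gcongr; exact n2 m (by linarith))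
  have k1 := wedge_le Y e y z (k := 242 / 100) (by
    calc _ ≤ 22 / 10 * (11 / 10 : ℝ) := by gcongr
      _ = _ := by norm_num)
  have k2 := wedge_le (N' + m • N₀ - Y) g y z (k := ω * (11 / 10)) (by gcongr)
  have k3 : m * ⟪N' + m • N₀ - Y, ⟪g, y⟫_ℝ • z - ⟪g, z⟫_ℝ • y⟫_ℝ
      ≤ m * (2 * (ω * (11 / 10)) * (‖N'‖ + m * ‖N₀‖ + ‖Y‖) * ‖z‖) := by
    apply mul_le_mul_of_nonneg_left _ (by linarith)
    exact k2.trans (by gcongr)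
  have k4 : w * ⟪N' + (2 * m) • N₀, z⟫_ℝ - ⟪N' + (2 * m) • N₀, ⟪e, y⟫_ℝ • z - ⟪e, z⟫_ℝ • y⟫_ℝ
      ≤ 11 * ω * (‖N'‖ + 2 * m * ‖N₀‖) * ‖z‖ := by
    rw [inner_sub_right, inner_smul_right, inner_smul_right]
    have e1 : -((⟪e, y⟫_ℝ - w) * ⟪N' + (2 * m) • N₀, z⟫_ℝ)
        ≤ 8 * ω * ((‖N'‖ + 2 * m * ‖N₀‖) * ‖z‖) := by
      refine (neg_le_abs _).trans ?_
      rw [abs_mul]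
      exact mul_le_mul hw ((abs_real_inner_le_norm _ _).trans (by gcongr)) (abs_nonneg _)
        (by positivity)
    have e2 : ⟪e, z⟫_ℝ * ⟪N' + (2 * m) • N₀, y⟫_ℝ
        ≤ 2 * ω * ‖z‖ * ((‖N'‖ + 2 * m * ‖N₀‖) * (11 / 10)) := by
      refine (le_abs_self _).trans ?_
      rw [abs_mul]
      exact mul_le_mul hz ((abs_real_inner_le_norm _ _).trans (by gcongr)) (abs_nonneg _)
        (by positivity)
    have p1 : 0 ≤ ω * ((‖N'‖ + 2 * m * ‖N₀‖) * ‖z‖) := by positivity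
    linarith
  have p1 : 0 ≤ ω * ‖N'‖ * ‖z‖ := by positivity
  have p2 : 0 ≤ ω * ‖N₀‖ * ‖z‖ * m := by positivity
  have q1 := mul_le_mul_of_nonneg_right hm p1
  have q2 := mul_le_mul_of_nonneg_right hm p2
  have q3 := mul_le_mul_of_nonneg_right hmω (by positivity : 0 ≤ ‖Y‖ * ‖z‖)
  have p3 : 0 ≤ ‖Y‖ * ‖z‖ := by positivity
  linarith

theorem Neck.flux_le (h : Neck m a b K ε c s ν p r N yt yh γ E1 E2) {ω t : ℝ} {w : ℝ → ℝ}
    (hwc : Continuous w) (ht : t ∈ Icc a b) (hω : 0 ≤ ω) (hmω : m * ω ≤ 1)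
    {y z : EuclideanSpace ℝ (Fin n)}
    (hy : ‖y‖ ≤ 11 / 10)
    (hb : ∀ θ ∈ Icc (0 : ℝ) (2 * π), ‖c θ • p t θ + s θ • r t θ‖ ≤ 22 / 10 ∧
      |⟪c θ • p t θ + s θ • r t θ, y⟫_ℝ - w θ| ≤ 8 * ω ∧
      |⟪c θ • p t θ + s θ • r t θ, z⟫_ℝ| ≤ 2 * ω * ‖z‖ ∧ ‖γ t θ‖ ≤ ω)
    (hz : ‖z‖ ^ 2 = ∫ θ in (0 : ℝ)..(2 * π), w θ * ⟪pt N t θ + (2 * m) • N t θ, z⟫_ℝ) :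
    ‖z‖ ^ 2 ≤ ∫ θ in (0 : ℝ)..(2 * π), fluxDens m ω N yt yh t θ := by
  have i1 := h.P_smooth
  have i2 := h.R_smooth
  have i3 := h.N_smooth
  have i4 := h.yt_smooth
  have i5 := h.yh_smooth
  have i6 := h.γ_smooth
  have i7 := h.c_smooth.continuous
  have i8 := h.s_smooth.continuous
  have hm := h.one_le
  have hpi : (0 : ℝ) ≤ 2 * π := by positivity
  have ii : ∀ {g : ℝ → ℝ}, Continuous g → IntervalIntegrable g volume 0 (2 * π) :=
    fun hg => hg.intervalIntegrable _ _
  have F := h.flux t ht y z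
  set g : ℝ → ℝ := fun θ => 14 * m * ω * ‖pt N t θ‖ + 25 * m ^ 2 * ω * ‖N t θ‖ + 8 * ‖yt t θ‖
    with hg
  have h1 : ‖z‖ ^ 2 ≤ (∫ θ in (0 : ℝ)..(2 * π), g θ) * ‖z‖ := by
    rw [← intervalIntegral.integral_mul_const]
    rw [← intervalIntegral.integral_const_mul, ← intervalIntegral.integral_add
      (ii (by fun_prop)) (ii (by fun_prop))] at F
    have mono : ∀ A B : ℝ → ℝ, Continuous A → Continuous B →
        (∀ θ ∈ Icc (0 : ℝ) (2 * π),
          w θ * ⟪pt N t θ + (2 * m) • N t θ, z⟫_ℝ - A θ + B θ ≤ g θ * ‖z‖) →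
        (∫ θ in (0 : ℝ)..(2 * π), A θ = ∫ θ in (0 : ℝ)..(2 * π), B θ) →
        ‖z‖ ^ 2 ≤ ∫ θ in (0 : ℝ)..(2 * π), g θ * ‖z‖ := fun A B hA hB hle hAB => by
      have := intervalIntegral.integral_mono_on hpi (ii (by fun_prop)) (ii (by fun_prop)) hle
      rw [intervalIntegral.integral_add (ii (by fun_prop)) (ii hB),
        intervalIntegral.integral_sub (ii (by fun_prop)) (ii hA), hAB, ← hz] at this
      linarith
    refine mono _ _ (by fun_prop) (by fun_prop) (fun θ hθ => ?_) F
    obtain ⟨b1, b2, b3, b4⟩ := hb θ hθ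
    exact flux_pointwise hm hω hmω hy b1 b2 b3 b4
  have hg0 : 0 ≤ ∫ θ in (0 : ℝ)..(2 * π), g θ :=
    intervalIntegral.integral_nonneg hpi fun θ _ => by
      have : 0 ≤ m := by linarith
      rw [hg]; positivity
  have h2 : ‖z‖ ≤ ∫ θ in (0 : ℝ)..(2 * π), g θ := by
    rcases (norm_nonneg z).eq_or_lt with h0 | h0
    · rwa [← h0]
    · rw [sq] at h1
      exact le_of_mul_le_mul_right h1 h0
  have h3 : ‖z‖ ^ 2 ≤ (∫ θ in (0 : ℝ)..(2 * π), g θ) ^ 2 := by gcongr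
  have hm4 : 1 ≤ m ^ 2 := by nlinarith
  have h4 := sq_circleInt_le (h := g) (f := fun θ => 3 * (625 * m ^ 4 * ω ^ 2
    * (gradSq N t θ + ‖N t θ‖ ^ 2) + 64 * (‖yt t θ‖ ^ 2 + ‖yh t θ‖ ^ 2)))
    (by rw [hg]; fun_prop) (by unfold gradSq; fun_prop) fun θ _ => by
      rw [hg]
      unfold gradSq
      have e := sq_nonneg (14 * m * ω * ‖pt N t θ‖ - 25 * m ^ 2 * ω * ‖N t θ‖)
      have e' := sq_nonneg (14 * m * ω * ‖pt N t θ‖ - 8 * ‖yt t θ‖)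
      have e'' := sq_nonneg (25 * m ^ 2 * ω * ‖N t θ‖ - 8 * ‖yt t θ‖)
      have e3 : 196 * m ^ 2 * (ω ^ 2 * ‖pt N t θ‖ ^ 2) ≤ 625 * m ^ 4 * (ω ^ 2 * ‖pt N t θ‖ ^ 2) := by
        gcongr ?_ * _
        nlinarith
      have e4 : 0 ≤ m ^ 4 * ω ^ 2 * ‖pth N t θ‖ ^ 2 := by positivity
      have e5 := sq_nonneg ‖yh t θ‖
      linarith
  refine h3.trans (h4.trans ?_)
  rw [← intervalIntegral.integral_const_mul]
  refine intervalIntegral.integral_mono_on hpi (ii (by unfold gradSq; fun_prop))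
    (ii (by unfold fluxDens gradSq; fun_prop)) fun θ _ => ?_
  unfold fluxDens
  have hp2 := Real.pi_lt_d2
  have e1 : 0 ≤ m ^ 4 * ω ^ 2 * (gradSq N t θ + ‖N t θ‖ ^ 2) := by
    have := gradSq_nonneg (N := N) t θ
    positivity
  have e2 : 0 ≤ ‖yt t θ‖ ^ 2 + ‖yh t θ‖ ^ 2 := by positivity
  have f1 := mul_le_mul_of_nonneg_right hp2.le e1
  have f2 := mul_le_mul_of_nonneg_right hp2.le e2
  linarith

end NeckFlux

section NeckProjection

variable {n : ℕ} {m a b K ε : ℝ} {c s : ℝ → ℝ} {ν : ℝ → ℝ → ℝ}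
  {p r N yt yh γ E1 E2 : ℝ → ℝ → EuclideanSpace ℝ (Fin n)}

theorem LinSys.map {E : ℝ → ℝ → ℝ} (h : LinSys m a b c s E p r N yt yh)
    (Q : EuclideanSpace ℝ (Fin n) →L[ℝ] EuclideanSpace ℝ (Fin n)) {a' b' : ℝ} (ha : a ≤ a')
    (hb : b' ≤ b) :
    LinSys m a' b' c s E (fun t θ => Q (p t θ)) (fun t θ => Q (r t θ)) (fun t θ => Q (N t θ))
      (fun t θ => Q (yt t θ)) (fun t θ => Q (yh t θ)) := by
  have i1 := h.P_smooth
  have i2 := h.R_smooth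
  have i3 := h.N_smooth
  have i4 := h.yt_smooth
  have i5 := h.yh_smooth
  have hsm : ∀ {x : ℝ → ℝ → EuclideanSpace ℝ (Fin n)}, Sm x → Sm (fun t θ => Q (x t θ)) :=
    fun hx => Q.contDiff.comp hx
  have hper : ∀ {x : ℝ → ℝ → EuclideanSpace ℝ (Fin n)}, Per x → Per (fun t θ => Q (x t θ)) :=
    fun hx t θ => congrArg Q (hx t θ)
  have e1 : ∀ {x : ℝ → ℝ → EuclideanSpace ℝ (Fin n)}, Sm x →
      pt (fun t θ => Q (x t θ)) = fun t θ => Q (pt x t θ) :=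
    fun hx => funext fun t => funext fun θ => pt_clm t θ Q hx
  have e2 : ∀ {x : ℝ → ℝ → EuclideanSpace ℝ (Fin n)}, Sm x →
      pth (fun t θ => Q (x t θ)) = fun t θ => Q (pth x t θ) :=
    fun hx => funext fun t => funext fun θ => pth_clm t θ Q hx
  refine ⟨h.one_le, h.c_smooth, h.s_smooth, h.c_deriv, h.s_deriv, h.sq_add_sq, h.c_per, h.s_per,
    h.E_smooth, hsm i1, hsm i2, hsm i3, hsm i4, hsm i5, h.E_per, hper h.P_per, hper h.R_per,
    hper h.N_per, hper h.yt_per, hper h.yh_per, fun t θ => ?_, fun t θ => ?_, fun t ht θ => ?_⟩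
  · rw [e1 i1, e2 i2, ← map_sub, h.first, map_smul]
  · rw [e2 i1, e1 i2, ← map_add, h.second, map_smul]
  · have := congrArg Q (h.willmore t ⟨ha.trans ht.1, ht.2.trans hb⟩ θ)
    rw [e1 i3, e2 i3, e1 i4, e2 i5, e1 (contDiff_pt i3), e2 (contDiff_pth i3)]
    simpa only [map_add, map_smul] using this

/-- The flux of a neck in normal directions is small. -/
theorem Neck.projected_flux (h : Neck m a b K ε c s ν p r N yt yh γ E1 E2) {ω t : ℝ} {w : ℝ → ℝ}
    (hwc : Continuous w) (ht : t ∈ Icc a b) (hω : 0 ≤ ω) (hmω : m * ω ≤ 1)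
    {Q : EuclideanSpace ℝ (Fin n) →L[ℝ] EuclideanSpace ℝ (Fin n)}
    {p₀ r₀ y : EuclideanSpace ℝ (Fin n)}
    (hQ : ∀ x, ⟪Q x, p₀⟫_ℝ = 0 ∧ ⟪Q x, r₀⟫_ℝ = 0)
    (hQ' : ∀ x, ∃ α β : ℝ, x = Q x + (α • p₀ + β • r₀))
    (hy : ‖y‖ ≤ 11 / 10)
    (hb : ∀ θ ∈ Icc (0 : ℝ) (2 * π), ‖c θ • p t θ + s θ • r t θ‖ ≤ 22 / 10 ∧
      |⟪c θ • p t θ + s θ • r t θ, y⟫_ℝ - w θ| ≤ 8 * ω ∧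
      (∀ z, ⟪z, p₀⟫_ℝ = 0 → ⟪z, r₀⟫_ℝ = 0 →
        |⟪c θ • p t θ + s θ • r t θ, z⟫_ℝ| ≤ 2 * ω * ‖z‖) ∧ ‖γ t θ‖ ≤ ω) :
    ‖∫ θ in (0 : ℝ)..(2 * π), w θ • (pt (fun t θ => Q (N t θ)) t θ + (2 * m) • Q (N t θ))‖ ^ 2
      ≤ ∫ θ in (0 : ℝ)..(2 * π), fluxDens m ω N yt yh t θ := by
  have i3 := h.N_smooth
  have hX : Continuous fun θ => w θ • (pt N t θ + (2 * m) • N t θ) := by fun_prop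
  have e : ∫ θ in (0 : ℝ)..(2 * π), w θ • (pt (fun t θ => Q (N t θ)) t θ + (2 * m) • Q (N t θ))
      = Q (∫ θ in (0 : ℝ)..(2 * π), w θ • (pt N t θ + (2 * m) • N t θ)) := by
    rw [← Q.intervalIntegral_comp_comm (hX.intervalIntegrable _ _)]
    refine intervalIntegral.integral_congr fun θ _ => ?_
    simp only [pt_clm t θ Q i3, map_smul, map_add]
  rw [e]
  obtain ⟨X, hXe⟩ : ∃ X, X = ∫ θ in (0 : ℝ)..(2 * π), w θ • (pt N t θ + (2 * m) • N t θ) :=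
    ⟨_, rfl⟩
  rw [← hXe]
  obtain ⟨z1, z2⟩ := hQ X
  refine h.flux_le hwc ht hω hmω hy (fun θ hθ => ?_) ?_
  · obtain ⟨b1, b2, b3, b4⟩ := hb θ hθ
    exact ⟨b1, b2, b3 _ z1 z2, b4⟩
  · obtain ⟨α, β, hx⟩ := hQ' X
    obtain ⟨Z, hZ⟩ : ∃ Z, Z = Q X := ⟨_, rfl⟩
    rw [← hZ] at z1 z2 hx ⊢
    have e1 : ⟪X, Z⟫_ℝ = ‖Z‖ ^ 2 := by
      have e2 : ⟪X, Z⟫_ℝ = ⟪Z + (α • p₀ + β • r₀), Z⟫_ℝ := by rw [← hx]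
      rw [e2, inner_add_left, inner_add_left, real_inner_smul_left, real_inner_smul_left,
        real_inner_comm Z p₀, real_inner_comm Z r₀, z1, z2, real_inner_self_eq_norm_sq]
      ring
    have e3 := (innerSL ℝ Z).intervalIntegral_comp_comm (hX.intervalIntegrable (μ := volume) 0 (2 * π))
    rw [← hXe] at e3
    rw [← e1, real_inner_comm]
    refine e3.symm.trans (intervalIntegral.integral_congr fun θ _ => ?_)
    simp only [innerSL_apply_apply, inner_smul_right]
    rw [real_inner_comm]

/-- Projection to the normal space of the mean tangent plane of a neck. -/
theorem Neck.exists_projection (h : Neck m a b K ε c s ν p r N yt yh γ E1 E2)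
    {a' b' A κ ω tc : ℝ} (ha : a ≤ a') (hb : b' ≤ b) (htc : tc ∈ Icc a' b') (hκ : 0 ≤ κ)
    (hA : ∀ t ∈ Icc a' b', ∫ θ in (0 : ℝ)..(2 * π), tripleSq E1 E2 N t θ ≤ A)
    (hAκ : 26 * A + 640 * ε ^ 2 ≤ κ ^ 2) (hω : (4 + (b' - a')) * κ ≤ ω)
    (hω1 : ω ≤ 1 / 100) (hmω : m * ω ≤ 1) (hεω : ε ≤ ω) :
    ∃ Q : EuclideanSpace ℝ (Fin n) →L[ℝ] EuclideanSpace ℝ (Fin n), (∀ x, ‖Q x‖ ≤ ‖x‖) ∧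
      smean (fun t θ => Q (p t θ)) tc = 0 ∧ smean (fun t θ => Q (r t θ)) tc = 0 ∧
      (∀ t ∈ Icc a' b', ∀ θ ∈ Icc (0 : ℝ) (2 * π), tripleSq E1 E2 N t θ
        ≤ 2 * tripleSq (fun t θ => Q (E1 t θ)) (fun t θ => Q (E2 t θ)) (fun t θ => Q (N t θ)) t θ) ∧
      (∀ t ∈ Icc a' b', ‖∫ θ in (0 : ℝ)..(2 * π),
          c θ • (pt (fun t θ => Q (N t θ)) t θ + (2 * m) • Q (N t θ))‖ ^ 2
        ≤ ∫ θ in (0 : ℝ)..(2 * π), fluxDens m ω N yt yh t θ) ∧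
      (∀ t ∈ Icc a' b', ‖∫ θ in (0 : ℝ)..(2 * π),
          s θ • (pt (fun t θ => Q (N t θ)) t θ + (2 * m) • Q (N t θ))‖ ^ 2
        ≤ ∫ θ in (0 : ℝ)..(2 * π), fluxDens m ω N yt yh t θ) := by
  have i1 := h.P_smooth
  have i2 := h.R_smooth
  have hI : ∀ t ∈ Icc a' b', t ∈ Icc a b := fun t ht => ⟨ha.trans ht.1, ht.2.trans hb⟩
  have osc := fun t (ht : t ∈ Icc a' b') θ (hθ : θ ∈ Icc (0 : ℝ) (2 * π)) =>
    h.oscillation ha hb htc hκ hA hAκ hω ht hθ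
  have hω0 : 0 ≤ ω := (norm_nonneg _).trans (osc tc htc 0 ⟨le_rfl, by positivity⟩).1
  obtain ⟨Q, Qp, Qr, Qo, Qn, Qd⟩ := exists_normal_projection (smean p tc) (smean r tc)
  have hmean : ∀ {x : ℝ → ℝ → EuclideanSpace ℝ (Fin n)}, Sm x → Q (smean x tc) = 0 →
      smean (fun t θ => Q (x t θ)) tc = 0 := fun {x} hx h0 => by
    have hxt : Continuous (x tc) :=
      hx.continuous.comp (by fun_prop : Continuous fun θ : ℝ => (tc, θ))
    rw [smean, Q.intervalIntegral_comp_comm (hxt.intervalIntegrable _ _), ← map_smul]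
    exact h0
  have hε := h.ε_le
  refine ⟨Q, Qn, hmean i1 Qp, hmean i2 Qr, fun t ht θ hθ => ?_, fun t ht => ?_, fun t ht => ?_⟩
  · obtain ⟨o1, o2, -⟩ := osc t ht θ hθ
    have e := (h.exp_le (hI t ht) θ).2.1
    have key : ∀ {x : EuclideanSpace ℝ (Fin n)}, ⟪p t θ, x⟫_ℝ = 0 ∧ ⟪r t θ, x⟫_ℝ = 0 →
        ‖x‖ ^ 2 ≤ 2 * ‖Q x‖ ^ 2 := fun {x} hx => by
      obtain ⟨α, β, hd⟩ := Qd x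
      exact norm_sq_le_two_projection hω1 (by rwa [h.norm_p t (hI t ht)])
        (by rwa [h.norm_r t (hI t ht)]) (h.inner_p_r t (hI t ht) θ) o1 o2 hx.1 hx.2 (Qo x).1 (Qo x).2 hd
    have k1 := key (h.inner_E1 t (hI t ht) θ)
    have k2 := key (h.inner_E2 t (hI t ht) θ)
    have k3 := key (h.inner_N t (hI t ht) θ)
    unfold tripleSq
    linarith
  · have fp := fun θ (hθ : θ ∈ Icc (0 : ℝ) (2 * π)) =>
      frame_pairing hω1 hε (h.norm_p t (hI t ht) θ) (h.norm_r t (hI t ht) θ)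
        (h.exp_le (hI t ht) θ).2.2 (h.inner_p_r t (hI t ht) θ) (osc t ht θ hθ).1 (osc t ht θ hθ).2.1
        (h.abs_c_le θ).1 (h.abs_c_le θ).2
    refine h.projected_flux h.c_smooth.continuous (hI t ht) hω0 hmω Qo Qd
      (fp 0 ⟨le_rfl, by positivity⟩).1 fun θ hθ => ?_
    obtain ⟨-, f2, f3, f4⟩ := fp θ hθ
    exact ⟨f3, f2.trans (by linarith), f4, (osc t ht θ hθ).2.2⟩
  · have fp := fun θ (hθ : θ ∈ Icc (0 : ℝ) (2 * π)) =>
      frame_pairing hω1 hε (h.norm_r t (hI t ht) θ) (h.norm_p t (hI t ht) θ)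
        (h.exp_le (hI t ht) θ).2.2 (by rw [real_inner_comm]; exact h.inner_p_r t (hI t ht) θ)
        (osc t ht θ hθ).2.1 (osc t ht θ hθ).1 (h.abs_c_le θ).2 (h.abs_c_le θ).1
    refine h.projected_flux h.s_smooth.continuous (hI t ht) hω0 hmω Qo Qd
      (fp 0 ⟨le_rfl, by positivity⟩).1 fun θ hθ => ?_
    obtain ⟨-, f2, f3, f4⟩ := fp θ hθ
    rw [add_comm (c θ • p t θ)]
    exact ⟨f3, f2.trans (by linarith), fun z z1 z2 => f4 z z2 z1, (osc t ht θ hθ).2.2⟩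

/-- Poincaré estimate for the projected frame. -/
theorem Neck.projected_energy (h : Neck m a b K ε c s ν p r N yt yh γ E1 E2)
    (Q : EuclideanSpace ℝ (Fin n) →L[ℝ] EuclideanSpace ℝ (Fin n)) (hQ : ∀ x, ‖Q x‖ ≤ ‖x‖)
    {a' b' tc : ℝ} (ha : a ≤ a') (hb : b' ≤ b) (htc : tc ∈ Icc a' b')
    (hp : smean (fun t θ => Q (p t θ)) tc = 0) (hr : smean (fun t θ => Q (r t θ)) tc = 0)
    (hε : 64 * (1 + (b' - a') ^ 2) * ε ^ 2 ≤ 1) :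
    cylInt (fun t θ => ‖Q (p t θ)‖ ^ 2 + ‖Q (r t θ)‖ ^ 2) a' b'
        ≤ 64 * (1 + (b' - a') ^ 2) * cylInt (tripleSq E1 E2 N) a' b' ∧
      cylInt (fun t θ => ‖pth (fun t θ => Q (p t θ)) t θ‖ ^ 2
          + ‖pth (fun t θ => Q (r t θ)) t θ‖ ^ 2) a' b'
        ≤ 32 * cylInt (tripleSq E1 E2 N) a' b' := by
  have i1 := h.P_smooth
  have i2 := h.R_smooth
  have j1 := h.E1_smooth
  have j2 := h.E2_smooth
  have j3 := h.N_smooth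
  have L := h.toLinSys.map Q ha hb
  have k1 := L.P_smooth
  have k2 := L.R_smooth
  have P1 := poincare L.P_smooth L.P_per htc hp
  have P2 := poincare L.R_smooth L.R_per htc hr
  set D1 := cylInt (fun t θ => ‖pt (fun t θ => Q (p t θ)) t θ‖ ^ 2) a' b' with hD1
  set D2 := cylInt (fun t θ => ‖pth (fun t θ => Q (p t θ)) t θ‖ ^ 2) a' b' with hD2
  set D3 := cylInt (fun t θ => ‖pt (fun t θ => Q (r t θ)) t θ‖ ^ 2) a' b' with hD3
  set D4 := cylInt (fun t θ => ‖pth (fun t θ => Q (r t θ)) t θ‖ ^ 2) a' b' with hD4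
  set Z1 := cylInt (fun t θ => ‖Q (p t θ)‖ ^ 2) a' b' with hZ1
  set Z2 := cylInt (fun t θ => ‖Q (r t θ)‖ ^ 2) a' b' with hZ2
  set 𝓔 := cylInt (tripleSq E1 E2 N) a' b' with h𝓔
  have eZ : cylInt (fun t θ => ‖Q (p t θ)‖ ^ 2 + ‖Q (r t θ)‖ ^ 2) a' b' = Z1 + Z2 :=
    cylInt_add (by fun_prop) (by fun_prop)
  have eD : cylInt (fun t θ => ‖pth (fun t θ => Q (p t θ)) t θ‖ ^ 2
      + ‖pth (fun t θ => Q (r t θ)) t θ‖ ^ 2) a' b' = D2 + D4 :=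
    cylInt_add (by fun_prop) (by fun_prop)
  have n1 : 0 ≤ D1 := cylInt_nonneg fun _ _ _ _ => by positivity
  have n3 : 0 ≤ D3 := cylInt_nonneg fun _ _ _ _ => by positivity
  have n2 : 0 ≤ D2 := cylInt_nonneg fun _ _ _ _ => by positivity
  have n4 : 0 ≤ D4 := cylInt_nonneg fun _ _ _ _ => by positivity
  have G : D1 + D2 + (D3 + D4) ≤ 16 * 𝓔 + 16 * ε ^ 2 * (Z1 + Z2) := by
    rw [hD1, hD2, hD3, hD4, ← eZ, h𝓔, ← cylInt_const_mul, ← cylInt_const_mul,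
      ← cylInt_add (by fun_prop) (by fun_prop), ← cylInt_add (by fun_prop) (by fun_prop),
      ← cylInt_add (by fun_prop) (by fun_prop), ← cylInt_add (by fun_prop) (by fun_prop)]
    refine cylInt_mono (by fun_prop) (by fun_prop) fun t ht θ _ => ?_
    rw [pt_clm t θ Q i1, pth_clm t θ Q i1, pt_clm t θ Q i2, pth_clm t θ Q i2]
    obtain ⟨d1, d2, d3, d4⟩ := h.derivatives_le Q hQ ⟨ha.trans ht.1, ht.2.trans hb⟩ θ
    linarith
  rw [eZ, eD]
  set T2 := (b' - a') ^ 2 with hT2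
  have hT0 : 0 ≤ T2 := sq_nonneg _
  have S : Z1 + Z2 ≤ 2 * (1 + T2) * (D1 + D2 + (D3 + D4)) := by
    have := mul_nonneg hT0 n2
    have := mul_nonneg hT0 n4
    linarith
  have S2 : 16 * ε ^ 2 * (Z1 + Z2) ≤ (D1 + D2 + (D3 + D4)) / 2 := by
    calc 16 * ε ^ 2 * (Z1 + Z2) ≤ 16 * ε ^ 2 * (2 * (1 + T2) * (D1 + D2 + (D3 + D4))) := by gcongr
      _ = (64 * (1 + T2) * ε ^ 2) * ((D1 + D2 + (D3 + D4)) / 2) := by ring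
      _ ≤ 1 * ((D1 + D2 + (D3 + D4)) / 2) := by gcongr
      _ = _ := one_mul _
  refine ⟨?_, by linarith⟩
  calc Z1 + Z2 ≤ 2 * (1 + T2) * (D1 + D2 + (D3 + D4)) := S
    _ ≤ 2 * (1 + T2) * (32 * 𝓔) := by gcongr; linarith
    _ = _ := by ring

end NeckProjection

section Cutoff

theorem exp_neg_abs_le_inv_cosh (x : ℝ) : exp (-|x|) ≤ (cosh x)⁻¹ := by
  rw [exp_neg]
  refine inv_anti₀ (cosh_pos x) ?_
  rw [← cosh_abs, cosh_eq]
  linarith [exp_le_exp.2 (neg_le_self (abs_nonneg x)), exp_pos (-|x|)]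

theorem inv_cosh_le (x : ℝ) : (cosh x)⁻¹ ≤ 2 * exp (-x) := by
  rw [inv_le_iff_one_le_mul₀ (cosh_pos x), cosh_eq]
  have : exp (-x) * exp x = 1 := by rw [← exp_add]; simp
  nlinarith [mul_pos (exp_pos (-x)) (exp_pos (-x))]

theorem hasDerivAt_inv_cosh (σ t₀ φ t : ℝ) :
    HasDerivAt (fun t => (cosh (σ * (t - t₀)))⁻¹ - φ)
      (-(sinh (σ * (t - t₀)) * σ) / cosh (σ * (t - t₀)) ^ 2) t := by
  have h1 : HasDerivAt (fun t => σ * (t - t₀)) σ t := by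
    simpa using ((hasDerivAt_id t).sub_const t₀).const_mul σ
  exact ((h1.cosh).inv (cosh_pos _).ne').sub_const φ

/-- Exponentially decaying cutoff functions. -/
theorem exists_cutoff {σ σ' : ℝ} (hσ : 1 / 2 ≤ σ) (hσ' : σ < σ') :
    ∃ Kc : ℝ, 0 ≤ Kc ∧ ∀ ℓ : ℝ, 5 ≤ ℓ → ∀ t₀ : ℝ, ∃ ζ : ℝ → ℝ, ContDiff ℝ (⊤ : ℕ∞) ζ ∧
      ζ (t₀ - (3 * ℓ / 2 - 1)) = 0 ∧ ζ (t₀ + (3 * ℓ / 2 - 1)) = 0 ∧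
      (∀ t ∈ Icc (t₀ - (3 * ℓ / 2 - 1)) (t₀ + (3 * ℓ / 2 - 1)), ζ t ^ 2 ≤ 1) ∧
      (∀ t, deriv ζ t ^ 2 ≤ σ' ^ 2 * ζ t ^ 2 + Kc * exp (-(3 * σ * ℓ))) ∧
      ∀ t ∈ Icc (t₀ - ℓ / 2) (t₀ + ℓ / 2), exp (-(σ * ℓ)) / 4 ≤ ζ t ^ 2 := by
  have hd : 0 < σ' ^ 2 - σ ^ 2 := by nlinarith
  obtain ⟨k, hk⟩ : ∃ k, k = σ ^ 2 + σ ^ 4 / (σ' ^ 2 - σ ^ 2) := ⟨_, rfl⟩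
  have hk0 : 0 ≤ k := by rw [hk]; positivity
  have young : ∀ x y : ℝ, σ ^ 2 * (x + y) ^ 2 ≤ σ' ^ 2 * x ^ 2 + k * y ^ 2 := fun x y => by
    have e : σ' ^ 2 * x ^ 2 + k * y ^ 2 - σ ^ 2 * (x + y) ^ 2
        = ((σ' ^ 2 - σ ^ 2) * x - σ ^ 2 * y) ^ 2 / (σ' ^ 2 - σ ^ 2) := by
      rw [hk]; field_simp; ring
    have : 0 ≤ ((σ' ^ 2 - σ ^ 2) * x - σ ^ 2 * y) ^ 2 / (σ' ^ 2 - σ ^ 2) := by positivity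
    linarith
  refine ⟨k * (4 * exp (2 * σ)), by positivity, fun ℓ hℓ t₀ => ?_⟩
  obtain ⟨φ, hφ⟩ : ∃ φ, φ = (cosh (σ * (3 * ℓ / 2 - 1)))⁻¹ := ⟨_, rfl⟩
  have hφ0 : 0 < φ := by rw [hφ]; exact inv_pos.2 (cosh_pos _)
  have hφ1 : φ ≤ 2 * exp (-(σ * (3 * ℓ / 2 - 1))) := hφ ▸ inv_cosh_le _
  have hder := fun t => (hasDerivAt_inv_cosh σ t₀ φ t).deriv
  refine ⟨fun t => (cosh (σ * (t - t₀)))⁻¹ - φ, ?_, ?_, ?_, fun t ht => ?_, fun t => ?_,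
    fun t ht => ?_⟩
  · refine (ContDiff.inv ?_ fun t => (cosh_pos _).ne').sub contDiff_const
    exact contDiff_cosh.comp (by fun_prop)
  · simp only [hφ]
    rw [← cosh_neg, sub_eq_zero]
    congr 2
    ring
  · simp only [hφ]
    rw [sub_eq_zero]
    congr 2
    ring
  · have h1 : φ ≤ (cosh (σ * (t - t₀)))⁻¹ := by
      rw [hφ]
      refine inv_anti₀ (cosh_pos _) (cosh_le_cosh.2 ?_)
      rw [abs_mul, abs_mul, abs_of_nonneg (by linarith : 0 ≤ 3 * ℓ / 2 - 1)]
      refine mul_le_mul_of_nonneg_left ?_ (abs_nonneg _)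
      rw [abs_le]; constructor <;> linarith [ht.1, ht.2]
    have h2 : (cosh (σ * (t - t₀)))⁻¹ ≤ 1 := inv_le_one_of_one_le₀ (one_le_cosh _)
    exact pow_le_one₀ (by linarith) (by linarith)
  · rw [hder]
    obtain ⟨C, hC⟩ : ∃ C, C = cosh (σ * (t - t₀)) := ⟨_, rfl⟩
    obtain ⟨S, hS⟩ : ∃ S, S = sinh (σ * (t - t₀)) := ⟨_, rfl⟩
    have hCS : C ^ 2 - S ^ 2 = 1 := by rw [hC, hS]; exact cosh_sq_sub_sinh_sq _
    have hCp : 0 < C := hC ▸ cosh_pos _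
    simp only [← hC, ← hS]
    have h1 : (-(S * σ) / C ^ 2) ^ 2 ≤ σ ^ 2 * (C⁻¹ - φ + φ) ^ 2 := by
      have e : σ ^ 2 * (C⁻¹ - φ + φ) ^ 2 - (-(S * σ) / C ^ 2) ^ 2
          = σ ^ 2 * (C ^ 2 - S ^ 2) / C ^ 4 := by field_simp; ring
      rw [hCS] at e
      have : 0 ≤ σ ^ 2 * 1 / C ^ 4 := by positivity
      linarith
    refine h1.trans ((young _ _).trans ?_)
    have h2 : φ ^ 2 ≤ 4 * exp (2 * σ) * exp (-(3 * σ * ℓ)) := by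
      calc φ ^ 2 ≤ (2 * exp (-(σ * (3 * ℓ / 2 - 1)))) ^ 2 := pow_le_pow_left₀ hφ0.le hφ1 2
        _ = 4 * exp (2 * σ) * exp (-(3 * σ * ℓ)) := by
          rw [mul_pow, ← exp_nat_mul, mul_assoc, ← exp_add]
          congr 1
          · norm_num
          · congr 1; push_cast; ring
    have := mul_le_mul_of_nonneg_left h2 hk0
    linarith
  · have h1 : exp (-(σ * ℓ / 2)) ≤ (cosh (σ * (t - t₀)))⁻¹ := by
      refine le_trans (exp_le_exp.2 (neg_le_neg ?_)) (exp_neg_abs_le_inv_cosh _)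
      rw [abs_mul, abs_of_nonneg (by linarith : 0 ≤ σ), mul_div_assoc]
      refine mul_le_mul_of_nonneg_left ?_ (by linarith)
      rw [abs_le]; constructor <;> linarith [ht.1, ht.2]
    have h2 : 4 ≤ exp (σ * (ℓ - 1)) := by
      have : (2 : ℝ) ≤ σ * (ℓ - 1) := by nlinarith
      have h3 := exp_le_exp.2 this
      have h4 : exp 2 = exp 1 * exp 1 := by rw [← exp_add]; norm_num
      nlinarith [exp_one_gt_d9]
    have h3 : φ ≤ exp (-(σ * ℓ / 2)) / 2 := by
      have e : exp (-(σ * ℓ / 2)) = exp (-(σ * (3 * ℓ / 2 - 1))) * exp (σ * (ℓ - 1)) := by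
        rw [← exp_add]; congr 1; ring
      rw [e]
      nlinarith [exp_pos (-(σ * (3 * ℓ / 2 - 1)))]
    have e : exp (-(σ * ℓ)) / 4 = (exp (-(σ * ℓ / 2)) / 2) ^ 2 := by
      rw [div_pow, ← exp_nat_mul]; norm_num; ring
    rw [e]
    exact pow_le_pow_left₀ (by positivity) (by linarith) 2

end Cutoff

section Window

variable {n : ℕ} {m a b K ε : ℝ} {c s : ℝ → ℝ} {ν : ℝ → ℝ → ℝ}
  {p r N yt yh γ E1 E2 : ℝ → ℝ → EuclideanSpace ℝ (Fin n)}

theorem continuous_fluxDens {ω : ℝ} (h1 : Sm N) (h2 : Sm yt) (h3 : Sm yh) :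
    Continuous (fun p : ℝ × ℝ => fluxDens m ω N yt yh p.1 p.2) := by
  unfold fluxDens; fun_prop

/-- The energy of a neck is controlled by the projected energy. -/
theorem Neck.tripleSq_le (h : Neck m a b K ε c s ν p r N yt yh γ E1 E2)
    (Q : EuclideanSpace ℝ (Fin n) →L[ℝ] EuclideanSpace ℝ (Fin n)) {t θ : ℝ} (ht : t ∈ Icc a b)
    (hQ : tripleSq E1 E2 N t θ
      ≤ 2 * tripleSq (fun t θ => Q (E1 t θ)) (fun t θ => Q (E2 t θ)) (fun t θ => Q (N t θ)) t θ) :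
    tripleSq E1 E2 N t θ
      ≤ 2 * (‖pt (fun t θ => Q (p t θ)) t θ + pth (fun t θ => Q (r t θ)) t θ‖ ^ 2
          + ‖pt (fun t θ => Q (r t θ)) t θ - pth (fun t θ => Q (p t θ)) t θ‖ ^ 2
          + ‖Q (N t θ)‖ ^ 2) + 16 * ε ^ 2 * (‖Q (p t θ)‖ ^ 2 + ‖Q (r t θ)‖ ^ 2) := by
  have i1 := h.P_smooth
  have i2 := h.R_smooth
  have n1 := h.nu_t_le t ht θ
  have n2 := h.nu_th_le t ht θ
  have s1 : pt ν t θ ^ 2 ≤ ε ^ 2 := by rw [← sq_abs]; exact pow_le_pow_left₀ (abs_nonneg _) n1 2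
  have s2 : pth ν t θ ^ 2 ≤ ε ^ 2 := by rw [← sq_abs]; exact pow_le_pow_left₀ (abs_nonneg _) n2 2
  rw [pt_clm t θ Q i1, pth_clm t θ Q i1, pt_clm t θ Q i2, pth_clm t θ Q i2]
  have key : ∀ (X A B : EuclideanSpace ℝ (Fin n)) (α β : ℝ), α ^ 2 ≤ ε ^ 2 → β ^ 2 ≤ ε ^ 2 →
      ‖(1 / 2 : ℝ) • X - (α • A + β • B)‖ ^ 2
        ≤ ‖X‖ ^ 2 / 2 + 4 * ε ^ 2 * (‖A‖ ^ 2 + ‖B‖ ^ 2) := fun X A B α β hα hβ => by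
    have k1 := norm_sub_sq_le_two ((1 / 2 : ℝ) • X) (α • A + β • B)
    have k2 := norm_add_sq_le_two (α • A) (β • B)
    rw [norm_smul_sq_real] at k1 k2
    rw [norm_smul_sq_real] at k2
    have := mul_le_mul_of_nonneg_right hα (sq_nonneg ‖A‖)
    have := mul_le_mul_of_nonneg_right hβ (sq_nonneg ‖B‖)
    linarith
  have q1 : Q (E1 t θ) = (1 / 2 : ℝ) • (Q (pt p t θ) + Q (pth r t θ))
      - (pt ν t θ • Q (p t θ) + pth ν t θ • Q (r t θ)) := by
    rw [h.E1_eq, map_sub, map_sub, map_smul, map_smul, map_smul, map_add]; module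
  have q2 : Q (E2 t θ) = (1 / 2 : ℝ) • (Q (pt r t θ) - Q (pth p t θ))
      - (pt ν t θ • Q (r t θ) + (-pth ν t θ) • Q (p t θ)) := by
    rw [h.E2_eq, map_add, map_sub, map_smul, map_smul, map_smul, map_sub]; module
  have k1 := key (Q (pt p t θ) + Q (pth r t θ)) (Q (p t θ)) (Q (r t θ)) _ _ s1 s2
  have k2 := key (Q (pt r t θ) - Q (pth p t θ)) (Q (r t θ)) (Q (p t θ)) _ (-pth ν t θ) s1
    (by rwa [neg_sq])
  rw [← q1] at k1
  rw [← q2] at k2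
  unfold tripleSq at hQ ⊢
  beta_reduce at hQ
  linarith [sq_nonneg ‖Q (pt p t θ) + Q (pth r t θ)‖, sq_nonneg ‖Q (pt r t θ) - Q (pth p t θ)‖]

theorem weighted_decay_constants {m K T σ β ε ω 𝓔 𝓔' l d S1 qN nN qG G qy y Z : ℝ} (hm : 1 ≤ m)
    (hT : 2 ≤ T) (hσ : σ < 1) (hβ : 0 ≤ β) (h𝓔' : 0 ≤ 𝓔') (hl : l ≤ 2 * d + 16 * ε ^ 2 * Z)
    (hd : d ≤ 7000 / (1 - σ) ^ 4 * (β * (S1 + qN + qG)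
      + ((4 * ε) ^ 2 * qN + qy + (12000 * m ^ 4 * ω ^ 2 * (G + nN) + 1300 * y))))
    (hZ : Z ≤ 64 * (1 + (T - 2) ^ 2) * 𝓔') (h𝓔 : 𝓔' ≤ 𝓔) (hS1 : S1 ≤ 32 * 𝓔') (hnN : nN ≤ 𝓔')
    (hqN : qN ≤ nN) (hqG : qG ≤ G) (hG : G ≤ 900 * m ^ 2 * T ^ 4 * 𝓔) (hqy : qy ≤ y)
    (hy : y ≤ 15000 * K ^ 2 * m ^ 2 * T ^ 4 * 𝓔 ^ 2) :
    l ≤ (14000 / (1 - σ) ^ 4 * (m ^ 6 * T ^ 4) * (933 * β + (16 * ε ^ 2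
          + (2 * 10 ^ 7 * K ^ 2 * 𝓔 + 12 * 10 ^ 6 * ω ^ 2)))
        + 2048 * T ^ 2 * ε ^ 2) * 𝓔 := by
  have h0 : 0 ≤ 𝓔 := h𝓔'.trans h𝓔
  have hT4 : 1 ≤ T ^ 4 := one_le_pow₀ (by linarith)
  have hm2 : 1 ≤ m ^ 2 := one_le_pow₀ hm
  have hm4 : 1 ≤ m ^ 4 := one_le_pow₀ hm
  obtain ⟨w, hw⟩ : ∃ w, w = m ^ 2 * T ^ 4 := ⟨_, rfl⟩
  have hw1 : 1 ≤ w := hw ▸ one_le_mul_of_one_le_of_one_le hm2 hT4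
  obtain ⟨W, hW⟩ : ∃ W, W = m ^ 6 * T ^ 4 := ⟨_, rfl⟩
  have hWw : W = m ^ 4 * w := by rw [hW, hw]; ring
  have hwW : w ≤ W := by rw [hWw]; exact le_mul_of_one_le_left (by linarith) hm4
  have hwE : 𝓔 ≤ w * 𝓔 := le_mul_of_one_le_left h0 hw1
  have hWE : w * 𝓔 ≤ W * 𝓔 := mul_le_mul_of_nonneg_right hwW h0
  have hG' : G ≤ 900 * (w * 𝓔) := hG.trans_eq (by rw [hw]; ring)
  have hy' : y ≤ 15000 * K ^ 2 * (W * 𝓔) * 𝓔 := by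
    refine hy.trans ?_
    have := mul_le_mul_of_nonneg_left hWE (by positivity : 0 ≤ 15000 * K ^ 2 * 𝓔)
    refine le_trans (le_of_eq ?_) (this.trans (le_of_eq ?_))
    · rw [hw]; ring
    · ring
  have b1 : β * (S1 + qN + qG) ≤ β * (933 * (W * 𝓔)) :=
    mul_le_mul_of_nonneg_left (by linarith) hβ
  have b2 : (4 * ε) ^ 2 * qN ≤ (4 * ε) ^ 2 * (W * 𝓔) :=
    mul_le_mul_of_nonneg_left (by linarith) (sq_nonneg _)
  have b3 : 12000 * m ^ 4 * ω ^ 2 * (G + nN) ≤ 12000 * m ^ 4 * ω ^ 2 * (1000 * (w * 𝓔)) :=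
    mul_le_mul_of_nonneg_left (by linarith) (by positivity)
  have b3' : 12000 * m ^ 4 * ω ^ 2 * (1000 * (w * 𝓔)) = 12 * 10 ^ 6 * ω ^ 2 * (W * 𝓔) := by
    rw [hWw]; ring
  have b4 : 0 ≤ K ^ 2 * (W * 𝓔) * 𝓔 := by
    have : 0 ≤ W * 𝓔 := h0.trans (hwE.trans hWE)
    positivity
  have b5 : 16 * ε ^ 2 * Z ≤ 16 * ε ^ 2 * (128 * T ^ 2 * 𝓔) := by
    refine mul_le_mul_of_nonneg_left (hZ.trans ?_) (by positivity)
    refine mul_le_mul ?_ h𝓔 h𝓔' (by positivity)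
    nlinarith
  have b6 : d ≤ 7000 / (1 - σ) ^ 4 * (933 * β * (W * 𝓔) + (16 * ε ^ 2 * (W * 𝓔)
      + (2 * 10 ^ 7 * K ^ 2 * (W * 𝓔) * 𝓔 + 12 * 10 ^ 6 * ω ^ 2 * (W * 𝓔)))) := by
    refine hd.trans (mul_le_mul_of_nonneg_left ?_ ?_)
    · linarith
    · have : 0 < 1 - σ := by linarith
      positivity
  rw [← hW]
  calc l ≤ _ := hl
    _ ≤ 2 * (7000 / (1 - σ) ^ 4 * (933 * β * (W * 𝓔) + (16 * ε ^ 2 * (W * 𝓔)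
      + (2 * 10 ^ 7 * K ^ 2 * (W * 𝓔) * 𝓔 + 12 * 10 ^ 6 * ω ^ 2 * (W * 𝓔)))))
      + 16 * ε ^ 2 * (128 * T ^ 2 * 𝓔) := by linarith
    _ = _ := by ring

/-- Energy of a neck in its middle part, in terms of the parameters of the cutoff. -/
theorem Neck.weighted_decay (h : Neck m a b K ε c s ν p r N yt yh γ E1 E2) {ω κ σ β tc : ℝ}
    {ζ : ℝ → ℝ} (hab : 2 ≤ b - a) (hE : 4000 * K ^ 2 * cylInt (tripleSq E1 E2 N) a b ≤ 1)
    (htc : tc ∈ Icc (a + 1) (b - 1)) (hκ : 0 ≤ κ)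
    (hAκ : 26 * (903 * m ^ 2 * (b - a) ^ 4 * cylInt (tripleSq E1 E2 N) a b) + 640 * ε ^ 2 ≤ κ ^ 2)
    (hω : (4 + (b - a)) * κ ≤ ω) (hω1 : ω ≤ 1 / 100) (hmω : m * ω ≤ 1) (hεω : ε ≤ ω)
    (hε : 128 * (b - a) ^ 2 * ε ^ 2 ≤ 1)
    (hζ : ContDiff ℝ (⊤ : ℕ∞) ζ) (hζa : ζ (a + 1) = 0) (hζb : ζ (b - 1) = 0)
    (hζ1 : ∀ t ∈ Icc (a + 1) (b - 1), ζ t ^ 2 ≤ 1)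
    (hζ' : ∀ t, deriv ζ t ^ 2 ≤ σ ^ 2 * ζ t ^ 2 + β)
    (hs0 : 1 / 2 ≤ σ) (hs1 : σ < 1) (hβ : 0 ≤ β) :
    cylInt (fun t θ => ζ t ^ 2 * tripleSq E1 E2 N t θ) (a + 1) (b - 1)
      ≤ (14000 / (1 - σ) ^ 4 * (m ^ 6 * (b - a) ^ 4) * (933 * β + (16 * ε ^ 2
          + (2 * 10 ^ 7 * K ^ 2 * cylInt (tripleSq E1 E2 N) a b + 12 * 10 ^ 6 * ω ^ 2)))
        + 2048 * (b - a) ^ 2 * ε ^ 2) * cylInt (tripleSq E1 E2 N) a b := by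
  have i1 := h.P_smooth
  have i2 := h.R_smooth
  have i3 := h.N_smooth
  have i4 := h.yt_smooth
  have i5 := h.yh_smooth
  have j1 := h.E1_smooth
  have j2 := h.E2_smooth
  have hζc := hζ.continuous
  have hm := h.one_le
  have hK := h.one_le_K
  have hI : ∀ t ∈ Icc (a + 1) (b - 1), t ∈ Icc a b :=
    fun t ht => ⟨by linarith [ht.1], by linarith [ht.2]⟩
  obtain ⟨g1, g2, g3⟩ := h.regularity hab hE
  obtain ⟨T, hT⟩ : ∃ T, T = b - a := ⟨_, rfl⟩
  have hT2 : 2 ≤ T := hT ▸ hab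
  obtain ⟨Q, Qn, Qp, Qr, QE, Qc, Qs⟩ := h.exists_projection (a' := a + 1) (b' := b - 1)
    (by linarith) (by linarith) htc hκ g3 hAκ
    ((mul_le_mul_of_nonneg_right (by linarith) hκ).trans hω) hω1 hmω hεω
  have hε' : 64 * (1 + (b - 1 - (a + 1)) ^ 2) * ε ^ 2 ≤ 1 := by
    refine le_trans (mul_le_mul_of_nonneg_right ?_ (sq_nonneg ε)) hε
    rw [show b - 1 - (a + 1) = T - 2 by rw [hT]; ring, ← hT]
    nlinarith
  obtain ⟨e1, e2⟩ := h.projected_energy Q Qn (by linarith) (by linarith) htc Qp Qr hε'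
  have L := h.toLinSys.map Q (a' := a + 1) (b' := b - 1) (by linarith) (by linarith)
  have l1 := L.P_smooth
  have l2 := L.R_smooth
  have l3 := L.N_smooth
  have D := L.decay (η := 4 * ε) (by linarith) (fun t ht θ => (h.exp_le (hI t ht) θ).2.2)
    (continuous_fluxDens (m := m) (ω := ω) i3 i4 i5) hζ hζa hζb hζ1 (fun t _ => hζ' t) hs0 hs1 hβ Qc Qs
  have cs : cylInt (tripleSq E1 E2 N) (a + 1) (b - 1) ≤ cylInt (tripleSq E1 E2 N) a b :=
    cylInt_subset (by fun_prop) (by linarith) (by linarith) fun _ _ _ _ => tripleSq_nonneg _ _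
  have cN : cylInt (fun t θ => ‖N t θ‖ ^ 2) (a + 1) (b - 1)
      ≤ cylInt (tripleSq E1 E2 N) (a + 1) (b - 1) :=
    cylInt_mono (by fun_prop) (by fun_prop) fun t _ θ _ => by
      unfold tripleSq
      linarith [sq_nonneg ‖E1 t θ‖, sq_nonneg ‖E2 t θ‖]
  have cQN : cylInt (fun t θ => ‖Q (N t θ)‖ ^ 2) (a + 1) (b - 1)
      ≤ cylInt (fun t θ => ‖N t θ‖ ^ 2) (a + 1) (b - 1) :=
    cylInt_mono (by fun_prop) (by fun_prop) fun t _ θ _ =>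
      pow_le_pow_left₀ (norm_nonneg _) (Qn _) 2
  have cG : cylInt (fun t θ => ‖pth (fun t θ => Q (N t θ)) t θ‖ ^ 2) (a + 1) (b - 1)
      ≤ cylInt (gradSq N) (a + 1) (b - 1) :=
    cylInt_mono (by fun_prop) (by fun_prop) fun t _ θ _ => by
      rw [pth_clm t θ Q i3, gradSq]
      have := pow_le_pow_left₀ (norm_nonneg _) (Qn (pth N t θ)) 2
      linarith [sq_nonneg ‖pt N t θ‖]
  have cy : cylInt (fun t θ => ‖Q (yt t θ)‖ ^ 2 + ‖Q (yh t θ)‖ ^ 2) (a + 1) (b - 1)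
      ≤ cylInt (fun t θ => ‖yt t θ‖ ^ 2 + ‖yh t θ‖ ^ 2) (a + 1) (b - 1) :=
    cylInt_mono (by fun_prop) (by fun_prop) fun t _ θ _ =>
      add_le_add (pow_le_pow_left₀ (norm_nonneg _) (Qn _) 2)
        (pow_le_pow_left₀ (norm_nonneg _) (Qn _) 2)
  have cΦ : cylInt (fluxDens m ω N yt yh) (a + 1) (b - 1)
      = 12000 * m ^ 4 * ω ^ 2 * (cylInt (gradSq N) (a + 1) (b - 1)
          + cylInt (fun t θ => ‖N t θ‖ ^ 2) (a + 1) (b - 1))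
        + 1300 * cylInt (fun t θ => ‖yt t θ‖ ^ 2 + ‖yh t θ‖ ^ 2) (a + 1) (b - 1) := by
    rw [← cylInt_add (by fun_prop) (by fun_prop), ← cylInt_const_mul, ← cylInt_const_mul,
      ← cylInt_add (by fun_prop) (by fun_prop)]
    rfl
  have cS : cylInt (fun t θ => ‖pth (fun t θ => Q (p t θ)) t θ‖ ^ 2
        + ‖pth (fun t θ => Q (r t θ)) t θ‖ ^ 2 + ‖Q (N t θ)‖ ^ 2
        + ‖pth (fun t θ => Q (N t θ)) t θ‖ ^ 2) (a + 1) (b - 1)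
      = cylInt (fun t θ => ‖pth (fun t θ => Q (p t θ)) t θ‖ ^ 2
          + ‖pth (fun t θ => Q (r t θ)) t θ‖ ^ 2) (a + 1) (b - 1)
        + cylInt (fun t θ => ‖Q (N t θ)‖ ^ 2) (a + 1) (b - 1)
        + cylInt (fun t θ => ‖pth (fun t θ => Q (N t θ)) t θ‖ ^ 2) (a + 1) (b - 1) := by
    rw [← cylInt_add (by fun_prop) (by fun_prop), ← cylInt_add (by fun_prop) (by fun_prop)]
  have main : cylInt (fun t θ => ζ t ^ 2 * tripleSq E1 E2 N t θ) (a + 1) (b - 1)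
      ≤ 2 * cylInt (fun t θ => ζ t ^ 2 * (‖pt (fun t θ => Q (p t θ)) t θ
            + pth (fun t θ => Q (r t θ)) t θ‖ ^ 2
          + ‖pt (fun t θ => Q (r t θ)) t θ - pth (fun t θ => Q (p t θ)) t θ‖ ^ 2
          + ‖Q (N t θ)‖ ^ 2)) (a + 1) (b - 1)
        + 16 * ε ^ 2 * cylInt (fun t θ => ‖Q (p t θ)‖ ^ 2 + ‖Q (r t θ)‖ ^ 2) (a + 1) (b - 1) := by
    rw [← cylInt_const_mul, ← cylInt_const_mul, ← cylInt_add (by fun_prop) (by fun_prop)]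
    refine cylInt_mono (by fun_prop) (by fun_prop) fun t ht θ hθ => ?_
    have k := mul_le_mul_of_nonneg_left (h.tripleSq_le Q (hI t ht) (QE t ht θ hθ)) (sq_nonneg (ζ t))
    have k2 := mul_le_mul_of_nonneg_right (hζ1 t ht)
      (by positivity : 0 ≤ 16 * ε ^ 2 * (‖Q (p t θ)‖ ^ 2 + ‖Q (r t θ)‖ ^ 2))
    linarith
  rw [cΦ, cS] at D
  rw [← hT] at g1 g2 ⊢
  rw [show b - 1 - (a + 1) = T - 2 by rw [hT]; ring] at e1
  exact weighted_decay_constants hm hT2 hs1 hβ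
    (cylInt_nonneg fun _ _ _ _ => tripleSq_nonneg _ _) main D e1 cs e2 cN cQN cG g1 cy g2

end Window

section WindowConstants

theorem eventually_mul_le (A : ℝ) {B : ℝ} (hB : 0 < B) :
    ∀ᶠ δ : ℝ in nhdsWithin 0 (Ioi 0), A * δ ≤ B := by
  have h : Tendsto (fun δ : ℝ => A * δ) (nhds 0) (nhds (A * 0)) :=
    (continuous_const.mul continuous_id).tendsto 0
  rw [mul_zero] at h
  exact (h.mono_left nhdsWithin_le_nhds).eventually_le_const hB

theorem exists_pow_mul_exp_le (A : ℝ) {μ : ℝ} (hμ : 0 < μ) :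
    ∃ ℓ₀ : ℝ, 5 ≤ ℓ₀ ∧ ∀ ℓ, ℓ₀ ≤ ℓ → A * ℓ ^ 4 * exp (-(μ * ℓ)) ≤ 1 := by
  have h := (tendsto_rpow_mul_exp_neg_mul_atTop_nhds_zero 4 μ hμ).const_mul A
  rw [mul_zero] at h
  obtain ⟨x, hx⟩ := eventually_atTop.1 (h.eventually_le_const one_pos)
  refine ⟨max x 5, le_max_right _ _, fun ℓ hℓ => ?_⟩
  have := hx ℓ ((le_max_left _ _).trans hℓ)
  rw [show (4 : ℝ) = (4 : ℕ) by norm_num, rpow_natCast] at this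
  rw [mul_assoc, ← neg_mul]
  exact this

theorem window_constants {m K G Kc q σ ℓ₀ ℓ ω ε δ 𝓔 x : ℝ} (hG : 0 ≤ G) (hq2 : q < 2)
    (hσ1 : σ < 1) (hσ0 : 0 < σ) (hℓ₀ : 5 ≤ ℓ₀) (hℓ : ℓ ∈ Icc ℓ₀ (2 * ℓ₀)) (h𝓔 : 0 ≤ 𝓔) (h𝓔δ : 𝓔 ≤ δ)
    (hε0 : 0 ≤ ε) (hεδ : ε ≤ δ) (hδ1 : δ ≤ 1) (hω0 : 0 ≤ ω) (hω1 : ω ≤ 1)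
    (h1 : 4 * (G * m ^ 6 * 81 * 933 * Kc) * 128 * ℓ ^ 4 * exp (-((2 * σ - q) * ℓ)) ≤ 1)
    (h2 : 4 * exp (2 * ℓ₀) * (G * (m ^ 6 * (6 * ℓ₀) ^ 4)) * (12 * 10 ^ 6) * ω
      ≤ exp (-(4 * ℓ₀)) / 256)
    (h3 : (4 * exp (2 * ℓ₀) * (G * (m ^ 6 * (6 * ℓ₀) ^ 4)) * (16 + 2 * 10 ^ 7 * K ^ 2)
      + 4 * exp (2 * ℓ₀) * (2048 * (6 * ℓ₀) ^ 2)) * δ ≤ exp (-(4 * ℓ₀)) / 256)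
    (hx : exp (-(σ * ℓ)) / 4 * x ≤ (G * (m ^ 6 * (3 * ℓ) ^ 4) * (933 * (Kc * exp (-(3 * σ * ℓ)))
      + (16 * ε ^ 2 + (2 * 10 ^ 7 * K ^ 2 * 𝓔 + 12 * 10 ^ 6 * ω ^ 2)))
        + 2048 * (3 * ℓ) ^ 2 * ε ^ 2) * 𝓔) :
    x ≤ exp (-(q * ℓ)) / 64 * 𝓔 := by
  obtain ⟨l1, l2⟩ := hℓ
  have hℓ0 : 0 ≤ ℓ := by linarith
  have hm6 : 0 ≤ m ^ 6 := (by decide : Even 6).pow_nonneg m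
  have hεε : ε ^ 2 ≤ δ := by nlinarith
  have hωω : ω ^ 2 ≤ ω := by nlinarith
  obtain ⟨X, hX⟩ : ∃ X, X = 4 * exp (σ * ℓ) := ⟨_, rfl⟩
  have hX0 : 0 ≤ X := by rw [hX]; positivity
  have hXle : X ≤ 4 * exp (2 * ℓ₀) := by
    rw [hX]
    exact mul_le_mul_of_nonneg_left (exp_le_exp.2 (by nlinarith)) (by norm_num)
  have hq : exp (-(4 * ℓ₀)) ≤ exp (-(q * ℓ)) := exp_le_exp.2 (by nlinarith)
  have e0 : x = X * (exp (-(σ * ℓ)) / 4 * x) := by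
    have : exp (σ * ℓ) * exp (-(σ * ℓ)) = 1 := by rw [← exp_add]; simp
    rw [hX]
    linear_combination (-x) * this
  rw [e0]
  refine (mul_le_mul_of_nonneg_left hx hX0).trans ?_
  rw [← mul_assoc]
  refine mul_le_mul_of_nonneg_right ?_ h𝓔
  have t1 : X * (G * (m ^ 6 * (3 * ℓ) ^ 4) * (933 * (Kc * exp (-(3 * σ * ℓ)))))
      ≤ exp (-(q * ℓ)) / 128 := by
    have e : exp (σ * ℓ) * exp (-(3 * σ * ℓ)) = exp (-((2 * σ - q) * ℓ)) * exp (-(q * ℓ)) := by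
      rw [← exp_add, ← exp_add]; congr 1; ring
    have := mul_le_mul_of_nonneg_right h1 (exp_pos (-(q * ℓ))).le
    have e' : X * (G * (m ^ 6 * (3 * ℓ) ^ 4) * (933 * (Kc * exp (-(3 * σ * ℓ)))))
        = 4 * (G * m ^ 6 * 81 * 933 * Kc) * ℓ ^ 4 * (exp (-((2 * σ - q) * ℓ)) * exp (-(q * ℓ))) := by
      rw [← e, hX]; ring
    rw [e']
    linarith
  have hW : G * (m ^ 6 * (3 * ℓ) ^ 4) ≤ G * (m ^ 6 * (6 * ℓ₀) ^ 4) :=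
    mul_le_mul_of_nonneg_left (mul_le_mul_of_nonneg_left
      (pow_le_pow_left₀ (by linarith) (by linarith) 4) hm6) hG
  have hP : X * (G * (m ^ 6 * (3 * ℓ) ^ 4)) ≤ 4 * exp (2 * ℓ₀) * (G * (m ^ 6 * (6 * ℓ₀) ^ 4)) :=
    mul_le_mul hXle hW (by positivity) (by positivity)
  have hP0 : 0 ≤ X * (G * (m ^ 6 * (3 * ℓ) ^ 4)) := by positivity
  have hD : 16 * ε ^ 2 + 2 * 10 ^ 7 * K ^ 2 * 𝓔 ≤ (16 + 2 * 10 ^ 7 * K ^ 2) * δ := by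
    have := mul_le_mul_of_nonneg_left h𝓔δ (by positivity : 0 ≤ 2 * 10 ^ 7 * K ^ 2)
    linarith
  have hδ0 : 0 ≤ δ := h𝓔.trans h𝓔δ
  have t2 : X * (G * (m ^ 6 * (3 * ℓ) ^ 4)) * (16 * ε ^ 2 + 2 * 10 ^ 7 * K ^ 2 * 𝓔)
      ≤ 4 * exp (2 * ℓ₀) * (G * (m ^ 6 * (6 * ℓ₀) ^ 4)) * ((16 + 2 * 10 ^ 7 * K ^ 2) * δ) :=
    mul_le_mul hP hD (by positivity) (by positivity)
  have t3 : X * (G * (m ^ 6 * (3 * ℓ) ^ 4)) * (12 * 10 ^ 6 * ω ^ 2)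
      ≤ 4 * exp (2 * ℓ₀) * (G * (m ^ 6 * (6 * ℓ₀) ^ 4)) * (12 * 10 ^ 6 * ω) :=
    mul_le_mul hP (by linarith) (by positivity) (by positivity)
  have t4 : X * (2048 * (3 * ℓ) ^ 2 * ε ^ 2)
      ≤ 4 * exp (2 * ℓ₀) * (2048 * (6 * ℓ₀) ^ 2 * δ) := by
    refine mul_le_mul hXle ?_ (by positivity) (by positivity)
    exact mul_le_mul (mul_le_mul_of_nonneg_left (pow_le_pow_left₀ (by linarith) (by linarith) 2)
      (by norm_num)) hεε (sq_nonneg _) (by positivity)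
  linarith

/-- Exponential decay of the energy in the middle part of a neck. -/
theorem exists_window_decay {m K q : ℝ} (hm : 1 ≤ m) (hq0 : 0 < q) (hq2 : q < 2) :
    ∃ ℓ₀ : ℝ, 5 ≤ ℓ₀ ∧ ∃ δ : ℝ, 0 < δ ∧ ∀ ℓ ∈ Icc ℓ₀ (2 * ℓ₀), ∀ {n : ℕ} {a ε : ℝ} {c s : ℝ → ℝ}
      {ν : ℝ → ℝ → ℝ} {p r N yt yh γ E1 E2 : ℝ → ℝ → EuclideanSpace ℝ (Fin n)},
      Neck m a (a + 3 * ℓ) K ε c s ν p r N yt yh γ E1 E2 → ε ≤ δ →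
      cylInt (tripleSq E1 E2 N) a (a + 3 * ℓ) ≤ δ →
      cylInt (tripleSq E1 E2 N) (a + ℓ) (a + 2 * ℓ)
        ≤ exp (-(q * ℓ)) / 64 * cylInt (tripleSq E1 E2 N) a (a + 3 * ℓ) := by
  obtain ⟨σ, hσ⟩ : ∃ σ, σ = (q + 2) / 4 := ⟨_, rfl⟩
  have hσ0 : 1 / 2 ≤ σ := by linarith
  have hσ1 : σ < 1 := by linarith
  obtain ⟨Kc, hKc, cut⟩ := exists_cutoff hσ0 (by linarith : σ < (1 + σ) / 2)
  obtain ⟨G, hG⟩ : ∃ G, G = 14000 / (1 - (1 + σ) / 2) ^ 4 := ⟨_, rfl⟩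
  have hG0 : 0 ≤ G := by
    have : 0 < 1 - (1 + σ) / 2 := by linarith
    rw [hG]; positivity
  obtain ⟨ℓ₀, hℓ₀, hdec⟩ := exists_pow_mul_exp_le (4 * (G * m ^ 6 * 81 * 933 * Kc) * 128)
    (by linarith : 0 < 2 * σ - q)
  have ew : (0 : ℝ) < exp (-(4 * ℓ₀)) / 256 := by positivity
  obtain ⟨ω, ⟨⟨w1, w2⟩, w3⟩, hω0⟩ := (((eventually_mul_le
    (4 * exp (2 * ℓ₀) * (G * (m ^ 6 * (6 * ℓ₀) ^ 4)) * (12 * 10 ^ 6)) ew).and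
    (eventually_mul_le m one_pos)).and
    (eventually_mul_le 1 (by norm_num : (0 : ℝ) < 1 / 100)) |>.and self_mem_nhdsWithin).exists
  have hω0 : 0 < ω := hω0
  obtain ⟨κ, hκ⟩ : ∃ κ, κ = ω / (4 + 6 * ℓ₀) := ⟨_, rfl⟩
  have hκ0 : 0 < κ := by rw [hκ]; positivity
  obtain ⟨δ, ⟨⟨⟨d1, d2⟩, d3⟩, d4, d5⟩, hδ0⟩ := ((((eventually_mul_le
    (26 * (903 * m ^ 2 * (6 * ℓ₀) ^ 4) + 640) (by positivity : 0 < κ ^ 2)).and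
    (eventually_mul_le (128 * (6 * ℓ₀) ^ 2) one_pos)).and
    (eventually_mul_le (4000 * K ^ 2) one_pos)).and
    ((eventually_mul_le 1 hω0).and (eventually_mul_le
      (4 * exp (2 * ℓ₀) * (G * (m ^ 6 * (6 * ℓ₀) ^ 4)) * (16 + 2 * 10 ^ 7 * K ^ 2)
      + 4 * exp (2 * ℓ₀) * (2048 * (6 * ℓ₀) ^ 2)) ew)) |>.and self_mem_nhdsWithin).exists
  have hδ0 : 0 < δ := hδ0
  refine ⟨ℓ₀, hℓ₀, δ, hδ0, fun ℓ hℓ => ?_⟩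
  intro n a ε c s ν p r N yt yh γ E1 E2 h hεδ hEδ
  have j1 := h.E1_smooth
  have j2 := h.E2_smooth
  have j3 := h.N_smooth
  have hℓ5 : 5 ≤ ℓ := hℓ₀.trans hℓ.1
  have hℓ6 : 3 * ℓ ≤ 6 * ℓ₀ := by linarith [hℓ.2]
  have hT : a + 3 * ℓ - a = 3 * ℓ := by ring
  have hε0 : 0 ≤ ε := (abs_nonneg _).trans (h.nu_le a ⟨le_rfl, by linarith⟩ 0)
  have h𝓔0 : 0 ≤ cylInt (tripleSq E1 E2 N) a (a + 3 * ℓ) :=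
    cylInt_nonneg fun _ _ _ _ => tripleSq_nonneg _ _
  have hεε : ε ^ 2 ≤ δ := by nlinarith
  obtain ⟨ζ, z1, z2, z3, z4, z5, z6⟩ := cut ℓ hℓ5 (a + 3 * ℓ / 2)
  rw [show a + 3 * ℓ / 2 - (3 * ℓ / 2 - 1) = a + 1 by ring] at z2 z4
  rw [show a + 3 * ℓ / 2 + (3 * ℓ / 2 - 1) = a + 3 * ℓ - 1 by ring] at z3 z4
  rw [show a + 3 * ℓ / 2 - ℓ / 2 = a + ℓ by ring, show a + 3 * ℓ / 2 + ℓ / 2 = a + 2 * ℓ by ring]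
    at z6
  have D := h.weighted_decay (ω := ω) (κ := κ) (σ := (1 + σ) / 2) (tc := a + 3 * ℓ / 2)
    (β := Kc * exp (-(3 * σ * ℓ))) (by linarith)
    ((mul_le_mul_of_nonneg_left hEδ (by positivity)).trans d3)
    ⟨by linarith, by linarith⟩ hκ0.le
    (by
      rw [hT]
      refine le_trans ?_ d1
      have : 903 * m ^ 2 * (3 * ℓ) ^ 4 * cylInt (tripleSq E1 E2 N) a (a + 3 * ℓ)
          ≤ 903 * m ^ 2 * (6 * ℓ₀) ^ 4 * δ := by gcongr
      linarith)
    (by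
      rw [hT, hκ, ← mul_div_assoc, div_le_iff₀ (by positivity), mul_comm ω]
      exact mul_le_mul_of_nonneg_right (by linarith) hω0.le)
    (by linarith) w2 (by linarith)
    (by
      rw [hT]
      refine le_trans ?_ d2
      gcongr)
    z1 z2 z3 z4 z5 (by linarith) (by linarith) (by positivity)
  rw [hT, ← hG] at D
  refine window_constants hG0 hq2 hσ1 (by linarith) hℓ₀ hℓ h𝓔0 hEδ hε0 hεδ (by linarith) hω0.le
    (by linarith) (hdec ℓ hℓ.1) w1 d5 (le_trans ?_ D)
  rw [← cylInt_const_mul]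
  have z1c := z1.continuous
  refine le_trans (cylInt_mono (G := fun t θ => ζ t ^ 2 * tripleSq E1 E2 N t θ) (by fun_prop)
    (by fun_prop) fun t ht θ _ => mul_le_mul_of_nonneg_right (z6 t ht) (tripleSq_nonneg _ _)) ?_
  exact cylInt_subset (by fun_prop) (by linarith) (by linarith) fun t _ θ _ =>
    mul_nonneg (sq_nonneg _) (tripleSq_nonneg _ _)

end WindowConstants

section ConformalGeometry

variable {n : ℕ}

theorem pt_eq_of_eqOn {F : Type*} [NormedAddCommGroup F] [NormedSpace ℝ F] {x y : ℝ → ℝ → F}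
    {A B : ℝ} (hAB : A < B) (hx : Sm x) (hy : Sm y)
    (h : ∀ t ∈ Icc A B, ∀ θ, x t θ = y t θ) {t : ℝ} (ht : t ∈ Icc A B) (θ : ℝ) :
    pt x t θ = pt y t θ := by
  have hu := uniqueDiffOn_Icc hAB t ht
  have h1 := ((Sm.hasDerivAt_t hx t θ).hasDerivWithinAt (s := Icc A B)).derivWithin hu
  have h2 := ((Sm.hasDerivAt_t hy t θ).hasDerivWithinAt (s := Icc A B)).derivWithin hu
  rw [← h1, ← h2]
  exact derivWithin_congr (fun s hs => h s hs θ) (h t ht θ)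

theorem pth_eq_of_eq {F : Type*} [NormedAddCommGroup F] [NormedSpace ℝ F] {x y : ℝ → ℝ → F}
    {t : ℝ} (h : ∀ θ, x t θ = y t θ) (θ : ℝ) : pth x t θ = pth y t θ := by
  unfold pth
  rw [funext h]

variable {f : ℝ → ℝ → EuclideanSpace ℝ (Fin n)} {u : ℝ → ℝ → ℝ} {A B : ℝ}

/-- First order consequences of conformality. -/
theorem ConfImm.inner_second_deriv (h : ConfImm f u (Icc A B)) (hAB : A < B) {t : ℝ}
    (ht : t ∈ Icc A B) (θ : ℝ) :
    ⟪pt f t θ, pt (pt f) t θ⟫_ℝ = exp (2 * u t θ) * pt u t θ ∧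
    ⟪pth f t θ, pt (pt f) t θ⟫_ℝ = -(exp (2 * u t θ) * pth u t θ) ∧
    ⟪pt f t θ, pt (pth f) t θ⟫_ℝ = exp (2 * u t θ) * pth u t θ ∧
    ⟪pth f t θ, pt (pth f) t θ⟫_ℝ = exp (2 * u t θ) * pt u t θ ∧
    ⟪pt f t θ, pth (pth f) t θ⟫_ℝ = -(exp (2 * u t θ) * pt u t θ) ∧
    ⟪pth f t θ, pth (pth f) t θ⟫_ℝ = exp (2 * u t θ) * pth u t θ := by
  have hf : Sm f := h.smooth_f
  have hu : Sm u := h.smooth_u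
  have e1 := pt_eq_of_eqOn (y := fun t θ => exp (2 * u t θ)) hAB (by unfold Sm; fun_prop) (by unfold Sm; fun_prop) h.conf_t ht θ
  have e2 := pth_eq_of_eq (t := t) (x := fun t θ => ‖pt f t θ‖ ^ 2)
    (y := fun t θ => exp (2 * u t θ)) (h.conf_t t ht) θ
  have e3 := pt_eq_of_eqOn (y := fun t θ => exp (2 * u t θ)) hAB (by unfold Sm; fun_prop) (by unfold Sm; fun_prop) h.conf_th ht θ
  have e4 := pth_eq_of_eq (t := t) (x := fun t θ => ‖pth f t θ‖ ^ 2)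
    (y := fun t θ => exp (2 * u t θ)) (h.conf_th t ht) θ
  have e5 := pt_eq_of_eqOn (y := fun _ _ => (0 : ℝ)) hAB (by unfold Sm; fun_prop) (by unfold Sm; fun_prop)
    h.conf_orth ht θ
  have e6 := pth_eq_of_eq (t := t) (x := fun t θ => ⟪pt f t θ, pth f t θ⟫_ℝ) (y := fun _ _ => (0 : ℝ))
    (h.conf_orth t ht) θ
  rw [pt_norm_sq t θ (by fun_prop), pt_exp t θ (by fun_prop), pt_mul t θ (by fun_prop) (by fun_prop),
    pt_const] at e1 e3
  rw [pth_norm_sq t θ (by fun_prop), pth_exp t θ (by fun_prop),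
    pth_mul t θ (by fun_prop) (by fun_prop), pth_const] at e2 e4
  rw [pt_inner t θ (by fun_prop) (by fun_prop), pt_const] at e5
  rw [pth_inner t θ (by fun_prop) (by fun_prop), pth_const, ← pt_pth_comm hf] at e6
  rw [← pt_pth_comm hf] at e2
  rw [real_inner_comm] at e5
  have e7 := real_inner_comm (pth f t θ) (pt (pth f) t θ)
  refine ⟨?_, ?_, ?_, ?_, ?_, ?_⟩ <;> linarith

/-- The second fundamental form is normal. -/
theorem ConfImm.inner_secondFF (h : ConfImm f u (Icc A B)) (hAB : A < B) {t : ℝ}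
    (ht : t ∈ Icc A B) (θ : ℝ) :
    (⟪pt f t θ, Att f u t θ⟫_ℝ = 0 ∧ ⟪pth f t θ, Att f u t θ⟫_ℝ = 0) ∧
    (⟪pt f t θ, Atth f u t θ⟫_ℝ = 0 ∧ ⟪pth f t θ, Atth f u t θ⟫_ℝ = 0) ∧
    (⟪pt f t θ, Athth f u t θ⟫_ℝ = 0 ∧ ⟪pth f t θ, Athth f u t θ⟫_ℝ = 0) := by
  obtain ⟨e1, e2, e3, e4, e5, e6⟩ := h.inner_second_deriv hAB ht θ
  have c1 := h.conf_t t ht θ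
  have c2 := h.conf_th t ht θ
  have c3 := h.conf_orth t ht θ
  have c4 := c3
  rw [real_inner_comm] at c4
  refine ⟨⟨?_, ?_⟩, ⟨?_, ?_⟩, ?_, ?_⟩ <;>
  simp only [Att, Atth, Athth, inner_add_right, inner_sub_right, real_inner_smul_right,
    real_inner_self_eq_norm_sq, e1, e2, e3, e4, e5, e6, c1, c2, c3, c4] <;> ring

theorem exp_smul_Hmc (f : ℝ → ℝ → EuclideanSpace ℝ (Fin n)) (u : ℝ → ℝ → ℝ) (t θ : ℝ) :
    exp (2 * u t θ) • Hmc f u t θ = Att f u t θ + Athth f u t θ := by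
  have e : exp (2 * u t θ) * exp (-(2 * u t θ)) = 1 := by rw [← exp_add]; simp
  rw [Hmc, smul_smul, e, Att, Athth]
  module

/-- The Gauss equation. -/
theorem ConfImm.gauss (h : ConfImm f u (Icc A B)) (hAB : A < B) {t : ℝ}
    (ht : t ∈ Icc A B) (θ : ℝ) :
    exp (2 * u t θ) * (pt (pt u) t θ + pth (pth u) t θ)
      = ‖Atth f u t θ‖ ^ 2 - ⟪Att f u t θ, Athth f u t θ⟫_ℝ := by
  have hf : Sm f := h.smooth_f
  have hu : Sm u := h.smooth_u
  obtain ⟨⟨n1, n2⟩, ⟨n3, n4⟩, n5, n6⟩ := h.inner_secondFF hAB ht θ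
  have c1 := h.conf_t t ht θ
  have c2 := h.conf_th t ht θ
  have c3 := h.conf_orth t ht θ
  have e1 := pth_eq_of_eq (t := t) (x := fun t θ => ⟪pt f t θ, pt (pth f) t θ⟫_ℝ)
    (y := fun t θ => exp (2 * u t θ) * pth u t θ)
    (fun θ => (h.inner_second_deriv hAB ht θ).2.2.1) θ
  have e2 := pt_eq_of_eqOn (x := fun t θ => ⟪pt f t θ, pth (pth f) t θ⟫_ℝ)
    (y := fun t θ => -(exp (2 * u t θ) * pt u t θ)) hAB
    (by unfold Sm; fun_prop) (by unfold Sm; fun_prop)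
    (fun t ht θ => (h.inner_second_deriv hAB ht θ).2.2.2.2.1) ht θ
  rw [pth_inner t θ (by fun_prop) (by fun_prop), pth_mul t θ (by fun_prop) (by fun_prop),
    pth_exp t θ (by fun_prop), pth_mul t θ (by fun_prop) (by fun_prop), pth_const] at e1
  rw [pt_inner t θ (by fun_prop) (by fun_prop), pt_neg t θ (by fun_prop),
    pt_mul t θ (by fun_prop) (by fun_prop),
    pt_exp t θ (by fun_prop), pt_mul t θ (by fun_prop) (by fun_prop), pt_const] at e2
  have s1 : pt (pt f) t θ = Att f u t θ + pt u t θ • pt f t θ - pth u t θ • pth f t θ := by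
    rw [Att]; module
  have s2 : pt (pth f) t θ = Atth f u t θ + pth u t θ • pt f t θ + pt u t θ • pth f t θ := by
    rw [Atth]; module
  have s3 : pth (pth f) t θ = Athth f u t θ - pt u t θ • pt f t θ + pth u t θ • pth f t θ := by
    rw [Athth]; module
  have d : pt (pth (pth f)) t θ = pth (pt (pth f)) t θ := pt_pth_comm (by unfold Sm; fun_prop) t θ
  rw [← pt_pth_comm hf] at e1
  rw [d] at e2
  have e3 : ⟪pt (pth f) t θ, pt (pth f) t θ⟫_ℝ - ⟪pt (pt f) t θ, pth (pth f) t θ⟫_ℝ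
      = exp (2 * u t θ) * (pt (pt u) t θ + pth (pth u) t θ
        + 2 * (pt u t θ ^ 2 + pth u t θ ^ 2)) := by
    linear_combination e1 - e2
  have c4 := c3
  have n1' := n1
  have n2' := n2
  have n3' := n3
  have n4' := n4
  rw [real_inner_comm] at c4 n1' n2' n3' n4'
  rw [s1, s2, s3] at e3
  simp only [inner_add_right, inner_sub_right, real_inner_smul_right, inner_add_left,
    inner_sub_left, real_inner_smul_left, real_inner_self_eq_norm_sq, n3, n4, n5, n6,
    n1', n2', n3', n4', norm_smul, mul_pow, Real.norm_eq_abs, sq_abs, c1, c2, c3, c4] at e3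
  linarith

end ConformalGeometry

section Normalization

variable {n : ℕ} {f : ℝ → ℝ → EuclideanSpace ℝ (Fin n)} {u : ℝ → ℝ → ℝ} {A B : ℝ}

@[fun_prop]
theorem contDiff_Hmc (hf : ContDiff ℝ (⊤ : ℕ∞) (fun p : ℝ × ℝ => f p.1 p.2))
    (hu : ContDiff ℝ (⊤ : ℕ∞) (fun p : ℝ × ℝ => u p.1 p.2)) :
    ContDiff ℝ (⊤ : ℕ∞) (fun p : ℝ × ℝ => Hmc f u p.1 p.2) := by
  unfold Hmc; fun_prop

@[fun_prop]
theorem contDiff_Att (hf : ContDiff ℝ (⊤ : ℕ∞) (fun p : ℝ × ℝ => f p.1 p.2))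
    (hu : ContDiff ℝ (⊤ : ℕ∞) (fun p : ℝ × ℝ => u p.1 p.2)) :
    ContDiff ℝ (⊤ : ℕ∞) (fun p : ℝ × ℝ => Att f u p.1 p.2) := by
  unfold Att; fun_prop

@[fun_prop]
theorem contDiff_Atth (hf : ContDiff ℝ (⊤ : ℕ∞) (fun p : ℝ × ℝ => f p.1 p.2))
    (hu : ContDiff ℝ (⊤ : ℕ∞) (fun p : ℝ × ℝ => u p.1 p.2)) :
    ContDiff ℝ (⊤ : ℕ∞) (fun p : ℝ × ℝ => Atth f u p.1 p.2) := by
  unfold Atth; fun_prop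

@[fun_prop]
theorem contDiff_Athth (hf : ContDiff ℝ (⊤ : ℕ∞) (fun p : ℝ × ℝ => f p.1 p.2))
    (hu : ContDiff ℝ (⊤ : ℕ∞) (fun p : ℝ × ℝ => u p.1 p.2)) :
    ContDiff ℝ (⊤ : ℕ∞) (fun p : ℝ × ℝ => Athth f u p.1 p.2) := by
  unfold Athth; fun_prop

theorem contDiff_Adens (hf : ContDiff ℝ (⊤ : ℕ∞) (fun p : ℝ × ℝ => f p.1 p.2))
    (hu : ContDiff ℝ (⊤ : ℕ∞) (fun p : ℝ × ℝ => u p.1 p.2)) :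
    ContDiff ℝ (⊤ : ℕ∞) (fun p : ℝ × ℝ => Adens f u p.1 p.2) := by
  unfold Adens Asq; fun_prop

theorem Adens_nonneg (f : ℝ → ℝ → EuclideanSpace ℝ (Fin n)) (u : ℝ → ℝ → ℝ) (t θ : ℝ) :
    0 ≤ Adens f u t θ := by
  unfold Adens Asq; positivity

/-- The longitudinal component of the quadratic part of the Willmore flux. -/
def fluxT (f : ℝ → ℝ → EuclideanSpace ℝ (Fin n)) (u : ℝ → ℝ → ℝ) :
    ℝ → ℝ → EuclideanSpace ℝ (Fin n) :=
  fun t θ => (-2 : ℝ) • (Real.exp (-(2 * u t θ)) •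
        (⟪Hmc f u t θ, Att f u t θ⟫_ℝ • pt f t θ + ⟪Hmc f u t θ, Atth f u t θ⟫_ℝ • pth f t θ))
      + (1 / 2 : ℝ) • (‖Hmc f u t θ‖ ^ 2 • pt f t θ)

/-- The angular component of the quadratic part of the Willmore flux. -/
def fluxTh (f : ℝ → ℝ → EuclideanSpace ℝ (Fin n)) (u : ℝ → ℝ → ℝ) :
    ℝ → ℝ → EuclideanSpace ℝ (Fin n) :=
  fun t θ => (-2 : ℝ) • (Real.exp (-(2 * u t θ)) •
        (⟪Hmc f u t θ, Atth f u t θ⟫_ℝ • pt f t θ + ⟪Hmc f u t θ, Athth f u t θ⟫_ℝ • pth f t θ))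
      + (1 / 2 : ℝ) • (‖Hmc f u t θ‖ ^ 2 • pth f t θ)

@[fun_prop]
theorem contDiff_fluxT (hf : ContDiff ℝ (⊤ : ℕ∞) (fun p : ℝ × ℝ => f p.1 p.2))
    (hu : ContDiff ℝ (⊤ : ℕ∞) (fun p : ℝ × ℝ => u p.1 p.2)) :
    ContDiff ℝ (⊤ : ℕ∞) (fun p : ℝ × ℝ => fluxT f u p.1 p.2) := by
  unfold fluxT; fun_prop

@[fun_prop]
theorem contDiff_fluxTh (hf : ContDiff ℝ (⊤ : ℕ∞) (fun p : ℝ × ℝ => f p.1 p.2))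
    (hu : ContDiff ℝ (⊤ : ℕ∞) (fun p : ℝ × ℝ => u p.1 p.2)) :
    ContDiff ℝ (⊤ : ℕ∞) (fun p : ℝ × ℝ => fluxTh f u p.1 p.2) := by
  unfold fluxTh; fun_prop

theorem ConfWillmore.laplace_Hmc (h : ConfWillmore f u (Icc A B)) {t : ℝ} (ht : t ∈ Icc A B)
    (θ : ℝ) : pt (pt (Hmc f u)) t θ + pth (pth (Hmc f u)) t θ
      = pt (fluxT f u) t θ + pth (fluxTh f u) t θ := by
  have hf : Sm f := h.smooth_f
  have hu : Sm u := h.smooth_u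
  have w := h.willmore t ht θ
  unfold fluxT fluxTh
  rw [pt_add t θ (by fun_prop) (by fun_prop), pth_add t θ (by fun_prop) (by fun_prop),
    pt_smul (a := fun _ _ => (-2 : ℝ)) t θ (by fun_prop) (by fun_prop),
    pt_smul (a := fun _ _ => (1 / 2 : ℝ)) t θ (by fun_prop) (by fun_prop),
    pth_smul (a := fun _ _ => (-2 : ℝ)) t θ (by fun_prop) (by fun_prop),
    pth_smul (a := fun _ _ => (1 / 2 : ℝ)) t θ (by fun_prop) (by fun_prop)]
  simp only [pt_const, pth_const]
  unfold willmoreOp at w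
  linear_combination (norm := module) (1 / 2 : ℝ) • w

theorem pt_exp_smul (k d : ℝ) {F : ℝ → ℝ → EuclideanSpace ℝ (Fin n)} (hF : Sm F) (t θ : ℝ) :
    pt (fun t θ => exp (k * t + d) • F t θ) t θ
      = exp (k * t + d) • (k • F t θ + pt F t θ) := by
  rw [pt_smul t θ (by fun_prop) hF, pt_exp t θ (by fun_prop), pt_add t θ (by fun_prop) (by fun_prop),
    pt_fst, pt_const]
  have : deriv (fun s : ℝ => k * s) t = k := by
    simp
  rw [this]
  module

theorem pth_exp_smul (k d : ℝ) {F : ℝ → ℝ → EuclideanSpace ℝ (Fin n)} (hF : Sm F) (t θ : ℝ) :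
    pth (fun t θ => exp (k * t + d) • F t θ) t θ = exp (k * t + d) • pth F t θ := by
  rw [pth_smul t θ (by fun_prop) hF, pth_fst t θ (fun t => exp (k * t + d))]
  module

/-- First rotated and rescaled tangent vector. -/
def frameP (m l : ℝ) (f : ℝ → ℝ → EuclideanSpace ℝ (Fin n)) :
    ℝ → ℝ → EuclideanSpace ℝ (Fin n) :=
  fun t θ => exp (m * t + -l) • (cos (m * θ) • pt f t θ + sin (m * θ) • pth f t θ)

/-- Second rotated and rescaled tangent vector. -/
def frameR (m l : ℝ) (f : ℝ → ℝ → EuclideanSpace ℝ (Fin n)) :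
    ℝ → ℝ → EuclideanSpace ℝ (Fin n) :=
  fun t θ => exp (m * t + -l) • (sin (m * θ) • pt f t θ - cos (m * θ) • pth f t θ)

/-- Diagonal component of the trace-free second fundamental form. -/
def traceFreeD (f : ℝ → ℝ → EuclideanSpace ℝ (Fin n)) (u : ℝ → ℝ → ℝ) :
    ℝ → ℝ → EuclideanSpace ℝ (Fin n) :=
  fun t θ => (1 / 2 : ℝ) • (Att f u t θ - Athth f u t θ)

/-- First rotated and rescaled component of the trace-free second fundamental form. -/
def frameE1 (m l : ℝ) (f : ℝ → ℝ → EuclideanSpace ℝ (Fin n)) (u : ℝ → ℝ → ℝ) :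
    ℝ → ℝ → EuclideanSpace ℝ (Fin n) :=
  fun t θ => exp (m * t + -l) •
    (cos (m * θ) • traceFreeD f u t θ + sin (m * θ) • Atth f u t θ)

/-- Second rotated and rescaled component of the trace-free second fundamental form. -/
def frameE2 (m l : ℝ) (f : ℝ → ℝ → EuclideanSpace ℝ (Fin n)) (u : ℝ → ℝ → ℝ) :
    ℝ → ℝ → EuclideanSpace ℝ (Fin n) :=
  fun t θ => exp (m * t + -l) •
    (sin (m * θ) • traceFreeD f u t θ - cos (m * θ) • Atth f u t θ)

/-- The field `x` multiplied by `e^{l - m t}`. -/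
def rescale (m l : ℝ) (x : ℝ → ℝ → EuclideanSpace ℝ (Fin n)) :
    ℝ → ℝ → EuclideanSpace ℝ (Fin n) :=
  fun t θ => exp (-m * t + l) • x t θ

/-- A rescaled primitive controlling the flux identity. -/
def framePrim (m l : ℝ) (f : ℝ → ℝ → EuclideanSpace ℝ (Fin n)) :
    ℝ → ℝ → EuclideanSpace ℝ (Fin n) :=
  fun t θ => exp (m * t + -l) •
    (f t θ + (1 / m) • pt f t θ - (f t 0 + (1 / m) • pt f t 0))

/-- The conformal exponent relative to `l - m t`. -/
def relExp (m l : ℝ) (u : ℝ → ℝ → ℝ) : ℝ → ℝ → ℝ := fun t θ => u t θ + m * t - l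

theorem pt_relExp (m l : ℝ) (hu : Sm u) (t θ : ℝ) : pt (relExp m l u) t θ = pt u t θ + m := by
  unfold relExp
  rw [pt_sub t θ (by fun_prop) (by fun_prop), pt_add t θ hu (by fun_prop), pt_const, pt_fst]
  have : deriv (fun s : ℝ => m * s) t = m := by
    simp
  rw [this, sub_zero]

theorem pth_relExp (m l : ℝ) (hu : Sm u) (t θ : ℝ) : pth (relExp m l u) t θ = pth u t θ := by
  unfold relExp
  rw [pth_sub t θ (by fun_prop) (by fun_prop), pth_add t θ hu (by fun_prop), pth_const,
    pth_fst t θ (fun t => m * t), sub_zero, add_zero]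

theorem laplace_relExp (m l : ℝ) (hu : Sm u) (t θ : ℝ) :
    pt (pt (relExp m l u)) t θ + pth (pth (relExp m l u)) t θ
      = pt (pt u) t θ + pth (pth u) t θ := by
  have e1 : pt (relExp m l u) = fun t θ => pt u t θ + m := by
    funext t θ; exact pt_relExp m l hu t θ
  have e2 : pth (relExp m l u) = pth u := by
    funext t θ; exact pth_relExp m l hu t θ
  rw [e1, e2, pt_add t θ (by fun_prop) (by fun_prop), pt_const, add_zero]

theorem deriv_cos_mul (m θ : ℝ) : deriv (fun θ => cos (m * θ)) θ = -(m * sin (m * θ)) := by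
  have := (((hasDerivAt_id θ).const_mul m).cos).deriv
  simp only [id] at this
  rw [this]; ring

theorem deriv_sin_mul (m θ : ℝ) : deriv (fun θ => sin (m * θ)) θ = m * cos (m * θ) := by
  have := (((hasDerivAt_id θ).const_mul m).sin).deriv
  simp only [id] at this
  rw [this]; ring

theorem frameP_derivs (m l : ℝ) (hf : Sm f) (t θ : ℝ) :
    pt (frameP m l f) t θ = exp (m * t + -l) • (m • (cos (m * θ) • pt f t θ
        + sin (m * θ) • pth f t θ) + (cos (m * θ) • pt (pt f) t θ + sin (m * θ) • pt (pth f) t θ)) ∧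
    pth (frameP m l f) t θ = exp (m * t + -l) • (-(m * sin (m * θ)) • pt f t θ
        + (m * cos (m * θ)) • pth f t θ + (cos (m * θ) • pt (pth f) t θ
        + sin (m * θ) • pth (pth f) t θ)) := by
  constructor
  · unfold frameP
    rw [pt_exp_smul m (-l) (by unfold Sm; fun_prop), pt_add t θ (by fun_prop) (by fun_prop),
      pt_smul t θ (by fun_prop) (by fun_prop), pt_smul t θ (by fun_prop) (by fun_prop),
      pt_snd t θ (fun θ => cos (m * θ)), pt_snd t θ (fun θ => sin (m * θ))]
    module
  · unfold frameP
    rw [pth_exp_smul m (-l) (by unfold Sm; fun_prop), pth_add t θ (by fun_prop) (by fun_prop),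
      pth_smul t θ (by fun_prop) (by fun_prop), pth_smul t θ (by fun_prop) (by fun_prop),
      pth_snd t θ (fun θ => cos (m * θ)), pth_snd t θ (fun θ => sin (m * θ)), deriv_cos_mul, deriv_sin_mul,
      ← pt_pth_comm hf]
    module

theorem frameR_derivs (m l : ℝ) (hf : Sm f) (t θ : ℝ) :
    pt (frameR m l f) t θ = exp (m * t + -l) • (m • (sin (m * θ) • pt f t θ
        - cos (m * θ) • pth f t θ) + (sin (m * θ) • pt (pt f) t θ - cos (m * θ) • pt (pth f) t θ)) ∧
    pth (frameR m l f) t θ = exp (m * t + -l) • ((m * cos (m * θ)) • pt f t θ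
        + (m * sin (m * θ)) • pth f t θ + (sin (m * θ) • pt (pth f) t θ
        - cos (m * θ) • pth (pth f) t θ)) := by
  constructor
  · unfold frameR
    rw [pt_exp_smul m (-l) (by unfold Sm; fun_prop), pt_sub t θ (by fun_prop) (by fun_prop),
      pt_smul t θ (by fun_prop) (by fun_prop), pt_smul t θ (by fun_prop) (by fun_prop),
      pt_snd t θ (fun θ => cos (m * θ)), pt_snd t θ (fun θ => sin (m * θ))]
    module
  · unfold frameR
    rw [pth_exp_smul m (-l) (by unfold Sm; fun_prop), pth_sub t θ (by fun_prop) (by fun_prop),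
      pth_smul t θ (by fun_prop) (by fun_prop), pth_smul t θ (by fun_prop) (by fun_prop),
      pth_snd t θ (fun θ => cos (m * θ)), pth_snd t θ (fun θ => sin (m * θ)), deriv_cos_mul, deriv_sin_mul,
      ← pt_pth_comm hf]
    module

theorem frame_first (m l : ℝ) (hf : Sm f) (t θ : ℝ) :
    pt (frameP m l f) t θ - pth (frameR m l f) t θ
      = (exp (2 * relExp m l u t θ) * cos (m * θ)) • rescale m l (Hmc f u) t θ := by
  rw [(frameP_derivs m l hf t θ).1, (frameR_derivs m l hf t θ).2, rescale, Hmc, smul_smul, smul_smul]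
  have e : exp (2 * relExp m l u t θ) * cos (m * θ) * exp (-m * t + l) * exp (-(2 * u t θ))
      = exp (m * t + -l) * cos (m * θ) := by
    rw [mul_right_comm _ (cos (m * θ)), mul_right_comm _ (cos (m * θ)), ← exp_add, ← exp_add]
    congr 2
    unfold relExp; ring
  rw [e]
  module

theorem frame_second (m l : ℝ) (hf : Sm f) (t θ : ℝ) :
    pth (frameP m l f) t θ + pt (frameR m l f) t θ
      = (exp (2 * relExp m l u t θ) * sin (m * θ)) • rescale m l (Hmc f u) t θ := by
  rw [(frameP_derivs m l hf t θ).2, (frameR_derivs m l hf t θ).1, rescale, Hmc, smul_smul, smul_smul]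
  have e : exp (2 * relExp m l u t θ) * sin (m * θ) * exp (-m * t + l) * exp (-(2 * u t θ))
      = exp (m * t + -l) * sin (m * θ) := by
    rw [mul_right_comm _ (sin (m * θ)), mul_right_comm _ (sin (m * θ)), ← exp_add, ← exp_add]
    congr 2
    unfold relExp; ring
  rw [e]
  module

theorem frameE1_eq (m l : ℝ) (hf : Sm f) (hu : Sm u) (t θ : ℝ) :
    frameE1 m l f u t θ = (1 / 2 : ℝ) • (pt (frameP m l f) t θ + pth (frameR m l f) t θ)
      - pt (relExp m l u) t θ • frameP m l f t θ
      - pth (relExp m l u) t θ • frameR m l f t θ := by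
  rw [(frameP_derivs m l hf t θ).1, (frameR_derivs m l hf t θ).2, pt_relExp m l hu,
    pth_relExp m l hu, frameE1, traceFreeD, Att, Atth, Athth, frameP, frameR]
  module

theorem frameE2_eq (m l : ℝ) (hf : Sm f) (hu : Sm u) (t θ : ℝ) :
    frameE2 m l f u t θ = (1 / 2 : ℝ) • (pt (frameR m l f) t θ - pth (frameP m l f) t θ)
      - pt (relExp m l u) t θ • frameR m l f t θ
      + pth (relExp m l u) t θ • frameP m l f t θ := by
  rw [(frameP_derivs m l hf t θ).2, (frameR_derivs m l hf t θ).1, pt_relExp m l hu,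
    pth_relExp m l hu, frameE2, traceFreeD, Att, Atth, Athth, frameP, frameR]
  module

theorem pt_rescale (m l : ℝ) {x : ℝ → ℝ → EuclideanSpace ℝ (Fin n)} (hx : Sm x) (t θ : ℝ) :
    pt (rescale m l x) t θ = exp (-m * t + l) • (pt x t θ - m • x t θ) := by
  unfold rescale
  rw [pt_exp_smul (-m) l hx]
  module

theorem pth_rescale (m l : ℝ) {x : ℝ → ℝ → EuclideanSpace ℝ (Fin n)} (hx : Sm x) (t θ : ℝ) :
    pth (rescale m l x) t θ = rescale m l (pth x) t θ := by
  unfold rescale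
  rw [pth_exp_smul (-m) l hx]

@[fun_prop]
theorem contDiff_rescale (m l : ℝ) {x : ℝ → ℝ → EuclideanSpace ℝ (Fin n)}
    (hx : ContDiff ℝ (⊤ : ℕ∞) (fun p : ℝ × ℝ => x p.1 p.2)) :
    ContDiff ℝ (⊤ : ℕ∞) (fun p : ℝ × ℝ => rescale m l x p.1 p.2) := by
  unfold rescale; fun_prop

theorem frame_willmore (m l : ℝ) (h : ConfWillmore f u (Icc A B)) {t : ℝ} (ht : t ∈ Icc A B)
    (θ : ℝ) :
    pt (pt (rescale m l (Hmc f u))) t θ + pth (pth (rescale m l (Hmc f u))) t θ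
      + (2 * m) • pt (rescale m l (Hmc f u)) t θ + m ^ 2 • rescale m l (Hmc f u) t θ
      = pt (rescale m l (fluxT f u)) t θ + m • rescale m l (fluxT f u) t θ
        + pth (rescale m l (fluxTh f u)) t θ := by
  have hf : Sm f := h.smooth_f
  have hu : Sm u := h.smooth_u
  have hH : Sm (Hmc f u) := by unfold Sm; fun_prop
  have hT : Sm (fluxT f u) := by unfold Sm; fun_prop
  have hTh : Sm (fluxTh f u) := by unfold Sm; fun_prop
  have e1 : pt (rescale m l (Hmc f u))
      = rescale m l (fun t θ => pt (Hmc f u) t θ - m • Hmc f u t θ) := by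
    funext t θ; rw [pt_rescale m l hH]; rfl
  have e2 : pth (rescale m l (Hmc f u)) = rescale m l (pth (Hmc f u)) := by
    funext t θ; exact pth_rescale m l hH t θ
  have w := h.laplace_Hmc ht θ
  rw [e1, e2, pt_rescale m l (by unfold Sm; fun_prop), pth_rescale m l (by unfold Sm; fun_prop),
    pt_rescale m l hT, pth_rescale m l hTh,
    pt_sub t θ (by fun_prop) (by fun_prop),
    pt_smul (a := fun _ _ => m) t θ (by fun_prop) (by fun_prop), pt_const]
  simp only [rescale]
  linear_combination (norm := module) exp (-m * t + l) • w

end Normalization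

section NormalizedEstimates

variable {n : ℕ} {f : ℝ → ℝ → EuclideanSpace ℝ (Fin n)} {u : ℝ → ℝ → ℝ} {A B m l : ℝ} {t θ : ℝ}

theorem exp_sq_relExp (m l : ℝ) (u : ℝ → ℝ → ℝ) (t θ : ℝ) :
    exp (m * t + -l) ^ 2 * exp (2 * u t θ) = exp (2 * relExp m l u t θ) := by
  rw [← exp_nat_mul, ← exp_add]
  congr 1
  unfold relExp; push_cast; ring

theorem norm_rotate_sq {E : Type*} [NormedAddCommGroup E] [InnerProductSpace ℝ E] (c s r : ℝ)
    (x y : E) : ‖r • (c • x + s • y)‖ ^ 2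
      = r ^ 2 * (c ^ 2 * ‖x‖ ^ 2 + 2 * (c * s) * ⟪x, y⟫_ℝ + s ^ 2 * ‖y‖ ^ 2) := by
  rw [norm_smul, mul_pow, norm_add_sq_real, norm_smul, norm_smul, real_inner_smul_left,
    real_inner_smul_right, mul_pow, mul_pow]
  simp only [Real.norm_eq_abs, sq_abs]
  ring

theorem norm_frameP (h : ConfImm f u (Icc A B)) (ht : t ∈ Icc A B) :
    ‖frameP m l f t θ‖ ^ 2 = exp (2 * relExp m l u t θ) := by
  rw [frameP, norm_rotate_sq, h.conf_t t ht, h.conf_th t ht, h.conf_orth t ht, ← exp_sq_relExp]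
  linear_combination exp (m * t + -l) ^ 2 * exp (2 * u t θ) * cos_sq_add_sin_sq (m * θ)

theorem frameR_eq : frameR m l f t θ
    = exp (m * t + -l) • (sin (m * θ) • pt f t θ + (-cos (m * θ)) • pth f t θ) := by
  unfold frameR; module

theorem frameE2_eq' : frameE2 m l f u t θ = exp (m * t + -l) •
    (sin (m * θ) • traceFreeD f u t θ + (-cos (m * θ)) • Atth f u t θ) := by
  unfold frameE2; module

theorem norm_frameR (h : ConfImm f u (Icc A B)) (ht : t ∈ Icc A B) :
    ‖frameR m l f t θ‖ ^ 2 = exp (2 * relExp m l u t θ) := by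
  rw [frameR_eq, norm_rotate_sq, h.conf_t t ht, h.conf_th t ht, h.conf_orth t ht, ← exp_sq_relExp]
  linear_combination exp (m * t + -l) ^ 2 * exp (2 * u t θ) * cos_sq_add_sin_sq (m * θ)

theorem inner_frameP_frameR (h : ConfImm f u (Icc A B)) (ht : t ∈ Icc A B) :
    ⟪frameP m l f t θ, frameR m l f t θ⟫_ℝ = 0 := by
  have c1 := h.conf_t t ht θ
  have c2 := h.conf_th t ht θ
  have c3 := h.conf_orth t ht θ
  have c4 := c3
  rw [real_inner_comm] at c4
  simp only [frameP, frameR, inner_add_left, inner_sub_right, real_inner_smul_left,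
    real_inner_smul_right, real_inner_self_eq_norm_sq, c1, c2, c3, c4]
  ring

theorem inner_frame_normal (m l : ℝ) {x : EuclideanSpace ℝ (Fin n)}
    (hx : ⟪pt f t θ, x⟫_ℝ = 0 ∧ ⟪pth f t θ, x⟫_ℝ = 0) :
    ⟪frameP m l f t θ, x⟫_ℝ = 0 ∧ ⟪frameR m l f t θ, x⟫_ℝ = 0 := by
  simp only [frameP, frameR, inner_add_left, inner_sub_left, real_inner_smul_left, hx.1, hx.2]
  simp

theorem Hmc_eq : Hmc f u t θ = exp (-(2 * u t θ)) • (Att f u t θ + Athth f u t θ) := by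
  rw [← exp_smul_Hmc, smul_smul, ← exp_add, neg_add_cancel, exp_zero, one_smul]

theorem inner_rescale_Hmc (h : ConfImm f u (Icc A B)) (hAB : A < B) (ht : t ∈ Icc A B) :
    ⟪pt f t θ, rescale m l (Hmc f u) t θ⟫_ℝ = 0 ∧ ⟪pth f t θ, rescale m l (Hmc f u) t θ⟫_ℝ = 0 := by
  obtain ⟨⟨n1, n2⟩, ⟨n3, n4⟩, n5, n6⟩ := h.inner_secondFF hAB ht θ
  simp [rescale, Hmc_eq, inner_add_right, real_inner_smul_right, n1, n2, n5, n6]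

theorem inner_frameE1 (h : ConfImm f u (Icc A B)) (hAB : A < B) (ht : t ∈ Icc A B) :
    ⟪pt f t θ, frameE1 m l f u t θ⟫_ℝ = 0 ∧ ⟪pth f t θ, frameE1 m l f u t θ⟫_ℝ = 0 := by
  obtain ⟨⟨n1, n2⟩, ⟨n3, n4⟩, n5, n6⟩ := h.inner_secondFF hAB ht θ
  simp [frameE1, traceFreeD, inner_add_right, inner_sub_right, real_inner_smul_right,
    n1, n2, n3, n4, n5, n6]

theorem inner_frameE2 (h : ConfImm f u (Icc A B)) (hAB : A < B) (ht : t ∈ Icc A B) :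
    ⟪pt f t θ, frameE2 m l f u t θ⟫_ℝ = 0 ∧ ⟪pth f t θ, frameE2 m l f u t θ⟫_ℝ = 0 := by
  obtain ⟨⟨n1, n2⟩, ⟨n3, n4⟩, n5, n6⟩ := h.inner_secondFF hAB ht θ
  simp [frameE2, traceFreeD, inner_sub_right, real_inner_smul_right,
    n1, n2, n3, n4, n5, n6]

/-- The trace-free part is preserved by the rotation. -/
theorem norm_frameE (m l : ℝ) (f : ℝ → ℝ → EuclideanSpace ℝ (Fin n)) (u : ℝ → ℝ → ℝ) (t θ : ℝ) :
    ‖frameE1 m l f u t θ‖ ^ 2 + ‖frameE2 m l f u t θ‖ ^ 2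
      = exp (m * t + -l) ^ 2 * ((1 / 4) * ‖Att f u t θ - Athth f u t θ‖ ^ 2
        + ‖Atth f u t θ‖ ^ 2) := by
  rw [frameE1, frameE2_eq', norm_rotate_sq, norm_rotate_sq]
  have e : ‖traceFreeD f u t θ‖ ^ 2 = (1 / 4) * ‖Att f u t θ - Athth f u t θ‖ ^ 2 := by
    rw [traceFreeD, norm_smul, mul_pow]; norm_num
  rw [e]
  linear_combination exp (m * t + -l) ^ 2 * ((1 / 4) * ‖Att f u t θ - Athth f u t θ‖ ^ 2
        + ‖Atth f u t θ‖ ^ 2) * cos_sq_add_sin_sq (m * θ)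

theorem exp_smul_rescale_Hmc (m l : ℝ) (f : ℝ → ℝ → EuclideanSpace ℝ (Fin n)) (u : ℝ → ℝ → ℝ)
    (t θ : ℝ) : exp (2 * relExp m l u t θ) • rescale m l (Hmc f u) t θ
      = exp (m * t + -l) • (Att f u t θ + Athth f u t θ) := by
  rw [← exp_smul_Hmc, rescale, smul_smul, smul_smul, ← exp_add, ← exp_add]
  congr 2
  unfold relExp; ring

theorem sq_norm_rescale_Hmc (m l : ℝ) (f : ℝ → ℝ → EuclideanSpace ℝ (Fin n)) (u : ℝ → ℝ → ℝ)
    (t θ : ℝ) : exp (2 * relExp m l u t θ) ^ 2 * ‖rescale m l (Hmc f u) t θ‖ ^ 2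
      = exp (m * t + -l) ^ 2 * ‖Att f u t θ + Athth f u t θ‖ ^ 2 := by
  have e := congrArg (fun x => ‖x‖ ^ 2) (exp_smul_rescale_Hmc m l f u t θ)
  simpa only [norm_smul, mul_pow, Real.norm_eq_abs, sq_abs] using e

/-- The squared norm of the second fundamental form in terms of the normalised fields. -/
theorem frame_energy (m l : ℝ) (f : ℝ → ℝ → EuclideanSpace ℝ (Fin n)) (u : ℝ → ℝ → ℝ) (t θ : ℝ) :
    exp (m * t + -l) ^ 2 * (‖Att f u t θ‖ ^ 2 + 2 * ‖Atth f u t θ‖ ^ 2 + ‖Athth f u t θ‖ ^ 2)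
      = 2 * (‖frameE1 m l f u t θ‖ ^ 2 + ‖frameE2 m l f u t θ‖ ^ 2)
        + (1 / 2) * exp (2 * relExp m l u t θ) ^ 2 * ‖rescale m l (Hmc f u) t θ‖ ^ 2 := by
  have e := sq_norm_rescale_Hmc m l f u t θ
  rw [norm_frameE, norm_sub_sq_real]
  rw [norm_add_sq_real] at e
  linear_combination (-1 / 2) * e

theorem frame_Adens (m l : ℝ) (f : ℝ → ℝ → EuclideanSpace ℝ (Fin n)) (u : ℝ → ℝ → ℝ) (t θ : ℝ) :
    exp (2 * relExp m l u t θ) * Adens f u t θ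
      = 2 * (‖frameE1 m l f u t θ‖ ^ 2 + ‖frameE2 m l f u t θ‖ ^ 2)
        + (1 / 2) * exp (2 * relExp m l u t θ) ^ 2 * ‖rescale m l (Hmc f u) t θ‖ ^ 2 := by
  rw [← frame_energy, Adens, Asq, ← exp_sq_relExp]
  have e : exp (2 * u t θ) * exp (-(4 * u t θ)) * exp (2 * u t θ) = 1 := by
    rw [← exp_add, ← exp_add, ← exp_zero]; congr 1; ring
  linear_combination exp (m * t + -l) ^ 2
    * (‖Att f u t θ‖ ^ 2 + 2 * ‖Atth f u t θ‖ ^ 2 + ‖Athth f u t θ‖ ^ 2) * e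

theorem frame_gauss (h : ConfImm f u (Icc A B)) (hAB : A < B) (ht : t ∈ Icc A B) :
    exp (2 * relExp m l u t θ) * (pt (pt u) t θ + pth (pth u) t θ)
      = ‖frameE1 m l f u t θ‖ ^ 2 + ‖frameE2 m l f u t θ‖ ^ 2
        - (1 / 4) * exp (2 * relExp m l u t θ) ^ 2 * ‖rescale m l (Hmc f u) t θ‖ ^ 2 := by
  have g := h.gauss hAB ht θ
  have e := sq_norm_rescale_Hmc m l f u t θ
  rw [norm_frameE, norm_sub_sq_real, ← exp_sq_relExp]
  rw [norm_add_sq_real, ← exp_sq_relExp] at e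
  linear_combination exp (m * t + -l) ^ 2 * g + (1 / 4) * e

theorem exp_two_mul_bounds {x : ℝ} (h : |x| ≤ 1 / 100) :
    9 / 10 ≤ exp (2 * x) ∧ exp (2 * x) ≤ 11 / 10 := by
  rw [abs_le] at h
  constructor
  · linarith [add_one_le_exp (2 * x)]
  · have h1 := add_one_le_exp (-(2 * x))
    have h2 : exp (2 * x) * exp (-(2 * x)) = 1 := by rw [← exp_add]; simp
    nlinarith [exp_pos (2 * x)]

theorem Adens_comparable (hν : |relExp m l u t θ| ≤ 1 / 100) :
    (1 / 4) * tripleSq (frameE1 m l f u) (frameE2 m l f u) (rescale m l (Hmc f u)) t θ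
        ≤ Adens f u t θ ∧
      Adens f u t θ
        ≤ 4 * tripleSq (frameE1 m l f u) (frameE2 m l f u) (rescale m l (Hmc f u)) t θ := by
  have e := frame_Adens m l f u t θ
  obtain ⟨h1, h2⟩ := exp_two_mul_bounds hν
  unfold tripleSq
  have hA := Adens_nonneg f u t θ
  generalize Adens f u t θ = D at *
  generalize exp (2 * relExp m l u t θ) = w at *
  have p1 := sq_nonneg ‖frameE1 m l f u t θ‖
  have p2 := sq_nonneg ‖frameE2 m l f u t θ‖
  have p3 := sq_nonneg ‖rescale m l (Hmc f u) t θ‖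
  generalize ‖frameE1 m l f u t θ‖ ^ 2 = a at *
  generalize ‖frameE2 m l f u t θ‖ ^ 2 = b at *
  generalize ‖rescale m l (Hmc f u) t θ‖ ^ 2 = d at *
  have w1 : w ^ 2 ≤ 121 / 100 := by nlinarith
  have w2 : 81 / 100 ≤ w ^ 2 := by nlinarith
  have q1 := mul_le_mul_of_nonneg_right w1 p3
  have q2 := mul_le_mul_of_nonneg_right w2 p3
  have q3 := mul_le_mul_of_nonneg_right h1 hA
  have q4 := mul_le_mul_of_nonneg_right h2 hA
  constructor <;> linarith

theorem laplace_relExp_le (h : ConfImm f u (Icc A B)) (hAB : A < B) (ht : t ∈ Icc A B)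
    (hν : |relExp m l u t θ| ≤ 1 / 100) :
    |pt (pt (relExp m l u)) t θ + pth (pth (relExp m l u)) t θ|
      ≤ 100 * tripleSq (frameE1 m l f u) (frameE2 m l f u) (rescale m l (Hmc f u)) t θ := by
  have e := frame_gauss (m := m) (l := l) h hAB ht (θ := θ)
  obtain ⟨h1, h2⟩ := exp_two_mul_bounds hν
  rw [laplace_relExp m l h.smooth_u]
  unfold tripleSq
  generalize pt (pt u) t θ + pth (pth u) t θ = D at *
  generalize exp (2 * relExp m l u t θ) = w at *
  have p1 := sq_nonneg ‖frameE1 m l f u t θ‖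
  have p2 := sq_nonneg ‖frameE2 m l f u t θ‖
  have p3 := sq_nonneg ‖rescale m l (Hmc f u) t θ‖
  generalize ‖frameE1 m l f u t θ‖ ^ 2 = a at *
  generalize ‖frameE2 m l f u t θ‖ ^ 2 = b at *
  generalize ‖rescale m l (Hmc f u) t θ‖ ^ 2 = d at *
  have w1 : w ^ 2 ≤ 121 / 100 := by nlinarith
  have q1 := mul_le_mul_of_nonneg_right w1 p3
  have q2 := mul_nonneg (sq_nonneg w) p3
  have q3 := mul_le_mul_of_nonneg_right h1 (abs_nonneg D)
  have q4 : w * |D| ≤ a + b + (1 / 4) * (w ^ 2 * d) := by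
    rw [← abs_of_nonneg (by linarith : 0 ≤ w), ← abs_mul, e, abs_of_nonneg (by linarith : 0 ≤ w)]
    rw [abs_le]; constructor <;> linarith
  linarith

/-- A bound for quadratic flux terms. -/
theorem norm_quadratic_flux_le {E : Type*} [NormedAddCommGroup E] [InnerProductSpace ℝ E]
    {H a b x y : E} {F r : ℝ} (hF : 0 < F) (hx : ‖x‖ = F) (hy : ‖y‖ = F) (hr : 0 < r)
    (hw : 9 / 10 ≤ (r * F) ^ 2) (hw' : (r * F) ^ 2 ≤ 11 / 10) :
    r⁻¹ * ‖(-2 : ℝ) • ((F ^ 2)⁻¹ • (⟪H, a⟫_ℝ • x + ⟪H, b⟫_ℝ • y)) + (1 / 2 : ℝ) • (‖H‖ ^ 2 • x)‖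
      ≤ 6 * (r⁻¹ * ‖H‖) ^ 2 + 2 * ((r * ‖a‖) ^ 2 + (r * ‖b‖) ^ 2) := by
  have h0 : 0 < r * F := by positivity
  have h1 : 9 / 10 ≤ r * F := by nlinarith
  have h2 : r * F ≤ 11 / 10 := by nlinarith
  have k1 : ‖(-2 : ℝ) • ((F ^ 2)⁻¹ • (⟪H, a⟫_ℝ • x + ⟪H, b⟫_ℝ • y)) + (1 / 2 : ℝ) • (‖H‖ ^ 2 • x)‖
      ≤ 2 * ((F ^ 2)⁻¹ * (‖H‖ * ‖a‖ * F + ‖H‖ * ‖b‖ * F)) + (1 / 2) * (‖H‖ ^ 2 * F) := by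
    refine (norm_add_le _ _).trans (add_le_add ?_ ?_)
    · rw [norm_smul, norm_smul, Real.norm_eq_abs, Real.norm_eq_abs, abs_neg, abs_two,
        abs_of_pos (by positivity : 0 < (F ^ 2)⁻¹)]
      gcongr
      refine (norm_add_le _ _).trans (add_le_add ?_ ?_)
      · rw [norm_smul, hx]; gcongr; exact norm_inner_le_norm H a
      · rw [norm_smul, hy]; gcongr; exact norm_inner_le_norm H b
    · rw [norm_smul, norm_smul, hx]; simp
  have k2 := mul_le_mul_of_nonneg_left k1 (by positivity : 0 ≤ r⁻¹)
  refine k2.trans ?_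
  have e : r⁻¹ * (2 * ((F ^ 2)⁻¹ * (‖H‖ * ‖a‖ * F + ‖H‖ * ‖b‖ * F)) + (1 / 2) * (‖H‖ ^ 2 * F))
      = (r * F)⁻¹ * (2 * (r⁻¹ * ‖H‖) * (r * ‖a‖) + 2 * (r⁻¹ * ‖H‖) * (r * ‖b‖))
        + (1 / 2) * (r * F) * (r⁻¹ * ‖H‖) ^ 2 := by
    field_simp
  rw [e]
  have i1 : (r * F)⁻¹ ≤ 2 := by
    rw [inv_le_comm₀ h0 (by norm_num)]; linarith
  have n0 : 0 ≤ r⁻¹ * ‖H‖ := by positivity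
  have na : 0 ≤ r * ‖a‖ := by positivity
  have nb : 0 ≤ r * ‖b‖ := by positivity
  generalize r⁻¹ * ‖H‖ = N at *
  generalize r * ‖a‖ = α at *
  generalize r * ‖b‖ = β at *
  have j1 := mul_le_mul_of_nonneg_right i1 (by positivity : 0 ≤ 2 * N * α + 2 * N * β)
  have j2 := mul_le_mul_of_nonneg_right h2 (sq_nonneg N)
  nlinarith [sq_nonneg (N - α), sq_nonneg (N - β)]

theorem norm_eq_exp_of_sq {E : Type*} [NormedAddCommGroup E] {x : E} {a : ℝ}
    (h : ‖x‖ ^ 2 = exp (2 * a)) : ‖x‖ = exp a := by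
  have : ‖x‖ ^ 2 = exp a ^ 2 := by rw [h, ← exp_nat_mul]; norm_num
  exact (sq_eq_sq₀ (norm_nonneg _) (exp_pos _).le).1 this

theorem exp_mul_sq_bounds (hν : |relExp m l u t θ| ≤ 1 / 100) :
    9 / 10 ≤ (exp (m * t + -l) * exp (u t θ)) ^ 2 ∧
      (exp (m * t + -l) * exp (u t θ)) ^ 2 ≤ 11 / 10 := by
  have e : (exp (m * t + -l) * exp (u t θ)) ^ 2 = exp (2 * relExp m l u t θ) := by
    rw [mul_pow, ← exp_nat_mul (u t θ), ← exp_sq_relExp]; norm_num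
  rw [e]
  exact exp_two_mul_bounds hν

theorem rescale_eq (m l : ℝ) (x : ℝ → ℝ → EuclideanSpace ℝ (Fin n)) (t θ : ℝ) :
    rescale m l x t θ = (exp (m * t + -l))⁻¹ • x t θ := by
  rw [rescale, ← exp_neg]; congr 2; ring

theorem quadratic_terms_le (hν : |relExp m l u t θ| ≤ 1 / 100) {D : ℝ}
    (hD : D ≤ ‖Att f u t θ‖ ^ 2 + 2 * ‖Atth f u t θ‖ ^ 2 + ‖Athth f u t θ‖ ^ 2) :
    6 * ‖rescale m l (Hmc f u) t θ‖ ^ 2 + 2 * (exp (m * t + -l) ^ 2 * D)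
      ≤ 100 * tripleSq (frameE1 m l f u) (frameE2 m l f u) (rescale m l (Hmc f u)) t θ := by
  have e := frame_energy m l f u t θ
  obtain ⟨h1, h2⟩ := exp_two_mul_bounds hν
  have d1 := mul_le_mul_of_nonneg_left hD (sq_nonneg (exp (m * t + -l)))
  rw [e] at d1
  unfold tripleSq
  generalize exp (2 * relExp m l u t θ) = w at *
  have p1 := sq_nonneg ‖frameE1 m l f u t θ‖
  have p2 := sq_nonneg ‖frameE2 m l f u t θ‖
  have p3 := sq_nonneg ‖rescale m l (Hmc f u) t θ‖
  have w1 : w ^ 2 ≤ 121 / 100 := by nlinarith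
  have q1 := mul_le_mul_of_nonneg_right w1 p3
  linarith

theorem norm_rescale_fluxT_le (h : ConfImm f u (Icc A B)) (ht : t ∈ Icc A B)
    (hν : |relExp m l u t θ| ≤ 1 / 100) : ‖rescale m l (fluxT f u) t θ‖
      ≤ 100 * tripleSq (frameE1 m l f u) (frameE2 m l f u) (rescale m l (Hmc f u)) t θ := by
  obtain ⟨h1, h2⟩ := exp_mul_sq_bounds hν
  have k := norm_quadratic_flux_le (H := Hmc f u t θ) (a := Att f u t θ) (b := Atth f u t θ)
    (exp_pos (u t θ)) (norm_eq_exp_of_sq (h.conf_t t ht θ)) (norm_eq_exp_of_sq (h.conf_th t ht θ))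
    (exp_pos (m * t + -l)) h1 h2
  have k2 := quadratic_terms_le (f := f) (D := ‖Att f u t θ‖ ^ 2 + ‖Atth f u t θ‖ ^ 2) hν
    (by nlinarith [sq_nonneg ‖Atth f u t θ‖, sq_nonneg ‖Athth f u t θ‖])
  have e : (exp (u t θ) ^ 2)⁻¹ = exp (-(2 * u t θ)) := by
    rw [← exp_nat_mul, ← exp_neg]; norm_num
  rw [e] at k
  have e3 := congrArg norm (rescale_eq m l (fluxT f u) t θ)
  have e4 := congrArg norm (rescale_eq m l (Hmc f u) t θ)
  rw [norm_smul, Real.norm_eq_abs, abs_of_pos (inv_pos.2 (exp_pos _))] at e3 e4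
  rw [e3]
  rw [e4] at k2
  refine (k.trans (le_of_eq ?_)).trans k2
  ring

theorem norm_rescale_fluxTh_le (h : ConfImm f u (Icc A B)) (ht : t ∈ Icc A B)
    (hν : |relExp m l u t θ| ≤ 1 / 100) : ‖rescale m l (fluxTh f u) t θ‖
      ≤ 100 * tripleSq (frameE1 m l f u) (frameE2 m l f u) (rescale m l (Hmc f u)) t θ := by
  obtain ⟨h1, h2⟩ := exp_mul_sq_bounds hν
  have k := norm_quadratic_flux_le (H := Hmc f u t θ) (a := Athth f u t θ) (b := Atth f u t θ)
    (exp_pos (u t θ)) (norm_eq_exp_of_sq (h.conf_th t ht θ)) (norm_eq_exp_of_sq (h.conf_t t ht θ))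
    (exp_pos (m * t + -l)) h1 h2
  have k2 := quadratic_terms_le (f := f) (D := ‖Athth f u t θ‖ ^ 2 + ‖Atth f u t θ‖ ^ 2) hν
    (by nlinarith [sq_nonneg ‖Atth f u t θ‖, sq_nonneg ‖Att f u t θ‖])
  have e : (exp (u t θ) ^ 2)⁻¹ = exp (-(2 * u t θ)) := by
    rw [← exp_nat_mul, ← exp_neg]; norm_num
  rw [e] at k
  have e3 := congrArg norm (rescale_eq m l (fluxTh f u) t θ)
  have e4 := congrArg norm (rescale_eq m l (Hmc f u) t θ)
  rw [norm_smul, Real.norm_eq_abs, abs_of_pos (inv_pos.2 (exp_pos _))] at e3 e4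
  rw [e3, fluxTh, add_comm (⟪Hmc f u t θ, Atth f u t θ⟫_ℝ • pt f t θ)]
  rw [e4] at k2
  refine (k.trans (le_of_eq ?_)).trans k2
  ring

end NormalizedEstimates

section FluxIdentity

variable {n : ℕ} {f : ℝ → ℝ → EuclideanSpace ℝ (Fin n)} {u : ℝ → ℝ → ℝ} {A B m l : ℝ} {t θ : ℝ}

/-- The infinitesimal rotation `x ↦ ⟪x, y⟫ z - ⟪x, z⟫ y`. -/
def wedge (y z : EuclideanSpace ℝ (Fin n)) :
    EuclideanSpace ℝ (Fin n) →L[ℝ] EuclideanSpace ℝ (Fin n) :=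
  (innerSL ℝ y).smulRight z - (innerSL ℝ z).smulRight y

theorem wedge_apply (y z x : EuclideanSpace ℝ (Fin n)) :
    wedge y z x = ⟪x, y⟫_ℝ • z - ⟪x, z⟫_ℝ • y := by
  simp [wedge, real_inner_comm]

/-- The matrix of `wedge y z`. -/
def wedgeMatrix (y z : EuclideanSpace ℝ (Fin n)) : Matrix (Fin n) (Fin n) ℝ :=
  Matrix.vecMulVec z.ofLp y.ofLp - Matrix.vecMulVec y.ofLp z.ofLp

theorem wedgeMatrix_transpose (y z : EuclideanSpace ℝ (Fin n)) :
    (wedgeMatrix y z).transpose = -wedgeMatrix y z := by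
  simp [wedgeMatrix, Matrix.transpose_vecMulVec]

theorem toEuclideanLin_wedgeMatrix (y z x : EuclideanSpace ℝ (Fin n)) :
    Matrix.toEuclideanLin (wedgeMatrix y z) x = wedge y z x := by
  ext i
  simp [wedge_apply, wedgeMatrix, Matrix.toLpLin_apply,
    Matrix.vecMulVec_mulVec, PiLp.inner_apply, dotProduct, mul_comm]

theorem continuous_slice_fst {E : Type*} [TopologicalSpace E] {x : ℝ → ℝ → E}
    (hx : Continuous fun p : ℝ × ℝ => x p.1 p.2) (t : ℝ) : Continuous fun θ => x t θ :=
  hx.comp (by fun_prop : Continuous fun θ : ℝ => (t, θ))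

theorem integral_sub_combination {E : Type*} [NormedAddCommGroup E] [NormedSpace ℝ E]
    {a b c : ℝ → E} {x y : ℝ} (ha : IntervalIntegrable a volume x y)
    (hb : IntervalIntegrable b volume x y) (hc : IntervalIntegrable c volume x y) (k j : ℝ) :
    ∫ θ in x..y, (a θ - (k • b θ + j • c θ))
      = (∫ θ in x..y, a θ) - (k • (∫ θ in x..y, b θ) + j • ∫ θ in x..y, c θ) := by
  have hb' : IntervalIntegrable (fun θ => k • b θ) volume x y := hb.smul k
  have hc' : IntervalIntegrable (fun θ => j • c θ) volume x y := hc.smul j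
  rw [intervalIntegral.integral_sub ha (hb'.add hc'), intervalIntegral.integral_add hb' hc',
    intervalIntegral.integral_smul, intervalIntegral.integral_smul]

theorem integral_fluxT_of_tau1 (hf : Sm f) (hu : Sm u)
    (h : ∀ c : EuclideanSpace ℝ (Fin n), tau1 f u c t = 0) :
    ∫ θ in (0 : ℝ)..(2 * π), (pt (Hmc f u) t θ - fluxT f u t θ) = 0 := by
  have i1 : IntervalIntegrable (fun θ => pt (Hmc f u) t θ) volume 0 (2 * π) :=
    (continuous_slice_fst (x := fun t θ => pt (Hmc f u) t θ) (by fun_prop) t).intervalIntegrable _ _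
  have i2 : IntervalIntegrable (fun θ => Real.exp (-(2 * u t θ)) •
        (⟪Hmc f u t θ, Att f u t θ⟫_ℝ • pt f t θ + ⟪Hmc f u t θ, Atth f u t θ⟫_ℝ • pth f t θ))
        volume 0 (2 * π) :=
    (continuous_slice_fst (x := fun t θ => Real.exp (-(2 * u t θ)) •
        (⟪Hmc f u t θ, Att f u t θ⟫_ℝ • pt f t θ + ⟪Hmc f u t θ, Atth f u t θ⟫_ℝ • pth f t θ))
        (by fun_prop) t).intervalIntegrable _ _
  have i3 : IntervalIntegrable (fun θ => ‖Hmc f u t θ‖ ^ 2 • pt f t θ) volume 0 (2 * π) :=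
    (continuous_slice_fst (x := fun t θ => ‖Hmc f u t θ‖ ^ 2 • pt f t θ)
      (by fun_prop) t).intervalIntegrable _ _
  have e : ∫ θ in (0 : ℝ)..(2 * π), (pt (Hmc f u) t θ - fluxT f u t θ)
      = (-1 / 2 : ℝ) • ((-2 : ℝ) • (∫ θ in (0 : ℝ)..(2 * π), pt (Hmc f u) t θ)
    - (4 : ℝ) • (∫ θ in (0 : ℝ)..(2 * π), Real.exp (-(2 * u t θ)) •
        (⟪Hmc f u t θ, Att f u t θ⟫_ℝ • pt f t θ + ⟪Hmc f u t θ, Atth f u t θ⟫_ℝ • pth f t θ))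
    + ∫ θ in (0 : ℝ)..(2 * π), ‖Hmc f u t θ‖ ^ 2 • pt f t θ) := by
    unfold fluxT
    rw [integral_sub_combination i1 i2 i3]
    module
  rw [e]
  have h2 := h ((-2 : ℝ) • (∫ θ in (0 : ℝ)..(2 * π), pt (Hmc f u) t θ)
    - (4 : ℝ) • (∫ θ in (0 : ℝ)..(2 * π), Real.exp (-(2 * u t θ)) •
        (⟪Hmc f u t θ, Att f u t θ⟫_ℝ • pt f t θ + ⟪Hmc f u t θ, Atth f u t θ⟫_ℝ • pth f t θ))
    + ∫ θ in (0 : ℝ)..(2 * π), ‖Hmc f u t θ‖ ^ 2 • pt f t θ)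
  rw [tau1, real_inner_self_eq_norm_sq] at h2
  rw [norm_eq_zero.1 (pow_eq_zero_iff (two_ne_zero)|>.1 h2), smul_zero]

theorem integral_fluxT_of_tau2 (hf : Sm f) (hu : Sm u)
    (h : ∀ S : Matrix (Fin n) (Fin n) ℝ, S.transpose = -S → tau2 f u S t = 0)
    (y z : EuclideanSpace ℝ (Fin n)) :
    ∫ θ in (0 : ℝ)..(2 * π), ⟪Hmc f u t θ, wedge y z (pt f t θ)⟫_ℝ
      = ∫ θ in (0 : ℝ)..(2 * π), ⟪pt (Hmc f u) t θ - fluxT f u t θ, wedge y z (f t θ)⟫_ℝ := by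
  have h2 := h (wedgeMatrix y z) (wedgeMatrix_transpose y z)
  unfold tau2 at h2
  simp only [toEuclideanLin_wedgeMatrix] at h2
  have e1 : ∀ θ, pt (fun a b => wedge y z (f a b)) t θ = wedge y z (pt f t θ) := fun θ =>
    pt_clm t θ (wedge y z) hf
  simp only [e1] at h2
  have i0 : IntervalIntegrable (fun θ => ⟪Hmc f u t θ, wedge y z (pt f t θ)⟫_ℝ) volume 0 (2 * π) :=
    (continuous_slice_fst (x := fun t θ => ⟪Hmc f u t θ, wedge y z (pt f t θ)⟫_ℝ)
      (by fun_prop) t).intervalIntegrable _ _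
  have i1 : IntervalIntegrable (fun θ => ⟪pt (Hmc f u) t θ, wedge y z (f t θ)⟫_ℝ)
      volume 0 (2 * π) :=
    (continuous_slice_fst (x := fun t θ => ⟪pt (Hmc f u) t θ, wedge y z (f t θ)⟫_ℝ)
      (by fun_prop) t).intervalIntegrable _ _
  have i2 : IntervalIntegrable (fun θ => Real.exp (-(2 * u t θ)) *
        (⟪Hmc f u t θ, Att f u t θ⟫_ℝ * ⟪pt f t θ, wedge y z (f t θ)⟫_ℝ
          + ⟪Hmc f u t θ, Atth f u t θ⟫_ℝ * ⟪pth f t θ, wedge y z (f t θ)⟫_ℝ)) volume 0 (2 * π) :=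
    (continuous_slice_fst (x := fun t θ => Real.exp (-(2 * u t θ)) *
        (⟪Hmc f u t θ, Att f u t θ⟫_ℝ * ⟪pt f t θ, wedge y z (f t θ)⟫_ℝ
          + ⟪Hmc f u t θ, Atth f u t θ⟫_ℝ * ⟪pth f t θ, wedge y z (f t θ)⟫_ℝ))
        (by fun_prop) t).intervalIntegrable _ _
  have i3 : IntervalIntegrable (fun θ => ‖Hmc f u t θ‖ ^ 2 * ⟪pt f t θ, wedge y z (f t θ)⟫_ℝ)
      volume 0 (2 * π) :=
    (continuous_slice_fst (x := fun t θ => ‖Hmc f u t θ‖ ^ 2 * ⟪pt f t θ, wedge y z (f t θ)⟫_ℝ)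
      (by fun_prop) t).intervalIntegrable _ _
  have e2 : ∀ θ, ⟪pt (Hmc f u) t θ - fluxT f u t θ, wedge y z (f t θ)⟫_ℝ
      = ⟪pt (Hmc f u) t θ, wedge y z (f t θ)⟫_ℝ - ((-2) * (Real.exp (-(2 * u t θ)) *
        (⟪Hmc f u t θ, Att f u t θ⟫_ℝ * ⟪pt f t θ, wedge y z (f t θ)⟫_ℝ
          + ⟪Hmc f u t θ, Atth f u t θ⟫_ℝ * ⟪pth f t θ, wedge y z (f t θ)⟫_ℝ))
        + (1 / 2) * (‖Hmc f u t θ‖ ^ 2 * ⟪pt f t θ, wedge y z (f t θ)⟫_ℝ)) := fun θ => by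
    simp only [fluxT, inner_sub_left, inner_add_left, real_inner_smul_left]
  simp only [e2]
  have k := integral_sub_combination i1 i2 i3 (-2) (1 / 2)
  simp only [smul_eq_mul] at k
  rw [k]
  rw [intervalIntegral.integral_sub i0 i1] at h2
  linarith

theorem frame_flux (hm : m ≠ 0) (hf : Sm f) (hu : Sm u)
    (h1 : ∀ c : EuclideanSpace ℝ (Fin n), tau1 f u c t = 0)
    (h2 : ∀ S : Matrix (Fin n) (Fin n) ℝ, S.transpose = -S → tau2 f u S t = 0)
    (y z : EuclideanSpace ℝ (Fin n)) :
    ∫ θ in (0 : ℝ)..(2 * π), ⟪pt (rescale m l (Hmc f u)) t θ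
        + (2 * m) • rescale m l (Hmc f u) t θ,
        wedge y z (cos (m * θ) • frameP m l f t θ + sin (m * θ) • frameR m l f t θ)⟫_ℝ
      = (∫ θ in (0 : ℝ)..(2 * π), ⟪rescale m l (fluxT f u) t θ,
        wedge y z (cos (m * θ) • frameP m l f t θ + sin (m * θ) • frameR m l f t θ)⟫_ℝ)
        + m * ∫ θ in (0 : ℝ)..(2 * π), ⟪pt (rescale m l (Hmc f u)) t θ
          + m • rescale m l (Hmc f u) t θ - rescale m l (fluxT f u) t θ,
          wedge y z (framePrim m l f t θ)⟫_ℝ := by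
  have hH : Sm (Hmc f u) := by unfold Sm; fun_prop
  have k1 := integral_fluxT_of_tau1 hf hu h1
  have k2 := integral_fluxT_of_tau2 hf hu h2 y z
  have e0 : ∀ θ, cos (m * θ) • frameP m l f t θ + sin (m * θ) • frameR m l f t θ
      = exp (m * t + -l) • pt f t θ := fun θ => by
    simp only [frameP, frameR]
    linear_combination (norm := module) cos_sq_add_sin_sq (m * θ) • exp (m * t + -l) • pt f t θ
  have ew : exp (-m * t + l) * exp (m * t + -l) = 1 := by
    rw [← exp_add, ← exp_zero]; congr 1; ring
  have e1 : ∀ θ, ⟪pt (rescale m l (Hmc f u)) t θ + (2 * m) • rescale m l (Hmc f u) t θ,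
        wedge y z (cos (m * θ) • frameP m l f t θ + sin (m * θ) • frameR m l f t θ)⟫_ℝ
      = ⟪pt (Hmc f u) t θ, wedge y z (pt f t θ)⟫_ℝ
        + m * ⟪Hmc f u t θ, wedge y z (pt f t θ)⟫_ℝ := fun θ => by
    rw [e0, pt_rescale m l hH]
    simp only [rescale, map_smul, inner_add_left, inner_sub_left, real_inner_smul_left,
      real_inner_smul_right, smul_sub]
    linear_combination (⟪pt (Hmc f u) t θ, wedge y z (pt f t θ)⟫_ℝ
        + m * ⟪Hmc f u t θ, wedge y z (pt f t θ)⟫_ℝ) * ew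
  have e2 : ∀ θ, ⟪rescale m l (fluxT f u) t θ,
        wedge y z (cos (m * θ) • frameP m l f t θ + sin (m * θ) • frameR m l f t θ)⟫_ℝ
      = ⟪fluxT f u t θ, wedge y z (pt f t θ)⟫_ℝ := fun θ => by
    rw [e0]
    simp only [rescale, map_smul, real_inner_smul_left, real_inner_smul_right]
    linear_combination ⟪fluxT f u t θ, wedge y z (pt f t θ)⟫_ℝ * ew
  have e3 : ∀ θ, ⟪pt (rescale m l (Hmc f u)) t θ
          + m • rescale m l (Hmc f u) t θ - rescale m l (fluxT f u) t θ,
          wedge y z (framePrim m l f t θ)⟫_ℝ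
      = ⟪pt (Hmc f u) t θ - fluxT f u t θ, wedge y z (f t θ)⟫_ℝ
        + ((1 / m) * ⟪pt (Hmc f u) t θ - fluxT f u t θ, wedge y z (pt f t θ)⟫_ℝ
        - ⟪pt (Hmc f u) t θ - fluxT f u t θ, wedge y z (f t 0 + (1 / m) • pt f t 0)⟫_ℝ) := fun θ => by
    have d1 : pt (rescale m l (Hmc f u)) t θ + m • rescale m l (Hmc f u) t θ
        - rescale m l (fluxT f u) t θ
        = exp (-m * t + l) • (pt (Hmc f u) t θ - fluxT f u t θ) := by
      rw [pt_rescale m l hH]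
      simp only [rescale]
      module
    rw [d1, framePrim]
    generalize f t 0 + (1 / m) • pt f t 0 = q
    generalize pt (Hmc f u) t θ - fluxT f u t θ = D
    simp only [map_smul, map_sub, map_add, real_inner_smul_left, inner_add_right, inner_sub_right,
      real_inner_smul_right]
    linear_combination (⟪D, wedge y z (f t θ)⟫_ℝ + ((1 / m) * ⟪D, wedge y z (pt f t θ)⟫_ℝ
      - ⟪D, wedge y z q⟫_ℝ)) * ew
  simp only [e1, e2, e3]
  have hfl : Sm (fluxT f u) := by unfold Sm; fun_prop
  have k3 : ∀ q : EuclideanSpace ℝ (Fin n),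
      ∫ θ in (0 : ℝ)..(2 * π), ⟪pt (Hmc f u) t θ - fluxT f u t θ, q⟫_ℝ = 0 := fun q => by
    have i1 : IntervalIntegrable (fun θ => pt (Hmc f u) t θ - fluxT f u t θ) volume 0 (2 * π) :=
      (continuous_slice_fst (x := fun t θ => pt (Hmc f u) t θ - fluxT f u t θ)
        (by fun_prop) t).intervalIntegrable _ _
    have c := (innerSL ℝ q).intervalIntegral_comp_comm i1
    rw [k1, map_zero] at c
    exact (intervalIntegral.integral_congr fun θ _ =>
      real_inner_comm q (pt (Hmc f u) t θ - fluxT f u t θ)).trans c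
  have i0 : IntervalIntegrable (fun θ => ⟪Hmc f u t θ, wedge y z (pt f t θ)⟫_ℝ) volume 0 (2 * π) :=
    (continuous_slice_fst (x := fun t θ => ⟪Hmc f u t θ, wedge y z (pt f t θ)⟫_ℝ)
      (by fun_prop) t).intervalIntegrable _ _
  have i1 : IntervalIntegrable (fun θ => ⟪pt (Hmc f u) t θ, wedge y z (pt f t θ)⟫_ℝ)
      volume 0 (2 * π) :=
    (continuous_slice_fst (x := fun t θ => ⟪pt (Hmc f u) t θ, wedge y z (pt f t θ)⟫_ℝ)
      (by fun_prop) t).intervalIntegrable _ _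
  have i2 : IntervalIntegrable (fun θ => ⟪fluxT f u t θ, wedge y z (pt f t θ)⟫_ℝ)
      volume 0 (2 * π) :=
    (continuous_slice_fst (x := fun t θ => ⟪fluxT f u t θ, wedge y z (pt f t θ)⟫_ℝ)
      (by fun_prop) t).intervalIntegrable _ _
  have i3 : IntervalIntegrable (fun θ => ⟪pt (Hmc f u) t θ - fluxT f u t θ, wedge y z (f t θ)⟫_ℝ)
      volume 0 (2 * π) :=
    (continuous_slice_fst
      (x := fun t θ => ⟪pt (Hmc f u) t θ - fluxT f u t θ, wedge y z (f t θ)⟫_ℝ)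
      (by fun_prop) t).intervalIntegrable _ _
  have i4 : IntervalIntegrable
      (fun θ => (1 / m) * ⟪pt (Hmc f u) t θ - fluxT f u t θ, wedge y z (pt f t θ)⟫_ℝ)
      volume 0 (2 * π) :=
    (continuous_slice_fst
      (x := fun t θ => (1 / m) * ⟪pt (Hmc f u) t θ - fluxT f u t θ, wedge y z (pt f t θ)⟫_ℝ)
      (by fun_prop) t).intervalIntegrable _ _
  have i5 : IntervalIntegrable (fun θ => ⟪pt (Hmc f u) t θ - fluxT f u t θ,
      wedge y z (f t 0 + (1 / m) • pt f t 0)⟫_ℝ) volume 0 (2 * π) :=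
    (continuous_slice_fst (x := fun t θ => ⟪pt (Hmc f u) t θ - fluxT f u t θ,
      wedge y z (f t 0 + (1 / m) • pt f t 0)⟫_ℝ) (by fun_prop) t).intervalIntegrable _ _
  rw [intervalIntegral.integral_add i1 (i0.const_mul m), intervalIntegral.integral_const_mul,
    intervalIntegral.integral_add i3 (i4.sub i5), intervalIntegral.integral_sub i4 i5,
    k3, ← k2, intervalIntegral.integral_const_mul]
  simp only [inner_sub_left]
  rw [intervalIntegral.integral_sub i1 i2]
  field_simp
  ring

end FluxIdentity

section NeckOfConformal

variable {n : ℕ} {f : ℝ → ℝ → EuclideanSpace ℝ (Fin n)} {u : ℝ → ℝ → ℝ} {A B m l : ℝ} {t θ : ℝ}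

theorem pth_framePrim (m l : ℝ) (hf : Sm f) (t θ : ℝ) :
    pth (framePrim m l f) t θ = exp (m * t + -l) • (pth f t θ + (1 / m) • pt (pth f) t θ) := by
  unfold framePrim
  rw [pth_exp_smul m (-l) (F := fun t θ => f t θ + (1 / m) • pt f t θ
      - (f t 0 + (1 / m) • pt f t 0)) ?_]
  · rw [pth_sub t θ (by fun_prop) ?_, pth_add t θ hf (by fun_prop),
      pth_smul (a := fun _ _ => 1 / m) t θ (by fun_prop) (by fun_prop), pth_const,
      pth_fst t θ (fun t => f t 0 + (1 / m) • pt f t 0), ← pt_pth_comm hf]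
    · module
    · have h1 : ContDiff ℝ (⊤ : ℕ∞) (fun p : ℝ × ℝ => f p.1 0) :=
        hf.comp (by fun_prop : ContDiff ℝ (⊤ : ℕ∞) fun p : ℝ × ℝ => (p.1, (0 : ℝ)))
      have h2 : ContDiff ℝ (⊤ : ℕ∞) (fun p : ℝ × ℝ => pt f p.1 0) :=
        (contDiff_pt hf).comp (by fun_prop : ContDiff ℝ (⊤ : ℕ∞) fun p : ℝ × ℝ => (p.1, (0 : ℝ)))
      fun_prop
  · have h1 : ContDiff ℝ (⊤ : ℕ∞) (fun p : ℝ × ℝ => f p.1 0) :=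
      hf.comp (by fun_prop : ContDiff ℝ (⊤ : ℕ∞) fun p : ℝ × ℝ => (p.1, (0 : ℝ)))
    have h2 : ContDiff ℝ (⊤ : ℕ∞) (fun p : ℝ × ℝ => pt f p.1 0) :=
      (contDiff_pt hf).comp (by fun_prop : ContDiff ℝ (⊤ : ℕ∞) fun p : ℝ × ℝ => (p.1, (0 : ℝ)))
    unfold Sm; fun_prop

theorem contDiff_framePrim (m l : ℝ) (hf : Sm f) : Sm (framePrim m l f) := by
  have h1 : ContDiff ℝ (⊤ : ℕ∞) (fun p : ℝ × ℝ => f p.1 0) :=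
    hf.comp (by fun_prop : ContDiff ℝ (⊤ : ℕ∞) fun p : ℝ × ℝ => (p.1, (0 : ℝ)))
  have h2 : ContDiff ℝ (⊤ : ℕ∞) (fun p : ℝ × ℝ => pt f p.1 0) :=
    (contDiff_pt hf).comp (by fun_prop : ContDiff ℝ (⊤ : ℕ∞) fun p : ℝ × ℝ => (p.1, (0 : ℝ)))
  unfold Sm framePrim; fun_prop

theorem pth_framePrim_le (hm : 1 ≤ m) (h : ConfImm f u (Icc A B)) (ht : t ∈ Icc A B)
    (hν : |relExp m l u t θ| ≤ 1 / 100) :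
    ‖pth (framePrim m l f) t θ‖ ≤ 2 * (‖frameE1 m l f u t θ‖ + ‖frameE2 m l f u t θ‖)
      + 4 * (|pt (relExp m l u) t θ| + |pth (relExp m l u) t θ|) := by
  have hm0 : 0 < m := by linarith
  obtain ⟨h1, h2⟩ := exp_mul_sq_bounds hν
  have hw : exp (m * t + -l) * exp (u t θ) ≤ 2 := by
    nlinarith [mul_pos (exp_pos (m * t + -l)) (exp_pos (u t θ))]
  have e : pth (framePrim m l f) t θ = (1 / m) • ((sin (m * θ) • frameE1 m l f u t θ
      - cos (m * θ) • frameE2 m l f u t θ)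
      + exp (m * t + -l) • (pth (relExp m l u) t θ • pt f t θ
        + pt (relExp m l u) t θ • pth f t θ)) := by
    have e1 : sin (m * θ) • frameE1 m l f u t θ - cos (m * θ) • frameE2 m l f u t θ
        = exp (m * t + -l) • Atth f u t θ := by
      simp only [frameE1, frameE2]
      linear_combination (norm := module)
        cos_sq_add_sin_sq (m * θ) • exp (m * t + -l) • Atth f u t θ
    have e2 : pth f t θ = (1 / m) • m • pth f t θ := by
      rw [smul_smul, one_div_mul_cancel hm0.ne', one_smul]
    rw [e1, pth_framePrim m l h.smooth_f, pt_relExp m l h.smooth_u, pth_relExp m l h.smooth_u, Atth]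
    linear_combination (norm := module) exp (m * t + -l) • e2
  have nt := norm_eq_exp_of_sq (h.conf_t t ht θ)
  have nth := norm_eq_exp_of_sq (h.conf_th t ht θ)
  rw [e, norm_smul, Real.norm_eq_abs, abs_of_pos (by positivity : 0 < 1 / m)]
  have k1 : ‖sin (m * θ) • frameE1 m l f u t θ - cos (m * θ) • frameE2 m l f u t θ‖
      ≤ ‖frameE1 m l f u t θ‖ + ‖frameE2 m l f u t θ‖ := by
    refine (norm_sub_le _ _).trans (add_le_add ?_ ?_) <;> rw [norm_smul, Real.norm_eq_abs]
    · exact mul_le_of_le_one_left (norm_nonneg _) (abs_sin_le_one _)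
    · exact mul_le_of_le_one_left (norm_nonneg _) (abs_cos_le_one _)
  have k2 : ‖exp (m * t + -l) • (pth (relExp m l u) t θ • pt f t θ
        + pt (relExp m l u) t θ • pth f t θ)‖
      ≤ 2 * (|pt (relExp m l u) t θ| + |pth (relExp m l u) t θ|) := by
    have k3 : ‖pth (relExp m l u) t θ • pt f t θ + pt (relExp m l u) t θ • pth f t θ‖
        ≤ (|pt (relExp m l u) t θ| + |pth (relExp m l u) t θ|) * exp (u t θ) := by
      refine (norm_add_le _ _).trans (le_of_eq ?_)
      rw [norm_smul, norm_smul, nt, nth, Real.norm_eq_abs, Real.norm_eq_abs]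
      ring
    rw [norm_smul, Real.norm_eq_abs, abs_of_pos (exp_pos _)]
    refine (mul_le_mul_of_nonneg_left k3 (exp_pos _).le).trans ?_
    have := mul_le_mul_of_nonneg_right hw
      (add_nonneg (abs_nonneg (pt (relExp m l u) t θ)) (abs_nonneg (pth (relExp m l u) t θ)))
    linarith
  have k4 := norm_add_le (sin (m * θ) • frameE1 m l f u t θ - cos (m * θ) • frameE2 m l f u t θ)
    (exp (m * t + -l) • (pth (relExp m l u) t θ • pt f t θ
        + pt (relExp m l u) t θ • pth f t θ))
  have hm1 : 1 / m ≤ 1 := by rw [div_le_one hm0]; exact hm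
  refine (mul_le_of_le_one_left (norm_nonneg _) hm1).trans ?_
  have := abs_nonneg (pt (relExp m l u) t θ)
  have := abs_nonneg (pth (relExp m l u) t θ)
  linarith [norm_nonneg (frameE1 m l f u t θ), norm_nonneg (frameE2 m l f u t θ)]

theorem cos_natCast_mul_add_two_pi (m : ℕ) (θ : ℝ) :
    cos (m * (θ + 2 * π)) = cos (m * θ) := by
  rw [mul_add]; exact cos_add_nat_mul_two_pi _ m

theorem sin_natCast_mul_add_two_pi (m : ℕ) (θ : ℝ) :
    sin (m * (θ + 2 * π)) = sin (m * θ) := by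
  rw [mul_add]; exact sin_add_nat_mul_two_pi _ m

/-- A conformal Willmore immersion with vanishing residues gives a neck after normalisation. -/
theorem ConfWillmore.neck (h : ConfWillmore f u (Icc A B)) (hAB : A < B) {m : ℕ} (hm : 0 < m)
    (h1 : ∀ t ∈ Icc A B, ∀ c : EuclideanSpace ℝ (Fin n), tau1 f u c t = 0)
    (h2 : ∀ t ∈ Icc A B, ∀ S : Matrix (Fin n) (Fin n) ℝ, S.transpose = -S → tau2 f u S t = 0)
    {a b l ε : ℝ} (hab : Icc a b ⊆ Icc A B) (hε : ε ≤ 1 / 100)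
    (b0 : ∀ t ∈ Icc a b, ∀ θ, |relExp m l u t θ| ≤ ε)
    (b1 : ∀ t ∈ Icc a b, ∀ θ, |pt (relExp m l u) t θ| ≤ ε)
    (b2 : ∀ t ∈ Icc a b, ∀ θ, |pth (relExp m l u) t θ| ≤ ε) :
    Neck m a b 100 ε (fun θ => cos (m * θ)) (fun θ => sin (m * θ)) (relExp m l u)
      (frameP m l f) (frameR m l f) (rescale m l (Hmc f u)) (rescale m l (fluxT f u))
      (rescale m l (fluxTh f u)) (framePrim m l f) (frameE1 m l f u) (frameE2 m l f u) := by
  have hf : Sm f := h.smooth_f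
  have hu : Sm u := h.smooth_u
  have pf : Per f := h.periodic_f
  have pu : Per u := h.periodic_u
  have hm1 : (1 : ℝ) ≤ m := by exact_mod_cast hm
  have hν : Sm (relExp m l u) := by unfold Sm relExp; fun_prop
  have pH : Per (Hmc f u) := fun t θ => by
    simp only [Hmc, pu t θ, pf.pt.pt t θ, pf.pth.pth t θ]
  have pA : Per (Att f u) := fun t θ => by
    simp only [Att, pf.pt.pt t θ, pf.pt t θ, pf.pth t θ, pu.pt t θ, pu.pth t θ]
  have pB : Per (Atth f u) := fun t θ => by
    simp only [Atth, pf.pth.pt t θ, pf.pt t θ, pf.pth t θ, pu.pt t θ, pu.pth t θ]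
  have pD : Per (Athth f u) := fun t θ => by
    simp only [Athth, pf.pth.pth t θ, pf.pt t θ, pf.pth t θ, pu.pt t θ, pu.pth t θ]
  have c := cos_natCast_mul_add_two_pi m
  have s := sin_natCast_mul_add_two_pi m
  have bν : ∀ t ∈ Icc a b, ∀ θ, |relExp m l u t θ| ≤ 1 / 100 := fun t ht θ =>
    (b0 t ht θ).trans hε
  exact
  { one_le := hm1
    c_smooth := by fun_prop
    s_smooth := by fun_prop
    c_deriv := deriv_cos_mul m
    s_deriv := deriv_sin_mul m
    sq_add_sq := fun θ => cos_sq_add_sin_sq _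
    c_per := c
    s_per := s
    E_smooth := by unfold Sm; fun_prop
    P_smooth := by unfold Sm frameP; fun_prop
    R_smooth := by unfold Sm frameR; fun_prop
    N_smooth := by unfold Sm; fun_prop
    yt_smooth := by unfold Sm; fun_prop
    yh_smooth := by unfold Sm; fun_prop
    E_per := fun t θ => by simp only [relExp, pu t θ]
    P_per := fun t θ => by simp only [frameP, pf.pt t θ, pf.pth t θ, c, s]
    R_per := fun t θ => by simp only [frameR, pf.pt t θ, pf.pth t θ, c, s]
    N_per := fun t θ => by simp only [rescale, pH t θ]
    yt_per := fun t θ => by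
      simp only [rescale, fluxT, pH t θ, pA t θ, pB t θ, pf.pt t θ, pf.pth t θ, pu t θ]
    yh_per := fun t θ => by
      simp only [rescale, fluxTh, pH t θ, pB t θ, pD t θ, pf.pt t θ, pf.pth t θ, pu t θ]
    first := frame_first m l hf
    second := frame_second m l hf
    willmore := fun t ht θ => frame_willmore m l h (hab ht) θ
    one_le_K := by norm_num
    nu_smooth := hν
    γ_smooth := contDiff_framePrim m l hf
    E1_smooth := by unfold Sm frameE1 traceFreeD; fun_prop
    E2_smooth := by unfold Sm frameE2 traceFreeD; fun_prop
    E1_per := fun t θ => by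
      simp only [frameE1, traceFreeD, pA t θ, pB t θ, pD t θ, c, s]
    E2_per := fun t θ => by
      simp only [frameE2, traceFreeD, pA t θ, pB t θ, pD t θ, c, s]
    ε_le := hε
    nu_le := b0
    nu_t_le := b1
    nu_th_le := b2
    E1_eq := frameE1_eq m l hf hu
    E2_eq := frameE2_eq m l hf hu
    norm_p := fun t ht θ => norm_frameP h.toConfImm (hab ht)
    norm_r := fun t ht θ => norm_frameR h.toConfImm (hab ht)
    inner_p_r := fun t ht θ => inner_frameP_frameR h.toConfImm (hab ht)
    inner_N := fun t ht θ => inner_frame_normal m l (inner_rescale_Hmc h.toConfImm hAB (hab ht))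
    inner_E1 := fun t ht θ => inner_frame_normal m l (inner_frameE1 h.toConfImm hAB (hab ht))
    inner_E2 := fun t ht θ => inner_frame_normal m l (inner_frameE2 h.toConfImm hAB (hab ht))
    gauss := fun t ht θ => laplace_relExp_le h.toConfImm hAB (hab ht) (bν t ht θ)
    yt_le := fun t ht θ => norm_rescale_fluxT_le h.toConfImm (hab ht) (bν t ht θ)
    yh_le := fun t ht θ => norm_rescale_fluxTh_le h.toConfImm (hab ht) (bν t ht θ)
    flux := fun t ht y z => by
      simpa only [wedge_apply] using frame_flux (l := l) (by positivity : (m : ℝ) ≠ 0) hf hu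
        (h1 t (hab ht)) (h2 t (hab ht)) y z
    γ_zero := fun t ht => by simp [framePrim]
    γ_th_le := fun t ht θ => pth_framePrim_le hm1 h.toConfImm (hab ht) (bν t ht θ) }

end NeckOfConformal

section EnergyDecay

/-- A discrete maximum principle: a sequence dominated by a small multiple of its neighbours decays
geometrically away from both ends. -/
theorem le_of_neighbour_decay {a : ℕ → ℝ} {x : ℝ} {M : ℕ} (hx0 : 0 < x) (hx1 : x < 1)
    (h0 : 0 ≤ a 0) (hM : 0 ≤ a M)
    (h : ∀ j, j + 2 ≤ M → a (j + 1) ≤ x / 4 * (a j + a (j + 1) + a (j + 2))) :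
    ∀ j ≤ M, a j ≤ x ^ j * a 0 + x ^ (M - j) * a M := by
  obtain ⟨d, hd⟩ : ∃ d : ℕ → ℝ, d = fun j => a j - (x ^ j * a 0 + x ^ (M - j) * a M) := ⟨_, rfl⟩
  obtain ⟨i, hi, hmax⟩ := Finset.exists_max_image (Finset.range (M + 1)) d ⟨0, by simp⟩
  have hiM : i ≤ M := Nat.lt_succ_iff.mp (Finset.mem_range.mp hi)
  have key : d i ≤ 0 := by
    by_contra! hpos
    rcases i with _ | j
    · simp only [hd, pow_zero, one_mul] at hpos
      have := mul_nonneg (pow_nonneg hx0.le (M - 0)) hM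
      linarith
    rcases Nat.lt_or_ge (j + 1) M with hlt | hge
    · obtain ⟨r, rfl⟩ := Nat.exists_eq_add_of_le hlt
      have e0 : j.succ + 1 + r - j = r + 2 := by omega
      have e1 : j.succ + 1 + r - (j + 1) = r + 1 := by omega
      have e2 : j.succ + 1 + r - (j + 2) = r := by omega
      have m0 := hmax j (Finset.mem_range.mpr (by omega))
      have m2 := hmax (j + 2) (Finset.mem_range.mpr (by omega))
      have hj := h j (by omega)
      simp only [hd] at m0 m2 hpos
      rw [e1] at hpos
      rw [e0, e1] at m0
      rw [e2, e1] at m2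
      generalize a (j.succ + 1 + r) = B at *
      have hA : 0 ≤ x ^ j * a 0 := mul_nonneg (pow_nonneg hx0.le _) h0
      have hB : 0 ≤ x ^ r * B := mul_nonneg (pow_nonneg hx0.le _) hM
      have p1 : x ^ (j + 1) * a 0 = x * (x ^ j * a 0) := by ring
      have p2 : x ^ (j + 2) * a 0 = x * (x * (x ^ j * a 0)) := by ring
      have p3 : x ^ (r + 1) * B = x * (x ^ r * B) := by ring
      have p4 : x ^ (r + 2) * B = x * (x * (x ^ r * B)) := by ring
      rw [p1, p3] at m0 m2 hpos
      rw [p4] at m0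
      rw [p2] at m2
      generalize x ^ j * a 0 = A at *
      generalize x ^ r * B = R at *
      generalize a j = y0 at *
      generalize a (j + 1) = y1 at *
      generalize a (j + 2) = y2 at *
      have s1 : x * (x * A) ≤ x * A := by
        have := mul_nonneg hx0.le hA
        nlinarith
      have s2 : x * (x * R) ≤ x * R := by
        have := mul_nonneg hx0.le hB
        nlinarith
      have s3 : x * A ≤ A := by nlinarith
      have s4 : x * R ≤ R := by nlinarith
      have t := mul_le_mul_of_nonneg_left
        (show y0 + y1 + y2 ≤ 3 * (y1 - (x * A + x * R)) + 3 * (A + R) by linarith) hx0.le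
      nlinarith
    · have : M = j + 1 := le_antisymm hge hiM
      subst this
      simp only [hd, Nat.sub_self, pow_zero, one_mul] at hpos
      have := mul_nonneg (pow_nonneg hx0.le (j + 1)) h0
      linarith
  intro j hj
  have := hmax j (Finset.mem_range.mpr (by omega))
  simp only [hd] at this key
  linarith

theorem abs_pt_le_gradNorm (v : ℝ → ℝ → ℝ) (t θ : ℝ) : |pt v t θ| ≤ gradNorm v t θ :=
  Real.abs_le_sqrt (le_add_of_nonneg_right (sq_nonneg _))

theorem abs_pth_le_gradNorm (v : ℝ → ℝ → ℝ) (t θ : ℝ) : |pth v t θ| ≤ gradNorm v t θ :=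
  Real.abs_le_sqrt (le_add_of_nonneg_left (sq_nonneg _))

/-- The oscillation of a periodic function on a cylinder is controlled by its gradient. -/
theorem abs_sub_le_of_gradNorm_le {v : ℝ → ℝ → ℝ} (hv : Sm v) (hp : Per v) {a b β : ℝ}
    (hβ : 0 ≤ β) (h : ∀ t ∈ Icc a b, ∀ θ, gradNorm v t θ ≤ β) {t : ℝ} (ht : t ∈ Icc a b) (θ : ℝ) :
    |v t θ - v a 0| ≤ β * (b - a + 2 * π) := by
  obtain ⟨φ, hφ, hvφ⟩ : ∃ φ ∈ Ico (0 : ℝ) (0 + 2 * π), v t θ = v t φ :=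
    Function.Periodic.exists_mem_Ico (f := fun θ => v t θ) (fun θ => hp t θ)
      (by positivity) θ 0
  have ha : a ∈ Icc a b := left_mem_Icc.mpr (ht.1.trans ht.2)
  have h1 : ‖v t φ - v t 0‖ ≤ β * ‖φ - 0‖ :=
    Convex.norm_image_sub_le_of_norm_hasDerivWithin_le (s := univ) (f := fun θ => v t θ)
      (fun θ _ => (Sm.hasDerivAt_th hv t θ).hasDerivWithinAt)
      (fun θ _ => (abs_pth_le_gradNorm v t θ).trans (h t ht θ)) convex_univ trivial trivial
  have h2 : ‖v t 0 - v a 0‖ ≤ β * ‖t - a‖ :=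
    Convex.norm_image_sub_le_of_norm_hasDerivWithin_le (s := Icc a b) (f := fun s => v s 0)
      (fun s _ => (Sm.hasDerivAt_t hv s 0).hasDerivWithinAt)
      (fun s hs => (abs_pt_le_gradNorm v s 0).trans (h s hs 0)) (convex_Icc a b) ha ht
  simp only [Real.norm_eq_abs] at h1 h2
  have h3 : |φ - 0| ≤ 2 * π := by
    rw [sub_zero, abs_of_nonneg hφ.1]
    linarith [hφ.2]
  have h4 : |t - a| ≤ b - a := by
    rw [abs_of_nonneg (by linarith [ht.1])]
    linarith [ht.2]
  have h5 := mul_le_mul_of_nonneg_left h3 hβ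
  have h6 := mul_le_mul_of_nonneg_left h4 hβ
  have h7 := abs_sub_le (v t φ) (v t 0) (v a 0)
  rw [hvφ]
  linarith

theorem cylInt_eq_sum {F : ℝ → ℝ → ℝ} (hF : Continuous (fun p : ℝ × ℝ => F p.1 p.2)) {ℓ : ℝ}
    (hℓ : 0 < ℓ) (i p : ℕ) (hp : 0 < p) :
    cylInt F (i * ℓ) ((i + p : ℕ) * ℓ)
      = ∑ r ∈ Finset.range p, cylInt F ((i + r : ℕ) * ℓ) ((i + r + 1 : ℕ) * ℓ) := by
  induction p, hp using Nat.le_induction with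
  | base => simp
  | succ p hp ih =>
    rw [Finset.sum_range_succ, ← ih]
    refine cylInt_split ?_ ?_ hF
    · push_cast
      nlinarith [Nat.cast_nonneg (α := ℝ) p]
    · push_cast
      nlinarith

theorem exists_cell {L t : ℝ} {k : ℕ} (hL : 0 < L) (hk : 1 ≤ k)
    (ht : t ∈ Icc (0 : ℝ) (k * L)) :
    ∃ i : ℕ, 1 ≤ i ∧ i ≤ k ∧ t ∈ Icc (((i : ℝ) - 1) * L) ((i : ℝ) * L) := by
  have h1 : t / L ≤ k := by rw [div_le_iff₀ hL]; exact ht.2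
  rcases Nat.eq_zero_or_pos ⌈t / L⌉₊ with h0 | hpos
  · refine ⟨1, le_rfl, hk, ?_, ?_⟩
    · simpa using ht.1
    · have := Nat.ceil_eq_zero.mp h0
      have h2 := (div_le_iff₀ hL).mp this
      push_cast
      linarith
  · refine ⟨⌈t / L⌉₊, hpos, Nat.ceil_le.mpr h1, ?_, ?_⟩
    · have := Nat.ceil_lt_add_one (div_nonneg ht.1 hL.le)
      exact ((le_div_iff₀ hL).mp (by linarith))
    · exact (div_le_iff₀ hL).mp (Nat.le_ceil _)

/-- Decay of the energy across a window of three cells. -/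
theorem exists_energy_window_decay {m : ℕ} (hm : 0 < m) {q : ℝ} (hq0 : 0 < q) (hq2 : q < 2) :
    ∃ ℓ₀ : ℝ, 5 ≤ ℓ₀ ∧ ∃ δ : ℝ, 0 < δ ∧ ∀ ℓ ∈ Icc ℓ₀ (2 * ℓ₀), ∀ {n : ℕ}
      {f : ℝ → ℝ → EuclideanSpace ℝ (Fin n)} {v : ℝ → ℝ → ℝ} {A B : ℝ}, A < B →
      ConfWillmore f (fun t θ => -(m : ℝ) * t + v t θ) (Icc A B) →
      (∀ t ∈ Icc A B, ∀ c : EuclideanSpace ℝ (Fin n),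
        tau1 f (fun t θ => -(m : ℝ) * t + v t θ) c t = 0) →
      (∀ t ∈ Icc A B, ∀ S : Matrix (Fin n) (Fin n) ℝ, S.transpose = -S →
        tau2 f (fun t θ => -(m : ℝ) * t + v t θ) S t = 0) →
      ∀ a, Icc a (a + 3 * ℓ) ⊆ Icc A B → (∀ t ∈ Icc a (a + 3 * ℓ), ∀ θ, gradNorm v t θ ≤ δ) →
      cylInt (Adens f (fun t θ => -(m : ℝ) * t + v t θ)) a (a + 3 * ℓ) ≤ δ →
      cylInt (Adens f (fun t θ => -(m : ℝ) * t + v t θ)) (a + ℓ) (a + 2 * ℓ)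
        ≤ exp (-(q * ℓ)) / 4
          * cylInt (Adens f (fun t θ => -(m : ℝ) * t + v t θ)) a (a + 3 * ℓ) := by
  obtain ⟨ℓ₀, hℓ₀, δ, hδ, hdec⟩ :=
    exists_window_decay (K := 100) (by exact_mod_cast hm : (1 : ℝ) ≤ m) hq0 hq2
  obtain ⟨Λ, hΛ⟩ : ∃ Λ, Λ = 6 * ℓ₀ + 2 * π + 4 := ⟨_, rfl⟩
  have hΛ4 : 4 ≤ Λ := by linarith [Real.pi_pos]
  have hΛ0 : 0 < Λ := by linarith
  obtain ⟨ε, hε⟩ : ∃ ε, ε = min δ (1 / 100) := ⟨_, rfl⟩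
  have hε0 : 0 < ε := by rw [hε]; positivity
  have hεδ : ε ≤ δ := hε ▸ min_le_left _ _
  have hε1 : ε ≤ 1 / 100 := hε ▸ min_le_right _ _
  refine ⟨ℓ₀, hℓ₀, ε / Λ, by positivity, ?_⟩
  intro ℓ hℓ n f v A B hAB h h1 h2 a hab hgrad hen
  have hℓ0 : 0 < ℓ := by linarith [hℓ.1]
  have hmul : ε / Λ * Λ = ε := div_mul_cancel₀ ε hΛ0.ne'
  have hpos : 0 < ε / Λ := by positivity
  have hsmall : ε / Λ * 4 ≤ ε := by
    have := mul_le_mul_of_nonneg_left hΛ4 hpos.le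
    linarith
  have hu : Sm (fun t θ => -(m : ℝ) * t + v t θ) := h.smooth_u
  have hf : Sm f := h.smooth_f
  have hv : Sm v := by
    have e : v = fun t θ => (-(m : ℝ) * t + v t θ) + m * t := by
      funext t θ; ring
    rw [e]
    unfold Sm
    exact hu.add (by fun_prop)
  have hvp : Per v := fun t θ => by
    have := h.periodic_u t θ
    simpa using this
  have hrel : ∀ l, relExp m l (fun t θ => -(m : ℝ) * t + v t θ) = fun t θ => v t θ - l := by
    intro l
    funext t θ
    unfold relExp
    ring
  have hpt : ∀ l t θ, pt (fun t θ => v t θ - l) t θ = pt v t θ := by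
    intro l t θ
    rw [pt_sub t θ hv (by fun_prop), pt_const, sub_zero]
  have hpth : ∀ l t θ, pth (fun t θ => v t θ - l) t θ = pth v t θ := by
    intro l t θ
    rw [pth_sub t θ hv (by fun_prop), pth_const, sub_zero]
  have hosc : ∀ t ∈ Icc a (a + 3 * ℓ), ∀ θ, |v t θ - v a 0| ≤ ε := by
    intro t ht θ
    refine (abs_sub_le_of_gradNorm_le hv hvp hpos.le hgrad ht θ).trans ?_
    have : a + 3 * ℓ - a + 2 * π ≤ Λ := by linarith [hℓ.2]
    have := mul_le_mul_of_nonneg_left this hpos.le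
    linarith
  have hneck := h.neck hAB hm h1 h2 (l := v a 0) hab hε1
    (by rw [hrel]; exact hosc)
    (by
      intro t ht θ
      rw [hrel, hpt]
      linarith [abs_pt_le_gradNorm v t θ, hgrad t ht θ])
    (by
      intro t ht θ
      rw [hrel, hpth]
      linarith [abs_pth_le_gradNorm v t θ, hgrad t ht θ])
  have hd := hdec ℓ hℓ hneck hεδ
  have hcmp : ∀ t ∈ Icc a (a + 3 * ℓ), ∀ θ, |relExp m (v a 0)
      (fun t θ => -(m : ℝ) * t + v t θ) t θ| ≤ 1 / 100 := fun t ht θ => by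
    rw [hrel]
    exact (hosc t ht θ).trans hε1
  have cT : Continuous (fun p : ℝ × ℝ => tripleSq
      (frameE1 m (v a 0) f (fun t θ => -(m : ℝ) * t + v t θ))
      (frameE2 m (v a 0) f (fun t θ => -(m : ℝ) * t + v t θ))
      (rescale m (v a 0) (Hmc f (fun t θ => -(m : ℝ) * t + v t θ))) p.1 p.2) :=
    continuous_tripleSq hneck.E1_smooth.continuous hneck.E2_smooth.continuous
      hneck.N_smooth.continuous
  have cA := (contDiff_Adens (u := fun t θ => -(m : ℝ) * t + v t θ) hf hu).continuous
  have w1 : cylInt (Adens f (fun t θ => -(m : ℝ) * t + v t θ)) (a + ℓ) (a + 2 * ℓ) ≤ _ :=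
    cylInt_mono cA (continuous_const.mul cT) (fun t ht θ _ =>
      (Adens_comparable (hcmp t ⟨by linarith [ht.1], by linarith [ht.2]⟩ θ)).2)
  have w2 : _ ≤ cylInt (Adens f (fun t θ => -(m : ℝ) * t + v t θ)) a (a + 3 * ℓ) :=
    cylInt_mono (continuous_const.mul cT) cA (fun t ht θ _ => (Adens_comparable (hcmp t ht θ)).1)
  rw [cylInt_const_mul] at w1 w2
  have hd' := hd (by linarith)
  have := mul_le_mul_of_nonneg_left w2 (exp_pos (-(q * ℓ))).le
  linarith

theorem energy_decay_of_window {F : ℝ → ℝ → ℝ} (hF : Continuous (fun p : ℝ × ℝ => F p.1 p.2))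
    (hF0 : ∀ t θ, 0 ≤ F t θ) {q ℓ L : ℝ} {p k : ℕ} (hq0 : 0 < q) (hℓ : 0 < ℓ) (hp : 0 < p)
    (hL : L = p * ℓ) (hk : 3 ≤ k)
    (h : ∀ j : ℕ, j + 3 ≤ k * p → cylInt F (j * ℓ + ℓ) (j * ℓ + 2 * ℓ)
      ≤ exp (-(q * ℓ)) / 4 * cylInt F (j * ℓ) (j * ℓ + 3 * ℓ))
    (i : ℕ) (hi : 1 ≤ i) (hik : i ≤ k) :
    cylInt F (((i : ℝ) - 1) * L) ((i : ℝ) * L)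
      ≤ p * exp (q * L) * (exp (-(i : ℝ) * q * L) * cylInt F 0 (3 * L)
        + exp (-((k : ℝ) - (i : ℝ)) * q * L) * cylInt F (((k : ℝ) - 3) * L) ((k : ℝ) * L)) := by
  obtain ⟨i, rfl⟩ := Nat.exists_eq_add_of_le' hi
  obtain ⟨s, rfl⟩ := Nat.exists_eq_add_of_le hik
  have hp1 : (1 : ℝ) ≤ p := by exact_mod_cast hp
  have hL0 : ℓ ≤ L := by rw [hL]; nlinarith
  obtain ⟨x, hx⟩ : ∃ x, x = exp (-(q * ℓ)) := ⟨_, rfl⟩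
  have hx0 : 0 < x := hx ▸ exp_pos _
  have hx1 : x < 1 := by
    rw [hx, exp_lt_one_iff]
    have := mul_pos hq0 hℓ
    linarith
  obtain ⟨M, hM⟩ : ∃ M, (i + 1 + s) * p = M + 1 :=
    ⟨(i + 1 + s) * p - 1, by
      have : 0 < (i + 1 + s) * p := by positivity
      omega⟩
  obtain ⟨E, hE⟩ : ∃ E : ℕ → ℝ, E = fun j : ℕ => cylInt F (j * ℓ) ((j + 1 : ℕ) * ℓ) := ⟨_, rfl⟩
  have hE0 : ∀ j, 0 ≤ E j := fun j => by
    rw [hE]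
    exact cylInt_nonneg fun t _ θ _ => hF0 t θ
  have key := le_of_neighbour_decay (a := E) (M := M) hx0 hx1 (hE0 0) (hE0 M) (by
    intro j hj
    have hw := h j (by omega)
    have e1 := cylInt_eq_sum hF hℓ j 3 (by norm_num)
    simp only [Finset.sum_range_succ, Finset.sum_range_zero, zero_add, add_zero] at e1
    simp only [hE]
    have c1 : ((j + 1 : ℕ) : ℝ) * ℓ = j * ℓ + ℓ := by push_cast; ring
    have c2 : ((j + 1 + 1 : ℕ) : ℝ) * ℓ = j * ℓ + 2 * ℓ := by push_cast; ring
    have c3 : ((j + 3 : ℕ) : ℝ) * ℓ = j * ℓ + 3 * ℓ := by push_cast; ring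
    have c5 : ((j + 2 + 1 : ℕ) : ℝ) * ℓ = j * ℓ + 3 * ℓ := by push_cast; ring
    rw [c1, c2, c3] at e1
    rw [c1, c2, c5, ← e1, hx]
    exact hw)
  have hfirst : E 0 ≤ cylInt F 0 (3 * L) := by
    rw [hE]
    refine cylInt_subset hF (by simp) ?_ fun t _ θ _ => hF0 t θ
    push_cast
    linarith
  have hkp : ((i + 1 + s : ℕ) : ℝ) * p = M + 1 := by exact_mod_cast hM
  have hkL : ((i + 1 + s : ℕ) : ℝ) * L = (M + 1) * ℓ := by rw [hL, ← mul_assoc, hkp]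
  have hlast : E M ≤ cylInt F ((((i + 1 + s : ℕ) : ℝ) - 3) * L) (((i + 1 + s : ℕ) : ℝ) * L) := by
    rw [hE]
    refine cylInt_subset hF ?_ ?_ fun t _ θ _ => hF0 t θ
    · rw [sub_mul, hkL]
      linarith
    · rw [hkL]
      push_cast
      exact le_rfl
  obtain ⟨y, hy⟩ : ∃ y, y = x ^ p := ⟨_, rfl⟩
  have hyL : y = exp (-(q * L)) := by
    rw [hy, hx, ← exp_nat_mul, hL]
    congr 1
    ring
  have hcell : ∀ r ∈ Finset.range p, E (i * p + r)
      ≤ x ^ (i * p) * cylInt F 0 (3 * L) + x ^ (s * p)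
        * cylInt F ((((i + 1 + s : ℕ) : ℝ) - 3) * L) (((i + 1 + s : ℕ) : ℝ) * L) := by
    intro r hr
    have hr := Finset.mem_range.mp hr
    have hM' : i * p + p + s * p = M + 1 := by rw [← hM]; ring
    refine (key (i * p + r) (by omega)).trans (add_le_add ?_ ?_)
    · exact mul_le_mul (pow_le_pow_of_le_one hx0.le hx1.le (by omega)) hfirst (hE0 0) (by positivity)
    · exact mul_le_mul (pow_le_pow_of_le_one hx0.le hx1.le (by omega)) hlast (hE0 M) (by positivity)
  have hsum := Finset.sum_le_sum hcell
  rw [Finset.sum_const, Finset.card_range, nsmul_eq_mul] at hsum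
  have e2 := cylInt_eq_sum hF hℓ (i * p) p hp
  have l1 : (((i + 1 : ℕ) : ℝ) - 1) * L = ((i * p : ℕ) : ℝ) * ℓ := by
    rw [hL]; push_cast; ring
  have l2 : ((i + 1 : ℕ) : ℝ) * L = ((i * p + p : ℕ) : ℝ) * ℓ := by
    rw [hL]; push_cast; ring
  rw [l1, l2, e2]
  refine le_trans (le_of_eq (by rw [hE])) (hsum.trans ?_)
  have x1 : x ^ (i * p) = exp (q * L) * exp (-((i + 1 : ℕ) : ℝ) * q * L) := by
    rw [mul_comm i p, pow_mul, ← hy, hyL, ← exp_nat_mul, ← exp_add]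
    congr 1
    push_cast
    ring
  have x2 : x ^ (s * p)
      ≤ exp (q * L) * exp (-(((i + 1 + s : ℕ) : ℝ) - ((i + 1 : ℕ) : ℝ)) * q * L) := by
    rw [mul_comm s p, pow_mul, ← hy, hyL, ← exp_nat_mul, ← exp_add, exp_le_exp]
    have := mul_pos hq0 (hℓ.trans_le hL0)
    push_cast
    linarith
  rw [x1, mul_assoc (p : ℝ), mul_add (exp (q * L)), ← mul_assoc (exp (q * L)),
    ← mul_assoc (exp (q * L))]
  refine mul_le_mul_of_nonneg_left (add_le_add le_rfl ?_) (by positivity)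
  exact mul_le_mul_of_nonneg_right x2 ((hE0 M).trans hlast)

end EnergyDecay

/-- **Theorem 4.3** (decay of the second fundamental form along the cylinder). -/
theorem second_fundamental_form_decay (n : ℕ) (q : ℝ) (hq0 : 0 < q) (hq2 : q < 2)
    (m : ℕ) (hm : 0 < m) :
    ∃ L₂ > (0 : ℝ), ∃ δ₂ > (0 : ℝ), ∀ L > L₂, ∃ C > (0 : ℝ), ∀ k : ℕ, 3 ≤ k →
      ∀ (f : ℝ → ℝ → EuclideanSpace ℝ (Fin n)) (v : ℝ → ℝ → ℝ),
      ConfWillmore f (fun t θ => -(m : ℝ) * t + v t θ) (Set.Icc 0 ((k : ℝ) * L)) →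
      (∀ t ∈ Set.Icc (0 : ℝ) ((k : ℝ) * L), ∀ c : EuclideanSpace ℝ (Fin n),
        tau1 f (fun t θ => -(m : ℝ) * t + v t θ) c t = 0) →
      (∀ t ∈ Set.Icc (0 : ℝ) ((k : ℝ) * L), ∀ S : Matrix (Fin n) (Fin n) ℝ, S.transpose = -S →
        tau2 f (fun t θ => -(m : ℝ) * t + v t θ) S t = 0) →
      (∀ i : ℕ, 1 ≤ i → i ≤ k → ∃ b : ℝ,
        (∀ t ∈ Set.Icc (((i : ℝ) - 1) * L) ((i : ℝ) * L), ∀ θ : ℝ, gradNorm v t θ ≤ b)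
        ∧ b + cylInt (Adens f (fun t θ => -(m : ℝ) * t + v t θ)) (((i : ℝ) - 1) * L) ((i : ℝ) * L)
            < δ₂) →
      ∀ i : ℕ, 1 ≤ i → i ≤ k →
        cylInt (Adens f (fun t θ => -(m : ℝ) * t + v t θ)) (((i : ℝ) - 1) * L) ((i : ℝ) * L)
          ≤ C * (Real.exp (-(i : ℝ) * q * L)
                * cylInt (Adens f (fun t θ => -(m : ℝ) * t + v t θ)) 0 (3 * L)
              + Real.exp (-((k : ℝ) - (i : ℝ)) * q * L)
                * cylInt (Adens f (fun t θ => -(m : ℝ) * t + v t θ))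
                    (((k : ℝ) - 3) * L) ((k : ℝ) * L)) := by
  obtain ⟨ℓ₀, hℓ₀, δ, hδ, hdec⟩ := exists_energy_window_decay hm hq0 hq2
  have hℓ₀0 : 0 < ℓ₀ := by linarith
  refine ⟨ℓ₀, hℓ₀0, δ / 3, by positivity, ?_⟩
  intro L hL
  have hL0 : 0 < L := hℓ₀0.trans hL
  obtain ⟨p, hp⟩ : ∃ p, p = ⌊L / ℓ₀⌋₊ := ⟨_, rfl⟩
  have hp1 : 1 ≤ p := by
    rw [hp, Nat.one_le_floor_iff, one_le_div hℓ₀0]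
    exact hL.le
  have hp0 : (0 : ℝ) < p := by exact_mod_cast hp1
  have hpL : p * ℓ₀ ≤ L := by
    rw [← le_div_iff₀ hℓ₀0, hp]
    exact Nat.floor_le (by positivity)
  have hLp : L ≤ p * (2 * ℓ₀) := by
    have h1 : L < (p + 1) * ℓ₀ := by
      rw [← div_lt_iff₀ hℓ₀0, hp]
      exact Nat.lt_floor_add_one _
    have : (1 : ℝ) * ℓ₀ ≤ p * ℓ₀ := mul_le_mul_of_nonneg_right (by exact_mod_cast hp1) hℓ₀0.le
    linarith
  obtain ⟨ℓ, hℓ⟩ : ∃ ℓ, ℓ = L / p := ⟨_, rfl⟩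
  have hLℓ : L = p * ℓ := by rw [hℓ, mul_div_cancel₀ L hp0.ne']
  have hℓmem : ℓ ∈ Icc ℓ₀ (2 * ℓ₀) :=
    ⟨le_of_mul_le_mul_left (hLℓ ▸ hpL) hp0, le_of_mul_le_mul_left (hLℓ ▸ hLp) hp0⟩
  have hℓ0 : 0 < ℓ := hℓ₀0.trans_le hℓmem.1
  refine ⟨p * exp (q * L), by positivity, ?_⟩
  intro k hk f v h h1 h2 hsmall
  have hk0 : (0 : ℝ) < k := by exact_mod_cast (by omega : 0 < k)
  have hF := (contDiff_Adens (u := fun t θ => -(m : ℝ) * t + v t θ) h.smooth_f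
    h.smooth_u).continuous
  have hF0 := Adens_nonneg f (fun t θ => -(m : ℝ) * t + v t θ)
  refine energy_decay_of_window hF hF0 hq0 hℓ0 hp1 hLℓ hk ?_
  have hgrad : ∀ t ∈ Icc (0 : ℝ) (k * L), ∀ θ, gradNorm v t θ ≤ δ := by
    intro t ht θ
    obtain ⟨i, hi, hik, hti⟩ := exists_cell hL0 (by omega) ht
    obtain ⟨b, hb, hbs⟩ := hsmall i hi hik
    have := cylInt_nonneg (F := Adens f (fun t θ => -(m : ℝ) * t + v t θ))
      (a := ((i : ℝ) - 1) * L) (b := i * L) fun t _ θ _ => hF0 t θ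
    linarith [hb t hti θ]
  have hpiece : ∀ j : ℕ, j + 1 ≤ k * p →
      cylInt (Adens f (fun t θ => -(m : ℝ) * t + v t θ)) (j * ℓ) ((j + 1 : ℕ) * ℓ) ≤ δ / 3 := by
    intro j hj
    have hjk : j / p < k := (Nat.div_lt_iff_lt_mul hp1).mpr hj
    obtain ⟨b, hb, hbs⟩ := hsmall (j / p + 1) (Nat.le_add_left 1 _) hjk
    have hb0 : 0 ≤ b := by
      refine (Real.sqrt_nonneg _).trans (hb (((j / p + 1 : ℕ) : ℝ) * L) ⟨?_, le_rfl⟩ 0)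
      linarith
    have d1 : (((j / p : ℕ) : ℝ)) * p ≤ j := by exact_mod_cast Nat.div_mul_le_self j p
    have d2 : (((j + 1 : ℕ) : ℝ)) ≤ ((j / p + 1 : ℕ) : ℝ) * p := by
      exact_mod_cast Nat.lt_mul_of_div_lt (Nat.lt_succ_self (j / p)) hp1
    have d3 := mul_le_mul_of_nonneg_right d1 hℓ0.le
    have d4 := mul_le_mul_of_nonneg_right d2 hℓ0.le
    have := cylInt_subset hF (a := (((j / p + 1 : ℕ) : ℝ) - 1) * L)
      (b := ((j / p + 1 : ℕ) : ℝ) * L) (a' := j * ℓ) (b' := (j + 1 : ℕ) * ℓ)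
      (by
        rw [hLℓ]
        push_cast
        linarith)
      (by
        rw [hLℓ]
        linarith)
      fun t _ θ _ => hF0 t θ
    linarith
  intro j hj
  have hend : (j : ℝ) * ℓ + 3 * ℓ ≤ k * L := by
    have : ((j + 3 : ℕ) : ℝ) ≤ k * p := by exact_mod_cast hj
    have := mul_le_mul_of_nonneg_right this hℓ0.le
    rw [hLℓ]
    push_cast at this
    linarith
  have hsub : Icc (j * ℓ) (j * ℓ + 3 * ℓ) ⊆ Icc (0 : ℝ) (k * L) :=
    Icc_subset_Icc (by positivity) hend
  refine hdec ℓ hℓmem (by positivity) h h1 h2 (j * ℓ) hsub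
    (fun t ht θ => hgrad t (hsub ht) θ) ?_
  have e1 := cylInt_eq_sum hF hℓ0 j 3 (by norm_num)
  simp only [Finset.sum_range_succ, Finset.sum_range_zero, zero_add, add_zero] at e1
  have c3 : ((j + 3 : ℕ) : ℝ) * ℓ = j * ℓ + 3 * ℓ := by push_cast; ring
  have hlast := hpiece (j + 2) hj
  rw [add_assoc, c3] at hlast
  rw [c3] at e1
  rw [e1]
  linarith [hpiece j (by omega), hpiece (j + 1) (by omega)]
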